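/- For every ε > 0 there exists a constant K > 0 such that the following holds. Let C, M, N be positive real numbers and let g : ℝ³ → ℝ be a smooth function with compact support contained in [C, 3C] × [M, 3M] × [N, 3N] satisfying |∂^{j+k+l} g / (∂m^j ∂n^k ∂c^l)(m, n, c)| ≤ M^{−j} N^{−k} C^{−l} for all 0 ≤ j, k, l ≤ 2 and all (m, n, c) ∈ ℝ³. Then for any sequences of complex numbers (a_m)_{m≥1} and (b_n)_{n≥1} and either choice of sign, |∑_{c≥1} ∑_{m≥1} ∑_{n≥1} a_m b_n g(m, n, c) S(m, ±n; c)| ≤ K · C^{1+ε} · √(MN) · ‖a‖₂ · ‖b‖₂, where ‖a‖₂ := (∑_{m≥1} |a_m|²)^{1/2} and ‖b‖₂ := (∑_{n≥1} |b_n|²)^{1/2} (these sums may be restricted to m ∈ [M, 3M] and n ∈ [N, 3N] since g vanishes elsewhere). -/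

import Mathlib

open MeasureTheory Complex

/-- `e(x) = exp(2πix)`. -/
noncomputable def eAdd (x : ℝ) : ℂ := Complex.exp (2 * Real.pi * Complex.I * x)

/-- The classical Kloosterman sum `S(a, b; c) = ∑_{x mod c, (x,c)=1} e((a x + b x̄)/c)`. -/
noncomputable def kloostermanS (a b : ℤ) (c : ℕ) : ℂ :=
  ∑ x ∈ Finset.filter (fun x : ℕ => Nat.Coprime x c) (Finset.range c),
    eAdd (((a * x + b * (((x : ZMod c)⁻¹).val : ℤ) : ℤ) : ℝ) / c)

namespace KB

open ModularGroup UpperHalfPlane Matrix.SpecialLinearGroup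
open scoped MatrixGroups Modular ENNReal

/-- Coprime pairs of integers, the bottom rows of matrices in `SL(2, ℤ)`. -/
abbrev CopPair : Type := {p : ℤ × ℤ // IsCoprime p.1 p.2}

theorem exists_rep (p : CopPair) : ∃ g : SL(2, ℤ), g 1 0 = p.1.1 ∧ g 1 1 = p.1.2 := by
  obtain ⟨g, -, hg⟩ := bottom_row_surj (R := ℤ) (a := ![p.1.1, p.1.2]) (by simpa using p.2)
  exact ⟨g, by simpa using congrFun hg 0, by simpa using congrFun hg 1⟩

/-- A matrix in `SL(2, ℤ)` with prescribed bottom row. -/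
noncomputable def rep (p : CopPair) : SL(2, ℤ) := (exists_rep p).choose

theorem rep_c (p : CopPair) : rep p 1 0 = p.1.1 := (exists_rep p).choose_spec.1
theorem rep_d (p : CopPair) : rep p 1 1 = p.1.2 := (exists_rep p).choose_spec.2

theorem eq_T_zpow_mul_of_row_eq (g h : SL(2, ℤ)) (h0 : g 1 0 = h 1 0) (h1 : g 1 1 = h 1 1) :
    ∃ n : ℤ, g = T ^ n * h := by
  have hg := g.det_coe
  have hh := h.det_coe
  rw [Matrix.det_fin_two] at hg hh
  refine ⟨g 0 0 * h 0 1 * -1 + g 0 1 * h 0 0, ?_⟩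
  ext i j
  rw [Matrix.SpecialLinearGroup.coe_mul, coe_T_zpow, Matrix.mul_apply]
  fin_cases i <;> fin_cases j <;> simp
  · rw [h0] at hg
    rw [h1] at hg
    linear_combination (h.1 0 0) * hg - (g.1 0 0) * hh
  · rw [h0] at hg
    rw [h1] at hg
    linear_combination (h.1 0 1) * hg - (g.1 0 1) * hh
  · exact h0
  · exact h1

theorem T_zpow_mul_row (n : ℤ) (h : SL(2, ℤ)) :
    (T ^ n * h) 1 0 = h 1 0 ∧ (T ^ n * h) 1 1 = h 1 1 := by
  constructor <;>
  · rw [Matrix.SpecialLinearGroup.coe_mul, coe_T_zpow, Matrix.mul_apply]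
    simp

/-- The decomposition of `SL(2, ℤ)` into cosets of the translations. -/
noncomputable def cosetEquiv : ℤ × CopPair ≃ SL(2, ℤ) :=
  Equiv.ofBijective (fun q => T ^ q.1 * rep q.2) (by
    constructor
    · rintro ⟨n, p⟩ ⟨m, q⟩ h
      have h' : T ^ n * rep p = T ^ m * rep q := h
      have hp : p = q := by
        have h0 := (T_zpow_mul_row n (rep p)).1
        have h1 := (T_zpow_mul_row n (rep p)).2
        rw [h', (T_zpow_mul_row m (rep q)).1, rep_c, rep_c] at h0
        rw [h', (T_zpow_mul_row m (rep q)).2, rep_d, rep_d] at h1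
        exact Subtype.ext (Prod.ext h0.symm h1.symm)
      subst hp
      have h2 : T ^ n = T ^ m := mul_right_cancel h'
      have h3 := congrArg (fun g : SL(2, ℤ) => g 0 1) h2
      simp only [coe_T_zpow] at h3
      simp at h3
      rw [h3]
    · intro g
      have hc := bottom_row_coprime g
      obtain ⟨n, hn⟩ := eq_T_zpow_mul_of_row_eq g (rep ⟨(g 1 0, g 1 1), hc⟩)
        (by rw [rep_c]) (by rw [rep_d])
      exact ⟨(n, ⟨(g 1 0, g 1 1), hc⟩), hn.symm⟩)

theorem cosetEquiv_apply (q : ℤ × CopPair) : cosetEquiv q = T ^ q.1 * rep q.2 := rfl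

instance : Countable SL(2, ℤ) := cosetEquiv.symm.injective.countable

/-- The strip `0 ≤ x < 1` in the upper half plane. -/
def strip : Set ℍ := {z | 0 ≤ z.re ∧ z.re < 1}

theorem measurable_re : Measurable (fun z : ℍ => z.re) := UpperHalfPlane.continuous_re.measurable
theorem measurable_im : Measurable (fun z : ℍ => z.im) := UpperHalfPlane.continuous_im.measurable

theorem measurableSet_strip : MeasurableSet strip :=
  (measurableSet_le measurable_const measurable_re).inter
    (measurableSet_lt measurable_re measurable_const)

theorem volume_eq_zero_of_image {s : Set ℍ} (h : volume ((↑) '' s : Set ℂ) = 0) :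
    volume s = 0 := by
  rw [UpperHalfPlane.volume_eq_lintegral, Measure.restrict_eq_zero.mpr h, lintegral_zero_measure]

instance smulInvariantSL : SMulInvariantMeasure SL(2, ℤ) ℍ volume := by
  constructor
  intro g s hs
  have := measure_preimage_smul (volume : Measure ℍ) (g : GL (Fin 2) ℝ) s
  exact this

instance : MeasurableConstSMul SL(2, ℤ) ℍ := ⟨fun g => by
  have : Continuous fun x : ℍ => g • x := by
    exact continuous_const_smul (g : GL (Fin 2) ℝ)
  exact this.measurable⟩

theorem volume_re_eq (c : ℝ) : volume {z : ℂ | z.re = c} = 0 := by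
  have h := Complex.volume_preserving_equiv_real_prod.measure_preimage
    (s := ({c} : Set ℝ) ×ˢ Set.univ)
    ((measurableSet_singleton c).prod MeasurableSet.univ).nullMeasurableSet
  rw [Measure.volume_eq_prod, Measure.prod_prod] at h
  simp only [Real.volume_singleton, zero_mul] at h
  convert h using 2
  ext z
  simp

theorem volume_fd_diff_fdo : volume (𝒟 \ 𝒟ᵒ) = 0 := by
  apply volume_eq_zero_of_image
  refine measure_mono_null (t := {z : ℂ | z.re = 1 / 2} ∪ {z : ℂ | z.re = -(1 / 2)} ∪
    Metric.sphere (0 : ℂ) 1) ?_ ?_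
  · rintro _ ⟨z, ⟨⟨h1, h2⟩, h3⟩, rfl⟩
    by_contra hcon
    simp only [Set.mem_union, Set.mem_ofPred_eq, coe_re, mem_sphere_iff_norm, sub_zero,
      not_or] at hcon
    refine h3 ⟨lt_of_le_of_ne h1 fun h => hcon.2 ?_, lt_of_le_of_ne h2 fun h => ?_⟩
    · rw [← sq_eq_sq₀ (norm_nonneg _) zero_le_one, ← Complex.normSq_eq_norm_sq, ← h, one_pow]
    · rcases (abs_eq (by norm_num)).mp h with h | h
      · exact hcon.1.1 h
      · exact hcon.1.2 h
  · rw [measure_union_null_iff, measure_union_null_iff]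
    exact ⟨⟨volume_re_eq _, volume_re_eq _⟩, Measure.addHaar_sphere _ _ _⟩

theorem ae_exists_mem_fdo : ∀ᵐ z : ℍ, ∃ g : SL(2, ℤ), g • z ∈ 𝒟ᵒ := by
  have h : ∀ᵐ z : ℍ, ∀ g : SL(2, ℤ), g • z ∉ 𝒟 \ 𝒟ᵒ := by
    rw [ae_all_iff]
    intro g
    have := measure_preimage_smul_of_nullMeasurableSet (μ := (volume : Measure ℍ))
      (s := 𝒟 \ 𝒟ᵒ) (isClosed_fd.measurableSet.diff isOpen_fdo.measurableSet).nullMeasurableSet g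
    rw [volume_fd_diff_fdo] at this
    exact measure_eq_zero_iff_ae_notMem.mp this
  filter_upwards [h] with z hz
  obtain ⟨g, hg⟩ := exists_smul_mem_fd z
  exact ⟨g, by_contra fun h => hz g ⟨hg, h⟩⟩

/-- Almost every point has exactly two translates in the open fundamental domain. -/
theorem ae_tsum_indicator_fdo :
    ∀ᵐ z : ℍ, ∑' g : SL(2, ℤ), (𝒟ᵒ : Set ℍ).indicator (fun _ => (1 : ℝ≥0∞)) (g • z) = 2 := by
  filter_upwards [ae_exists_mem_fdo] with z hz
  obtain ⟨g, hg⟩ := hz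
  have hne : g ≠ -g := by
    intro h
    have h0 := congrArg (fun x : SL(2, ℤ) => x 1 0) h
    have h1 := congrArg (fun x : SL(2, ℤ) => x 1 1) h
    simp only [Matrix.SpecialLinearGroup.coe_neg, Matrix.neg_apply] at h0 h1
    have hd := g.det_coe
    rw [Matrix.det_fin_two, show g.1 1 0 = 0 by omega, show g.1 1 1 = 0 by omega] at hd
    simp at hd
  rw [tsum_eq_sum (s := {g, -g})]
  · rw [Finset.sum_pair hne, ModularGroup.SL_neg_smul, Set.indicator_of_mem hg]
    norm_num
  · intro h hh
    refine Set.indicator_of_notMem (fun hmem => hh ?_) _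
    have h2 : (h * g⁻¹) • (g • z) ∈ 𝒟ᵒ := by rwa [← mul_smul, inv_mul_cancel_right]
    rcases eq_one_or_neg_one_of_mem_fdo_mem_fdo hg h2 with h3 | h3
    · simp [mul_inv_eq_one.mp h3]
    · have : h = -1 * g := by rw [← h3, inv_mul_cancel_right]
      simp [this]

theorem tsum_indicator_strip (z : ℍ) :
    ∑' n : ℤ, strip.indicator (fun _ => (1 : ℝ≥0∞)) (T ^ n • z) = 1 := by
  rw [tsum_eq_single (-⌊z.re⌋)]
  · refine Set.indicator_of_mem ?_ _
    simp only [strip, Set.mem_ofPred_eq, re_T_zpow_smul]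
    push_cast
    constructor <;> linarith [Int.floor_le z.re, Int.lt_floor_add_one z.re]
  · intro n hn
    refine Set.indicator_of_notMem (fun h => hn ?_) _
    simp only [strip, Set.mem_ofPred_eq, re_T_zpow_smul] at h
    have : ⌊z.re⌋ = -n := by
      rw [Int.floor_eq_iff]
      push_cast
      constructor <;> linarith
    omega

/-- Unfolding for nonnegative functions. -/
theorem lintegral_fdo_tsum_rep {K : ℍ → ℝ≥0∞} (hK : Measurable K)
    (hT : ∀ (n : ℤ) z, K (T ^ n • z) = K z) :
    ∫⁻ z in 𝒟ᵒ, ∑' p : CopPair, K (rep p • z) = 2 * ∫⁻ z in strip, K z := by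
  have hm : ∀ g : SL(2, ℤ), Measurable fun z : ℍ => g • z := measurable_const_smul
  have hD : MeasurableSet (𝒟ᵒ : Set ℍ) := isOpen_fdo.measurableSet
  set KS : ℍ → ℝ≥0∞ := strip.indicator K with hKS
  have hKSm : Measurable KS := hK.indicator measurableSet_strip
  have h1 : ∀ z : ℍ, ∑' p : CopPair, K (rep p • z) = ∑' g : SL(2, ℤ), KS (g • z) := by
    intro z
    rw [← cosetEquiv.tsum_eq, ENNReal.tsum_prod', ENNReal.tsum_comm]
    congr 1
    ext p
    simp only [cosetEquiv_apply, mul_smul, hKS]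
    have : ∀ n : ℤ, strip.indicator K (T ^ n • rep p • z) =
        strip.indicator (fun _ => (1 : ℝ≥0∞)) (T ^ n • rep p • z) * K (rep p • z) := by
      intro n
      by_cases h : T ^ n • rep p • z ∈ strip
      · rw [Set.indicator_of_mem h, Set.indicator_of_mem h, hT, one_mul]
      · rw [Set.indicator_of_notMem h, Set.indicator_of_notMem h, zero_mul]
    simp_rw [this, ENNReal.tsum_mul_right, tsum_indicator_strip, one_mul]
  simp_rw [h1]
  rw [lintegral_tsum (f := fun (g : SL(2, ℤ)) z => KS (g • z))
    fun g => (hKSm.comp (hm g)).aemeasurable]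
  have h2 : ∀ g : SL(2, ℤ), ∫⁻ z in 𝒟ᵒ, KS (g • z) =
      ∫⁻ z, KS z * (𝒟ᵒ : Set ℍ).indicator (fun _ => (1 : ℝ≥0∞)) (g⁻¹ • z) := by
    intro g
    rw [← lintegral_indicator hD]
    rw [← (measurePreserving_smul g (volume : Measure ℍ)).lintegral_comp
      (f := fun z => KS z * (𝒟ᵒ : Set ℍ).indicator (fun _ => (1 : ℝ≥0∞)) (g⁻¹ • z))
      (hKSm.mul ((measurable_const.indicator hD).comp (hm _)))]
    congr 1
    ext z
    rw [inv_smul_smul]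
    by_cases h : z ∈ 𝒟ᵒ
    · rw [Set.indicator_of_mem h, Set.indicator_of_mem h, mul_one]
    · rw [Set.indicator_of_notMem h, Set.indicator_of_notMem h, mul_zero]
  simp_rw [h2]
  rw [← lintegral_tsum (f := fun (g : SL(2, ℤ)) z =>
      KS z * (𝒟ᵒ : Set ℍ).indicator (fun _ => (1 : ℝ≥0∞)) (g⁻¹ • z)) fun g =>
    (hKSm.mul ((measurable_const.indicator hD).comp (hm _))).aemeasurable]
  simp_rw [ENNReal.tsum_mul_left]
  rw [← lintegral_indicator measurableSet_strip, ← lintegral_const_mul' _ _ (by norm_num)]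
  refine lintegral_congr_ae ?_
  filter_upwards [ae_tsum_indicator_fdo] with z hz
  have h3 := (Equiv.inv SL(2, ℤ)).tsum_eq
    (fun g => (𝒟ᵒ : Set ℍ).indicator (fun _ => (1 : ℝ≥0∞)) (g • z))
  simp only [Equiv.inv_apply] at h3
  rw [h3, hz, mul_comm]

end KB

namespace KB

open ModularGroup UpperHalfPlane Matrix.SpecialLinearGroup
open scoped MatrixGroups Modular ENNReal

/-- Poincaré series attached to a function on the upper half plane. -/
noncomputable def poin (F : ℍ → ℝ) (z : ℍ) : ℝ := (1 / 2) * ∑' p : CopPair, F (rep p • z)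

/-- Translation invariant functions supported in the horizontal strip `Y ≤ Im z ≤ R`. -/
structure Adm (Y R : ℝ) (F : ℍ → ℝ) : Prop where
  per : ∀ (n : ℤ) z, F (T ^ n • z) = F z
  supp : ∀ z, F z ≠ 0 → Y ≤ z.im ∧ z.im ≤ R

/-- The coprime pairs in a box. -/
noncomputable def boxPairs (B : ℤ) : Finset CopPair :=
  Finset.preimage (Finset.Icc (-B) B ×ˢ Finset.Icc (-B) B) Subtype.val
    Subtype.val_injective.injOn

theorem mem_boxPairs {B : ℤ} {p : CopPair} : p ∈ boxPairs B ↔ |p.1.1| ≤ B ∧ |p.1.2| ≤ B := by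
  simp [boxPairs, Finset.mem_preimage, abs_le]

theorem im_rep_smul (p : CopPair) (z : ℍ) : (rep p • z).im =
    z.im / (((p.1.1 : ℝ) * z.re + p.1.2) ^ 2 + ((p.1.1 : ℝ) * z.im) ^ 2) := by
  rw [ModularGroup.im_smul_eq_div_normSq]
  congr 1
  rw [ModularGroup.denom_apply, rep_c, rep_d, Complex.normSq_apply]
  simp
  ring

theorem denom_pos (p : CopPair) (z : ℍ) :
    0 < ((p.1.1 : ℝ) * z.re + p.1.2) ^ 2 + ((p.1.1 : ℝ) * z.im) ^ 2 := by
  have h := (rep p • z).im_pos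
  rw [im_rep_smul] at h
  exact (div_pos_iff_of_pos_left z.im_pos).mp h

theorem mem_boxPairs_of_le_im {Y X y₀ y₁ : ℝ} (hY : 0 < Y) (hy : 0 < y₀) {B : ℤ}
    (hB1 : 1 / (y₀ * Y) ≤ (B : ℝ) ^ 2)
    (hB2 : X * (1 + 1 / (y₀ * Y)) + (1 + y₁ / Y) ≤ B) (hB : 0 ≤ B)
    {z : ℍ} (h0 : y₀ ≤ z.im) (h1 : z.im ≤ y₁) (hX : |z.re| ≤ X) {p : CopPair}
    (hp : Y ≤ (rep p • z).im) : p ∈ boxPairs B := by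
  have hden := denom_pos p z
  rw [im_rep_smul, le_div_iff₀ hden] at hp
  set c : ℝ := ((p.1.1 : ℤ) : ℝ) with hc
  set d : ℝ := ((p.1.2 : ℤ) : ℝ) with hd
  have hz := z.im_pos
  have hc2 : c ^ 2 ≤ 1 / (y₀ * Y) := by
    rw [le_div_iff₀ (by positivity)]
    have : Y * (c * z.im) ^ 2 ≤ z.im := by nlinarith [sq_nonneg (c * z.re + d)]
    have h3 : Y * c ^ 2 * z.im ≤ 1 := by
      by_contra hcon
      push Not at hcon
      nlinarith
    nlinarith [mul_nonneg hY.le (sq_nonneg c)]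
  have hd2 : (c * z.re + d) ^ 2 ≤ y₁ / Y := by
    rw [le_div_iff₀ hY]
    nlinarith [sq_nonneg (c * z.im)]
  have hcabs : |c| ≤ 1 + 1 / (y₀ * Y) := by
    nlinarith [sq_abs c, abs_nonneg c, sq_nonneg (|c| - 1)]
  have hdabs : |c * z.re + d| ≤ 1 + y₁ / Y := by
    nlinarith [sq_abs (c * z.re + d), abs_nonneg (c * z.re + d), sq_nonneg (|c * z.re + d| - 1)]
  rw [mem_boxPairs]
  have hBr : (0 : ℝ) ≤ B := by exact_mod_cast hB
  constructor
  · have : |c| ≤ B := abs_le_of_sq_le_sq (hc2.trans hB1) hBr |> fun h => by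
      simpa [abs_le] using h
    rw [hc] at this
    exact_mod_cast this
  · have hX0 : 0 ≤ X := (abs_nonneg _).trans hX
    have : |d| ≤ B := by
      calc |d| = |(c * z.re + d) - c * z.re| := by ring_nf
        _ ≤ |c * z.re + d| + |c * z.re| := abs_sub _ _
        _ = |c * z.re + d| + |c| * |z.re| := by rw [abs_mul]
        _ ≤ (1 + y₁ / Y) + (1 + 1 / (y₀ * Y)) * X := by gcongr
        _ ≤ B := by linarith
    rw [hd] at this
    exact_mod_cast this

/-- Locally uniformly, only finitely many terms of a Poincaré series are nonzero. -/
theorem exists_box {Y : ℝ} (hY : 0 < Y) (X y₀ y₁ : ℝ) (hy : 0 < y₀) :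
    ∃ B : ℤ, ∀ z : ℍ, y₀ ≤ z.im → z.im ≤ y₁ → |z.re| ≤ X → ∀ p : CopPair,
      Y ≤ (rep p • z).im → p ∈ boxPairs B := by
  obtain ⟨n, hn⟩ := exists_nat_ge (X * (1 + 1 / (y₀ * Y)) + (1 + y₁ / Y) + 1 + 1 / (y₀ * Y) +
    |X * (1 + 1 / (y₀ * Y)) + (1 + y₁ / Y)|)
  have h0 : 0 < 1 / (y₀ * Y) := by positivity
  have h2 := neg_abs_le (X * (1 + 1 / (y₀ * Y)) + (1 + y₁ / Y))
  have h3 := abs_nonneg (X * (1 + 1 / (y₀ * Y)) + (1 + y₁ / Y))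
  have h4 : 1 + 1 / (y₀ * Y) ≤ n := by linarith
  refine ⟨n, fun z ha hb hc p hp => mem_boxPairs_of_le_im hY hy ?_ ?_ (by positivity) ha hb hc hp⟩
  · push_cast
    nlinarith
  · push_cast
    linarith

theorem exists_box_at {Y : ℝ} (hY : 0 < Y) (z : ℍ) :
    ∃ B : ℤ, ∀ p : CopPair, Y ≤ (rep p • z).im → p ∈ boxPairs B := by
  obtain ⟨B, hB⟩ := exists_box hY |z.re| z.im z.im z.im_pos
  exact ⟨B, hB z le_rfl le_rfl le_rfl⟩

theorem Adm.exists_sum {Y R : ℝ} (hY : 0 < Y) (z : ℍ) : ∃ s : Finset CopPair,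
    ∀ F : ℍ → ℝ, Adm Y R F → poin F z = (1 / 2) * ∑ p ∈ s, F (rep p • z) := by
  obtain ⟨B, hB⟩ := exists_box_at hY z
  refine ⟨boxPairs B, fun F hF => ?_⟩
  rw [poin, tsum_eq_sum]
  intro p hp
  by_contra h
  exact hp (hB p (hF.supp _ h).1)

theorem Adm.summable {Y R : ℝ} (hY : 0 < Y) {F : ℍ → ℝ} (hF : Adm Y R F) (z : ℍ) :
    Summable fun p : CopPair => F (rep p • z) := by
  obtain ⟨B, hB⟩ := exists_box_at hY z
  refine summable_of_ne_finset_zero (s := boxPairs B) fun p hp => ?_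
  by_contra h
  exact hp (hB p (hF.supp _ h).1)

/-- Right multiplication on bottom rows. -/
noncomputable def rowMul (g : SL(2, ℤ)) (p : CopPair) : CopPair :=
  ⟨((rep p * g) 1 0, (rep p * g) 1 1), by exact bottom_row_coprime (rep p * g)⟩

theorem exists_rep_rowMul (g : SL(2, ℤ)) (p : CopPair) :
    ∃ n : ℤ, rep (rowMul g p) = T ^ n * (rep p * g) :=
  eq_T_zpow_mul_of_row_eq _ _ (by rw [rep_c]; rfl) (by rw [rep_d]; rfl)

theorem rowMul_rowMul (g h : SL(2, ℤ)) (p : CopPair) :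
    rowMul h (rowMul g p) = rowMul (g * h) p := by
  obtain ⟨n, hn⟩ := exists_rep_rowMul g p
  have h1 := T_zpow_mul_row n (rep p * g * h)
  rw [← mul_assoc, ← hn, mul_assoc (rep p)] at h1
  exact Subtype.ext (Prod.ext h1.1 h1.2)

theorem rowMul_one (p : CopPair) : rowMul 1 p = p := by
  refine Subtype.ext (Prod.ext ?_ ?_)
  · simp [rowMul, rep_c]
  · simp [rowMul, rep_d]

/-- Right multiplication as a permutation of bottom rows. -/
noncomputable def rowEquiv (g : SL(2, ℤ)) : CopPair ≃ CopPair where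
  toFun := rowMul g
  invFun := rowMul g⁻¹
  left_inv p := by rw [rowMul_rowMul, mul_inv_cancel, rowMul_one]
  right_inv p := by rw [rowMul_rowMul, inv_mul_cancel, rowMul_one]

theorem poin_smul {F : ℍ → ℝ} (hF : ∀ (n : ℤ) z, F (T ^ n • z) = F z) (g : SL(2, ℤ)) (z : ℍ) :
    poin F (g • z) = poin F z := by
  rw [poin, poin, ← (rowEquiv g).tsum_eq (fun p => F (rep p • z))]
  congr 2
  ext p
  obtain ⟨n, hn⟩ := exists_rep_rowMul g p
  change _ = F (rep (rowMul g p) • z)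
  rw [hn, mul_smul, hF, mul_smul]

theorem poin_mul {K ψ : ℍ → ℝ} (hψ : ∀ (g : SL(2, ℤ)) z, ψ (g • z) = ψ z) (z : ℍ) :
    poin (fun z => K z * ψ z) z = poin K z * ψ z := by
  simp only [poin, hψ, tsum_mul_right]
  ring

theorem Adm.poin_eq_zero {Y R : ℝ} (hY : 0 < Y) {F : ℍ → ℝ} (hF : Adm Y R F) {z : ℍ}
    (h1 : R < z.im) (h2 : 1 / Y < z.im) : poin F z = 0 := by
  rw [poin, mul_eq_zero]
  right
  convert tsum_zero with p
  by_contra h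
  obtain ⟨h3, h4⟩ := hF.supp _ h
  have hd := denom_pos p z
  rw [im_rep_smul] at h3 h4
  have hz := z.im_pos
  rcases eq_or_ne p.1.1 0 with h0 | h0
  · have h5 := p.2
    rw [h0, isCoprime_zero_left] at h5
    have h6 : (p.1.2 : ℝ) ^ 2 = 1 := by
      rcases Int.isUnit_iff.mp h5 with h | h <;> rw [h] <;> norm_num
    rw [h0] at h4
    simp only [Int.cast_zero, zero_mul, zero_add, h6] at h4
    norm_num at h4
    linarith
  · have h7 : (1 : ℝ) ≤ (p.1.1 : ℝ) ^ 2 := by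
      have : (1 : ℤ) ≤ p.1.1 ^ 2 := by
        have := sq_nonneg p.1.1
        have := pow_ne_zero 2 h0
        omega
      exact_mod_cast this
    rw [le_div_iff₀ hd] at h3
    rw [div_lt_iff₀ hY] at h2
    have : Y * (z.im) ^ 2 ≤ z.im := by
      have h8 : z.im ^ 2 ≤ ((p.1.1 : ℝ) * z.im) ^ 2 := by nlinarith [sq_nonneg z.im]
      nlinarith [sq_nonneg ((p.1.1 : ℝ) * z.re + p.1.2)]
    nlinarith

theorem Adm.mono {Y R Y' R' : ℝ} {F : ℍ → ℝ} (hF : Adm Y R F) (hY : Y' ≤ Y) (hR : R ≤ R') :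
    Adm Y' R' F :=
  ⟨hF.per, fun z hz => ⟨hY.trans (hF.supp z hz).1, (hF.supp z hz).2.trans hR⟩⟩

theorem ofReal_poin {Y R : ℝ} (hY : 0 < Y) {K : ℍ → ℝ} (hK : Adm Y R K) (h0 : ∀ z, 0 ≤ K z)
    (z : ℍ) : ENNReal.ofReal (poin K z) =
      (1 / 2) * ∑' p : CopPair, ENNReal.ofReal (K (rep p • z)) := by
  rw [poin, ENNReal.ofReal_mul (by norm_num), ENNReal.ofReal_tsum_of_nonneg (fun _ => h0 _)
    (hK.summable hY z)]
  congr 1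
  rw [ENNReal.ofReal_div_of_pos (by norm_num)]
  simp

theorem measurable_rep_smul (p : CopPair) : Measurable fun z : ℍ => rep p • z :=
  measurable_const_smul _

theorem lintegral_poin {Y R : ℝ} (hY : 0 < Y) {K : ℍ → ℝ} (hK : Adm Y R K) (h0 : ∀ z, 0 ≤ K z)
    (hm : Measurable K) :
    ∫⁻ z in 𝒟ᵒ, ENNReal.ofReal (poin K z) = ∫⁻ z in strip, ENNReal.ofReal (K z) := by
  simp_rw [ofReal_poin hY hK h0]
  rw [lintegral_const_mul' _ _ (by simp), lintegral_fdo_tsum_rep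
    (K := fun z => ENNReal.ofReal (K z)) hm.ennreal_ofReal (fun n z => by rw [hK.per])]
  rw [← mul_assoc, one_div, ENNReal.inv_mul_cancel (by norm_num) (by norm_num), one_mul]

theorem measurable_poin_of_nonneg {Y R : ℝ} (hY : 0 < Y) {K : ℍ → ℝ} (hK : Adm Y R K)
    (h0 : ∀ z, 0 ≤ K z) (hm : Measurable K) : Measurable (poin K) := by
  have h : poin K = fun z => (ENNReal.ofReal (poin K z)).toReal := by
    ext z
    rw [ENNReal.toReal_ofReal]
    exact mul_nonneg (by norm_num) (tsum_nonneg fun _ => h0 _)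
  rw [h]
  simp_rw [ofReal_poin hY hK h0]
  refine (Measurable.const_mul (Measurable.tsum fun p => ?_) _).ennreal_toReal
  exact (hm.comp (measurable_rep_smul p)).ennreal_ofReal

theorem Adm.comp {Y R : ℝ} {F : ℍ → ℝ} (hF : Adm Y R F) {u : ℝ → ℝ} (hu : u 0 = 0) :
    Adm Y R (fun z => u (F z)) :=
  ⟨fun n z => by rw [hF.per], fun z hz => hF.supp z fun h => hz (by rw [h, hu])⟩

theorem Adm.add {Y R : ℝ} {F G : ℍ → ℝ} (hF : Adm Y R F) (hG : Adm Y R G) :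
    Adm Y R (fun z => F z + G z) :=
  ⟨fun n z => by rw [hF.per, hG.per], fun z hz => by
    by_cases h : F z = 0
    · exact hG.supp z fun h' => hz (by rw [h, h', add_zero])
    · exact hF.supp z h⟩

theorem Adm.mul_left {Y R : ℝ} {F G : ℍ → ℝ} (hF : Adm Y R F)
    (hG : ∀ (n : ℤ) z, G (T ^ n • z) = G z) : Adm Y R (fun z => F z * G z) :=
  ⟨fun n z => by rw [hF.per, hG], fun z hz => hF.supp z fun h => hz (by rw [h, zero_mul])⟩

theorem poin_add {Y R : ℝ} (hY : 0 < Y) {F G : ℍ → ℝ} (hF : Adm Y R F) (hG : Adm Y R G) (z : ℍ) :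
    poin (fun z => F z + G z) z = poin F z + poin G z := by
  rw [poin, (hF.summable hY z).tsum_add (hG.summable hY z), poin, poin]
  ring

theorem poin_const_mul (r : ℝ) (F : ℍ → ℝ) (z : ℍ) :
    poin (fun z => r * F z) z = r * poin F z := by
  rw [poin, tsum_mul_left, poin]
  ring

theorem Adm.posPart {Y R : ℝ} {F : ℍ → ℝ} (hF : Adm Y R F) : Adm Y R (fun z => max (F z) 0) :=
  hF.comp (u := fun t => max t 0) (by simp)

theorem Adm.negPart {Y R : ℝ} {F : ℍ → ℝ} (hF : Adm Y R F) : Adm Y R (fun z => max (-F z) 0) :=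
  hF.comp (u := fun t => max (-t) 0) (by simp)

theorem Adm.poin_eq_sub {Y R : ℝ} (hY : 0 < Y) {F : ℍ → ℝ} (hF : Adm Y R F) :
    poin F = fun z => poin (fun z => max (F z) 0) z - poin (fun z => max (-F z) 0) z := by
  ext z
  rw [sub_eq_add_neg, ← neg_one_mul, ← poin_const_mul, ← poin_add hY hF.posPart
    (hF.negPart.comp (u := fun t => -1 * t) (by simp))]
  congr 1
  ext z
  rcases le_total (F z) 0 with h | h
  · rw [max_eq_right h, max_eq_left (by linarith)]; ring
  · rw [max_eq_left h, max_eq_right (by linarith)]; ring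

theorem measurable_poin {Y R : ℝ} (hY : 0 < Y) {F : ℍ → ℝ} (hF : Adm Y R F)
    (hm : Measurable F) : Measurable (poin F) := by
  rw [hF.poin_eq_sub hY]
  exact (measurable_poin_of_nonneg hY hF.posPart (fun _ => le_max_right _ _)
    (hm.max measurable_const)).sub (measurable_poin_of_nonneg hY hF.negPart
    (fun _ => le_max_right _ _) (hm.neg.max measurable_const))

theorem poin_nonneg {K : ℍ → ℝ} (h0 : ∀ z, 0 ≤ K z) (z : ℍ) : 0 ≤ poin K z :=
  mul_nonneg (by norm_num) (tsum_nonneg fun _ => h0 _)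

theorem integrable_poin_of_nonneg {Y R : ℝ} (hY : 0 < Y) {K : ℍ → ℝ} (hK : Adm Y R K)
    (h0 : ∀ z, 0 ≤ K z) (hm : Measurable K) (hi : IntegrableOn K strip) :
    IntegrableOn (poin K) 𝒟ᵒ ∧ ∫ z in 𝒟ᵒ, poin K z = ∫ z in strip, K z := by
  have h1 := lintegral_poin hY hK h0 hm
  have hpm := measurable_poin hY hK hm
  refine ⟨⟨hpm.aestronglyMeasurable, ?_⟩, ?_⟩
  · rw [hasFiniteIntegral_iff_ofReal (ae_of_all _ (poin_nonneg h0)), h1]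
    exact (hasFiniteIntegral_iff_ofReal (ae_of_all _ h0)).mp hi.2
  · rw [integral_eq_lintegral_of_nonneg_ae (ae_of_all _ (poin_nonneg h0))
      hpm.aestronglyMeasurable, h1, integral_eq_lintegral_of_nonneg_ae (ae_of_all _ h0)
      hm.aestronglyMeasurable]

/-- Unfolding. -/
theorem integral_poin {Y R : ℝ} (hY : 0 < Y) {K : ℍ → ℝ} (hK : Adm Y R K)
    (hm : Measurable K) (hi : IntegrableOn K strip) :
    IntegrableOn (poin K) 𝒟ᵒ ∧ ∫ z in 𝒟ᵒ, poin K z = ∫ z in strip, K z := by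
  have h1 := integrable_poin_of_nonneg hY hK.posPart (fun _ => le_max_right _ _)
    (hm.max measurable_const) hi.pos_part
  have h2 := integrable_poin_of_nonneg hY hK.negPart (fun _ => le_max_right _ _)
    (hm.neg.max measurable_const) hi.neg_part
  rw [hK.poin_eq_sub hY]
  refine ⟨h1.1.sub h2.1, ?_⟩
  rw [integral_sub h1.1 h2.1, h1.2, h2.2, ← integral_sub hi.pos_part hi.neg_part]
  congr 1
  ext z
  rcases le_total (K z) 0 with h | h
  · rw [max_eq_right h, max_eq_left (by linarith)]; ring
  · rw [max_eq_left h, max_eq_right (by linarith)]; ring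

end KB

namespace KB

open ModularGroup UpperHalfPlane Matrix.SpecialLinearGroup
open scoped MatrixGroups Modular ENNReal

theorem sum_range_telescope_le {b : ℝ} (hb : 0 < b) (n : ℕ) :
    ∑ k ∈ Finset.range (n + 1), b ^ 2 / (b ^ 2 + (k : ℝ) ^ 2) ≤ 1 + 2 * b := by
  have h : ∀ n : ℕ, ∑ k ∈ Finset.range (n + 1), b ^ 2 / (b ^ 2 + (k : ℝ) ^ 2) ≤
      1 + 2 * b ^ 2 * (1 / b - 1 / (b + n)) := by
    intro n
    induction n with
    | zero => simp [hb.ne']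
    | succ n ih =>
      rw [Finset.sum_range_succ]
      have h1 : b ^ 2 / (b ^ 2 + ((n + 1 : ℕ) : ℝ) ^ 2) ≤
          2 * b ^ 2 * (1 / (b + n) - 1 / (b + (n + 1 : ℕ))) := by
        push_cast
        have hn : (0 : ℝ) ≤ n := Nat.cast_nonneg n
        rw [div_sub_div _ _ (by positivity) (by positivity), mul_div_assoc',
          div_le_div_iff₀ (by positivity) (by positivity)]
        have : (b + n) * (b + (n + 1)) ≤ 2 * (b ^ 2 + ((n : ℝ) + 1) ^ 2) := by
          nlinarith [sq_nonneg (b - (n + 1))]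
        nlinarith [sq_nonneg b, mul_le_mul_of_nonneg_left this (sq_nonneg b)]
      linarith [h1, ih]
  refine (h n).trans ?_
  have : 0 ≤ 1 / (b + (n : ℝ)) := by positivity
  have h2 : b ^ 2 * (1 / b) = b := by field_simp
  nlinarith [mul_nonneg (sq_nonneg b) this]

theorem sum_Icc_le {b : ℝ} (hb : 0 < b) (n : ℕ) :
    ∑ k ∈ Finset.Icc (-(n : ℤ)) n, b ^ 2 / (b ^ 2 + (k : ℝ) ^ 2) ≤ 1 + 4 * b := by
  rw [Finset.sum_Icc_of_even_eq_range (f := fun k : ℤ => b ^ 2 / (b ^ 2 + (k : ℝ) ^ 2))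
    (by intro k; push_cast; ring_nf)]
  have := sum_range_telescope_le hb n
  have h0 : b ^ 2 / (b ^ 2 + ((0 : ℤ) : ℝ) ^ 2) = 1 := by
    simp [hb.ne']
  rw [h0, nsmul_eq_mul]
  push_cast
  linarith

/-- The weight `(My)² / (1 + (My)²)`. -/
noncomputable def theta (M y : ℝ) : ℝ := (M * y) ^ 2 / (1 + (M * y) ^ 2)

theorem theta_nonneg (M y : ℝ) : 0 ≤ theta M y := by unfold theta; positivity

theorem theta_le_one (M y : ℝ) : theta M y ≤ 1 := by
  unfold theta
  rw [div_le_one (by positivity)]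
  linarith

theorem theta_pos {M y : ℝ} (hM : 0 < M) (hy : 0 < y) : 0 < theta M y := by
  unfold theta; positivity

theorem theta_le_prod {M x y c d : ℝ} (hM : 0 < M) (hy : 0 < y) (hx : |x| ≤ 1 / 2)
    (hn : 1 ≤ x ^ 2 + y ^ 2) (hden : 0 < (c * x + d) ^ 2 + (c * y) ^ 2) :
    theta M (y / ((c * x + d) ^ 2 + (c * y) ^ 2)) ≤
      6 * ((M * y / (M * y + (c * y) ^ 2)) * (M * y / (M * y + d ^ 2))) := by
  set A := M * y with hA
  have hA0 : 0 < A := by positivity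
  set D := (c * x + d) ^ 2 + (c * y) ^ 2 with hD
  have h1 : theta M (y / D) = A ^ 2 / (D ^ 2 + A ^ 2) := by
    unfold theta
    rw [mul_div_assoc', ← hA, div_pow]
    field_simp
  set s := (c * y) ^ 2 + d ^ 2 with hs
  have h2 : s ≤ 2 * D := by
    have hx2 := abs_le.mp hx
    have h3 : 0 ≤ c ^ 2 * (x ^ 2 + y ^ 2 - 1) := mul_nonneg (sq_nonneg c) (by linarith)
    have h4 : 0 ≤ (c ^ 2 + d ^ 2) + 4 * (c * d * x) := by
      rcases le_total 0 (c * d) with h | h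
      · nlinarith [sq_nonneg (c - d)]
      · nlinarith [sq_nonneg (c + d)]
    nlinarith [mul_nonneg (sq_nonneg c) (sq_nonneg x)]
  have hs0 : 0 ≤ s := by positivity
  rw [h1, div_mul_div_comm, mul_div_assoc', div_le_div_iff₀ (by positivity) (by positivity)]
  have h5 : (A + (c * y) ^ 2) * (A + d ^ 2) ≤ 6 * (D ^ 2 + A ^ 2) := by
    have h6 : (c * y) ^ 2 * d ^ 2 ≤ s ^ 2 / 4 := by
      rw [hs]; nlinarith [sq_nonneg ((c * y) ^ 2 - d ^ 2)]
    have h7 : s ^ 2 ≤ 4 * D ^ 2 := by nlinarith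
    nlinarith [sq_nonneg (A - s)]
  nlinarith [mul_le_mul_of_nonneg_left h5 (sq_nonneg A)]

theorem sum_theta_le {M : ℝ} (hM : 1 / 3 ≤ M) {z : ℍ} (hz : z ∈ 𝒟ᵒ) (s : Finset CopPair) :
    ∑ p ∈ s, theta M (rep p • z).im ≤ 150 * M := by
  classical
  have hM0 : 0 < M := by linarith
  have hy := z.im_pos
  set y := z.im with hydef
  set x := z.re with hxdef
  have hx : |x| ≤ 1 / 2 := hz.2.le
  have hn : 1 ≤ x ^ 2 + y ^ 2 := by
    have := hz.1
    rw [Complex.normSq_apply] at this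
    simp only [coe_re, coe_im] at this
    nlinarith
  set A := M * y with hA
  have hA0 : 0 < A := by positivity
  obtain ⟨n, hn1⟩ : ∃ n : ℕ, ∀ p ∈ s, |p.1.1| ≤ (n : ℤ) ∧ |p.1.2| ≤ (n : ℤ) := by
    refine ⟨s.sup (fun p => max p.1.1.natAbs p.1.2.natAbs), fun p hp => ?_⟩
    have := Finset.le_sup (f := fun p : CopPair => max p.1.1.natAbs p.1.2.natAbs) hp
    simp only [max_le_iff] at this
    rw [Int.abs_eq_natAbs, Int.abs_eq_natAbs]
    constructor <;> omega
  set I := Finset.Icc (-(n : ℤ)) n with hI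
  set u : ℤ → ℝ := fun c => A / (A + ((c : ℝ) * y) ^ 2) with hu
  set w : ℤ → ℝ := fun d => A / (A + (d : ℝ) ^ 2) with hw
  have hu0 : ∀ c, 0 ≤ u c := fun c => by simp only [hu]; positivity
  have hw0 : ∀ c, 0 ≤ w c := fun c => by simp only [hw]; positivity
  set f : ℤ × ℤ → ℝ := fun q => (if q.1 = 0 ∧ |q.2| = 1 then 1 else 0) +
    (if q.1 ≠ 0 then 6 * (u q.1 * w q.2) else 0) with hf
  have hf0 : ∀ q, 0 ≤ f q := fun q => by
    simp only [hf]
    have := mul_nonneg (hu0 q.1) (hw0 q.2)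
    split_ifs <;> linarith
  have h1 : ∀ p ∈ s, theta M (rep p • z).im ≤ f p.1 := by
    intro p hp
    simp only [hf]
    by_cases h0 : p.1.1 = 0
    · have h5 := p.2
      rw [h0, isCoprime_zero_left] at h5
      rw [if_pos ⟨h0, Int.isUnit_iff_abs_eq.mp h5⟩, if_neg (by simpa using h0), add_zero]
      exact theta_le_one _ _
    · rw [if_neg (by tauto), if_pos h0, zero_add, im_rep_smul]
      exact theta_le_prod hM0 hy hx hn (denom_pos p z)
  have hb : 0 < √A := Real.sqrt_pos.mpr hA0
  have hb2 : √A ^ 2 = A := Real.sq_sqrt hA0.le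
  have hsw : ∑ d ∈ I, w d ≤ 1 + 4 * √A := by
    have := sum_Icc_le hb n
    rw [hb2] at this
    exact this
  have hsu : ∑ c ∈ I, (if c ≠ 0 then u c else 0) ≤ 4 * (√A / y) := by
    have h2 := sum_Icc_le (div_pos hb hy) n
    have h3 : ∀ c : ℤ, (√A / y) ^ 2 / ((√A / y) ^ 2 + (c : ℝ) ^ 2) = u c := by
      intro c
      simp only [hu]
      rw [div_pow, hb2]
      field_simp
    simp_rw [h3] at h2
    have h4 : ∑ c ∈ I, (if c ≠ 0 then u c else 0) = ∑ c ∈ I, u c - 1 := by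
      have h0 : (0 : ℤ) ∈ I := by simp [hI]
      rw [← Finset.add_sum_erase _ _ h0, ← Finset.add_sum_erase _ u h0]
      have : u 0 = 1 := by simp [hu, hA0.ne']
      rw [this, if_neg (by simp), zero_add, add_sub_cancel_left]
      exact Finset.sum_congr rfl fun c hc => by simp [Finset.ne_of_mem_erase hc]
    linarith
  have hq : √A / y ≤ 2 * M := by
    rw [div_le_iff₀ hy]
    apply Real.sqrt_le_iff.mpr
    refine ⟨by positivity, ?_⟩
    have hx2 : x ^ 2 ≤ 1 / 4 := by
      have := abs_le.mp hx
      nlinarith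
    have hy1 : 3 / 4 ≤ y := by nlinarith
    rw [hA]
    have : 1 ≤ 4 * M * y := by nlinarith
    nlinarith [mul_pos hM0 hy]
  have hq2 : √A / y * √A = M := by
    rw [div_mul_eq_mul_div, ← sq, hb2, hA]
    field_simp
  calc ∑ p ∈ s, theta M (rep p • z).im ≤ ∑ p ∈ s, f p.1 := Finset.sum_le_sum h1
    _ = ∑ q ∈ s.map ⟨Subtype.val, Subtype.val_injective⟩, f q := by rw [Finset.sum_map]; rfl
    _ ≤ ∑ q ∈ I ×ˢ I, f q := by
        refine Finset.sum_le_sum_of_subset_of_nonneg ?_ fun q _ _ => hf0 q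
        intro q hq
        obtain ⟨p, hp, rfl⟩ := Finset.mem_map.mp hq
        obtain ⟨h2, h3⟩ := hn1 p hp
        rw [Finset.mem_product, hI, Finset.mem_Icc, Finset.mem_Icc]
        exact ⟨abs_le.mp h2, abs_le.mp h3⟩
    _ ≤ 2 + 6 * ((∑ c ∈ I, (if c ≠ 0 then u c else 0)) * ∑ d ∈ I, w d) := by
        simp only [hf]
        rw [Finset.sum_add_distrib]
        refine add_le_add ?_ (le_of_eq ?_)
        · rw [Finset.sum_boole]
          have : ((I ×ˢ I).filter fun q : ℤ × ℤ => q.1 = 0 ∧ |q.2| = 1) ⊆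
              {((0 : ℤ), (1 : ℤ)), (0, -1)} := by
            intro q hq
            obtain ⟨-, h2, h3⟩ := Finset.mem_filter.mp hq
            rcases (abs_eq (by norm_num)).mp h3 with h | h
            · simp [Prod.ext_iff, h2, h]
            · simp [Prod.ext_iff, h2, h]
          have h5 := (Finset.card_le_card this).trans Finset.card_le_two
          exact_mod_cast h5
        · rw [Finset.sum_mul_sum, ← Finset.sum_product', Finset.mul_sum]
          refine Finset.sum_congr rfl fun q _ => ?_
          split_ifs <;> simp
    _ ≤ 2 + 6 * (4 * (√A / y) * (1 + 4 * √A)) := by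
        gcongr
    _ ≤ 150 * M := by nlinarith

theorem sq_poin_le {Y R : ℝ} (hY : 0 < Y) {F : ℍ → ℝ} (hF : Adm Y R F) {M : ℝ}
    (hM : 1 / 3 ≤ M) {z : ℍ} (hz : z ∈ 𝒟ᵒ) :
    poin F z ^ 2 ≤ 75 * M * poin (fun z => F z ^ 2 / theta M z.im) z := by
  have hM0 : 0 < M := by linarith
  have hG : Adm Y R (fun z => F z ^ 2 / theta M z.im) :=
    ⟨fun n z => by rw [hF.per, im_T_zpow_smul],
      fun z hz => hF.supp z fun h => hz (by rw [h]; simp)⟩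
  obtain ⟨s, hs⟩ := Adm.exists_sum (R := R) hY z
  rw [hs _ hF, hs _ hG]
  have h1 : (∑ p ∈ s, F (rep p • z)) ^ 2 ≤ (∑ p ∈ s, theta M (rep p • z).im) *
      ∑ p ∈ s, F (rep p • z) ^ 2 / theta M (rep p • z).im := by
    refine Finset.sum_sq_le_sum_mul_sum_of_sq_le_mul _ (fun p _ => theta_nonneg _ _)
      (fun p _ => div_nonneg (sq_nonneg _) (theta_nonneg _ _)) fun p _ => le_of_eq ?_
    rw [mul_div_cancel₀]
    exact (theta_pos hM0 (rep p • z).im_pos).ne'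
  have h2 : 0 ≤ ∑ p ∈ s, F (rep p • z) ^ 2 / theta M (rep p • z).im :=
    Finset.sum_nonneg fun p _ => div_nonneg (sq_nonneg _) (theta_nonneg _ _)
  nlinarith [mul_le_mul_of_nonneg_right (sum_theta_le hM hz s) h2]

/-- The `L²` bound for Poincaré series. -/
theorem integral_sq_poin_le {Y R : ℝ} (hY : 0 < Y) {F : ℍ → ℝ} (hF : Adm Y R F)
    (hm : Measurable F) {M : ℝ} (hM : 1 / 3 ≤ M)
    (hi : IntegrableOn (fun z => F z ^ 2 / theta M z.im) strip) :
    IntegrableOn (fun z => poin F z ^ 2) 𝒟ᵒ ∧ ∫ z in 𝒟ᵒ, poin F z ^ 2 ≤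
      75 * M * ∫ z in strip, F z ^ 2 / theta M z.im := by
  have hG : Adm Y R (fun z => F z ^ 2 / theta M z.im) :=
    ⟨fun n z => by rw [hF.per, im_T_zpow_smul],
      fun z hz => hF.supp z fun h => hz (by rw [h]; simp)⟩
  have hGm : Measurable (fun z : ℍ => F z ^ 2 / theta M z.im) := by
    have := measurable_im
    unfold theta
    fun_prop
  obtain ⟨h1, h2⟩ := integral_poin hY hG hGm hi
  have hle : ∀ᵐ z ∂(volume.restrict (𝒟ᵒ : Set ℍ)), poin F z ^ 2 ≤
      75 * M * poin (fun z => F z ^ 2 / theta M z.im) z :=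
    ae_restrict_of_forall_mem isOpen_fdo.measurableSet fun z hz => sq_poin_le hY hF hM hz
  have h3 : IntegrableOn (fun z => poin F z ^ 2) 𝒟ᵒ := by
    refine (h1.const_mul (75 * M)).mono' ((measurable_poin hY hF hm).pow_const 2).aestronglyMeasurable ?_
    filter_upwards [hle] with z hz
    rwa [Real.norm_of_nonneg (sq_nonneg _)]
  refine ⟨h3, ?_⟩
  rw [← h2, ← integral_const_mul]
  exact integral_mono_ae h3 (h1.const_mul _) hle

/-- Real coordinates on the upper half plane. -/
def toPair (z : ℍ) : ℝ × ℝ := (z.re, z.im)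

theorem toPair_eq : toPair = Complex.measurableEquivRealProd ∘ UpperHalfPlane.coe := by
  ext z <;> rfl

theorem measurableEmbedding_toPair : MeasurableEmbedding toPair := by
  rw [toPair_eq]
  exact Complex.measurableEquivRealProd.measurableEmbedding.comp measurableEmbedding_coe

theorem map_toPair : Measure.map toPair (volume : Measure ℍ) =
    (volume.restrict {p : ℝ × ℝ | 0 < p.2}).withDensity
      fun p => ENNReal.ofReal (1 / p.2 ^ 2) := by
  ext s hs
  have hs' : MeasurableSet (toPair ⁻¹' s) := measurableEmbedding_toPair.measurable hs
  have hpos : MeasurableSet {p : ℝ × ℝ | 0 < p.2} := measurableSet_lt measurable_const measurable_snd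
  rw [measurableEmbedding_toPair.map_apply, UpperHalfPlane.volume_eq_lintegral,
    withDensity_apply _ hs, Measure.restrict_restrict hs,
    ← (Complex.volume_preserving_equiv_real_prod).setLIntegral_comp_preimage (hs.inter hpos)
      (by fun_prop)]
  have himg : ((↑) '' (toPair ⁻¹' s) : Set ℂ) =
      (Complex.measurableEquivRealProd) ⁻¹' (s ∩ {p : ℝ × ℝ | 0 < p.2}) := by
    ext w
    constructor
    · rintro ⟨z, hz, rfl⟩
      exact ⟨hz, z.im_pos⟩
    · rintro ⟨h1, h2⟩
      exact ⟨⟨w, h2⟩, h1, rfl⟩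
  rw [himg]
  refine setLIntegral_congr_fun (Complex.measurableEquivRealProd.measurable (hs.inter hpos)) ?_
  intro w _
  simp only [Complex.measurableEquivRealProd_apply]
  rw [ENNReal.ofReal, ENNReal.coe_inj]
  ext
  rw [Real.coe_toNNReal _ (by positivity)]
  simp

end KB

namespace KB

open ModularGroup UpperHalfPlane Matrix.SpecialLinearGroup
open scoped MatrixGroups Modular ENNReal ContDiff

theorem volume_restrict_toPair (s : Set (ℝ × ℝ)) (hs : MeasurableSet s) :
    Measure.map toPair ((volume : Measure ℍ).restrict (toPair ⁻¹' s)) =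
      (volume.restrict (s ∩ {p : ℝ × ℝ | 0 < p.2})).withDensity
        fun p => ENNReal.ofReal (1 / p.2 ^ 2) := by
  rw [← measurableEmbedding_toPair.restrict_map, map_toPair, restrict_withDensity hs,
    Measure.restrict_restrict hs]

theorem integral_toPair (s : Set (ℝ × ℝ)) (hs : MeasurableSet s) (f : ℝ × ℝ → ℝ) :
    ∫ z in toPair ⁻¹' s, f (toPair z) = ∫ p in s ∩ {p : ℝ × ℝ | 0 < p.2}, f p / p.2 ^ 2 := by
  rw [← measurableEmbedding_toPair.integral_map, volume_restrict_toPair s hs,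
    integral_withDensity_eq_integral_toReal_smul (by fun_prop) (by simp)]
  refine integral_congr_ae (ae_of_all _ fun p => ?_)
  simp only [smul_eq_mul]
  rw [ENNReal.toReal_ofReal (by positivity)]
  ring

theorem integrableOn_toPair (s : Set (ℝ × ℝ)) (hs : MeasurableSet s) (f : ℝ × ℝ → ℝ) :
    IntegrableOn (fun z => f (toPair z)) (toPair ⁻¹' s) ↔
      IntegrableOn (fun p => f p / p.2 ^ 2) (s ∩ {p : ℝ × ℝ | 0 < p.2}) := by
  rw [IntegrableOn, ← Function.comp_def, ← measurableEmbedding_toPair.integrable_map_iff,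
    volume_restrict_toPair s hs,
    integrable_withDensity_iff_integrable_smul' (by fun_prop) (by simp), IntegrableOn]
  refine integrable_congr (ae_of_all _ fun p => ?_)
  simp only [smul_eq_mul]
  rw [ENNReal.toReal_ofReal (by positivity)]
  ring

theorem strip_eq : strip = toPair ⁻¹' (Set.Ico 0 1 ×ˢ Set.univ) := by
  ext z
  simp [strip, toPair]

theorem strip_inter : (Set.Ico (0 : ℝ) 1 ×ˢ (Set.univ : Set ℝ)) ∩ {p : ℝ × ℝ | 0 < p.2} =
    Set.Ico 0 1 ×ˢ Set.Ioi 0 := by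
  ext p; simp [and_assoc]

theorem integral_strip (f : ℝ × ℝ → ℝ) :
    ∫ z in strip, f (toPair z) = ∫ p in Set.Ico (0 : ℝ) 1 ×ˢ Set.Ioi (0 : ℝ), f p / p.2 ^ 2 := by
  rw [strip_eq, integral_toPair _ (by measurability), strip_inter]

theorem integrableOn_strip (f : ℝ × ℝ → ℝ) :
    IntegrableOn (fun z => f (toPair z)) strip ↔
      IntegrableOn (fun p => f p / p.2 ^ 2) (Set.Ico (0 : ℝ) 1 ×ˢ Set.Ioi (0 : ℝ)) := by
  rw [strip_eq, integrableOn_toPair _ (by measurability), strip_inter]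

/-- Product functions on the upper half plane. -/
def prodF (A φ : ℝ → ℝ) (z : ℍ) : ℝ := A z.re * φ z.im

theorem re_T_zpow (n : ℤ) (z : ℍ) : (T ^ n • z).re = z.re + n := by
  rw [re_T_zpow_smul]

theorem adm_prodF {A φ : ℝ → ℝ} (hA : Function.Periodic A 1) {Y R : ℝ}
    (hφ : ∀ y, φ y ≠ 0 → Y ≤ y ∧ y ≤ R) : Adm Y R (prodF A φ) := by
  refine ⟨fun n z => ?_, fun z hz => hφ _ fun h => hz (by rw [prodF, h, mul_zero])⟩
  rw [prodF, prodF, im_T_zpow_smul, re_T_zpow]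
  have := hA.int_mul n z.re
  rw [mul_one] at this
  rw [this]

theorem integral_strip_prodF (A φ : ℝ → ℝ) :
    ∫ z in strip, prodF A φ z = (∫ x in (0 : ℝ)..1, A x) * ∫ y in Set.Ioi 0, φ y / y ^ 2 := by
  have := integral_strip (fun p => A p.1 * φ p.2)
  rw [show (fun z : ℍ => prodF A φ z) = fun z => (fun p : ℝ × ℝ => A p.1 * φ p.2) (toPair z) from rfl,
    this, intervalIntegral.integral_of_le zero_le_one, ← integral_Ico_eq_integral_Ioc]
  have h2 := setIntegral_prod_mul (μ := (volume : Measure ℝ)) (ν := (volume : Measure ℝ)) A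
    (fun y => φ y / y ^ 2) (Set.Ico 0 1) (Set.Ioi 0)
  rw [← Measure.volume_eq_prod] at h2
  rw [← h2]
  congr 1
  ext p
  ring

theorem integrableOn_strip_prodF {A φ : ℝ → ℝ} (hA : IntegrableOn A (Set.Ico 0 1))
    (hφ : IntegrableOn (fun y => φ y / y ^ 2) (Set.Ioi 0)) : IntegrableOn (prodF A φ) strip := by
  have := (integrableOn_strip (fun p => A p.1 * φ p.2)).mpr
  refine this ?_
  have h := Integrable.mul_prod hA hφ
  rw [IntegrableOn, Measure.volume_eq_prod, ← Measure.prod_restrict]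
  refine h.congr (ae_of_all _ fun p => ?_)
  simp only
  ring

/-- Integration by parts on a rectangle against a product function. -/
theorem ibp_rect {A A' A'' φ φ' φ'' : ℝ → ℝ} {h hx hy : ℝ × ℝ → ℝ} {a b : ℝ} (ha : 0 < a)
    (hab : a ≤ b) (dA : ∀ x, HasDerivAt A (A' x) x) (dA' : ∀ x, HasDerivAt A' (A'' x) x)
    (cA : Continuous A'') (dφ : ∀ x, HasDerivAt φ (φ' x) x)
    (dφ' : ∀ x, HasDerivAt φ' (φ'' x) x) (cφ : Continuous φ'') (hφa : φ' a = 0) (hφb : φ' b = 0)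
    (hper : Function.Periodic A' 1)
    (ch : ContinuousOn h (Set.univ ×ˢ Set.Ioi 0)) (chx : ContinuousOn hx (Set.univ ×ˢ Set.Ioi 0))
    (chy : ContinuousOn hy (Set.univ ×ˢ Set.Ioi 0))
    (dhx : ∀ x y, 0 < y → HasDerivAt (fun x => h (x, y)) (hx (x, y)) x)
    (dhy : ∀ x y, 0 < y → HasDerivAt (fun y => h (x, y)) (hy (x, y)) y)
    (hh : ∀ x y, 0 < y → h (x + 1, y) = h (x, y)) :
    ∫ p in Set.Icc (0 : ℝ) 1 ×ˢ Set.Icc a b, (A' p.1 * φ p.2 * hx p + A p.1 * φ' p.2 * hy p) =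
      -∫ p in Set.Icc (0 : ℝ) 1 ×ˢ Set.Icc a b, (A'' p.1 * φ p.2 + A p.1 * φ'' p.2) * h p := by
  have cA0 : Continuous A := continuous_iff_continuousAt.mpr fun x => (dA x).continuousAt
  have cA1 : Continuous A' := continuous_iff_continuousAt.mpr fun x => (dA' x).continuousAt
  have cφ0 : Continuous φ := continuous_iff_continuousAt.mpr fun x => (dφ x).continuousAt
  have cφ1 : Continuous φ' := continuous_iff_continuousAt.mpr fun x => (dφ' x).continuousAt
  set S := Set.Icc (0 : ℝ) 1 ×ˢ Set.Icc a b with hS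
  have hSc : IsCompact S := isCompact_Icc.prod isCompact_Icc
  have hsub : S ⊆ Set.univ ×ˢ Set.Ioi 0 := fun p hp => ⟨trivial, ha.trans_le hp.2.1⟩
  have int {f : ℝ × ℝ → ℝ} (hf : ContinuousOn f S) : IntegrableOn f S volume :=
    hf.integrableOn_compact hSc
  have cA0' : Continuous fun p : ℝ × ℝ => A p.1 := by fun_prop
  have cA1' : Continuous fun p : ℝ × ℝ => A' p.1 := by fun_prop
  have cA2' : Continuous fun p : ℝ × ℝ => A'' p.1 := by fun_prop
  have cφ0' : Continuous fun p : ℝ × ℝ => φ p.2 := by fun_prop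
  have cφ1' : Continuous fun p : ℝ × ℝ => φ' p.2 := by fun_prop
  have cφ2' : Continuous fun p : ℝ × ℝ => φ'' p.2 := by fun_prop
  have ch' := ch.mono hsub
  have chx' := chx.mono hsub
  have chy' := chy.mono hsub
  have i1 := int (f := fun p => A' p.1 * φ p.2 * hx p) (by fun_prop)
  have i2 := int (f := fun p => A p.1 * φ' p.2 * hy p) (by fun_prop)
  have i3 := int (f := fun p => A'' p.1 * φ p.2 * h p) (by fun_prop)
  have i4 := int (f := fun p => A p.1 * φ'' p.2 * h p) (by fun_prop)
  have slx {f : ℝ × ℝ → ℝ} (hf : ContinuousOn f (Set.univ ×ˢ Set.Ioi 0)) {y : ℝ} (hy0 : 0 < y)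
      (s : Set ℝ) : ContinuousOn (fun x => f (x, y)) s :=
    hf.comp (by fun_prop) (fun x _ => ⟨trivial, hy0⟩)
  have sly {f : ℝ × ℝ → ℝ} (hf : ContinuousOn f (Set.univ ×ˢ Set.Ioi 0)) {x : ℝ} :
      ContinuousOn (fun y => f (x, y)) (Set.Icc a b) :=
    hf.comp (by fun_prop) (fun y hy => ⟨trivial, ha.trans_le hy.1⟩)
  have e1 : ∫ p in S, A' p.1 * φ p.2 * hx p = -∫ p in S, A'' p.1 * φ p.2 * h p := by
    rw [hS, Measure.volume_eq_prod, 
      ← setIntegral_prod_swap (Set.Icc 0 1) (Set.Icc a b) (fun p => A' p.1 * φ p.2 * hx p),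
      ← setIntegral_prod_swap (Set.Icc 0 1) (Set.Icc a b) (fun p => A'' p.1 * φ p.2 * h p),
      setIntegral_prod, setIntegral_prod, ← integral_neg]
    · refine setIntegral_congr_fun measurableSet_Icc fun y hy' => ?_
      have hy0 : 0 < y := ha.trans_le hy'.1
      simp only [Prod.swap_prod_mk]
      rw [integral_Icc_eq_integral_Ioc, integral_Icc_eq_integral_Ioc,
        ← intervalIntegral.integral_of_le zero_le_one, ← intervalIntegral.integral_of_le zero_le_one]
      have := intervalIntegral.integral_mul_deriv_eq_deriv_mul (a := 0) (b := 1) (u := fun x => A' x)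
        (u' := A'') (v := fun x => h (x, y)) (v' := fun x => hx (x, y))
        (fun x _ => dA' x) (fun x _ => dhx x y hy0) (cA.intervalIntegrable _ _)
        ((slx chx hy0 _).intervalIntegrable)
      have e0 : h (1, y) = h (0, y) := by simpa using hh 0 y hy0
      have e0' : A' 1 = A' 0 := by simpa using hper 0
      rw [e0, e0', sub_self, zero_sub] at this
      have l1 : ∀ x, A' x * φ y * hx (x, y) = φ y * (A' x * hx (x, y)) := fun x => by ring
      have l2 : ∀ x, A'' x * φ y * h (x, y) = φ y * (A'' x * h (x, y)) := fun x => by ring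
      simp_rw [l1, l2]
      rw [intervalIntegral.integral_const_mul, intervalIntegral.integral_const_mul, this]
      ring
    · exact IntegrableOn.swap i3
    · exact IntegrableOn.swap i1
  have e2 : ∫ p in S, A p.1 * φ' p.2 * hy p = -∫ p in S, A p.1 * φ'' p.2 * h p := by
    rw [hS, Measure.volume_eq_prod, setIntegral_prod, setIntegral_prod, ← integral_neg]
    · refine setIntegral_congr_fun measurableSet_Icc fun x _ => ?_
      simp only
      rw [integral_Icc_eq_integral_Ioc, integral_Icc_eq_integral_Ioc,
        ← intervalIntegral.integral_of_le hab, ← intervalIntegral.integral_of_le hab]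
      have := intervalIntegral.integral_mul_deriv_eq_deriv_mul (a := a) (b := b) (u := φ')
        (u' := φ'') (v := fun y => h (x, y)) (v' := fun y => hy (x, y))
        (fun x _ => dφ' x) (fun y hy' => dhy x y (by
          rw [Set.uIcc_of_le hab] at hy'; exact ha.trans_le hy'.1)) (cφ.intervalIntegrable _ _)
        (by
          apply ContinuousOn.intervalIntegrable
          rw [Set.uIcc_of_le hab]
          exact sly chy)
      rw [hφa, hφb, zero_mul, zero_mul, sub_self, zero_sub] at this
      have l1 : ∀ y, A x * φ' y * hy (x, y) = A x * (φ' y * hy (x, y)) := fun x => by ring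
      have l2 : ∀ y, A x * φ'' y * h (x, y) = A x * (φ'' y * h (x, y)) := fun x => by ring
      simp_rw [l1, l2]
      rw [intervalIntegral.integral_const_mul, intervalIntegral.integral_const_mul, this]
      ring
    · exact i4
    · exact i2
  rw [integral_add i1 i2, e1, e2]
  simp_rw [add_mul]
  rw [integral_add i3 i4]
  ring
end KB

namespace KB

open ModularGroup Matrix.SpecialLinearGroup
open UpperHalfPlane hiding I continuous_re continuous_im
open scoped MatrixGroups Modular ENNReal ContDiff Topology

/-- Extension of a function on the upper half plane to the complex plane. -/
noncomputable def ex (f : ℍ → ℝ) (w : ℂ) : ℝ := f (ofComplex w)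

theorem ex_coe (f : ℍ → ℝ) (z : ℍ) : ex f z = f z := by rw [ex, ofComplex_apply]

theorem isOpen_im_pos : IsOpen {w : ℂ | 0 < w.im} := isOpen_lt continuous_const continuous_im

/-- Continuously differentiable functions on the upper half plane. -/
def Sm (f : ℍ → ℝ) : Prop := ContDiffOn ℝ 1 (ex f) {w : ℂ | 0 < w.im}

theorem sm_iff {f : ℍ → ℝ} : Sm f ↔ ∀ z : ℍ, ContDiffAt ℝ 1 (ex f) z := by
  constructor
  · intro h z
    exact h.contDiffAt (isOpen_im_pos.mem_nhds z.im_pos)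
  · intro h w hw
    exact (h ⟨w, hw⟩).contDiffWithinAt

theorem Sm.differentiableAt {f : ℍ → ℝ} (h : Sm f) (z : ℍ) : DifferentiableAt ℝ (ex f) z :=
  (sm_iff.mp h z).differentiableAt (by norm_num)

/-- The derivative at a point of the upper half plane. -/
noncomputable def DD (f : ℍ → ℝ) (z : ℍ) : ℂ →L[ℝ] ℝ := fderiv ℝ (ex f) z

/-- The Euclidean inner product of gradients. -/
noncomputable def gdot (f h : ℍ → ℝ) (z : ℍ) : ℝ :=
  DD f z 1 * DD h z 1 + DD f z I * DD h z I

/-- The Möbius map attached to an integral matrix. -/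
noncomputable def mob (g : SL(2, ℤ)) (w : ℂ) : ℂ :=
  ((g 0 0 : ℤ) * w + (g 0 1 : ℤ)) / ((g 1 0 : ℤ) * w + (g 1 1 : ℤ))

theorem coe_smul_eq_mob (g : SL(2, ℤ)) (z : ℍ) : ((g • z : ℍ) : ℂ) = mob g z := by
  rw [UpperHalfPlane.coe_specialLinearGroup_apply, mob]
  simp

theorem den_ne (g : SL(2, ℤ)) (z : ℍ) : ((g 1 0 : ℤ) : ℂ) * z + (g 1 1 : ℤ) ≠ 0 := by
  have := UpperHalfPlane.denom_ne_zero (g : GL (Fin 2) ℝ) z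
  rw [ModularGroup.denom_apply] at this
  exact this

theorem normSq_den (g : SL(2, ℤ)) (z : ℍ) :
    (g • z).im = z.im / normSq (((g 1 0 : ℤ) : ℂ) * z + (g 1 1 : ℤ)) := by
  rw [ModularGroup.im_smul_eq_div_normSq, ModularGroup.denom_apply]

theorem hasDerivAt_mob (g : SL(2, ℤ)) (z : ℍ) :
    HasDerivAt (mob g) (1 / (((g 1 0 : ℤ) : ℂ) * z + (g 1 1 : ℤ)) ^ 2) z := by
  have h := den_ne g z
  have hd : ((g 0 0 : ℤ) : ℂ) * (g 1 1 : ℤ) - (g 0 1 : ℤ) * (g 1 0 : ℤ) = 1 := by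
    have := g.det_coe
    rw [Matrix.det_fin_two] at this
    exact_mod_cast this
  have h1 : HasDerivAt (fun w : ℂ => ((g 0 0 : ℤ) : ℂ) * w + (g 0 1 : ℤ)) (g 0 0 : ℤ) z := by
    simpa using ((hasDerivAt_id (z : ℂ)).const_mul ((g 0 0 : ℤ) : ℂ)).add_const ((g 0 1 : ℤ) : ℂ)
  have h2 : HasDerivAt (fun w : ℂ => ((g 1 0 : ℤ) : ℂ) * w + (g 1 1 : ℤ)) (g 1 0 : ℤ) z := by
    simpa using ((hasDerivAt_id (z : ℂ)).const_mul ((g 1 0 : ℤ) : ℂ)).add_const ((g 1 1 : ℤ) : ℂ)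
  refine (h1.div h2 h).congr_deriv ?_
  rw [div_left_inj' (pow_ne_zero 2 h), ← hd]
  ring

theorem ex_smul_eventuallyEq (f : ℍ → ℝ) (g : SL(2, ℤ)) (z : ℍ) :
    ex (fun z => f (g • z)) =ᶠ[𝓝 (z : ℂ)] fun w => ex f (mob g w) := by
  filter_upwards [isOpen_im_pos.mem_nhds z.im_pos] with w hw
  rw [ex, ofComplex_apply_of_im_pos hw, ← ex_coe f, coe_smul_eq_mob]

theorem DD_smul {f : ℍ → ℝ} (hf : Sm f) (g : SL(2, ℤ)) (z : ℍ) (v : ℂ) :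
    DD (fun z => f (g • z)) z v =
      DD f (g • z) (1 / (((g 1 0 : ℤ) : ℂ) * z + (g 1 1 : ℤ)) ^ 2 * v) := by
  rw [DD, (ex_smul_eventuallyEq f g z).fderiv_eq]
  have h1 := (hasDerivAt_mob g z).hasFDerivAt.restrictScalars ℝ
  have h2 := hf.differentiableAt (g • z)
  rw [coe_smul_eq_mob] at h2
  have := h2.hasFDerivAt.comp (z : ℂ) h1
  rw [Function.comp_def] at this
  rw [this.fderiv, DD, coe_smul_eq_mob]
  simp [mul_comm]

theorem sm_smul {f : ℍ → ℝ} (hf : Sm f) (g : SL(2, ℤ)) : Sm (fun z => f (g • z)) := by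
  rw [sm_iff] at hf ⊢
  intro z
  refine ContDiffAt.congr_of_eventuallyEq ?_ (ex_smul_eventuallyEq f g z)
  have h1 : ContDiffAt ℂ 1 (mob g) z := by
    have h := den_ne g z
    unfold mob
    fun_prop (disch := assumption)
  have h2 := hf (g • z)
  rw [coe_smul_eq_mob] at h2
  exact h2.comp (z : ℂ) (h1.restrict_scalars ℝ)

theorem dot_conformal (l₁ l₂ : ℂ →L[ℝ] ℝ) (c : ℂ) :
    l₁ (c * 1) * l₂ (c * 1) + l₁ (c * I) * l₂ (c * I) =
      normSq c * (l₁ 1 * l₂ 1 + l₁ I * l₂ I) := by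
  have h : ∀ l : ℂ →L[ℝ] ℝ, l (c * 1) = c.re * l 1 + c.im * l I ∧
      l (c * I) = -c.im * l 1 + c.re * l I := by
    intro l
    constructor
    · rw [show c * 1 = c.re • (1 : ℂ) + c.im • I by simp]
      rw [map_add, map_smul, map_smul, smul_eq_mul, smul_eq_mul]
    · rw [show c * I = (-c.im) • (1 : ℂ) + c.re • I by
        apply Complex.ext <;> simp]
      rw [map_add, map_smul, map_smul, smul_eq_mul, smul_eq_mul]
  rw [(h l₁).1, (h l₁).2, (h l₂).1, (h l₂).2, normSq_apply]
  ring

theorem gdot_smul {f h : ℍ → ℝ} (hf : Sm f) (hh : Sm h) (g : SL(2, ℤ)) (z : ℍ) :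
    z.im ^ 2 * gdot (fun z => f (g • z)) (fun z => h (g • z)) z =
      (g • z).im ^ 2 * gdot f h (g • z) := by
  have h0 := den_ne g z
  have h1 : normSq (((g 1 0 : ℤ) : ℂ) * z + (g 1 1 : ℤ)) ≠ 0 := by
    rwa [Ne, normSq_eq_zero]
  rw [gdot, DD_smul hf, DD_smul hf, DD_smul hh, DD_smul hh, dot_conformal, gdot, normSq_den]
  rw [map_div₀, map_pow, map_one]
  field_simp

theorem exists_finset_nhds {Y : ℝ} (hY : 0 < Y) (z : ℍ) : ∃ s : Finset CopPair,
    ∀ᶠ w in 𝓝 (z : ℂ), 0 < w.im ∧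
      ∀ p : CopPair, Y ≤ (rep p • ofComplex w).im → p ∈ s := by
  obtain ⟨B, hB⟩ := exists_box hY (|z.re| + 1) (z.im / 2) (2 * z.im) (half_pos z.im_pos)
  refine ⟨boxPairs B, ?_⟩
  have e1 : ∀ᶠ w in 𝓝 (z : ℂ), z.im / 2 < w.im :=
    continuous_im.continuousAt.eventually (lt_mem_nhds (half_lt_self z.im_pos))
  have e2 : ∀ᶠ w in 𝓝 (z : ℂ), w.im < 2 * z.im :=
    continuous_im.continuousAt.eventually (gt_mem_nhds (by
      change z.im < _; linarith [z.im_pos]))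
  have e3 : ∀ᶠ w in 𝓝 (z : ℂ), |w.re| < |z.re| + 1 :=
    (continuous_abs.comp continuous_re).continuousAt.eventually (gt_mem_nhds (by simp))
  filter_upwards [e1, e2, e3] with w h1 h2 h3
  have h0 : 0 < w.im := (half_pos z.im_pos).trans h1
  refine ⟨h0, fun p hp => hB (ofComplex w) ?_ ?_ ?_ p hp⟩
  · rw [ofComplex_apply_of_im_pos h0]; exact h1.le
  · rw [ofComplex_apply_of_im_pos h0]; exact h2.le
  · rw [ofComplex_apply_of_im_pos h0]; exact h3.le

theorem Adm.ex_poin {Y R : ℝ} (hY : 0 < Y) (z : ℍ) : ∃ s : Finset CopPair,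
    (∀ F, Adm Y R F → poin F z = (1 / 2) * ∑ p ∈ s, F (rep p • z)) ∧
    (∀ F, Adm Y R F → ex (poin F) =ᶠ[𝓝 (z : ℂ)]
      fun w => (1 / 2) * ∑ p ∈ s, ex (fun z => F (rep p • z)) w) := by
  obtain ⟨s, hs⟩ := exists_finset_nhds hY z
  have key : ∀ F, Adm Y R F → ∀ w : ℍ, (∀ p : CopPair, Y ≤ (rep p • w).im → p ∈ s) →
      poin F w = (1 / 2) * ∑ p ∈ s, F (rep p • w) := by
    intro F hF w hw
    rw [poin, tsum_eq_sum]
    intro p hp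
    by_contra h
    exact hp (hw p (hF.supp _ h).1)
  refine ⟨s, fun F hF => key F hF z ?_, fun F hF => ?_⟩
  · have := hs.self_of_nhds.2
    rwa [ofComplex_apply] at this
  · filter_upwards [hs] with w hw
    rw [ex, key F hF _ hw.2]
    rfl

theorem sm_poin {Y R : ℝ} (hY : 0 < Y) {F : ℍ → ℝ} (hF : Adm Y R F) (hs : Sm F) : Sm (poin F) := by
  rw [sm_iff]
  intro z
  obtain ⟨s, -, h⟩ := Adm.ex_poin (R := R) hY z
  refine ContDiffAt.congr_of_eventuallyEq ?_ (h F hF)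
  refine contDiffAt_const.mul (ContDiffAt.sum fun p _ => ?_)
  exact sm_iff.mp (sm_smul hs (rep p)) z

theorem DD_eq_zero {Y R : ℝ} {F : ℍ → ℝ} (hF : Adm Y R F) {z : ℍ} (h : ¬ (Y ≤ z.im ∧ z.im ≤ R)) :
    DD F z = 0 := by
  have hc : IsClosed {w : ℂ | Y ≤ w.im ∧ w.im ≤ R} :=
    (isClosed_le continuous_const continuous_im).inter (isClosed_le continuous_im continuous_const)
  have h2 : ex F =ᶠ[𝓝 (z : ℂ)] fun _ => 0 := by
    filter_upwards [hc.isOpen_compl.mem_nhds h, isOpen_im_pos.mem_nhds z.im_pos] with w hw hw0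
    rw [ex, ofComplex_apply_of_im_pos hw0]
    by_contra hne
    exact hw (hF.supp _ hne)
  rw [DD, h2.fderiv_eq]
  simp

theorem adm_gdot {Y R : ℝ} {F H : ℍ → ℝ} (hF : Adm Y R F) (sF : Sm F) (sH : Sm H)
    (hH : ∀ (g : SL(2, ℤ)) z, H (g • z) = H z) : Adm Y R (fun z => z.im ^ 2 * gdot F H z) := by
  refine ⟨fun n z => ?_, fun z hz => ?_⟩
  · rw [← gdot_smul sF sH]
    simp only [hF.per, hH]
  · by_contra h
    apply hz
    simp [gdot, DD_eq_zero hF h]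

theorem gdot_poin {Y R : ℝ} (hY : 0 < Y) {F H : ℍ → ℝ} (hF : Adm Y R F) (sF : Sm F) (sH : Sm H)
    (hH : ∀ (g : SL(2, ℤ)) z, H (g • z) = H z) (z : ℍ) :
    poin (fun z => z.im ^ 2 * gdot F H z) z = z.im ^ 2 * gdot (poin F) H z := by
  obtain ⟨s, h1, h2⟩ := Adm.ex_poin (R := R) hY z
  rw [h1 _ (adm_gdot hF sF sH hH)]
  have h3 : ∀ v, DD (poin F) z v = (1 / 2) * ∑ p ∈ s, DD (fun z => F (rep p • z)) z v := by
    intro v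
    rw [DD, (h2 F hF).fderiv_eq, fderiv_const_mul, fderiv_fun_sum]
    · simp [DD]
    · exact fun p _ => (sm_smul sF (rep p)).differentiableAt z
    · exact DifferentiableAt.fun_sum fun p _ => (sm_smul sF (rep p)).differentiableAt z
  simp_rw [← gdot_smul sF sH, hH]
  simp_rw [gdot, h3]
  simp only [Finset.mul_sum, Finset.sum_mul, ← Finset.sum_add_distrib]
  refine Finset.sum_congr rfl fun p _ => ?_
  ring

end KB

namespace KB

open ModularGroup Matrix.SpecialLinearGroup
open UpperHalfPlane hiding I continuous_re continuous_im
open scoped MatrixGroups Modular ENNReal ContDiff Topology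

theorem hasDerivAt_supp {φ φ' : ℝ → ℝ} {Y R : ℝ} (d : ∀ x, HasDerivAt φ (φ' x) x)
    (h : ∀ y, φ y ≠ 0 → Y ≤ y ∧ y ≤ R) : ∀ y, φ' y ≠ 0 → Y ≤ y ∧ y ≤ R := by
  intro y hy
  by_contra hc
  apply hy
  have h2 : φ =ᶠ[𝓝 y] fun _ => 0 := by
    filter_upwards [isClosed_Icc.isOpen_compl.mem_nhds hc] with w hw
    by_contra hne
    exact hw (h w hne)
  rw [← (d y).deriv, h2.deriv_eq, deriv_const]

theorem contDiff_of_hasDerivAt {φ φ' : ℝ → ℝ} (d : ∀ x, HasDerivAt φ (φ' x) x)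
    (c : Continuous φ') : ContDiff ℝ 1 φ := by
  rw [contDiff_one_iff_deriv]
  refine ⟨fun x => (d x).differentiableAt, ?_⟩
  convert c using 1
  ext x
  exact (d x).deriv

theorem ex_prodF_eventuallyEq (A φ : ℝ → ℝ) (z : ℍ) :
    ex (prodF A φ) =ᶠ[𝓝 (z : ℂ)] fun w => A w.re * φ w.im := by
  filter_upwards [isOpen_im_pos.mem_nhds z.im_pos] with w hw
  rw [ex, ofComplex_apply_of_im_pos hw]
  rfl

theorem sm_prodF {A φ : ℝ → ℝ} (hA : ContDiff ℝ 1 A) (hφ : ContDiff ℝ 1 φ) : Sm (prodF A φ) := by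
  rw [sm_iff]
  intro z
  refine ContDiffAt.congr_of_eventuallyEq ?_ (ex_prodF_eventuallyEq A φ z)
  have h1 : ContDiff ℝ 1 (fun w : ℂ => A w.re) := hA.comp reCLM.contDiff
  have h2 : ContDiff ℝ 1 (fun w : ℂ => φ w.im) := hφ.comp imCLM.contDiff
  exact (h1.mul h2).contDiffAt

theorem DD_prodF {A φ A' φ' : ℝ → ℝ} (dA : ∀ x, HasDerivAt A (A' x) x)
    (dφ : ∀ x, HasDerivAt φ (φ' x) x) (z : ℍ) :
    DD (prodF A φ) z 1 = A' z.re * φ z.im ∧ DD (prodF A φ) z I = A z.re * φ' z.im := by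
  rw [DD, (ex_prodF_eventuallyEq A φ z).fderiv_eq]
  have h1 : HasFDerivAt (fun w : ℂ => A w.re) _ (z : ℂ) :=
    (dA z.re).comp_hasFDerivAt (z : ℂ) reCLM.hasFDerivAt
  have h2 : HasFDerivAt (fun w : ℂ => φ w.im) _ (z : ℂ) :=
    (dφ z.im).comp_hasFDerivAt (z : ℂ) imCLM.hasFDerivAt
  have h3 : HasFDerivAt (fun w : ℂ => A w.re * φ w.im) _ (z : ℂ) := h1.mul h2
  rw [h3.fderiv]
  constructor <;> simp [mul_comm]

theorem strip_continuousOn {f : ℝ × ℝ → ℝ} (hf : ContinuousOn f (Set.univ ×ˢ Set.Ioi 0))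
    {a b : ℝ} (ha : 0 < a) (hs : ∀ p : ℝ × ℝ, 0 < p.2 → f p ≠ 0 → a ≤ p.2 ∧ p.2 ≤ b) :
    IntegrableOn (fun z => f (toPair z)) strip ∧
    ∫ z in strip, f (toPair z) = ∫ p in Set.Icc (0 : ℝ) 1 ×ˢ Set.Icc a b, f p / p.2 ^ 2 := by
  have hmeas : (volume : Measure (ℝ × ℝ)).restrict (Set.Ico 0 1 ×ˢ Set.Icc a b) =
      volume.restrict (Set.Icc 0 1 ×ˢ Set.Icc a b) := by
    rw [Measure.volume_eq_prod, ← Measure.prod_restrict, ← Measure.prod_restrict,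
      Measure.restrict_congr_set Ico_ae_eq_Icc]
  have hsub : Set.Icc (0 : ℝ) 1 ×ˢ Set.Icc a b ⊆ Set.univ ×ˢ Set.Ioi 0 :=
    fun p hp => ⟨trivial, ha.trans_le hp.2.1⟩
  have hintegr : IntegrableOn (fun p : ℝ × ℝ => f p / p.2 ^ 2) (Set.Icc (0 : ℝ) 1 ×ˢ Set.Icc a b) := by
    refine ContinuousOn.integrableOn_compact (isCompact_Icc.prod isCompact_Icc) ?_
    refine (hf.mono hsub).div (by fun_prop) fun p hp => ?_
    have : 0 < p.2 := ha.trans_le hp.2.1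
    positivity
  have hsub2 : Set.Ico (0 : ℝ) 1 ×ˢ Set.Icc a b ⊆ Set.Ico (0 : ℝ) 1 ×ˢ Set.Ioi 0 :=
    fun p hp => ⟨hp.1, ha.trans_le hp.2.1⟩
  have hz : ∀ p ∈ (Set.Ico (0 : ℝ) 1 ×ˢ Set.Ioi (0 : ℝ)) \ (Set.Ico (0 : ℝ) 1 ×ˢ Set.Icc a b),
      f p / p.2 ^ 2 = 0 := by
    rintro p ⟨h1, h2⟩
    by_contra hne
    exact h2 ⟨h1.1, hs p h1.2 fun h => hne (by rw [h, zero_div])⟩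
  rw [integrableOn_strip, integral_strip]
  constructor
  · refine IntegrableOn.of_forall_sdiff_eq_zero ?_ (by measurability) hz
    rw [IntegrableOn, hmeas]
    exact hintegr
  · rw [← hmeas]
    exact setIntegral_eq_of_subset_of_forall_sdiff_eq_zero
      (measurableSet_Ico.prod measurableSet_Ioi) hsub2 hz

/-- The point of the complex plane with given coordinates. -/
noncomputable def mkC (p : ℝ × ℝ) : ℂ := equivRealProdCLM.symm p

theorem mkC_im (p : ℝ × ℝ) : (mkC p).im = p.2 := by simp [mkC]
theorem mkC_re (p : ℝ × ℝ) : (mkC p).re = p.1 := by simp [mkC]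

theorem continuous_mkC : Continuous mkC := by unfold mkC; fun_prop

theorem mkC_toPair (z : ℍ) : mkC (toPair z) = z := by
  apply Complex.ext
  · rw [mkC_re]; rfl
  · rw [mkC_im]; rfl

theorem Sm.continuousOn {h : ℍ → ℝ} (hh : Sm h) :
    ContinuousOn (fun p => ex h (mkC p)) (Set.univ ×ˢ Set.Ioi 0) :=
  ContDiffOn.continuousOn hh |>.comp continuous_mkC.continuousOn fun p hp => by
    simpa [mkC_im] using hp

theorem Sm.continuousOn_deriv {h : ℍ → ℝ} (hh : Sm h) (v : ℂ) :
    ContinuousOn (fun p => fderiv ℝ (ex h) (mkC p) v) (Set.univ ×ˢ Set.Ioi 0) := by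
  have h1 : ContinuousOn (fun w => fderiv ℝ (ex h) w) {w : ℂ | 0 < w.im} :=
    ContDiffOn.continuousOn_fderiv_of_isOpen hh isOpen_im_pos (by norm_num)
  have h2 : ContinuousOn (fun p => fderiv ℝ (ex h) (mkC p)) (Set.univ ×ˢ Set.Ioi 0) :=
    h1.comp continuous_mkC.continuousOn fun p hp => by simpa [mkC_im] using hp
  exact h2.clm_apply continuousOn_const

theorem Sm.hasDerivAt_fst {h : ℍ → ℝ} (hh : Sm h) (x y : ℝ) (hy : 0 < y) :
    HasDerivAt (fun x => ex h (mkC (x, y))) (fderiv ℝ (ex h) (mkC (x, y)) 1) x := by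
  have h1 : HasFDerivAt (ex h) _ (mkC (x, y)) := (hh.differentiableAt
    ⟨mkC (x, y), by rw [mkC_im]; exact hy⟩).hasFDerivAt
  have h2 : HasDerivAt (fun x : ℝ => mkC (x, y)) 1 x := by
    have : (fun x : ℝ => mkC (x, y)) = fun x : ℝ => (x : ℂ) + y * I := by
      ext x; apply Complex.ext <;> simp [mkC_re, mkC_im]
    rw [this]
    exact (ofRealCLM.hasDerivAt (x := x)).add_const _
  exact h1.comp_hasDerivAt x h2

theorem Sm.hasDerivAt_snd {h : ℍ → ℝ} (hh : Sm h) (x y : ℝ) (hy : 0 < y) :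
    HasDerivAt (fun y => ex h (mkC (x, y))) (fderiv ℝ (ex h) (mkC (x, y)) I) y := by
  have h1 : HasFDerivAt (ex h) _ (mkC (x, y)) := (hh.differentiableAt
    ⟨mkC (x, y), by rw [mkC_im]; exact hy⟩).hasFDerivAt
  have h2 : HasDerivAt (fun y : ℝ => mkC (x, y)) I y := by
    have : (fun y : ℝ => mkC (x, y)) = fun y : ℝ => (x : ℂ) + y * I := by
      ext x; apply Complex.ext <;> simp [mkC_re, mkC_im]
    rw [this]
    have := ((ofRealCLM.hasDerivAt (x := y)).mul_const I).const_add (x : ℂ)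
    simpa using this
  exact h1.comp_hasDerivAt y h2

theorem ex_periodic {h : ℍ → ℝ} (hp : ∀ z, h (T • z) = h z) (x y : ℝ) (hy : 0 < y) :
    ex h (mkC (x + 1, y)) = ex h (mkC (x, y)) := by
  have h1 : 0 < (mkC (x, y)).im := by rwa [mkC_im]
  have h2 : 0 < (mkC (x + 1, y)).im := by rwa [mkC_im]
  rw [ex, ex, ofComplex_apply_of_im_pos h1, ofComplex_apply_of_im_pos h2,
    ← hp ⟨mkC (x, y), h1⟩]
  congr 1
  rw [UpperHalfPlane.modular_T_smul]
  apply UpperHalfPlane.ext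
  rw [UpperHalfPlane.coe_vadd]
  apply Complex.ext <;> simp [mkC_re, mkC_im, add_comm]

theorem Sm.continuous {h : ℍ → ℝ} (hh : Sm h) : Continuous h := by
  have h1 : h = fun z : ℍ => ex h (z : ℂ) := by ext z; rw [ex_coe]
  rw [h1]
  exact (ContDiffOn.continuousOn hh).comp_continuous UpperHalfPlane.continuous_coe fun z => z.im_pos

theorem Sm.continuous_DD {h : ℍ → ℝ} (hh : Sm h) (v : ℂ) : Continuous (fun z => DD h z v) := by
  have h1 : ContinuousOn (fun w => fderiv ℝ (ex h) w) {w : ℂ | 0 < w.im} :=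
    ContDiffOn.continuousOn_fderiv_of_isOpen hh isOpen_im_pos (by norm_num)
  exact (h1.comp_continuous UpperHalfPlane.continuous_coe fun z => z.im_pos).clm_apply
    continuous_const

/-- Green's identity for incomplete Poincaré series. -/
theorem dirichlet_poin {A A' A'' φ φ' φ'' : ℝ → ℝ} {Y R : ℝ} (hY : 0 < Y)
    (hA : Function.Periodic A 1) (dA : ∀ x, HasDerivAt A (A' x) x)
    (dA' : ∀ x, HasDerivAt A' (A'' x) x) (cA : Continuous A'')
    (dφ : ∀ x, HasDerivAt φ (φ' x) x) (dφ' : ∀ x, HasDerivAt φ' (φ'' x) x) (cφ : Continuous φ'')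
    (hφ : ∀ y, φ y ≠ 0 → Y ≤ y ∧ y ≤ R) {H : ℍ → ℝ} (sH : Sm H)
    (hH : ∀ (g : SL(2, ℤ)) z, H (g • z) = H z) :
    IntegrableOn (fun z => z.im ^ 2 * gdot (poin (prodF A φ)) H z) 𝒟ᵒ ∧
    ∫ z in 𝒟ᵒ, z.im ^ 2 * gdot (poin (prodF A φ)) H z =
      -∫ z in 𝒟ᵒ, (poin (prodF A'' fun y => y ^ 2 * φ y) z +
        poin (prodF A fun y => y ^ 2 * φ'' y) z) * H z := by
  have hφ1 := hasDerivAt_supp dφ hφ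
  have hφ2 := hasDerivAt_supp dφ' hφ1
  have per_deriv : ∀ {f f' : ℝ → ℝ}, Function.Periodic f 1 → (∀ x, HasDerivAt f (f' x) x) →
      Function.Periodic f' 1 := by
    intro f f' h d x
    have h1 := (d (x + 1)).comp_add_const x 1
    have h2 : (fun y => f (y + 1)) = f := funext h
    rw [h2] at h1
    exact h1.unique (d x)
  have pA' := per_deriv hA dA
  have pA'' := per_deriv pA' dA'
  have cA0 : Continuous A := continuous_iff_continuousAt.mpr fun x => (dA x).continuousAt
  have cA1 : Continuous A' := continuous_iff_continuousAt.mpr fun x => (dA' x).continuousAt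
  have cφ0 : Continuous φ := continuous_iff_continuousAt.mpr fun x => (dφ x).continuousAt
  have cφ1 : Continuous φ' := continuous_iff_continuousAt.mpr fun x => (dφ' x).continuousAt
  have sF : Sm (prodF A φ) :=
    sm_prodF (contDiff_of_hasDerivAt dA cA1) (contDiff_of_hasDerivAt dφ cφ1)
  have aF : Adm Y R (prodF A φ) := adm_prodF hA hφ
  have aF1 : Adm Y R (prodF A'' fun y => y ^ 2 * φ y) :=
    adm_prodF pA'' fun y hy => hφ y (right_ne_zero_of_mul hy)
  have aF2 : Adm Y R (prodF A fun y => y ^ 2 * φ'' y) :=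
    adm_prodF hA fun y hy => hφ2 y (right_ne_zero_of_mul hy)
  set f : ℝ × ℝ → ℝ := fun p => p.2 ^ 2 * (A' p.1 * φ p.2 * fderiv ℝ (ex H) (mkC p) 1 +
    A p.1 * φ' p.2 * fderiv ℝ (ex H) (mkC p) I) with hf
  set k : ℝ × ℝ → ℝ := fun p => p.2 ^ 2 * ((A'' p.1 * φ p.2 + A p.1 * φ'' p.2) * ex H (mkC p)) with hk
  have e1 : (fun z : ℍ => z.im ^ 2 * gdot (prodF A φ) H z) = fun z => f (toPair z) := by
    ext z
    rw [gdot, (DD_prodF dA dφ z).1, (DD_prodF dA dφ z).2, hf]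
    simp only [mkC_toPair]
    rfl
  have e2 : (fun z : ℍ => (prodF A'' (fun y => y ^ 2 * φ y) z +
        prodF A (fun y => y ^ 2 * φ'' y) z) * H z) = fun z => k (toPair z) := by
    ext z
    simp only [hk, prodF, mkC_toPair, ex_coe]
    change _ = z.im ^ 2 * ((A'' z.re * φ z.im + A z.re * φ'' z.im) * H z)
    ring
  have cH := sH.continuousOn
  have cx := sH.continuousOn_deriv 1
  have cy := sH.continuousOn_deriv I
  have cf : ContinuousOn f (Set.univ ×ˢ Set.Ioi 0) := by
    have h1 : Continuous fun p : ℝ × ℝ => A' p.1 * φ p.2 := by fun_prop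
    have h2 : Continuous fun p : ℝ × ℝ => A p.1 * φ' p.2 := by fun_prop
    fun_prop
  have ck : ContinuousOn k (Set.univ ×ˢ Set.Ioi 0) := by
    have h1 : Continuous fun p : ℝ × ℝ => A'' p.1 * φ p.2 + A p.1 * φ'' p.2 := by fun_prop
    fun_prop
  have hb1 : Y / 2 ≤ max R Y + 1 := by
    have := le_max_right R Y; linarith
  have hb2 : ∀ y, Y ≤ y ∧ y ≤ R → Y / 2 ≤ y ∧ y ≤ max R Y + 1 := fun y h =>
    ⟨by linarith [h.1], by linarith [h.2, le_max_left R Y]⟩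
  obtain ⟨if1, if2⟩ := strip_continuousOn (a := Y / 2) (b := max R Y + 1) cf (half_pos hY)
    (fun p _ hp => hb2 _ (by
      by_contra hc
      have h1 : φ p.2 = 0 := by by_contra h; exact hc (hφ _ h)
      have h2 : φ' p.2 = 0 := by by_contra h; exact hc (hφ1 _ h)
      exact hp (by simp [hf, h1, h2])))
  obtain ⟨ik1, ik2⟩ := strip_continuousOn (a := Y / 2) (b := max R Y + 1) ck (half_pos hY)
    (fun p _ hp => hb2 _ (by
      by_contra hc
      have h1 : φ p.2 = 0 := by by_contra h; exact hc (hφ _ h)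
      have h2 : φ'' p.2 = 0 := by by_contra h; exact hc (hφ2 _ h)
      exact hp (by simp [hk, h1, h2])))
  have aK := adm_gdot aF sF sH hH
  have aK2 : Adm Y R (fun z : ℍ => (prodF A'' (fun y => y ^ 2 * φ y) z +
        prodF A (fun y => y ^ 2 * φ'' y) z) * H z) := (aF1.add aF2).mul_left fun n z => hH _ z
  have mK : Measurable (fun z : ℍ => z.im ^ 2 * gdot (prodF A φ) H z) := by
    have h1 := sF.continuous_DD 1
    have h2 := sF.continuous_DD I
    have h3 := sH.continuous_DD 1
    have h4 := sH.continuous_DD I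
    have h5 := UpperHalfPlane.continuous_im
    unfold gdot
    exact Continuous.measurable (by fun_prop)
  have mK2 : Measurable (fun z : ℍ => (prodF A'' (fun y => y ^ 2 * φ y) z +
        prodF A (fun y => y ^ 2 * φ'' y) z) * H z) := by
    have h5 := UpperHalfPlane.continuous_im
    have h6 := UpperHalfPlane.continuous_re
    have h7 := sH.continuous
    unfold prodF
    exact Continuous.measurable (by fun_prop)
  obtain ⟨r1, r2⟩ := integral_poin hY aK mK (by rw [e1]; exact if1)
  obtain ⟨-, r4⟩ := integral_poin hY aK2 mK2 (by rw [e2]; exact ik1)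
  have p1 : poin (fun z : ℍ => z.im ^ 2 * gdot (prodF A φ) H z) =
      fun z => z.im ^ 2 * gdot (poin (prodF A φ)) H z := funext (gdot_poin hY aF sF sH hH)
  rw [p1] at r1 r2
  have p2 : poin (fun z : ℍ => (prodF A'' (fun y => y ^ 2 * φ y) z +
        prodF A (fun y => y ^ 2 * φ'' y) z) * H z) = fun z =>
        (poin (prodF A'' fun y => y ^ 2 * φ y) z + poin (prodF A fun y => y ^ 2 * φ'' y) z) * H z := by
    ext z
    rw [poin_mul hH, poin_add hY aF1 aF2]
  rw [p2] at r4
  refine ⟨r1, ?_⟩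
  rw [r2, r4, e1, e2, if2, ik2]
  have hz : ∀ y, y ∉ Set.Icc Y R → φ' y = 0 := fun y hy => by
    by_contra h; exact hy (hφ1 _ h)
  have := ibp_rect (half_pos hY) hb1 dA dA' cA dφ dφ' cφ (hz _ fun h => by
    have := h.1; linarith) (hz _ fun h => by have := h.2; linarith [le_max_left R Y]) pA' cH cx cy
    sH.hasDerivAt_fst sH.hasDerivAt_snd ?_
  · have t1 : Set.EqOn (fun p => f p / p.2 ^ 2) (fun p => A' p.1 * φ p.2 *
        fderiv ℝ (ex H) (mkC p) 1 + A p.1 * φ' p.2 * fderiv ℝ (ex H) (mkC p) I)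
        (Set.Icc (0 : ℝ) 1 ×ˢ Set.Icc (Y / 2) (max R Y + 1)) := by
      intro p hp
      have : p.2 ≠ 0 := ((half_pos hY).trans_le hp.2.1).ne'
      simp only [hf]
      field_simp
    have t2 : Set.EqOn (fun p => k p / p.2 ^ 2) (fun p => (A'' p.1 * φ p.2 +
        A p.1 * φ'' p.2) * ex H (mkC p))
        (Set.Icc (0 : ℝ) 1 ×ˢ Set.Icc (Y / 2) (max R Y + 1)) := by
      intro p hp
      have : p.2 ≠ 0 := ((half_pos hY).trans_le hp.2.1).ne'
      simp only [hk]
      field_simp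
    have hm : MeasurableSet (Set.Icc (0 : ℝ) 1 ×ˢ Set.Icc (Y / 2) (max R Y + 1)) :=
      measurableSet_Icc.prod measurableSet_Icc
    rw [setIntegral_congr_fun hm t1, setIntegral_congr_fun hm t2, this]
  · exact fun x y hy => ex_periodic (fun z => hH T z) x y hy

end KB

namespace KB

open ModularGroup Matrix.SpecialLinearGroup
open UpperHalfPlane hiding I continuous_re continuous_im
open scoped MatrixGroups Modular ENNReal ContDiff Topology

theorem integral_add_le_of_hasDerivAt {G g P Q : ℝ → ℝ} {a b : ℝ} (hab : a ≤ b)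
    (hG : ∀ y ∈ Set.Icc a b, HasDerivAt G (g y) y) (cg : ContinuousOn g (Set.Icc a b))
    (cP : ContinuousOn P (Set.Icc a b)) (cQ : ContinuousOn Q (Set.Icc a b))
    (h : ∀ y ∈ Set.Icc a b, P y + g y ≤ Q y) :
    (∫ y in a..b, P y) + (G b - G a) ≤ ∫ y in a..b, Q y := by
  rw [← Set.uIcc_of_le hab] at hG cg cP cQ
  rw [← intervalIntegral.integral_eq_sub_of_hasDerivAt hG cg.intervalIntegrable,
    ← intervalIntegral.integral_add cP.intervalIntegrable cg.intervalIntegrable]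
  exact intervalIntegral.integral_mono_on hab (cP.add cg).intervalIntegrable
    cQ.intervalIntegrable h

theorem hardy {φ φ' : ℝ → ℝ} {b c : ℝ} (hb : 1 ≤ b) (d : ∀ y ∈ Set.Icc 1 b, HasDerivAt φ (φ' y) y)
    (cφ : Continuous φ) (cφ' : Continuous φ') (h1 : φ 1 = c) :
    ∫ y in (1 : ℝ)..b, (φ y - c) ^ 2 / y ^ 2 ≤ 4 * ∫ y in (1 : ℝ)..b, φ' y ^ 2 := by
  have hpos : ∀ y ∈ Set.Icc 1 b, y ≠ 0 := fun y hy => by linarith [hy.1]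
  have := integral_add_le_of_hasDerivAt (G := fun y => 2 * ((φ y - c) ^ 2 / y))
    (g := fun y => 2 * ((2 * (φ y - c) * φ' y * y - (φ y - c) ^ 2) / y ^ 2))
    (P := fun y => (φ y - c) ^ 2 / y ^ 2) (Q := fun y => 4 * φ' y ^ 2) hb
    (fun y hy => by
      have := ((((d y hy).sub_const c).pow 2).div (hasDerivAt_id y) (hpos y hy)).const_mul 2
      refine this.congr_deriv ?_
      simp)
    (continuousOn_const.mul
      (ContinuousOn.div (by fun_prop) (by fun_prop) fun y hy => pow_ne_zero 2 (hpos y hy)))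
    (ContinuousOn.div (by fun_prop) (by fun_prop) fun y hy => pow_ne_zero 2 (hpos y hy))
    (by fun_prop)
    (fun y hy => by
      have h0 := hpos y hy
      have : 4 * φ' y ^ 2 - ((φ y - c) ^ 2 / y ^ 2 +
          2 * ((2 * (φ y - c) * φ' y * y - (φ y - c) ^ 2) / y ^ 2)) =
          (2 * φ' y - (φ y - c) / y) ^ 2 := by
        field_simp
        ring
      nlinarith [sq_nonneg (2 * φ' y - (φ y - c) / y)])
  rw [intervalIntegral.integral_const_mul] at this
  simp only [h1, sub_self] at this
  have h2 : 0 ≤ 2 * ((φ b - c) ^ 2 / b) := by positivity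
  norm_num at this
  linarith

theorem trace_le {V V' : ℝ → ℝ} (d : ∀ y ∈ Set.Icc (1 : ℝ) 2, HasDerivAt V (V' y) y)
    (cV : Continuous V) (cV' : Continuous V') :
    V 1 ^ 2 ≤ ∫ y in (1 : ℝ)..2, (2 * V y ^ 2 + V' y ^ 2) := by
  have := integral_add_le_of_hasDerivAt (G := fun y => (y - 2) * V y ^ 2)
    (g := fun y => V y ^ 2 + (y - 2) * (2 * V y * V' y)) (P := fun _ => 0)
    (Q := fun y => 2 * V y ^ 2 + V' y ^ 2) one_le_two
    (fun y hy => by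
      have := ((hasDerivAt_id y).sub_const 2).mul ((d y hy).pow 2)
      refine this.congr_deriv ?_
      simp)
    (by fun_prop) (by fun_prop) (by fun_prop)
    (fun y hy => by
      have h1 : (y - 2) ^ 2 ≤ 1 := by nlinarith [hy.1, hy.2]
      nlinarith [sq_nonneg ((y - 2) * V y - V' y), sq_nonneg (V y)])
  norm_num at this
  exact this

theorem lens_le {φ φ' : ℝ → ℝ} {a c : ℝ} (ha : 43 / 50 ≤ a) (ha1 : a ≤ 1)
    (d : ∀ y ∈ Set.Icc a 1, HasDerivAt φ (φ' y) y)
    (cφ : Continuous φ) (cφ' : Continuous φ') :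
    ∫ y in a..1, (φ y - c) ^ 2 / y ^ 2 ≤
      2 / 5 * (φ 1 - c) ^ 2 + 2 / 5 * ∫ y in a..1, φ' y ^ 2 := by
  have hpos : ∀ y ∈ Set.Icc a 1, y ≠ 0 := fun y hy => by linarith [hy.1]
  have := integral_add_le_of_hasDerivAt (G := fun y => -(8 / 3) * ((y - a) * (φ y - c) ^ 2))
    (g := fun y => -(8 / 3) * ((φ y - c) ^ 2 + (y - a) * (2 * (φ y - c) * φ' y)))
    (P := fun y => (φ y - c) ^ 2 / y ^ 2) (Q := fun y => 2 / 5 * φ' y ^ 2) ha1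
    (fun y hy => by
      have := (((hasDerivAt_id y).sub_const a).mul (((d y hy).sub_const c).pow 2)).const_mul (-(8 / 3))
      refine this.congr_deriv ?_
      simp)
    (by fun_prop)
    (ContinuousOn.div (by fun_prop) (by fun_prop) fun y hy => pow_ne_zero 2 (hpos y hy))
    (by fun_prop)
    (fun y hy => by
      have h0 := hpos y hy
      have h1 : (φ y - c) ^ 2 / y ^ 2 ≤ 7 / 5 * (φ y - c) ^ 2 := by
        rw [div_le_iff₀ (by positivity)]
        have hy43 : 43 / 50 ≤ y := ha.trans hy.1
        have : 5 / 7 ≤ y ^ 2 := by nlinarith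
        nlinarith [sq_nonneg (φ y - c), mul_le_mul_of_nonneg_left this (sq_nonneg (φ y - c))]
      have h2 : (y - a) ^ 2 ≤ 2 / 100 := by
        have h5 : 0 ≤ y - a := sub_nonneg.2 hy.1
        have h6 : y - a ≤ 7 / 50 := by linarith [hy.2]
        nlinarith
      have h3 := mul_le_mul_of_nonneg_right h2 (sq_nonneg (φ' y))
      nlinarith [sq_nonneg ((φ y - c) + 40 / 19 * (y - a) * φ' y)])
  rw [intervalIntegral.integral_const_mul] at this
  norm_num at this
  have h4 : (1 - a) * (φ 1 - c) ^ 2 ≤ 7 / 50 * (φ 1 - c) ^ 2 :=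
    mul_le_mul_of_nonneg_right (by linarith) (sq_nonneg _)
  nlinarith [sq_nonneg (φ 1 - c)]

theorem sq_integral_le {g : ℝ → ℝ} (cg : Continuous g) :
    (∫ x in (-(1 / 2) : ℝ)..(1 / 2), g x) ^ 2 ≤ ∫ x in (-(1 / 2) : ℝ)..(1 / 2), g x ^ 2 := by
  set m := ∫ x in (-(1 / 2) : ℝ)..(1 / 2), g x with hm
  have h : 0 ≤ ∫ x in (-(1 / 2) : ℝ)..(1 / 2), (g x - m) ^ 2 :=
    intervalIntegral.integral_nonneg (by norm_num) fun x _ => sq_nonneg _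
  have h2 : ∀ x, (g x - m) ^ 2 = g x ^ 2 - 2 * m * g x + m ^ 2 := fun x => by ring
  simp_rw [h2] at h
  rw [intervalIntegral.integral_add, intervalIntegral.integral_sub,
    intervalIntegral.integral_const_mul, ← hm, intervalIntegral.integral_const] at h
  · norm_num at h
    nlinarith
  all_goals exact Continuous.intervalIntegrable (by fun_prop) _ _

theorem variance_eq {g : ℝ → ℝ} (cg : Continuous g) (c : ℝ) :
    ∫ x in (-(1 / 2) : ℝ)..(1 / 2), (g x - c) ^ 2 =
      ((∫ x in (-(1 / 2) : ℝ)..(1 / 2), g x) - c) ^ 2 +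
      ∫ x in (-(1 / 2) : ℝ)..(1 / 2), (g x - ∫ x in (-(1 / 2) : ℝ)..(1 / 2), g x) ^ 2 := by
  have key : ∀ c, ∫ x in (-(1 / 2) : ℝ)..(1 / 2), (g x - c) ^ 2 =
      (∫ x in (-(1 / 2) : ℝ)..(1 / 2), g x ^ 2) -
      2 * c * (∫ x in (-(1 / 2) : ℝ)..(1 / 2), g x) + c ^ 2 := by
    intro c
    have h2 : ∀ x, (g x - c) ^ 2 = g x ^ 2 - 2 * c * g x + c ^ 2 := fun x => by ring
    simp_rw [h2]
    rw [intervalIntegral.integral_add, intervalIntegral.integral_sub,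
      intervalIntegral.integral_const_mul, intervalIntegral.integral_const]
    · norm_num
    all_goals exact Continuous.intervalIntegrable (by fun_prop) _ _
  rw [key, key]
  ring

theorem poincare_le {f f' : ℝ → ℝ} (d : ∀ x, HasDerivAt f (f' x) x) (cf' : Continuous f') :
    ∫ x in (-(1 / 2) : ℝ)..(1 / 2), (f x - ∫ x in (-(1 / 2) : ℝ)..(1 / 2), f x) ^ 2 ≤
      ∫ x in (-(1 / 2) : ℝ)..(1 / 2), f' x ^ 2 := by
  have cf : Continuous f := continuous_iff_continuousAt.mpr fun x => (d x).continuousAt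
  set E := ∫ x in (-(1 / 2) : ℝ)..(1 / 2), f' x ^ 2 with hE
  have hE0 : 0 ≤ E := intervalIntegral.integral_nonneg (by norm_num) fun x _ => sq_nonneg _
  have h1 : ∀ x ∈ Set.Icc (-(1 / 2) : ℝ) (1 / 2), ∀ x' ∈ Set.Icc (-(1 / 2) : ℝ) (1 / 2),
      |f x - f x'| ≤ √E := by
    intro x hx x' hx'
    rw [← intervalIntegral.integral_eq_sub_of_hasDerivAt (fun y _ => d y) (cf'.intervalIntegrable _ _)]
    have ca : Continuous fun y => |f' y| := by fun_prop
    have e1 : |∫ y in x'..x, f' y| ≤ ∫ y in (-(1 / 2) : ℝ)..(1 / 2), |f' y| := by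
      have e2 : ∀ u v : ℝ, -(1 / 2) ≤ u → u ≤ v → v ≤ 1 / 2 →
          |∫ y in u..v, f' y| ≤ ∫ y in (-(1 / 2) : ℝ)..(1 / 2), |f' y| := by
        intro u v hu huv hv
        refine (intervalIntegral.abs_integral_le_integral_abs huv).trans ?_
        exact intervalIntegral.integral_mono_interval hu huv hv
          (ae_of_all _ fun y => abs_nonneg _) (ca.intervalIntegrable _ _)
      rcases le_total x' x with h | h
      · exact e2 _ _ hx'.1 h hx.2
      · rw [intervalIntegral.integral_symm, abs_neg]
        exact e2 _ _ hx.1 h hx'.2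
    refine e1.trans (Real.le_sqrt_of_sq_le ?_)
    have := sq_integral_le ca
    simpa only [sq_abs] using this
  have h2 : ∀ x ∈ Set.Icc (-(1 / 2) : ℝ) (1 / 2),
      (f x - ∫ x in (-(1 / 2) : ℝ)..(1 / 2), f x) ^ 2 ≤ E := by
    intro x hx
    have e : f x - ∫ x in (-(1 / 2) : ℝ)..(1 / 2), f x =
        ∫ x' in (-(1 / 2) : ℝ)..(1 / 2), (f x - f x') := by
      rw [intervalIntegral.integral_sub (by simp) (cf.intervalIntegrable _ _),
        intervalIntegral.integral_const]
      norm_num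
    have e3 : |f x - ∫ x in (-(1 / 2) : ℝ)..(1 / 2), f x| ≤ √E := by
      rw [e]
      have := intervalIntegral.norm_integral_le_of_norm_le_const (a := (-(1 / 2) : ℝ)) (b := 1 / 2)
        (C := √E) (f := fun x' => f x - f x') (fun x' hx' => by
          rw [Set.uIoc_of_le (by norm_num)] at hx'
          exact h1 x hx x' ⟨hx'.1.le, hx'.2⟩)
      norm_num at this
      simpa using this
    rw [← sq_abs]
    calc _ ≤ √E ^ 2 := pow_le_pow_left₀ (abs_nonneg _) e3 2
      _ = E := Real.sq_sqrt hE0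
  calc _ ≤ ∫ x in (-(1 / 2) : ℝ)..(1 / 2), E :=
        intervalIntegral.integral_mono_on (by norm_num)
          (Continuous.intervalIntegrable (by fun_prop) _ _) (by simp) h2
    _ = E := by rw [intervalIntegral.integral_const]; norm_num

theorem swap_continuous {f : ℝ × ℝ → ℝ} {s : Set ℝ} (a b c d : ℝ) (hcd : c ≤ d) (hs : Set.Icc c d ⊆ s)
    (hf : ContinuousOn f (Set.univ ×ˢ s)) :
    ∫ x in a..b, ∫ y in c..d, f (x, y) = ∫ y in c..d, ∫ x in a..b, f (x, y) := by
  refine intervalIntegral_intervalIntegral_swap (F := fun x y => f (x, y)) ?_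
  have : IntegrableOn f (Set.uIcc a b ×ˢ Set.uIcc c d) := by
    refine ContinuousOn.integrableOn_compact (isCompact_uIcc.prod isCompact_uIcc) ?_
    refine hf.mono fun p hp => ⟨trivial, hs ?_⟩
    rw [← Set.uIcc_of_le hcd]
    exact hp.2
  refine (this.mono_set (Set.prod_mono Set.uIoc_subset_uIcc Set.uIoc_subset_uIcc)).congr ?_
  exact ae_of_all _ fun _ => rfl

end KB

namespace KB

open ModularGroup Matrix.SpecialLinearGroup
open UpperHalfPlane hiding I continuous_re continuous_im
open scoped MatrixGroups Modular ENNReal ContDiff Topology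

theorem continuous_integral_snd {f : ℝ × ℝ → ℝ} (hf : Continuous f) (a b : ℝ) :
    Continuous fun y => ∫ x in a..b, f (x, y) :=
  intervalIntegral.continuous_parametric_intervalIntegral_of_continuous'
    (f := fun y x => f (x, y)) (by fun_prop) a b

theorem continuous_integral_fst {f : ℝ × ℝ → ℝ} (hf : Continuous f) (a : ℝ) {s : ℝ → ℝ}
    (hs : Continuous s) : Continuous fun x => ∫ y in a..s x, f (x, y) :=
  intervalIntegral.continuous_parametric_intervalIntegral_of_continuous
    (f := fun x y => f (x, y)) (by fun_prop) hs

theorem hasDerivAt_integral_fst {u uy : ℝ × ℝ → ℝ} (cu : Continuous u) (cuy : Continuous uy)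
    (dy : ∀ x y, 1 / 2 < y → HasDerivAt (fun y => u (x, y)) (uy (x, y)) y) {y : ℝ} (hy : 1 / 2 < y)
    (a b : ℝ) :
    HasDerivAt (fun y => ∫ x in a..b, u (x, y)) (∫ x in a..b, uy (x, y)) y := by
  have hy' : 1 / 2 < (1 / 2 + y) / 2 := by linarith
  have hy'' : (1 / 2 + y) / 2 < y := by linarith
  set y₀ := (1 / 2 + y) / 2 with hy₀
  have h : ∀ᶠ z in 𝓝 y, (∫ x in a..b, u (x, z)) =
      (∫ x in a..b, u (x, y₀)) + ∫ t in y₀..z, ∫ x in a..b, uy (x, t) := by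
    filter_upwards [lt_mem_nhds hy''] with z hz
    rw [← swap_continuous (s := Set.univ) a b y₀ z hz.le (by simp) cuy.continuousOn,
      ← intervalIntegral.integral_add]
    · refine intervalIntegral.integral_congr fun x _ => ?_
      rw [intervalIntegral.integral_eq_sub_of_hasDerivAt (f := fun y => u (x, y))
        (fun t ht => dy x t ?_)]
      · ring
      · exact Continuous.intervalIntegrable (by fun_prop) _ _
      · rw [Set.uIcc_of_le hz.le] at ht
        exact hy'.trans_le ht.1
    · exact Continuous.intervalIntegrable (by fun_prop) _ _
    · exact (continuous_integral_fst cuy _ continuous_const).intervalIntegrable _ _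
  have cI := continuous_integral_snd cuy a b
  have := (intervalIntegral.integral_hasDerivAt_right (cI.intervalIntegrable y₀ y)
    (cI.stronglyMeasurableAtFilter _ _) cI.continuousAt).const_add (∫ x in a..b, u (x, y₀))
  exact this.congr_of_eventuallyEq h

theorem gap_real {u ux uy : ℝ × ℝ → ℝ} (cu : Continuous u) (cux : Continuous ux)
    (cuy : Continuous uy) (dx : ∀ x y, HasDerivAt (fun x => u (x, y)) (ux (x, y)) x)
    (dy : ∀ x y, 1 / 2 < y → HasDerivAt (fun y => u (x, y)) (uy (x, y)) y) {b : ℝ} (hb : 2 ≤ b) :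
    ∃ c : ℝ, ∫ x in (-(1 / 2) : ℝ)..(1 / 2), ∫ y in √(1 - x ^ 2)..b,
        (u (x, y) - c) ^ 2 / (max y (1 / 2)) ^ 2 ≤
      4 * ∫ x in (-(1 / 2) : ℝ)..(1 / 2), ∫ y in √(1 - x ^ 2)..b,
        (ux (x, y) ^ 2 + uy (x, y) ^ 2) := by
  have hne : ∀ y : ℝ, (max y (1 / 2)) ^ 2 ≠ 0 := fun y =>
    pow_ne_zero 2 (by linarith [le_max_right y (1 / 2 : ℝ)])
  have hI : ∀ f : ℝ → ℝ, Continuous f → ∀ a b : ℝ, IntervalIntegrable f volume a b :=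
    fun f hf a b => hf.intervalIntegrable a b
  set u0 : ℝ → ℝ := fun y => ∫ x in (-(1 / 2) : ℝ)..(1 / 2), u (x, y) with hu0
  set u1 : ℝ → ℝ := fun y => ∫ x in (-(1 / 2) : ℝ)..(1 / 2), uy (x, y) with hu1
  have cu0 : Continuous u0 := continuous_integral_snd cu _ _
  have cu1 : Continuous u1 := continuous_integral_snd cuy _ _
  have du0 : ∀ y, 1 / 2 < y → HasDerivAt u0 (u1 y) y := fun y hy =>
    hasDerivAt_integral_fst cu cuy dy hy _ _
  set J : ℝ → ℝ := fun y => ∫ x in (-(1 / 2) : ℝ)..(1 / 2), ux (x, y) ^ 2 with hJ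
  set K : ℝ → ℝ := fun y => ∫ x in (-(1 / 2) : ℝ)..(1 / 2), uy (x, y) ^ 2 with hK
  set S : ℝ → ℝ := fun y => ∫ x in (-(1 / 2) : ℝ)..(1 / 2), (u (x, y) - u0 y) ^ 2 with hS
  have cJ : Continuous J := continuous_integral_snd (f := fun p => ux p ^ 2) (by fun_prop) _ _
  have cK : Continuous K := continuous_integral_snd (f := fun p => uy p ^ 2) (by fun_prop) _ _
  have cS : Continuous S :=
    continuous_integral_snd (f := fun p => (u p - u0 p.2) ^ 2) (by fun_prop) _ _
  have hSJ : ∀ y, S y ≤ J y := fun y =>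
    poincare_le (f := fun x => u (x, y)) (fun x => dx x y) (by fun_prop)
  have hS0 : ∀ y, 0 ≤ S y := fun y =>
    intervalIntegral.integral_nonneg (by norm_num) fun x _ => sq_nonneg _
  have hJ0 : ∀ y, 0 ≤ J y := fun y => (hS0 y).trans (hSJ y)
  have hKW : ∀ y, ∫ x in (-(1 / 2) : ℝ)..(1 / 2), (uy (x, y) - u1 y) ^ 2 = K y - u1 y ^ 2 := by
    intro y
    have := variance_eq (g := fun x => uy (x, y)) (by fun_prop) 0
    simp only [sub_zero] at this
    linarith
  have hW0 : ∀ y, 0 ≤ K y - u1 y ^ 2 := fun y => by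
    rw [← hKW]
    exact intervalIntegral.integral_nonneg (by norm_num) fun x _ => sq_nonneg _
  set c := u0 1 with hc
  refine ⟨c, ?_⟩
  have ca : Continuous fun x : ℝ => √(1 - x ^ 2) := by fun_prop
  have ha : ∀ x ∈ Set.Icc (-(1 / 2) : ℝ) (1 / 2), 43 / 50 ≤ √(1 - x ^ 2) ∧ √(1 - x ^ 2) ≤ 1 := by
    intro x hx
    have : x ^ 2 ≤ 1 / 4 := by nlinarith [hx.1, hx.2]
    constructor
    · exact Real.le_sqrt_of_sq_le (by norm_num; linarith)
    · exact Real.sqrt_le_one.2 (by nlinarith [sq_nonneg x])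
  set f : ℝ × ℝ → ℝ := fun p => (u p - c) ^ 2 / (max p.2 (1 / 2)) ^ 2 with hf
  set h : ℝ × ℝ → ℝ := fun p => ux p ^ 2 + uy p ^ 2 with hh
  have cf : Continuous f := Continuous.div (by fun_prop) (by fun_prop) fun p => hne p.2
  have ch : Continuous h := by fun_prop
  have split : ∀ q : ℝ × ℝ → ℝ, Continuous q →
      ∫ x in (-(1 / 2) : ℝ)..(1 / 2), ∫ y in √(1 - x ^ 2)..b, q (x, y) =
      (∫ x in (-(1 / 2) : ℝ)..(1 / 2), ∫ y in √(1 - x ^ 2)..1, q (x, y)) +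
      ∫ y in (1 : ℝ)..b, ∫ x in (-(1 / 2) : ℝ)..(1 / 2), q (x, y) := by
    intro q cq
    rw [← swap_continuous (s := Set.univ) _ _ 1 b (by linarith) (by simp) cq.continuousOn,
      ← intervalIntegral.integral_add]
    · refine intervalIntegral.integral_congr fun x _ => ?_
      exact (intervalIntegral.integral_add_adjacent_intervals (hI _ (by fun_prop) _ _)
        (hI _ (by fun_prop) _ _)).symm
    · refine hI _ ?_ _ _
      simp_rw [intervalIntegral.integral_symm (1 : ℝ)]
      exact (continuous_integral_fst cq 1 ca).neg
    · exact hI _ (continuous_integral_fst cq 1 continuous_const) _ _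
  rw [split f cf, split h ch]
  have upper : ∫ y in (1 : ℝ)..b, ∫ x in (-(1 / 2) : ℝ)..(1 / 2), f (x, y) ≤
      4 * (∫ y in (1 : ℝ)..b, u1 y ^ 2) + ∫ y in (1 : ℝ)..b, J y := by
    have h1 := hardy (φ := u0) (φ' := u1) (b := b) (c := c) (by linarith)
      (fun y hy => du0 y (by linarith [hy.1])) cu0 cu1 rfl
    have h2 : ∫ y in (1 : ℝ)..b, ∫ x in (-(1 / 2) : ℝ)..(1 / 2), f (x, y) ≤
        ∫ y in (1 : ℝ)..b, ((u0 y - c) ^ 2 / (max y (1 / 2)) ^ 2 + J y) := by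
      refine intervalIntegral.integral_mono_on (by linarith)
        (hI _ (continuous_integral_snd cf _ _) _ _)
        (hI _ (Continuous.add (Continuous.div (by fun_prop) (by fun_prop) hne) cJ) _ _) ?_
      intro y hy
      simp only [hf]
      rw [intervalIntegral.integral_div, variance_eq (g := fun x => u (x, y)) (by fun_prop) c,
        add_div]
      have hm : 1 ≤ (max y (1 / 2)) ^ 2 := one_le_pow₀ (hy.1.trans (le_max_left _ _))
      have := (div_le_self (hS0 y) hm).trans (hSJ y)
      exact add_le_add_right this _
    have cd : Continuous fun y => (u0 y - c) ^ 2 / (max y (1 / 2)) ^ 2 :=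
      Continuous.div (by fun_prop) (by fun_prop) hne
    rw [intervalIntegral.integral_add (hI _ cd _ _) (hI _ cJ _ _)] at h2
    have h3 : ∫ y in (1 : ℝ)..b, (u0 y - c) ^ 2 / (max y (1 / 2)) ^ 2 =
        ∫ y in (1 : ℝ)..b, (u0 y - c) ^ 2 / y ^ 2 := by
      refine intervalIntegral.integral_congr fun y hy => ?_
      rw [Set.uIcc_of_le (by linarith)] at hy
      rw [max_eq_left (by linarith [hy.1])]
    linarith
  have trace : ∫ x in (-(1 / 2) : ℝ)..(1 / 2), (u (x, 1) - c) ^ 2 ≤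
      ∫ y in (1 : ℝ)..b, (2 * J y + (K y - u1 y ^ 2)) := by
    have cq : Continuous fun p : ℝ × ℝ => 2 * (u p - u0 p.2) ^ 2 + (uy p - u1 p.2) ^ 2 := by
      fun_prop
    have h1 : ∫ x in (-(1 / 2) : ℝ)..(1 / 2), (u (x, 1) - c) ^ 2 ≤
        ∫ x in (-(1 / 2) : ℝ)..(1 / 2), ∫ y in (1 : ℝ)..2,
          (2 * (u (x, y) - u0 y) ^ 2 + (uy (x, y) - u1 y) ^ 2) := by
      refine intervalIntegral.integral_mono_on (by norm_num) (hI _ (by fun_prop) _ _)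
        (hI _ (continuous_integral_fst cq 1 continuous_const) _ _) fun x _ => ?_
      exact trace_le (V := fun y => u (x, y) - u0 y) (V' := fun y => uy (x, y) - u1 y)
        (fun y hy => (dy x y (by linarith [hy.1])).sub (du0 y (by linarith [hy.1])))
        (by fun_prop) (by fun_prop)
    refine h1.trans ?_
    rw [swap_continuous (f := fun p => 2 * (u p - u0 p.2) ^ 2 + (uy p - u1 p.2) ^ 2)
      (s := Set.univ) _ _ 1 2 (by norm_num) (by simp) cq.continuousOn]
    calc _ ≤ ∫ y in (1 : ℝ)..2, (2 * J y + (K y - u1 y ^ 2)) := by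
          refine intervalIntegral.integral_mono_on (by norm_num)
            (hI _ (continuous_integral_snd cq _ _) _ _) (hI _ (by fun_prop) _ _) fun y _ => ?_
          simp only
          rw [intervalIntegral.integral_add (hI _ (by fun_prop) _ _) (hI _ (by fun_prop) _ _),
            intervalIntegral.integral_const_mul, hKW]
          linarith [hSJ y]
      _ ≤ _ := intervalIntegral.integral_mono_interval le_rfl (by norm_num) hb
          (ae_of_all _ fun y => add_nonneg (by linarith [hJ0 y]) (hW0 y)) (hI _ (by fun_prop) _ _)
  have lens : ∫ x in (-(1 / 2) : ℝ)..(1 / 2), ∫ y in √(1 - x ^ 2)..1, f (x, y) ≤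
      2 / 5 * (∫ x in (-(1 / 2) : ℝ)..(1 / 2), (u (x, 1) - c) ^ 2) +
      2 / 5 * ∫ x in (-(1 / 2) : ℝ)..(1 / 2), ∫ y in √(1 - x ^ 2)..1, h (x, y) := by
    have cl : ∀ q : ℝ × ℝ → ℝ, Continuous q →
        Continuous fun x => ∫ y in √(1 - x ^ 2)..1, q (x, y) := by
      intro q cq
      simp_rw [intervalIntegral.integral_symm (1 : ℝ)]
      exact (continuous_integral_fst cq 1 ca).neg
    have c1 := cl h ch
    rw [← intervalIntegral.integral_const_mul, ← intervalIntegral.integral_const_mul,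
      ← intervalIntegral.integral_add (hI _ (by fun_prop) _ _) (hI _ (by fun_prop) _ _)]
    refine intervalIntegral.integral_mono_on (by norm_num) (hI _ (cl f cf) _ _)
      (hI _ (by fun_prop) _ _) fun x hx => ?_
    obtain ⟨h1, h2⟩ := ha x hx
    have h3 := lens_le (φ := fun y => u (x, y)) (φ' := fun y => uy (x, y)) (c := c) h1 h2
      (fun y hy => dy x y (by linarith [hy.1])) (by fun_prop) (by fun_prop)
    have h4 : ∫ y in √(1 - x ^ 2)..1, f (x, y) =
        ∫ y in √(1 - x ^ 2)..1, (u (x, y) - c) ^ 2 / y ^ 2 := by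
      refine intervalIntegral.integral_congr fun y hy => ?_
      rw [Set.uIcc_of_le h2] at hy
      simp only [hf]
      rw [max_eq_left (by linarith [hy.1])]
    rw [h4]
    have h5 : ∫ y in √(1 - x ^ 2)..1, uy (x, y) ^ 2 ≤ ∫ y in √(1 - x ^ 2)..1, h (x, y) :=
      intervalIntegral.integral_mono_on h2 (hI _ (by fun_prop) _ _) (hI _ (by fun_prop) _ _)
        fun y _ => le_add_of_nonneg_left (sq_nonneg _)
    linarith
  have e1 : ∫ y in (1 : ℝ)..b, ∫ x in (-(1 / 2) : ℝ)..(1 / 2), h (x, y) =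
      (∫ y in (1 : ℝ)..b, J y) + ∫ y in (1 : ℝ)..b, K y := by
    rw [← intervalIntegral.integral_add (hI _ cJ _ _) (hI _ cK _ _)]
    refine intervalIntegral.integral_congr fun y _ => ?_
    exact intervalIntegral.integral_add (hI _ (by fun_prop) _ _) (hI _ (by fun_prop) _ _)
  have e2 : ∫ y in (1 : ℝ)..b, (2 * J y + (K y - u1 y ^ 2)) =
      2 * (∫ y in (1 : ℝ)..b, J y) + ((∫ y in (1 : ℝ)..b, K y) - ∫ y in (1 : ℝ)..b, u1 y ^ 2) := by
    rw [intervalIntegral.integral_add (hI _ (by fun_prop) _ _) (hI _ (by fun_prop) _ _),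
      intervalIntegral.integral_sub (hI _ (by fun_prop) _ _) (hI _ (by fun_prop) _ _),
      intervalIntegral.integral_const_mul]
  have n1 : 0 ≤ ∫ y in (1 : ℝ)..b, J y :=
    intervalIntegral.integral_nonneg (by linarith) fun y _ => hJ0 y
  have n2 : 0 ≤ (∫ y in (1 : ℝ)..b, K y) - ∫ y in (1 : ℝ)..b, u1 y ^ 2 := by
    rw [← intervalIntegral.integral_sub (hI _ (by fun_prop) _ _) (hI _ (by fun_prop) _ _)]
    exact intervalIntegral.integral_nonneg (by linarith) fun y _ => hW0 y
  have n3 : 0 ≤ ∫ x in (-(1 / 2) : ℝ)..(1 / 2), ∫ y in √(1 - x ^ 2)..1, h (x, y) :=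
    intervalIntegral.integral_nonneg (by norm_num) fun x hx =>
      intervalIntegral.integral_nonneg (ha x hx).2 fun y _ =>
        add_nonneg (sq_nonneg _) (sq_nonneg _)
  rw [e1]
  linarith

end KB

namespace KB

open ModularGroup Matrix.SpecialLinearGroup
open UpperHalfPlane hiding I continuous_re continuous_im
open scoped MatrixGroups Modular ENNReal ContDiff Topology

/-- The fundamental domain cut at height `b`, in coordinates. -/
def trunc (b : ℝ) : Set (ℝ × ℝ) := {p | 1 < p.1 ^ 2 + p.2 ^ 2 ∧ |p.1| < 1 / 2 ∧ p.2 ≤ b}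

theorem measurableSet_trunc (b : ℝ) : MeasurableSet (trunc b) := by
  have h1 : MeasurableSet {p : ℝ × ℝ | 1 < p.1 ^ 2 + p.2 ^ 2} :=
    measurableSet_lt (by fun_prop) (by fun_prop)
  have h2 : MeasurableSet {p : ℝ × ℝ | |p.1| < 1 / 2} :=
    measurableSet_lt (by fun_prop) (by fun_prop)
  have h3 : MeasurableSet {p : ℝ × ℝ | p.2 ≤ b} := measurableSet_le (by fun_prop) (by fun_prop)
  exact h1.inter (h2.inter h3)

theorem mem_preimage_trunc (b : ℝ) (z : ℍ) : z ∈ toPair ⁻¹' trunc b ↔ z ∈ 𝒟ᵒ ∧ z.im ≤ b := by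
  simp only [trunc, toPair, Set.mem_preimage, Set.mem_ofPred_eq, fdo, normSq_apply, and_assoc]
  simp only [← pow_two]
  rfl

theorem half_lt_of_trunc {b : ℝ} {p : ℝ × ℝ} (hp : p ∈ trunc b) (h0 : 0 < p.2) : 1 / 2 < p.2 := by
  obtain ⟨h1, h2, -⟩ := hp
  have h3 : p.1 ^ 2 < (1 / 2) ^ 2 := by rw [← sq_abs]; gcongr
  nlinarith

theorem integrableOn_trunc {q : ℝ × ℝ → ℝ} (cq : Continuous q) (b : ℝ) :
    IntegrableOn q (trunc b ∩ {p : ℝ × ℝ | 0 < p.2}) := by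
  refine IntegrableOn.mono_set (cq.continuousOn.integrableOn_compact
    ((isCompact_Icc (a := (-(1 / 2) : ℝ)) (b := 1 / 2)).prod
      (isCompact_Icc (a := (0 : ℝ)) (b := b)))) ?_
  rintro p ⟨⟨-, h2, h3⟩, h0⟩
  exact ⟨⟨(abs_lt.1 h2).1.le, (abs_lt.1 h2).2.le⟩, le_of_lt h0, h3⟩

theorem integral_trunc {q : ℝ × ℝ → ℝ} (cq : Continuous q) {b : ℝ} (hb : 2 ≤ b) :
    ∫ p in trunc b ∩ {p : ℝ × ℝ | 0 < p.2}, q p =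
      ∫ x in (-(1 / 2) : ℝ)..(1 / 2), ∫ y in √(1 - x ^ 2)..b, q (x, y) := by
  have hm : MeasurableSet (trunc b ∩ {p : ℝ × ℝ | 0 < p.2}) :=
    (measurableSet_trunc b).inter (measurableSet_lt (by fun_prop) (by fun_prop))
  have hi := integrableOn_trunc cq b
  rw [← integral_indicator hm]
  rw [Measure.volume_eq_prod, integral_prod]
  swap
  · rw [← Measure.volume_eq_prod, integrable_indicator_iff hm]
    exact hi
  rw [intervalIntegral.integral_of_le (by norm_num), integral_Ioc_eq_integral_Ioo,
    ← integral_indicator measurableSet_Ioo]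
  refine integral_congr_ae (ae_of_all _ fun x => ?_)
  simp only
  by_cases hx : x ∈ Set.Ioo (-(1 / 2) : ℝ) (1 / 2)
  · rw [Set.indicator_of_mem hx]
    have h1 : x ^ 2 < 1 / 4 := by nlinarith [hx.1, hx.2]
    have h2 : √(1 - x ^ 2) ≤ 1 := Real.sqrt_le_one.2 (by nlinarith [sq_nonneg x])
    rw [intervalIntegral.integral_of_le (by linarith), ← integral_indicator measurableSet_Ioc]
    refine integral_congr_ae (ae_of_all _ fun y => ?_)
    simp only [Set.indicator]
    congr 1
    simp only [trunc, Set.mem_inter_iff, Set.mem_ofPred_eq, Set.mem_Ioc, eq_iff_iff]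
    constructor
    · rintro ⟨⟨h3, -, h4⟩, h5⟩
      exact ⟨(Real.sqrt_lt' h5).2 (by linarith), h4⟩
    · rintro ⟨h3, h4⟩
      have h5 : 0 < y := (Real.sqrt_nonneg _).trans_lt h3
      exact ⟨⟨by linarith [(Real.sqrt_lt' h5).1 h3], abs_lt.2 hx, h4⟩, h5⟩
  · rw [Set.indicator_of_notMem hx]
    refine integral_eq_zero_of_ae (ae_of_all _ fun y => ?_)
    refine Set.indicator_of_notMem (fun h => hx ?_) _
    exact abs_lt.1 h.1.2.1

theorem integral_fdo_trunc {f : ℍ → ℝ} {q : ℝ × ℝ → ℝ} (cq : Continuous q) {b : ℝ} (hb : 2 ≤ b)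
    (h : ∀ z : ℍ, 1 / 2 < z.im → f z = q (toPair z)) :
    IntegrableOn f (toPair ⁻¹' trunc b) ∧ ∫ z in toPair ⁻¹' trunc b, f z =
      ∫ x in (-(1 / 2) : ℝ)..(1 / 2), ∫ y in √(1 - x ^ 2)..b,
        q (x, y) / (max y (1 / 2)) ^ 2 := by
  have hms : MeasurableSet (toPair ⁻¹' trunc b) :=
    measurableEmbedding_toPair.measurable (measurableSet_trunc b)
  have hmq : MeasurableSet (trunc b ∩ {p : ℝ × ℝ | 0 < p.2}) :=
    (measurableSet_trunc b).inter (measurableSet_lt (by fun_prop) (by fun_prop))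
  have e : Set.EqOn f (fun z => q (toPair z)) (toPair ⁻¹' trunc b) := fun z hz =>
    h z (half_lt_of_trunc (p := toPair z) hz z.im_pos)
  have c2 : Continuous fun p : ℝ × ℝ => q p / (max p.2 (1 / 2)) ^ 2 :=
    Continuous.div cq (by fun_prop) fun p =>
      pow_ne_zero 2 (by linarith [le_max_right p.2 (1 / 2 : ℝ)])
  have e2 : Set.EqOn (fun p : ℝ × ℝ => q p / p.2 ^ 2) (fun p => q p / (max p.2 (1 / 2)) ^ 2)
      (trunc b ∩ {p : ℝ × ℝ | 0 < p.2}) := fun p hp => by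
    simp only
    rw [max_eq_left (half_lt_of_trunc hp.1 hp.2).le]
  constructor
  · rw [integrableOn_congr_fun e hms, integrableOn_toPair _ (measurableSet_trunc b),
      integrableOn_congr_fun e2 hmq]
    exact integrableOn_trunc c2 b
  · rw [setIntegral_congr_fun hms e, integral_toPair _ (measurableSet_trunc b),
      setIntegral_congr_fun hmq e2, integral_trunc c2 hb]

/-- A spectral gap for the modular surface. -/
theorem spectral_gap {w : ℍ → ℝ} (hw : Sm w) {R : ℝ} (hR : ∀ z : ℍ, R < z.im → w z = 0)
    (h0 : ∫ z in 𝒟ᵒ, w z = 0) (hi : IntegrableOn (fun z => z.im ^ 2 * gdot w w z) 𝒟ᵒ) :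
    ∫ z in 𝒟ᵒ, w z ^ 2 ≤ 4 * ∫ z in 𝒟ᵒ, z.im ^ 2 * gdot w w z := by
  have hb : 2 ≤ max 2 R := le_max_left _ _
  set b := max 2 R with hbR
  have hpos : ∀ p : ℝ × ℝ, 0 < max p.2 (1 / 2) := fun p => by
    linarith [le_max_right p.2 (1 / 2 : ℝ)]
  have cm : Continuous fun p : ℝ × ℝ => ((p.1, max p.2 (1 / 2)) : ℝ × ℝ) := by fun_prop
  have cu : Continuous fun p : ℝ × ℝ => ex w (mkC (p.1, max p.2 (1 / 2))) :=
    hw.continuousOn.comp_continuous cm fun p => ⟨trivial, hpos p⟩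
  have cd : ∀ v, Continuous fun p : ℝ × ℝ => fderiv ℝ (ex w) (mkC (p.1, max p.2 (1 / 2))) v :=
    fun v => (hw.continuousOn_deriv v).comp_continuous cm fun p => ⟨trivial, hpos p⟩
  obtain ⟨c, hc⟩ := gap_real cu (cd 1) (cd I) (fun x y => hw.hasDerivAt_fst x _ (hpos (x, y)))
    (fun x y hy => by
      have h1 := hw.hasDerivAt_snd x y (by linarith)
      simp only
      rw [max_eq_left hy.le]
      refine h1.congr_of_eventuallyEq ?_
      filter_upwards [lt_mem_nhds hy] with t ht
      rw [max_eq_left ht.le]) hb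
  have key : ∀ z : ℍ, 1 / 2 < z.im →
      mkC ((toPair z).1, max (toPair z).2 (1 / 2)) = z := fun z hz => by
    rw [show ((toPair z).1, max (toPair z).2 (1 / 2)) = toPair z from ?_, mkC_toPair]
    simp only [toPair]
    rw [max_eq_left hz.le]
  obtain ⟨i1, e1⟩ := integral_fdo_trunc (f := fun z => (w z - c) ^ 2)
    (q := fun p => (ex w (mkC (p.1, max p.2 (1 / 2))) - c) ^ 2) (by fun_prop) hb
    (fun z hz => by simp only [key z hz, ex_coe])
  obtain ⟨i2, e2⟩ := integral_fdo_trunc (f := fun z => z.im ^ 2 * gdot w w z)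
    (q := fun p => (max p.2 (1 / 2)) ^ 2 *
      (fderiv ℝ (ex w) (mkC (p.1, max p.2 (1 / 2))) 1 ^ 2 +
      fderiv ℝ (ex w) (mkC (p.1, max p.2 (1 / 2))) I ^ 2))
    (by have := cd 1; have := cd I; fun_prop) hb
    (fun z hz => by
      simp only [key z hz, gdot, DD]
      simp only [toPair]
      rw [max_eq_left hz.le]
      ring)
  obtain ⟨i3, -⟩ := integral_fdo_trunc (f := fun z => w z)
    (q := fun p => ex w (mkC (p.1, max p.2 (1 / 2)))) cu hb
    (fun z hz => by simp only [key z hz, ex_coe])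
  obtain ⟨i4, -⟩ := integral_fdo_trunc (f := fun z => w z ^ 2)
    (q := fun p => ex w (mkC (p.1, max p.2 (1 / 2))) ^ 2) (by fun_prop) hb
    (fun z hz => by simp only [key z hz, ex_coe])
  obtain ⟨i5, -⟩ := integral_fdo_trunc (f := fun _ => c ^ 2)
    (q := fun _ => c ^ 2) (by fun_prop) hb (fun z hz => rfl)
  have sub : toPair ⁻¹' trunc b ⊆ 𝒟ᵒ := fun z hz => ((mem_preimage_trunc b z).1 hz).1
  have e3 : (∫ x in (-(1 / 2) : ℝ)..(1 / 2), ∫ y in √(1 - x ^ 2)..b,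
      (fderiv ℝ (ex w) (mkC (x, max y (1 / 2))) 1 ^ 2 +
      fderiv ℝ (ex w) (mkC (x, max y (1 / 2))) I ^ 2)) =
      ∫ z in toPair ⁻¹' trunc b, z.im ^ 2 * gdot w w z := by
    rw [e2]
    refine intervalIntegral.integral_congr fun x _ => intervalIntegral.integral_congr fun y _ => ?_
    simp only
    rw [mul_div_cancel_left₀ _ (pow_ne_zero 2 (hpos (x, y)).ne')]
  have hz : ∀ z ∈ 𝒟ᵒ \ toPair ⁻¹' trunc b, w z = 0 := fun z hz => by
    refine hR z ?_
    by_contra h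
    exact hz.2 ((mem_preimage_trunc b z).2 ⟨hz.1, (not_lt.1 h).trans (le_max_right _ _)⟩)
  have hmo : MeasurableSet (𝒟ᵒ : Set ℍ) := isOpen_fdo.measurableSet
  have e4 : ∫ z in toPair ⁻¹' trunc b, w z = 0 := by
    rw [← h0]
    exact (setIntegral_eq_of_subset_of_forall_sdiff_eq_zero hmo sub hz).symm
  have e5 : ∫ z in toPair ⁻¹' trunc b, w z ^ 2 = ∫ z in 𝒟ᵒ, w z ^ 2 :=
    (setIntegral_eq_of_subset_of_forall_sdiff_eq_zero hmo sub fun z h => by simp [hz z h]).symm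
  have e6 : ∫ z in toPair ⁻¹' trunc b, (w z - c) ^ 2 =
      (∫ z in 𝒟ᵒ, w z ^ 2) + ∫ z in toPair ⁻¹' trunc b, c ^ 2 := by
    have h2 : ∀ z, (w z - c) ^ 2 = w z ^ 2 - 2 * c * w z + c ^ 2 := fun z => by ring
    simp_rw [h2]
    have i6 : IntegrableOn (fun z => w z ^ 2 - 2 * c * w z) (toPair ⁻¹' trunc b) :=
      i4.sub (i3.const_mul _)
    rw [integral_add i6 i5, integral_sub i4 (i3.const_mul _),
      integral_const_mul, e4, e5]
    ring
  have h5 : 0 ≤ ∫ z in toPair ⁻¹' trunc b, c ^ 2 := integral_nonneg fun _ => sq_nonneg c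
  have h6 : ∫ z in toPair ⁻¹' trunc b, z.im ^ 2 * gdot w w z ≤ ∫ z in 𝒟ᵒ, z.im ^ 2 * gdot w w z :=
    setIntegral_mono_set hi (ae_of_all _ fun z => by
      simp only [gdot, Pi.zero_apply]
      exact mul_nonneg (sq_nonneg _) (add_nonneg (mul_self_nonneg _) (mul_self_nonneg _)))
      (LE.le.eventuallyLE sub)
  simp only at hc
  rw [← e1, e3, e6] at hc
  linarith

end KB

namespace KB

open scoped ContDiff Topology RealInnerProductSpace

/-- Smooth compactly supported functions of a real variable. -/
structure TF (q : ℝ → ℝ) : Prop where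
  smooth : ContDiff ℝ ∞ q
  cpt : HasCompactSupport q

theorem TF.deriv {q : ℝ → ℝ} (h : TF q) : TF (deriv q) :=
  ⟨(contDiff_infty_iff_deriv.1 h.smooth).2, h.cpt.deriv⟩

theorem TF.add {q s : ℝ → ℝ} (hq : TF q) (hs : TF s) : TF (fun v => q v + s v) :=
  ⟨hq.smooth.add hs.smooth, hq.cpt.add hs.cpt⟩

theorem TF.const_mul {q : ℝ → ℝ} (hq : TF q) (c : ℝ) : TF (fun v => c * q v) :=
  ⟨contDiff_const.mul hq.smooth, hq.cpt.mul_left (f := fun _ => c)⟩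

theorem TF.bounded {q : ℝ → ℝ} (h : TF q) : ∃ B, 0 ≤ B ∧ ∀ x, |q x| ≤ B := by
  obtain ⟨B, hB⟩ := h.cpt.exists_bound_of_continuous h.smooth.continuous
  exact ⟨B, (norm_nonneg _).trans (hB 0), hB⟩

/-- A pair of operators behaving like a restricted Laplacian in the variable `v`. -/
structure Wave {E : Type*} [NormedAddCommGroup E] [InnerProductSpace ℝ E] (ρ : ℝ)
    (Φ₀ Φ₁ : (ℝ → ℝ) → E) : Prop where
  add₀ : ∀ q s, TF q → TF s → Φ₀ (fun v => q v + s v) = Φ₀ q + Φ₀ s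
  smul₀ : ∀ (c : ℝ) q, TF q → Φ₀ (fun v => c * q v) = c • Φ₀ q
  add₁ : ∀ q s, TF q → TF s → Φ₁ (fun v => q v + s v) = Φ₁ q + Φ₁ s
  smul₁ : ∀ (c : ℝ) q, TF q → Φ₁ (fun v => c * q v) = c • Φ₁ q
  nonneg : 0 ≤ ρ
  bound₀ : ∀ q, TF q → ‖Φ₀ q‖ ^ 2 ≤ ρ ^ 2 * ∫ v, q v ^ 2 * (1 + Real.exp (-(2 * v)))
  bound₁ : ∀ q, TF q → ‖Φ₁ q‖ ^ 2 ≤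
    ρ ^ 2 * ∫ v, q v ^ 2 * (Real.exp (4 * v) * (1 + Real.exp (-(2 * v))))
  symm : ∀ q s, TF q → TF s → ⟪Φ₀ (deriv (deriv q)) + Φ₁ q, Φ₀ s⟫ =
    ⟪Φ₀ (deriv (deriv s)) + Φ₁ s, Φ₀ q⟫
  neg : ∀ q, TF q → ⟪Φ₀ (deriv (deriv q)) + Φ₁ q, Φ₀ q⟫ ≤ 0

theorem taylor_le {ψ : ℝ → ℝ} (hψ : ContDiff ℝ ∞ ψ) {B : ℝ}
    (hB : ∀ x, |deriv (deriv ψ) x| ≤ B) (x h : ℝ) :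
    |ψ (x + h) - ψ x - h * deriv ψ x| ≤ B * h ^ 2 := by
  have h1 := contDiff_infty_iff_deriv.1 hψ
  have h2 := contDiff_infty_iff_deriv.1 h1.2
  have hB0 : 0 ≤ B := (abs_nonneg _).trans (hB 0)
  have l1 : ∀ y, |deriv ψ y - deriv ψ x| ≤ B * |y - x| := fun y =>
    Convex.norm_image_sub_le_of_norm_deriv_le (s := Set.univ) (fun z _ => h2.1 z)
      (fun z _ => hB z) convex_univ trivial trivial
  have l2 := Convex.norm_image_sub_le_of_norm_hasDerivWithin_le
    (f := fun y => ψ y - y * deriv ψ x) (f' := fun y => deriv ψ y - deriv ψ x)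
    (s := Set.uIcc x (x + h)) (C := B * |h|) (x := x) (y := x + h)
    (fun y _ => by
      have := ((h1.1 y).hasDerivAt.sub ((hasDerivAt_id y).mul_const (deriv ψ x)))
      refine (this.congr_deriv ?_).hasDerivWithinAt
      simp)
    (fun y hy => (l1 y).trans (mul_le_mul_of_nonneg_left (by
      have := Set.abs_sub_left_of_mem_uIcc hy
      simpa using this) hB0)) (convex_uIcc _ _) Set.left_mem_uIcc Set.right_mem_uIcc
  have e : ψ (x + h) - ψ x - h * deriv ψ x =
      (ψ (x + h) - (x + h) * deriv ψ x) - (ψ x - x * deriv ψ x) := by ring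
  rw [e]
  refine l2.trans (le_of_eq ?_)
  rw [add_sub_cancel_left, Real.norm_eq_abs, mul_assoc, abs_mul_abs_self, pow_two]

/-- Products `η · ψ(· + t)` with `η` supported in `(-∞, 1]` and `ψ` in `[1, ∞)`. -/
theorem tf_mul_shift {η ψ : ℝ → ℝ} (hη : ContDiff ℝ ∞ η) (hψ : ContDiff ℝ ∞ ψ)
    (sη : ∀ v, 1 ≤ v → η v = 0) (sψ : ∀ u, u ≤ 1 → ψ u = 0) (t : ℝ) :
    TF (fun v => η v * ψ (v + t)) := by
  refine ⟨hη.mul (hψ.comp (contDiff_id.add contDiff_const)),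
    HasCompactSupport.intro (isCompact_Icc (a := 1 - t) (b := 1)) fun v hv => ?_⟩
  rcases lt_or_ge v (1 - t) with h | h
  · rw [sψ _ (by linarith), mul_zero]
  · rw [sη v, zero_mul]
    by_contra h2
    exact hv ⟨h, (not_le.1 h2).le⟩

theorem integral_sq_mul_le {q W : ℝ → ℝ} {a b B : ℝ} (hab : a ≤ b) (cq : Continuous q)
    (cW : Continuous W) (hW : ∀ v, 0 ≤ W v) (sq : ∀ v, q v ≠ 0 → v ∈ Set.Icc a b)
    (hB : ∀ v ∈ Set.Icc a b, |q v| ≤ B) :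
    ∫ v, q v ^ 2 * W v ≤ B ^ 2 * ∫ v in a..b, W v := by
  rw [intervalIntegral.integral_of_le hab, ← integral_Icc_eq_integral_Ioc]
  have e : ∫ v, q v ^ 2 * W v = ∫ v in Set.Icc a b, q v ^ 2 * W v := by
    rw [setIntegral_eq_integral_of_forall_compl_eq_zero]
    intro v hv
    have : q v = 0 := by by_contra h; exact hv (sq v h)
    simp [this]
  rw [e, ← integral_const_mul]
  refine setIntegral_mono_on (ContinuousOn.integrableOn_Icc (by fun_prop))
    (ContinuousOn.integrableOn_Icc (by fun_prop)) measurableSet_Icc fun v hv => ?_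
  refine mul_le_mul_of_nonneg_right ?_ (hW v)
  rw [← sq_abs]
  exact pow_le_pow_left₀ (abs_nonneg _) (hB v hv) 2

theorem hasDerivAt_shift {E : Type*} [NormedAddCommGroup E] [InnerProductSpace ℝ E] {ρ : ℝ}
    {Φ : (ℝ → ℝ) → E} (add : ∀ q s, TF q → TF s → Φ (fun v => q v + s v) = Φ q + Φ s)
    (smul : ∀ (c : ℝ) q, TF q → Φ (fun v => c * q v) = c • Φ q) {W : ℝ → ℝ}
    (cW : Continuous W) (hW : ∀ v, 0 ≤ W v)
    (bound : ∀ q, TF q → ‖Φ q‖ ^ 2 ≤ ρ ^ 2 * ∫ v, q v ^ 2 * W v)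
    {η ψ : ℝ → ℝ} (hη : ContDiff ℝ ∞ η) (hψ : ContDiff ℝ ∞ ψ)
    (sη : ∀ v, 1 ≤ v → η v = 0) (sψ : ∀ u, u ≤ 1 → ψ u = 0)
    (sψ' : ∀ u, u ≤ 1 → deriv ψ u = 0) {B : ℝ} (hB : ∀ x, |deriv (deriv ψ) x| ≤ B) (t : ℝ) :
    HasDerivAt (fun t => Φ (fun v => η v * ψ (v + t))) (Φ (fun v => η v * deriv ψ (v + t))) t := by
  have hψ' := (contDiff_infty_iff_deriv.1 hψ).2
  have hB0 : 0 ≤ B := (abs_nonneg _).trans (hB 0)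
  have ht : min (-t) 0 ≤ 1 := (min_le_right _ _).trans zero_le_one
  set a := min (-t) 0 with ha
  obtain ⟨D, hD⟩ := (isCompact_Icc (a := a) (b := 1)).exists_bound_of_continuousOn
    hη.continuous.continuousOn
  have hD0 : 0 ≤ D := (norm_nonneg _).trans (hD 1 ⟨ht, le_rfl⟩)
  set J := ∫ v in a..1, W v with hJ
  have key : ∀ h : ℝ, |h| ≤ 1 → ‖Φ (fun v => η v * ψ (v + (t + h))) - Φ (fun v => η v * ψ (v + t)) -
      h • Φ (fun v => η v * deriv ψ (v + t))‖ ≤ √(ρ ^ 2 * ((D * B) ^ 2 * J)) * h ^ 2 := by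
    intro h hh
    have T1 := tf_mul_shift hη hψ sη sψ (t + h)
    have T2 := tf_mul_shift hη hψ sη sψ t
    have T3 := tf_mul_shift hη hψ' sη sψ' t
    have T4 := (T2.const_mul (-1)).add (T3.const_mul (-h))
    have T5 := T1.add T4
    have e : Φ (fun v => η v * ψ (v + (t + h))) - Φ (fun v => η v * ψ (v + t)) -
        h • Φ (fun v => η v * deriv ψ (v + t)) = Φ (fun v => η v * ψ (v + (t + h)) +
          (-1 * (η v * ψ (v + t)) + -h * (η v * deriv ψ (v + t)))) := by
      rw [add _ _ T1 T4, add _ _ (T2.const_mul (-1)) (T3.const_mul (-h)), smul _ _ T2, smul _ _ T3]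
      module
    rw [e]
    refine abs_le_of_sq_le_sq' ?_ (by positivity) |>.2
    refine (bound _ T5).trans ?_
    rw [mul_pow, Real.sq_sqrt (by
      have : 0 ≤ J := intervalIntegral.integral_nonneg ht fun v _ => hW v
      positivity)]
    have := integral_sq_mul_le (a := a) (b := 1) (B := D * (B * h ^ 2)) ht T5.smooth.continuous cW hW
      (fun v hv => by
        by_contra hc
        apply hv
        rcases le_or_gt 1 v with h1 | h1
        · simp [sη v h1]
        · have h2 : v < a := by
            by_contra h3
            exact hc ⟨not_lt.1 h3, h1.le⟩
          have h4 : v < -t := h2.trans_le (min_le_left _ _)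
          have h5 := (abs_le.1 hh).2
          simp [sψ (v + (t + h)) (by linarith), sψ (v + t) (by linarith),
            sψ' (v + t) (by linarith)])
      (fun v hv => by
        have e2 : η v * ψ (v + (t + h)) + (-1 * (η v * ψ (v + t)) + -h * (η v * deriv ψ (v + t))) =
          η v * (ψ (v + t + h) - ψ (v + t) - h * deriv ψ (v + t)) := by
          rw [add_assoc v t h]; ring
        rw [e2, abs_mul]
        exact mul_le_mul (hD v hv) (taylor_le hψ hB _ _) (abs_nonneg _) hD0)
    calc _ ≤ ρ ^ 2 * ((D * (B * h ^ 2)) ^ 2 * J) := mul_le_mul_of_nonneg_left this (sq_nonneg _)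
      _ = _ := by ring
  rw [hasDerivAt_iff_isLittleO_nhds_zero]
  have h1 : (fun h : ℝ => Φ (fun v => η v * ψ (v + (t + h))) - Φ (fun v => η v * ψ (v + t)) -
      h • Φ (fun v => η v * deriv ψ (v + t))) =O[𝓝 0] fun h : ℝ => h ^ 2 := by
    refine Asymptotics.IsBigO.of_bound (√(ρ ^ 2 * ((D * B) ^ 2 * J))) ?_
    filter_upwards [Metric.closedBall_mem_nhds (0 : ℝ) one_pos] with h hh
    refine (key h (by simpa using hh)).trans (le_of_eq ?_)
    rw [Real.norm_eq_abs, abs_of_nonneg (sq_nonneg h)]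
  exact h1.trans_isLittleO (by
    simpa using Asymptotics.isLittleO_pow_id (𝕜 := ℝ) (n := 2) (by norm_num))

end KB

namespace KB

open scoped ContDiff Topology RealInnerProductSpace

theorem deriv_eq_zero_of_eqOn {f : ℝ → ℝ} (hf : Differentiable ℝ f) {s : Set ℝ}
    (hs : UniqueDiffOn ℝ s) {c : ℝ} (h : ∀ x ∈ s, f x = c) {x : ℝ} (hx : x ∈ s) : deriv f x = 0 := by
  have h1 := (hf x).hasDerivAt.hasDerivWithinAt (s := s)
  have h2 : HasDerivWithinAt f 0 s x := (hasDerivWithinAt_const x s c).congr h (h x hx)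
  exact (hs x hx).eq_deriv _ h1 h2

/-- A smooth cutoff equal to `1` on `(-∞, 0]` and to `0` on `[1, ∞)`. -/
noncomputable def cut (v : ℝ) : ℝ := Real.smoothTransition (1 - v)

theorem contDiff_cut : ContDiff ℝ ∞ cut :=
  Real.smoothTransition.contDiff.comp (contDiff_const.sub contDiff_id)

theorem cut_eq_one {v : ℝ} (h : v ≤ 0) : cut v = 1 :=
  Real.smoothTransition.one_of_one_le (by linarith)

theorem cut_eq_zero {v : ℝ} (h : 1 ≤ v) : cut v = 0 :=
  Real.smoothTransition.zero_of_nonpos (by linarith)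

theorem cut_nonneg (v : ℝ) : 0 ≤ cut v := Real.smoothTransition.nonneg _

theorem cut_le_one (v : ℝ) : cut v ≤ 1 := Real.smoothTransition.le_one _

theorem contDiff_deriv {f : ℝ → ℝ} (h : ContDiff ℝ ∞ f) : ContDiff ℝ ∞ (deriv f) :=
  (contDiff_infty_iff_deriv.1 h).2

theorem differentiable_of_smooth {f : ℝ → ℝ} (h : ContDiff ℝ ∞ f) : Differentiable ℝ f :=
  (contDiff_infty_iff_deriv.1 h).1

theorem deriv_cut_of_le {v : ℝ} (h : v ≤ 0) : deriv cut v = 0 :=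
  deriv_eq_zero_of_eqOn (differentiable_of_smooth contDiff_cut) (uniqueDiffOn_Iic 0)
    (fun _ hx => cut_eq_one hx) h

theorem deriv_cut_of_ge {v : ℝ} (h : 1 ≤ v) : deriv cut v = 0 :=
  deriv_eq_zero_of_eqOn (differentiable_of_smooth contDiff_cut) (uniqueDiffOn_Ici 1)
    (fun _ hx => cut_eq_zero hx) h

theorem deriv2_cut_of_le {v : ℝ} (h : v ≤ 0) : deriv (deriv cut) v = 0 :=
  deriv_eq_zero_of_eqOn (differentiable_of_smooth (contDiff_deriv contDiff_cut)) (uniqueDiffOn_Iic 0)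
    (fun _ hx => deriv_cut_of_le hx) h

theorem deriv2_cut_of_ge {v : ℝ} (h : 1 ≤ v) : deriv (deriv cut) v = 0 :=
  deriv_eq_zero_of_eqOn (differentiable_of_smooth (contDiff_deriv contDiff_cut)) (uniqueDiffOn_Ici 1)
    (fun _ hx => deriv_cut_of_ge hx) h

theorem tf_deriv_cut : TF (deriv cut) :=
  ⟨contDiff_deriv contDiff_cut, HasCompactSupport.intro (isCompact_Icc (a := 0) (b := 1))
    fun v hv => by
      rcases le_total v 0 with h | h
      · exact deriv_cut_of_le h
      · exact deriv_cut_of_ge (le_of_not_ge fun h2 => hv ⟨h, h2⟩)⟩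

theorem exists_cut_bound : ∃ X : ℝ, 1 ≤ X ∧ (∀ v, |deriv cut v| ≤ X) ∧
    ∀ v, |deriv (deriv cut) v| ≤ X := by
  obtain ⟨B, -, hB⟩ := tf_deriv_cut.bounded
  obtain ⟨B', -, hB'⟩ := tf_deriv_cut.deriv.bounded
  refine ⟨max 1 (max B B'), le_max_left _ _, fun v => ?_, fun v => ?_⟩
  · exact (hB v).trans ((le_max_left _ _).trans (le_max_right _ _))
  · exact (hB' v).trans ((le_max_right _ _).trans (le_max_right _ _))

theorem sq_integral_interval_le {p : ℝ → ℝ} (cp : Continuous p) {a b : ℝ} (hab : a ≤ b) :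
    (∫ x in a..b, p x) ^ 2 ≤ (b - a) * ∫ x in a..b, p x ^ 2 := by
  rcases hab.eq_or_lt with rfl | hlt
  · simp
  set I := ∫ x in a..b, p x with hI
  have h : 0 ≤ ∫ x in a..b, ((b - a) * p x - I) ^ 2 :=
    intervalIntegral.integral_nonneg hab fun x _ => sq_nonneg _
  have h2 : ∀ x, ((b - a) * p x - I) ^ 2 =
      (b - a) ^ 2 * p x ^ 2 - 2 * (b - a) * I * p x + I ^ 2 := fun x => by ring
  simp_rw [h2] at h
  rw [intervalIntegral.integral_add, intervalIntegral.integral_sub,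
    intervalIntegral.integral_const_mul, intervalIntegral.integral_const_mul, ← hI,
    intervalIntegral.integral_const, smul_eq_mul] at h
  · have h3 : 0 < b - a := sub_pos.2 hlt
    refine le_of_mul_le_mul_left ?_ h3
    nlinarith
  all_goals exact Continuous.intervalIntegrable (by fun_prop) _ _

theorem hasDerivAt_symm_form {E : Type*} [NormedAddCommGroup E] [InnerProductSpace ℝ E]
    {ℓ w : ℝ → E} {w' : E} {t : ℝ} (hs : ∀ s t, ⟪ℓ s, w t⟫ = ⟪ℓ t, w s⟫)
    (hℓ : ContinuousAt ℓ t) (hw : HasDerivAt w w' t) :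
    HasDerivAt (fun t => ⟪ℓ t, w t⟫) (2 * ⟪ℓ t, w'⟫) t := by
  rw [hasDerivAt_iff_tendsto_slope] at hw ⊢
  have h1 : Filter.Tendsto (fun s => ⟪ℓ s + ℓ t, slope w t s⟫) (𝓝[≠] t) (𝓝 ⟪ℓ t + ℓ t, w'⟫) :=
    ((hℓ.tendsto.mono_left nhdsWithin_le_nhds).add tendsto_const_nhds).inner hw
  have e : (2 : ℝ) * ⟪ℓ t, w'⟫ = ⟪ℓ t + ℓ t, w'⟫ := by rw [inner_add_left]; ring
  rw [e]
  refine h1.congr fun s => ?_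
  simp only [slope, vsub_eq_sub, inner_smul_right, inner_add_left, inner_sub_right, smul_eq_mul]
  rw [hs t s]
  ring

theorem energy_gronwall {e r : ℝ → ℝ} {T R : ℝ} (hT : 0 ≤ T) (hR : 0 ≤ R)
    (de : ∀ t ∈ Set.Icc 0 T, HasDerivAt e (r t) t) (he : ∀ t ∈ Set.Icc 0 T, 0 ≤ e t)
    (hr : ∀ t ∈ Set.Icc 0 T, r t ≤ 2 * R * √(e t)) (h0 : e 0 = 0) : √(e T) ≤ R * T := by
  refine le_of_forall_pos_le_add fun δ hδ => ?_
  have hpos : ∀ t ∈ Set.Icc 0 T, 0 < e t + δ ^ 2 := fun t ht =>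
    add_pos_of_nonneg_of_pos (he t ht) (by positivity)
  have hd : ∀ t ∈ Set.Icc 0 T, HasDerivAt (fun t => √(e t + δ ^ 2) - R * t)
      (r t / (2 * √(e t + δ ^ 2)) - R) t := fun t ht => by
    have := (((de t ht).add_const (δ ^ 2)).sqrt (hpos t ht).ne').sub
      ((hasDerivAt_id t).const_mul R)
    refine this.congr_deriv ?_
    simp
  have anti : AntitoneOn (fun t => √(e t + δ ^ 2) - R * t) (Set.Icc 0 T) := by
    refine antitoneOn_of_deriv_nonpos (convex_Icc 0 T)
      (fun t ht => (hd t ht).continuousAt.continuousWithinAt)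
      (fun t ht => (hd t (interior_subset ht)).differentiableAt.differentiableWithinAt) fun t ht => ?_
    have ht' := interior_subset ht
    rw [(hd t ht').deriv, sub_nonpos, div_le_iff₀ (by have := hpos t ht'; positivity)]
    refine (hr t ht').trans ?_
    have : √(e t) ≤ √(e t + δ ^ 2) := Real.sqrt_le_sqrt (by nlinarith)
    nlinarith
  have := anti ⟨le_rfl, hT⟩ ⟨hT, le_rfl⟩ hT
  simp only [h0, zero_add, mul_zero, sub_zero, Real.sqrt_sq hδ.le] at this
  have h2 : √(e T) ≤ √(e T + δ ^ 2) := Real.sqrt_le_sqrt (by nlinarith)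
  linarith

theorem continuous_weight : Continuous fun v : ℝ => 1 + Real.exp (-(2 * v)) := by fun_prop

theorem continuous_weight' :
    Continuous fun v : ℝ => Real.exp (4 * v) * (1 + Real.exp (-(2 * v))) := by fun_prop

theorem weight_le {v : ℝ} (hv : 0 ≤ v) : 1 + Real.exp (-(2 * v)) ≤ 2 := by
  have : Real.exp (-(2 * v)) ≤ 1 := Real.exp_le_one_iff.2 (by linarith)
  linarith

theorem integral_weight_le : ∫ v in (0 : ℝ)..1, (1 + Real.exp (-(2 * v))) ≤ 2 := by
  calc _ ≤ ∫ v in (0 : ℝ)..1, (2 : ℝ) :=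
        intervalIntegral.integral_mono_on zero_le_one (continuous_weight.intervalIntegrable _ _)
          (by simp) fun v hv => weight_le hv.1
    _ = 2 := by simp

theorem integral_weight'_le (a : ℝ) :
    ∫ v in a..1, Real.exp (4 * v) * (1 + Real.exp (-(2 * v))) ≤ 64 := by
  have hd : ∀ v ∈ Set.uIcc a 1, HasDerivAt (fun v => Real.exp (4 * v) / 4 + Real.exp (2 * v) / 2)
      (Real.exp (4 * v) * (1 + Real.exp (-(2 * v)))) v := fun v _ => by
    have := ((((hasDerivAt_id v).const_mul 4).exp).div_const 4).add
      ((((hasDerivAt_id v).const_mul 2).exp).div_const 2)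
    refine this.congr_deriv ?_
    rw [mul_add, ← Real.exp_add]
    simp only [id]
    ring_nf
  rw [intervalIntegral.integral_eq_sub_of_hasDerivAt hd (continuous_weight'.intervalIntegrable _ _)]
  have e1 : Real.exp (4 * 1) = Real.exp 1 ^ 4 := by rw [← Real.exp_nat_mul]; norm_num
  have e2 : Real.exp (2 * 1) = Real.exp 1 ^ 2 := by rw [← Real.exp_nat_mul]; norm_num
  have h3 : Real.exp 1 ≤ 3 := Real.exp_one_lt_three.le
  have h1 : Real.exp 1 ^ 4 ≤ 3 ^ 4 := pow_le_pow_left₀ (Real.exp_pos _).le h3 4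
  have h2 : Real.exp 1 ^ 2 ≤ 3 ^ 2 := pow_le_pow_left₀ (Real.exp_pos _).le h3 2
  have := Real.exp_pos (4 * a)
  have := Real.exp_pos (2 * a)
  rw [e1, e2]
  linarith

end KB

namespace KB

open scoped ContDiff Topology RealInnerProductSpace

theorem TF.integrable_sq {q : ℝ → ℝ} (hq : TF q) : Integrable fun v => q v ^ 2 := by
  refine Continuous.integrable_of_hasCompactSupport (hq.smooth.continuous.pow 2) ?_
  exact hq.cpt.comp_left (g := fun x => x ^ 2) (by simp)

section

variable {E : Type*} [NormedAddCommGroup E] [InnerProductSpace ℝ E] {ρ : ℝ} {Φ₀ Φ₁ : (ℝ → ℝ) → E}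

theorem Wave.zero (H : Wave ρ Φ₀ Φ₁) : Φ₀ (fun _ => 0) = 0 := by
  have h : TF (fun _ => 0) := ⟨contDiff_const, HasCompactSupport.zero⟩
  have := H.smul₀ 0 _ h
  simpa using this

theorem deriv2_mul_shift {η f : ℝ → ℝ} (hη : ContDiff ℝ ∞ η) (hf : ContDiff ℝ ∞ f) (t : ℝ) :
    deriv (deriv fun v => η v * f (v + t)) = fun v => deriv (deriv η) v * f (v + t) +
      (2 * (deriv η v * deriv f (v + t)) + η v * deriv (deriv f) (v + t)) := by
  have d : ∀ {g : ℝ → ℝ}, ContDiff ℝ ∞ g → ∀ v, HasDerivAt g (deriv g v) v := fun hg v =>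
    (differentiable_of_smooth hg v).hasDerivAt
  have e1 : (deriv fun v => η v * f (v + t)) =
      fun v => deriv η v * f (v + t) + η v * deriv f (v + t) := by
    ext v
    exact ((d hη v).mul ((d hf (v + t)).comp_add_const v t)).deriv
  rw [e1]
  ext v
  have := (((d (contDiff_deriv hη) v).mul ((d hf (v + t)).comp_add_const v t)).add
    ((d hη v).mul ((d (contDiff_deriv hf) (v + t)).comp_add_const v t))).deriv
  refine this.trans ?_
  ring

omit [InnerProductSpace ℝ E] in
theorem norm_le_of_sq {x : E} {a : ℝ} (ha : 0 ≤ a) (h : ‖x‖ ^ 2 ≤ a ^ 2) : ‖x‖ ≤ a :=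
  (abs_le_of_sq_le_sq' h ha).2

theorem Wave.energy (H : Wave ρ Φ₀ Φ₁) {X : ℝ} (hX : 1 ≤ X) (hX1 : ∀ v, |deriv cut v| ≤ X)
    (hX2 : ∀ v, |deriv (deriv cut) v| ≤ X) {p : ℝ → ℝ} (hp : TF p) (sp : ∀ u, u ≤ 1 → p u = 0)
    {T : ℝ} (hT : 1 ≤ T) :
    ‖Φ₀ (fun v => cut v * p (v + T))‖ ≤ 14 * X * ρ * √(T * ∫ v, p v ^ 2) * T := by
  have hρ := H.nonneg
  have cp := hp.smooth.continuous
  set P := ∫ v, p v ^ 2 with hP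
  have hip := hp.integrable_sq
  have hP0 : 0 ≤ P := integral_nonneg fun v => sq_nonneg _
  set f : ℝ → ℝ := fun u => ∫ s in (1 : ℝ)..u, p s with hf
  have df : ∀ u, HasDerivAt f (p u) u := fun u =>
    intervalIntegral.integral_hasDerivAt_right (cp.intervalIntegrable _ _)
      (cp.stronglyMeasurableAtFilter _ _) cp.continuousAt
  have ef : deriv f = p := funext fun u => (df u).deriv
  have sf : ContDiff ℝ ∞ f :=
    contDiff_infty_iff_deriv.2 ⟨fun u => (df u).differentiableAt, by rw [ef]; exact hp.smooth⟩
  have zf : ∀ u, u ≤ 1 → f u = 0 := fun u hu => by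
    simp only [hf]
    rw [intervalIntegral.integral_zero_ae]
    refine ae_of_all _ fun x hx => sp x ?_
    rw [Set.uIoc_of_ge hu] at hx
    exact hx.2
  have f_sq : ∀ u, 1 ≤ u → f u ^ 2 ≤ (u - 1) * P := fun u hu => by
    refine (sq_integral_interval_le cp hu).trans (mul_le_mul_of_nonneg_left ?_ (by linarith))
    rw [intervalIntegral.integral_of_le hu]
    exact setIntegral_le_integral hip (ae_of_all _ fun v => sq_nonneg _)
  have f_abs : ∀ u, u ≤ T + 1 → |f u| ≤ √(T * P) := fun u hu => by
    refine Real.abs_le_sqrt ?_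
    rcases le_total u 1 with h | h
    · rw [zf u h, zero_pow two_ne_zero]; positivity
    · exact (f_sq u h).trans (mul_le_mul_of_nonneg_right (by linarith) hP0)
  have hp1 := hp.deriv
  have hp2 := hp1.deriv
  have sp1 : ∀ u, u ≤ 1 → deriv p u = 0 := fun u hu =>
    deriv_eq_zero_of_eqOn (differentiable_of_smooth hp.smooth) (uniqueDiffOn_Iic 1)
      (fun x hx => sp x hx) hu
  have sp2 : ∀ u, u ≤ 1 → deriv (deriv p) u = 0 := fun u hu =>
    deriv_eq_zero_of_eqOn (differentiable_of_smooth hp1.smooth) (uniqueDiffOn_Iic 1)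
      (fun x hx => sp1 x hx) hu
  obtain ⟨B1, -, hB1⟩ := hp1.bounded
  obtain ⟨B2, -, hB2⟩ := hp2.bounded
  obtain ⟨B3, -, hB3⟩ := hp2.deriv.bounded
  have cc := contDiff_cut
  have cc1 := contDiff_deriv cc
  have cc2 := contDiff_deriv cc1
  have w0 : ∀ v : ℝ, 0 ≤ 1 + Real.exp (-(2 * v)) := fun v => by positivity
  have w1 : ∀ v : ℝ, 0 ≤ Real.exp (4 * v) * (1 + Real.exp (-(2 * v))) := fun v => by positivity
  have z0 : ∀ v, 1 ≤ v → cut v = 0 := fun v => cut_eq_zero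
  have z1 : ∀ v, 1 ≤ v → deriv cut v = 0 := fun v => deriv_cut_of_ge
  have z2 : ∀ v, 1 ≤ v → deriv (deriv cut) v = 0 := fun v => deriv2_cut_of_ge
  set w : ℝ → E := fun t => Φ₀ (fun v => cut v * f (v + t)) with hw
  set w' : ℝ → E := fun t => Φ₀ (fun v => cut v * p (v + t)) with hw'
  set w'' : ℝ → E := fun t => Φ₀ (fun v => cut v * deriv p (v + t)) with hw''
  set r₁ : ℝ → E := fun t => Φ₀ (fun v => deriv (deriv cut) v * f (v + t)) with hr₁
  set r₂ : ℝ → E := fun t => Φ₀ (fun v => deriv cut v * p (v + t)) with hr₂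
  set r₃ : ℝ → E := fun t => Φ₁ (fun v => cut v * f (v + t)) with hr₃
  set ℓ : ℝ → E := fun t => Φ₀ (deriv (deriv fun v => cut v * f (v + t))) +
    Φ₁ (fun v => cut v * f (v + t)) with hℓ
  have tf0 : ∀ t, TF fun v => cut v * f (v + t) := tf_mul_shift cc sf z0 zf
  have eℓ : ∀ t, ℓ t = r₁ t + ((2 : ℝ) • r₂ t + w'' t) + r₃ t := fun t => by
    have t1 := tf_mul_shift cc2 sf z2 zf t
    have t2 := tf_mul_shift cc1 hp.smooth z1 sp t
    have t3 := tf_mul_shift cc hp1.smooth z0 sp1 t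
    simp only [hℓ]
    rw [deriv2_mul_shift cc sf, ef, H.add₀ _ _ t1 ((t2.const_mul 2).add t3),
      H.add₀ _ _ (t2.const_mul 2) t3, H.smul₀ _ _ t2]
  have dw : ∀ t, HasDerivAt w (w' t) t := fun t => by
    have := hasDerivAt_shift H.add₀ H.smul₀ continuous_weight w0 H.bound₀ cc sf z0 zf
      (by rwa [ef]) (by rw [ef]; exact hB1) t
    rwa [ef] at this
  have dw' : ∀ t, HasDerivAt w' (w'' t) t := fun t =>
    hasDerivAt_shift H.add₀ H.smul₀ continuous_weight w0 H.bound₀ cc hp.smooth z0 sp sp1 hB2 t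
  have cw'' : Continuous w'' := continuous_iff_continuousAt.2 fun t =>
    (hasDerivAt_shift H.add₀ H.smul₀ continuous_weight w0 H.bound₀ cc hp1.smooth z0 sp1 sp2
      hB3 t).continuousAt
  have cr₁ : Continuous r₁ := continuous_iff_continuousAt.2 fun t =>
    (hasDerivAt_shift H.add₀ H.smul₀ continuous_weight w0 H.bound₀ cc2 sf z2 zf
      (by rwa [ef]) (by rw [ef]; exact hB1) t).continuousAt
  have cr₂ : Continuous r₂ := continuous_iff_continuousAt.2 fun t =>
    (hasDerivAt_shift H.add₀ H.smul₀ continuous_weight w0 H.bound₀ cc1 hp.smooth z1 sp sp1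
      hB2 t).continuousAt
  have cr₃ : Continuous r₃ := continuous_iff_continuousAt.2 fun t =>
    (hasDerivAt_shift H.add₁ H.smul₁ continuous_weight' w1 H.bound₁ cc sf z0 zf
      (by rwa [ef]) (by rw [ef]; exact hB1) t).continuousAt
  have cℓ : Continuous ℓ := by
    rw [funext eℓ]
    fun_prop
  have sym : ∀ s t, ⟪ℓ s, w t⟫ = ⟪ℓ t, w s⟫ := fun s t => H.symm _ _ (tf0 s) (tf0 t)
  have neg : ∀ t, ⟪ℓ t, w t⟫ ≤ 0 := fun t => H.neg _ (tf0 t)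
  set e : ℝ → ℝ := fun t => ‖w' t‖ ^ 2 - ⟪ℓ t, w t⟫ with he
  have de : ∀ t, HasDerivAt e (2 * ⟪w'' t - ℓ t, w' t⟫) t := fun t => by
    refine ((dw' t).norm_sq.sub (hasDerivAt_symm_form sym cℓ.continuousAt (dw t))).congr_deriv ?_
    rw [inner_sub_left, real_inner_comm (w'' t)]
    ring
  have hwe : ∀ t, ‖w' t‖ ^ 2 ≤ e t := fun t => by
    have := neg t
    simp only [he]
    linarith
  set S := √(T * P) with hS
  have hS0 : 0 ≤ S := Real.sqrt_nonneg _
  have hS2 : S ^ 2 = T * P := Real.sq_sqrt (by positivity)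
  have b1 : ∀ t ∈ Set.Icc 0 T, ‖r₁ t‖ ≤ 2 * X * ρ * S := fun t ht => by
    refine norm_le_of_sq (by positivity) ((H.bound₀ _ (tf_mul_shift cc2 sf z2 zf t)).trans ?_)
    have := integral_sq_mul_le (q := fun v => deriv (deriv cut) v * f (v + t)) (B := X * S)
      zero_le_one (tf_mul_shift cc2 sf z2 zf t).smooth.continuous continuous_weight w0
      (fun v hv => by
        by_contra h
        apply hv
        rcases le_total v 0 with h1 | h1
        · simp [deriv2_cut_of_le h1]
        · simp [z2 v (le_of_not_ge fun h2 => h ⟨h1, h2⟩)])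
      (fun v hv => by
        rw [abs_mul]
        exact mul_le_mul (hX2 v) (f_abs _ (by linarith [hv.2, ht.2])) (abs_nonneg _) (by linarith))
    calc _ ≤ ρ ^ 2 * ((X * S) ^ 2 * 2) := by
          gcongr
          exact this.trans (mul_le_mul_of_nonneg_left integral_weight_le (sq_nonneg _))
      _ ≤ _ := by nlinarith [sq_nonneg (ρ * X * S)]
  have b2 : ∀ t ∈ Set.Icc 0 T, ‖r₂ t‖ ≤ 2 * X * ρ * S := fun t ht => by
    have t2 := tf_mul_shift cc1 hp.smooth z1 sp t
    refine norm_le_of_sq (by positivity) ((H.bound₀ _ t2).trans ?_)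
    have h1 : ∫ v, (deriv cut v * p (v + t)) ^ 2 * (1 + Real.exp (-(2 * v))) ≤
        ∫ v, 2 * X ^ 2 * p (v + t) ^ 2 := by
      refine integral_mono_of_nonneg (ae_of_all _ fun v => mul_nonneg (sq_nonneg _) (w0 v))
        ((hip.comp_add_right t).const_mul _) (ae_of_all _ fun v => ?_)
      simp only
      rcases le_total v 0 with h1 | h1
      · rw [deriv_cut_of_le h1]
        simp only [zero_mul, ne_eq, OfNat.ofNat_ne_zero, not_false_eq_true, zero_pow]
        positivity
      · have h2 : deriv cut v ^ 2 ≤ X ^ 2 := by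
          rw [← sq_abs]; exact pow_le_pow_left₀ (abs_nonneg _) (hX1 v) 2
        calc _ ≤ X ^ 2 * p (v + t) ^ 2 * 2 := by
              rw [mul_pow]
              exact mul_le_mul (mul_le_mul_of_nonneg_right h2 (sq_nonneg _)) (weight_le h1)
                (w0 v) (by positivity)
          _ = _ := by ring
    rw [integral_const_mul, integral_add_right_eq_self (fun v => p v ^ 2) t] at h1
    calc _ ≤ ρ ^ 2 * (2 * X ^ 2 * P) := by gcongr
      _ ≤ ρ ^ 2 * (4 * X ^ 2 * (T * P)) := by
          have : P ≤ T * P := le_mul_of_one_le_left hP0 hT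
          gcongr
          norm_num
      _ = _ := by rw [← hS2]; ring
  have b3 : ∀ t ∈ Set.Icc 0 T, ‖r₃ t‖ ≤ 8 * ρ * S := fun t ht => by
    refine norm_le_of_sq (by positivity) ((H.bound₁ _ (tf0 t)).trans ?_)
    have := integral_sq_mul_le (q := fun v => cut v * f (v + t)) (B := S) (a := 1 - t) (b := 1)
      (by linarith [ht.1]) (tf0 t).smooth.continuous continuous_weight' w1
      (fun v hv => by
        by_contra h
        apply hv
        rcases le_total v (1 - t) with h1 | h1
        · simp [zf (v + t) (by linarith)]
        · simp [z0 v (le_of_not_ge fun h2 => h ⟨h1, h2⟩)])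
      (fun v hv => by
        rw [abs_mul, abs_of_nonneg (cut_nonneg v)]
        exact (mul_le_of_le_one_left (abs_nonneg _) (cut_le_one v)).trans
          (f_abs _ (by linarith [hv.2, ht.2])))
    calc _ ≤ ρ ^ 2 * (S ^ 2 * 64) := by
          gcongr
          exact this.trans (mul_le_mul_of_nonneg_left (integral_weight'_le _) (sq_nonneg _))
      _ = _ := by ring
  have br : ∀ t ∈ Set.Icc 0 T, ‖w'' t - ℓ t‖ ≤ 14 * X * ρ * S := fun t ht => by
    have e1 : w'' t - ℓ t = -(r₁ t + (2 : ℝ) • r₂ t + r₃ t) := by rw [eℓ]; module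
    rw [e1, norm_neg]
    have h2 : ‖(2 : ℝ) • r₂ t‖ = 2 * ‖r₂ t‖ := by rw [norm_smul]; norm_num
    have h3 := norm_add_le (r₁ t + (2 : ℝ) • r₂ t) (r₃ t)
    have h4 := norm_add_le (r₁ t) ((2 : ℝ) • r₂ t)
    have h5 : 8 * ρ * S ≤ 8 * X * ρ * S := by
      have : 0 ≤ ρ * S := by positivity
      nlinarith
    linarith [b1 t ht, b2 t ht, b3 t ht]
  have hz : ∀ (g : ℝ → ℝ), (∀ u, u ≤ 1 → g u = 0) → (fun v => cut v * g (v + 0)) = fun _ => 0 := by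
    intro g hg
    ext v
    rcases le_total v 1 with h | h
    · simp [hg v h]
    · simp [z0 v h]
  have e0 : e 0 = 0 := by
    simp only [he, hw', hw, hz p sp, hz f zf, H.zero]
    simp
  have := energy_gronwall (r := fun t => 2 * ⟪w'' t - ℓ t, w' t⟫) (R := 14 * X * ρ * S) (T := T)
    (zero_le_one.trans hT) (by positivity) (fun t _ => de t) (fun t _ => (sq_nonneg _).trans (hwe t))
    (fun t ht => by
      have h1 := real_inner_le_norm (w'' t - ℓ t) (w' t)
      have h2 : ‖w' t‖ ≤ √(e t) := Real.le_sqrt_of_sq_le (hwe t)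
      have h3 := mul_le_mul (br t ht) h2 (norm_nonneg _) (by positivity)
      linarith) e0
  exact (Real.le_sqrt_of_sq_le (hwe T)).trans this

theorem Wave.norm_le (H : Wave ρ Φ₀ Φ₁) {X : ℝ} (hX : 1 ≤ X) (hX1 : ∀ v, |deriv cut v| ≤ X)
    (hX2 : ∀ v, |deriv (deriv cut) v| ≤ X) {q : ℝ → ℝ} (hq : TF q) {T : ℝ} (hT : 1 ≤ T)
    (sq : ∀ v, v ≤ 1 - T → q v = 0) :
    ‖Φ₀ q‖ ≤ 16 * X * ρ * T ^ 2 * √(∫ v, q v ^ 2) := by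
  have hρ := H.nonneg
  have cq := hq.smooth.continuous
  have hp : TF fun u => q (u - T) :=
    ⟨hq.smooth.comp (contDiff_id.sub contDiff_const),
      hq.cpt.comp_homeomorph (Homeomorph.subRight T)⟩
  have h1 := H.energy hX hX1 hX2 hp (fun u hu => sq _ (by linarith)) hT
  have e1 : ∫ u, q (u - T) ^ 2 = ∫ u, q u ^ 2 := integral_sub_right_eq_self (fun v => q v ^ 2) T
  simp only [add_sub_cancel_right, e1] at h1
  set P := ∫ u, q u ^ 2 with hP
  have hP0 : 0 ≤ P := integral_nonneg fun v => sq_nonneg _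
  have hiq := hq.integrable_sq
  have t1 : TF fun v => cut v * q v := ⟨contDiff_cut.mul hq.smooth, hq.cpt.mul_left⟩
  have t2 : TF fun v => (1 - cut v) * q v :=
    ⟨(contDiff_const.sub contDiff_cut).mul hq.smooth, hq.cpt.mul_left (f := fun v => 1 - cut v)⟩
  have e2 : Φ₀ q = Φ₀ (fun v => cut v * q v) + Φ₀ (fun v => (1 - cut v) * q v) := by
    rw [← H.add₀ _ _ t1 t2]
    congr 1
    ext v
    ring
  have h2 : ‖Φ₀ (fun v => (1 - cut v) * q v)‖ ≤ 2 * ρ * √P := by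
    refine norm_le_of_sq (by positivity) ((H.bound₀ _ t2).trans ?_)
    have h3 : ∫ v, ((1 - cut v) * q v) ^ 2 * (1 + Real.exp (-(2 * v))) ≤ ∫ v, 2 * q v ^ 2 := by
      refine integral_mono_of_nonneg (ae_of_all _ fun v => by positivity)
        (hiq.const_mul _) (ae_of_all _ fun v => ?_)
      simp only
      rcases le_total v 0 with h1 | h1
      · rw [cut_eq_one h1]
        simp only [sub_self, zero_mul, ne_eq, OfNat.ofNat_ne_zero, not_false_eq_true, zero_pow]
        positivity
      · have h2 : (1 - cut v) ^ 2 ≤ 1 := by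
          have := cut_nonneg v
          have := cut_le_one v
          nlinarith
        calc _ ≤ 1 * q v ^ 2 * 2 := by
              rw [mul_pow]
              exact mul_le_mul (mul_le_mul_of_nonneg_right h2 (sq_nonneg _)) (weight_le h1)
                (by positivity) (by positivity)
          _ = _ := by ring
    rw [integral_const_mul] at h3
    calc _ ≤ ρ ^ 2 * (2 * P) := by gcongr
      _ ≤ ρ ^ 2 * (4 * P) := by gcongr; norm_num
      _ = (2 * ρ * √P) ^ 2 := by rw [mul_pow, Real.sq_sqrt hP0]; ring
  rw [e2]
  have h4 : √(T * P) ≤ T * √P := by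
    rw [Real.sqrt_mul (by linarith)]
    exact mul_le_mul_of_nonneg_right ((Real.sqrt_le_left (by linarith)).2 (by nlinarith))
      (Real.sqrt_nonneg _)
  calc _ ≤ 14 * X * ρ * √(T * P) * T + 2 * ρ * √P := (norm_add_le _ _).trans (add_le_add h1 h2)
    _ ≤ 14 * X * ρ * (T * √P) * T + 2 * X * ρ * T ^ 2 * √P := by
        have : 1 ≤ X * T ^ 2 := one_le_mul_of_one_le_of_one_le hX (one_le_pow₀ hT)
        have h5 : 0 ≤ ρ * √P := by positivity
        refine add_le_add (by gcongr) ?_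
        nlinarith
    _ = _ := by ring

end

end KB

namespace KB

open ModularGroup Matrix.SpecialLinearGroup
open UpperHalfPlane hiding I continuous_re continuous_im
open scoped MatrixGroups Modular ENNReal ContDiff Topology RealInnerProductSpace

noncomputable section

/-- The function `y ↦ y ^ s * q (log (M * y))` on the half line. -/
def lift (M : ℝ) (q : ℝ → ℝ) (s y : ℝ) : ℝ :=
  if 0 < y then Real.exp (s * Real.log y) * q (Real.log M + Real.log y) else 0

theorem lift_of_pos {M : ℝ} {q : ℝ → ℝ} {s y : ℝ} (hy : 0 < y) :
    lift M q s y = Real.exp (s * Real.log y) * q (Real.log M + Real.log y) := if_pos hy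

theorem lift_supp {M : ℝ} {q : ℝ → ℝ} {a b : ℝ} (hq : ∀ v, q v ≠ 0 → a ≤ v ∧ v ≤ b)
    {s y : ℝ} (h : lift M q s y ≠ 0) :
    Real.exp (a - Real.log M) ≤ y ∧ y ≤ Real.exp (b - Real.log M) := by
  rcases lt_or_ge 0 y with hy | hy
  · rw [lift_of_pos hy] at h
    obtain ⟨h1, h2⟩ := hq _ (right_ne_zero_of_mul h)
    rw [← Real.le_log_iff_exp_le hy, ← Real.log_le_iff_le_exp hy]
    constructor <;> linarith
  · rw [lift, if_neg (not_lt.2 hy)] at h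
    exact absurd rfl h

theorem TF.exists_supp {q : ℝ → ℝ} (hq : TF q) : ∃ a b, ∀ v, q v ≠ 0 → a ≤ v ∧ v ≤ b := by
  obtain ⟨a, ha⟩ := hq.cpt.isCompact.bddBelow
  obtain ⟨b, hb⟩ := hq.cpt.isCompact.bddAbove
  exact ⟨a, b, fun v hv => ⟨ha (subset_tsupport _ hv), hb (subset_tsupport _ hv)⟩⟩

theorem hasDerivAt_lift (M : ℝ) {q : ℝ → ℝ} (hq : TF q) (s y : ℝ) :
    HasDerivAt (lift M q s) (lift M (fun v => s * q v + deriv q v) (s - 1) y) y := by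
  rcases lt_or_ge 0 y with hy | hy
  · have h1 : HasDerivAt (fun y => Real.exp (s * Real.log y) * q (Real.log M + Real.log y))
        (Real.exp (s * Real.log y) * (s * y⁻¹) * q (Real.log M + Real.log y) +
          Real.exp (s * Real.log y) * (deriv q (Real.log M + Real.log y) * y⁻¹)) y := by
      have hl := Real.hasDerivAt_log hy.ne'
      have hd : HasDerivAt q (deriv q (Real.log M + Real.log y)) (Real.log M + Real.log y) :=
        ((contDiff_infty_iff_deriv.1 hq.smooth).1 _).hasDerivAt
      exact ((hl.const_mul s).exp).mul (hd.comp y (hl.const_add _))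
    have h2 : lift M q s =ᶠ[𝓝 y] fun y => Real.exp (s * Real.log y) * q (Real.log M + Real.log y) := by
      filter_upwards [lt_mem_nhds hy] with u hu using lift_of_pos hu
    refine (h1.congr_of_eventuallyEq h2).congr_deriv ?_
    rw [lift_of_pos hy, sub_mul, Real.exp_sub, one_mul, Real.exp_log hy]
    field_simp
  · obtain ⟨a, b, hab⟩ := hq.exists_supp
    have h2 : lift M q s =ᶠ[𝓝 y] fun _ => 0 := by
      filter_upwards [gt_mem_nhds (hy.trans_lt (Real.exp_pos (a - Real.log M)))] with u hu
      by_contra h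
      exact absurd (lift_supp hab h).1 (not_le.2 hu)
    rw [lift, if_neg (not_lt.2 hy)]
    exact (hasDerivAt_const y (0 : ℝ)).congr_of_eventuallyEq h2

theorem sq_mul_lift (M : ℝ) (q : ℝ → ℝ) (s y : ℝ) : y ^ 2 * lift M q s y = lift M q (s + 2) y := by
  rcases lt_or_ge 0 y with hy | hy
  · rw [lift_of_pos hy, lift_of_pos hy, add_mul, Real.exp_add, two_mul, Real.exp_add,
      Real.exp_log hy]
    ring
  · simp [lift, not_lt.2 hy]

theorem measurable_lift {M : ℝ} {q : ℝ → ℝ} (hq : Measurable q) (s : ℝ) :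
    Measurable (lift M q s) := by
  unfold lift
  refine Measurable.ite measurableSet_Ioi ?_ measurable_const
  fun_prop

/-- The change of variables `y = exp (v - log M)`. -/
theorem integral_exp_sub (M : ℝ) (f : ℝ → ℝ) : ∫ y in Set.Ioi 0, f y =
    ∫ v, Real.exp (v - Real.log M) * f (Real.exp (v - Real.log M)) := by
  have hi : (fun v => Real.exp (v - Real.log M)) '' Set.univ = Set.Ioi 0 := by
    ext y
    simp only [Set.image_univ, Set.mem_range, Set.mem_Ioi]
    exact ⟨fun ⟨v, hv⟩ => hv ▸ Real.exp_pos _, fun h => ⟨Real.log M + Real.log y, by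
      rw [add_sub_cancel_left, Real.exp_log h]⟩⟩
  have := integral_image_eq_integral_abs_deriv_smul (s := Set.univ) MeasurableSet.univ
    (f := fun v => Real.exp (v - Real.log M)) (f' := fun v => Real.exp (v - Real.log M))
    (fun v _ => (((hasDerivAt_id v).sub_const (Real.log M)).exp.congr_deriv (by simp)).hasDerivWithinAt)
    (fun u _ v _ h => by simpa using h) f
  rw [hi] at this
  rw [this]
  simp [abs_of_pos (Real.exp_pos _)]

theorem integrableOn_exp_sub (M : ℝ) (f : ℝ → ℝ) : IntegrableOn f (Set.Ioi 0) ↔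
    Integrable fun v => Real.exp (v - Real.log M) * f (Real.exp (v - Real.log M)) := by
  have hi : (fun v => Real.exp (v - Real.log M)) '' Set.univ = Set.Ioi 0 := by
    ext y
    simp only [Set.image_univ, Set.mem_range, Set.mem_Ioi]
    exact ⟨fun ⟨v, hv⟩ => hv ▸ Real.exp_pos _, fun h => ⟨Real.log M + Real.log y, by
      rw [add_sub_cancel_left, Real.exp_log h]⟩⟩
  have := integrableOn_image_iff_integrableOn_abs_deriv_smul (s := Set.univ) MeasurableSet.univ
    (f := fun v => Real.exp (v - Real.log M)) (f' := fun v => Real.exp (v - Real.log M))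
    (fun v _ => (((hasDerivAt_id v).sub_const (Real.log M)).exp.congr_deriv (by simp)).hasDerivWithinAt)
    (fun u _ v _ h => by simpa using h) f
  rw [hi] at this
  rw [this]
  simp [abs_of_pos (Real.exp_pos _)]

theorem lift_sq_div (M : ℝ) (hM : 0 < M) (q : ℝ → ℝ) (s v : ℝ) :
    Real.exp (v - Real.log M) * (lift M q s (Real.exp (v - Real.log M)) ^ 2 /
      theta M (Real.exp (v - Real.log M)) / Real.exp (v - Real.log M) ^ 2) =
    Real.exp ((2 * s - 1) * (v - Real.log M)) * (q v ^ 2 * (1 + Real.exp (-(2 * v)))) := by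
  rw [lift_of_pos (Real.exp_pos _), Real.log_exp, add_sub_cancel, theta]
  have e1 : M * Real.exp (v - Real.log M) = Real.exp v := by
    rw [Real.exp_sub, Real.exp_log hM]; field_simp
  have e2 : Real.exp (-(2 * v)) = (Real.exp v ^ 2)⁻¹ := by
    rw [Real.exp_neg, two_mul, Real.exp_add, pow_two]
  have e3 : Real.exp ((2 * s - 1) * (v - Real.log M)) =
      Real.exp (s * (v - Real.log M)) ^ 2 / Real.exp (v - Real.log M) := by
    rw [← Real.exp_nat_mul, ← Real.exp_sub]; congr 1; push_cast; ring
  rw [e1, e2, e3]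
  have := Real.exp_pos v
  have := Real.exp_pos (v - Real.log M)
  field_simp
  ring

theorem integrable_of_supp {q W : ℝ → ℝ} (hq : Measurable q) {a b B : ℝ}
    (sq : ∀ v, q v ≠ 0 → a ≤ v ∧ v ≤ b) (hB : ∀ v, |q v| ≤ B) (cW : Continuous W) :
    Integrable fun v => W v * q v ^ 2 := by
  rw [← integrableOn_iff_integrable_of_support_subset (s := Set.Icc a b) (fun v hv => by
    refine sq v fun h => hv ?_
    simp [h])]
  refine (cW.continuousOn.integrableOn_Icc).mul_bdd (c := B ^ 2)
    (hq.pow_const 2).aestronglyMeasurable (ae_of_all _ fun v => ?_)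
  rw [Real.norm_eq_abs, abs_pow]
  exact pow_le_pow_left₀ (abs_nonneg _) (hB v) 2

/-- The basic `L²` bound for incomplete theta series in logarithmic coordinates. -/
theorem sq_poin_lift_le {M : ℝ} (hM : 1 / 3 ≤ M) {A : ℝ → ℝ} (hA : Function.Periodic A 1)
    (cA : Continuous A) {q : ℝ → ℝ} (hq : Measurable q) {a b B : ℝ}
    (sq : ∀ v, q v ≠ 0 → a ≤ v ∧ v ≤ b) (hB : ∀ v, |q v| ≤ B) (s : ℝ) :
    IntegrableOn (fun z => poin (prodF A (lift M q s)) z ^ 2) 𝒟ᵒ ∧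
    ∫ z in 𝒟ᵒ, poin (prodF A (lift M q s)) z ^ 2 ≤ 75 * M * ((∫ x in (0 : ℝ)..1, A x ^ 2) *
      ∫ v, Real.exp ((2 * s - 1) * (v - Real.log M)) * (q v ^ 2 * (1 + Real.exp (-(2 * v))))) := by
  have hM0 : 0 < M := by linarith
  have e : (fun z : ℍ => prodF A (lift M q s) z ^ 2 / theta M z.im) =
      prodF (fun x => A x ^ 2) (fun y => lift M q s y ^ 2 / theta M y) := by
    ext z; simp only [prodF]; ring
  have hi : IntegrableOn (fun z => prodF A (lift M q s) z ^ 2 / theta M z.im) strip := by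
    rw [e]
    refine integrableOn_strip_prodF ((cA.pow 2).continuousOn.integrableOn_Icc.mono_set
      Set.Ico_subset_Icc_self) ?_
    rw [integrableOn_exp_sub M]
    simp only [lift_sq_div M hM0]
    refine (integrable_of_supp hq sq hB (W := fun v => Real.exp ((2 * s - 1) * (v - Real.log M)) *
      (1 + Real.exp (-(2 * v)))) (by fun_prop)).congr (ae_of_all _ fun v => ?_)
    simp only; ring
  have hm : Measurable (prodF A (lift M q s)) :=
    (cA.measurable.comp measurable_re).mul ((measurable_lift hq s).comp measurable_im)
  have := integral_sq_poin_le (Real.exp_pos _)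
    (adm_prodF hA (fun y hy => lift_supp sq hy)) hm hM hi
  rw [e, integral_strip_prodF, integral_exp_sub M] at this
  simp only [lift_sq_div M hM0] at this
  exact this

theorem memLp_poin_lift {M : ℝ} (hM : 1 / 3 ≤ M) {A : ℝ → ℝ} (hA : Function.Periodic A 1)
    (cA : Continuous A) {q : ℝ → ℝ} (hq : Measurable q) {a b B : ℝ}
    (sq : ∀ v, q v ≠ 0 → a ≤ v ∧ v ≤ b) (hB : ∀ v, |q v| ≤ B) (s : ℝ) :
    MemLp (poin (prodF A (lift M q s))) 2 (volume.restrict 𝒟ᵒ) := by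
  refine (memLp_two_iff_integrable_sq ?_).2 (sq_poin_lift_le hM hA cA hq sq hB s).1
  exact (measurable_poin (Real.exp_pos _) (adm_prodF hA (fun y hy => lift_supp sq hy))
    ((cA.measurable.comp measurable_re).mul
      ((measurable_lift hq s).comp measurable_im))).aestronglyMeasurable

end

end KB

namespace KB

open ModularGroup Matrix.SpecialLinearGroup
open UpperHalfPlane hiding I continuous_re continuous_im
open scoped MatrixGroups Modular ENNReal ContDiff Topology RealInnerProductSpace

noncomputable section

/-- The incomplete Poincaré series with amplitude `A` and profile `y ^ s * q (log (M * y))`. -/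
def pser (M : ℝ) (A : ℝ → ℝ) (s : ℝ) (q : ℝ → ℝ) : ℍ → ℝ := poin (prodF A (lift M q s))

theorem lift_add (M : ℝ) (q r : ℝ → ℝ) (s y : ℝ) :
    lift M (fun v => q v + r v) s y = lift M q s y + lift M r s y := by
  unfold lift; split_ifs <;> ring

theorem lift_const_mul (M c : ℝ) (q : ℝ → ℝ) (s y : ℝ) :
    lift M (fun v => c * q v) s y = c * lift M q s y := by
  unfold lift; split_ifs <;> ring

theorem exists_supp_common {q r : ℝ → ℝ} {a b a' b' : ℝ} (hq : ∀ v, q v ≠ 0 → a ≤ v ∧ v ≤ b)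
    (hr : ∀ v, r v ≠ 0 → a' ≤ v ∧ v ≤ b') : ∃ a b, (∀ v, q v ≠ 0 → a ≤ v ∧ v ≤ b) ∧
      ∀ v, r v ≠ 0 → a ≤ v ∧ v ≤ b :=
  ⟨min a a', max b b', fun v hv => ⟨(min_le_left _ _).trans (hq v hv).1,
    (hq v hv).2.trans (le_max_left _ _)⟩, fun v hv => ⟨(min_le_right _ _).trans (hr v hv).1,
    (hr v hv).2.trans (le_max_right _ _)⟩⟩

theorem pser_add (M : ℝ) {A : ℝ → ℝ} (hA : Function.Periodic A 1) (s : ℝ) {q r : ℝ → ℝ}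
    {a b a' b' : ℝ} (hq : ∀ v, q v ≠ 0 → a ≤ v ∧ v ≤ b) (hr : ∀ v, r v ≠ 0 → a' ≤ v ∧ v ≤ b')
    (z : ℍ) : pser M A s (fun v => q v + r v) z = pser M A s q z + pser M A s r z := by
  obtain ⟨c, d, h1, h2⟩ := exists_supp_common hq hr
  rw [pser, pser, pser, ← poin_add (Real.exp_pos _) (adm_prodF hA (fun y hy => lift_supp h1 hy))
    (adm_prodF hA (fun y hy => lift_supp h2 hy))]
  congr 1
  ext z
  simp only [prodF, lift_add]
  ring

theorem pser_const_mul (M c : ℝ) (A : ℝ → ℝ) (s : ℝ) (q : ℝ → ℝ) (z : ℍ) :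
    pser M A s (fun v => c * q v) z = c * pser M A s q z := by
  rw [pser, pser, ← poin_const_mul]
  congr 1
  ext z
  simp only [prodF, lift_const_mul]
  ring

theorem TF.memLp {q : ℝ → ℝ} (hq : TF q) {M : ℝ} (hM : 1 / 3 ≤ M) {A : ℝ → ℝ}
    (hA : Function.Periodic A 1) (cA : Continuous A) (s : ℝ) :
    MemLp (pser M A s q) 2 (volume.restrict 𝒟ᵒ) := by
  obtain ⟨a, b, h⟩ := hq.exists_supp
  obtain ⟨B, -, hB⟩ := hq.bounded
  exact memLp_poin_lift hM hA cA hq.smooth.continuous.measurable h hB s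

/-- The class of a function in `L²` of the fundamental domain. -/
def vec (f : ℍ → ℝ) : Lp ℝ 2 ((volume : Measure ℍ).restrict 𝒟ᵒ) :=
  open Classical in if h : MemLp f 2 (volume.restrict 𝒟ᵒ) then h.toLp f else 0

theorem vec_eq {f : ℍ → ℝ} (h : MemLp f 2 (volume.restrict 𝒟ᵒ)) : vec f = h.toLp f := dif_pos h

theorem inner_vec {f g : ℍ → ℝ} (hf : MemLp f 2 (volume.restrict 𝒟ᵒ))
    (hg : MemLp g 2 (volume.restrict 𝒟ᵒ)) : ⟪vec f, vec g⟫ = ∫ z in 𝒟ᵒ, f z * g z := by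
  rw [vec_eq hf, vec_eq hg, L2.inner_def]
  refine integral_congr_ae ?_
  filter_upwards [hf.coeFn_toLp, hg.coeFn_toLp] with z h1 h2
  rw [h1, h2]
  simp [mul_comm]

theorem norm_vec_sq {f : ℍ → ℝ} (hf : MemLp f 2 (volume.restrict 𝒟ᵒ)) :
    ‖vec f‖ ^ 2 = ∫ z in 𝒟ᵒ, f z ^ 2 := by
  rw [← real_inner_self_eq_norm_sq, inner_vec hf hf]
  simp only [pow_two]

theorem vec_add {f g : ℍ → ℝ} (hf : MemLp f 2 (volume.restrict 𝒟ᵒ))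
    (hg : MemLp g 2 (volume.restrict 𝒟ᵒ)) : vec (f + g) = vec f + vec g := by
  rw [vec_eq hf, vec_eq hg, vec_eq (hf.add hg), MemLp.toLp_add]

theorem vec_smul (c : ℝ) {f : ℍ → ℝ} (hf : MemLp f 2 (volume.restrict 𝒟ᵒ)) :
    vec (c • f) = c • vec f := by
  rw [vec_eq hf, vec_eq (hf.const_smul c), MemLp.toLp_const_smul]

theorem gdot_comm (f h : ℍ → ℝ) (z : ℍ) : gdot f h z = gdot h f z := by
  unfold gdot; ring

section

variable {M : ℝ} {A A' A'' : ℝ → ℝ}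

theorem TF.sm {q : ℝ → ℝ} (hq : TF q) (hA : Function.Periodic A 1) (cA : ContDiff ℝ 1 A) (s : ℝ) :
    Sm (pser M A s q) := by
  obtain ⟨a, b, h⟩ := hq.exists_supp
  refine sm_poin (Real.exp_pos _) (adm_prodF hA (fun y hy => lift_supp h hy)) (sm_prodF cA ?_)
  exact contDiff_of_hasDerivAt (hasDerivAt_lift M hq s) (continuous_iff_continuousAt.2 fun y =>
    (hasDerivAt_lift M ((hq.const_mul s).add hq.deriv) (s - 1) y).continuousAt)

theorem dirichlet_pser {q r : ℝ → ℝ} (hq : TF q) (hr : TF r) (hM : 1 / 3 ≤ M)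
    (hA : Function.Periodic A 1) (dA : ∀ x, HasDerivAt A (A' x) x)
    (dA' : ∀ x, HasDerivAt A' (A'' x) x) (cA : Continuous A'') :
    IntegrableOn (fun z => z.im ^ 2 * gdot (pser M A (1 / 2) q) (pser M A (1 / 2) r) z) 𝒟ᵒ ∧
    ⟪vec (pser M A (1 / 2) (deriv (deriv q))) + vec (pser M A'' (5 / 2) q),
      vec (pser M A (1 / 2) r)⟫ =
      -(∫ z in 𝒟ᵒ, z.im ^ 2 * gdot (pser M A (1 / 2) q) (pser M A (1 / 2) r) z) +
        1 / 4 * ⟪vec (pser M A (1 / 2) q), vec (pser M A (1 / 2) r)⟫ := by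
  have cA0 : Continuous A := continuous_iff_continuousAt.2 fun x => (dA x).continuousAt
  have cA1 : Continuous A' := continuous_iff_continuousAt.2 fun x => (dA' x).continuousAt
  have per_deriv : ∀ {f f' : ℝ → ℝ}, Function.Periodic f 1 → (∀ x, HasDerivAt f (f' x) x) →
      Function.Periodic f' 1 := by
    intro f f' h d x
    have h1 := (d (x + 1)).comp_add_const x 1
    have h2 : (fun y => f (y + 1)) = f := funext h
    rw [h2] at h1
    exact h1.unique (d x)
  have hA2 := per_deriv (per_deriv hA dA) dA'
  obtain ⟨a, b, hs⟩ := hq.exists_supp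
  have t1 := (hq.const_mul (1 / 2)).add hq.deriv
  have d1 := hasDerivAt_lift M hq (1 / 2)
  have d2 := hasDerivAt_lift M t1 (1 / 2 - 1)
  have d3 := hasDerivAt_lift M ((t1.const_mul (1 / 2 - 1)).add t1.deriv) (1 / 2 - 1 - 1)
  have sH : Sm (pser M A (1 / 2) r) := hr.sm hA (contDiff_of_hasDerivAt dA cA1) _
  obtain ⟨a', b', hs'⟩ := hr.exists_supp
  have hH : ∀ (g : SL(2, ℤ)) z, pser M A (1 / 2) r (g • z) = pser M A (1 / 2) r z :=
    fun g z => poin_smul (adm_prodF hA (fun y hy => lift_supp hs' hy)).per g z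
  obtain ⟨i1, i2⟩ := dirichlet_poin (Real.exp_pos _) hA dA dA' cA d1 d2
    (continuous_iff_continuousAt.2 fun x => (d3 x).continuousAt) (fun y hy => lift_supp hs hy) sH hH
  refine ⟨i1, ?_⟩
  have m0 := hq.memLp hM hA cA0 (1 / 2)
  have m1 := hq.deriv.deriv.memLp hM hA cA0 (1 / 2)
  have m2 := hq.memLp hM hA2 cA (5 / 2)
  have m3 := hr.memLp hM hA cA0 (1 / 2)
  have e1 : poin (prodF A'' fun y => y ^ 2 * lift M q (1 / 2) y) = pser M A'' (5 / 2) q := by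
    simp only [sq_mul_lift, pser]
    norm_num
  have e2 : ∀ z, poin (prodF A fun y => y ^ 2 * lift M (fun v => (1 / 2 - 1) *
      (1 / 2 * q v + deriv q v) + deriv (fun v => 1 / 2 * q v + deriv q v) v)
        (1 / 2 - 1 - 1) y) z = pser M A (1 / 2) (deriv (deriv q)) z +
        -(1 / 4) * pser M A (1 / 2) q z := by
    intro z
    obtain ⟨c, d, hs2⟩ := hq.deriv.deriv.exists_supp
    obtain ⟨c', d', hs3⟩ := (hq.const_mul (-(1 / 4))).exists_supp
    rw [← pser_const_mul, ← pser_add M hA (1 / 2) hs2 hs3, pser]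
    congr 2
    ext y
    rw [sq_mul_lift, show (1 / 2 - 1 - 1 + 2 : ℝ) = 1 / 2 by norm_num]
    congr 1
    ext v
    have dq := (contDiff_infty_iff_deriv.1 hq.smooth).1 v
    have dq' := (contDiff_infty_iff_deriv.1 hq.deriv.smooth).1 v
    have e3 : deriv (fun v => 1 / 2 * q v + deriv q v) v = 1 / 2 * deriv q v + deriv (deriv q) v :=
      ((dq.hasDerivAt.const_mul (1 / 2)).add dq'.hasDerivAt).deriv
    rw [e3]
    ring
  have j1 : Integrable (fun z => pser M A (1 / 2) (deriv (deriv q)) z * pser M A (1 / 2) r z)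
    (volume.restrict 𝒟ᵒ) := m1.integrable_mul m3
  have j2 : Integrable (fun z => pser M A'' (5 / 2) q z * pser M A (1 / 2) r z)
    (volume.restrict 𝒟ᵒ) := m2.integrable_mul m3
  have j0 : Integrable (fun z => pser M A (1 / 2) q z * pser M A (1 / 2) r z)
    (volume.restrict 𝒟ᵒ) := m0.integrable_mul m3
  have e3 : ∀ z, (poin (prodF A'' fun y => y ^ 2 * lift M q (1 / 2) y) z +
      poin (prodF A fun y => y ^ 2 * lift M (fun v => (1 / 2 - 1) *
      (1 / 2 * q v + deriv q v) + deriv (fun v => 1 / 2 * q v + deriv q v) v)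
        (1 / 2 - 1 - 1) y) z) * pser M A (1 / 2) r z =
      (pser M A (1 / 2) (deriv (deriv q)) z * pser M A (1 / 2) r z +
        pser M A'' (5 / 2) q z * pser M A (1 / 2) r z) -
        1 / 4 * (pser M A (1 / 2) q z * pser M A (1 / 2) r z) := by
    intro z
    rw [e1, e2]
    ring
  simp only [e3] at i2
  have j12 : Integrable (fun z => pser M A (1 / 2) (deriv (deriv q)) z * pser M A (1 / 2) r z +
    pser M A'' (5 / 2) q z * pser M A (1 / 2) r z) (volume.restrict 𝒟ᵒ) := j1.add j2
  rw [integral_sub j12 (j0.const_mul _), integral_add j1 j2, integral_const_mul] at i2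
  rw [show pser M A (1 / 2) q = poin (prodF A (lift M q (1 / 2))) from rfl] at *
  rw [i2, inner_add_left, inner_vec m1 m3, inner_vec m2 m3, inner_vec m0 m3]
  ring

theorem periodic_deriv {f f' : ℝ → ℝ} (h : Function.Periodic f 1)
    (d : ∀ x, HasDerivAt f (f' x) x) : Function.Periodic f' 1 := by
  intro x
  have h1 := (d (x + 1)).comp_add_const x 1
  have h2 : (fun y => f (y + 1)) = f := funext h
  rw [h2] at h1
  exact h1.unique (d x)

/-- Poincaré series with a mean-zero amplitude satisfy the defining properties of `Wave`. -/
theorem wave_pser (hM : 1 / 3 ≤ M) (hA : Function.Periodic A 1)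
    (dA : ∀ x, HasDerivAt A (A' x) x) (dA' : ∀ x, HasDerivAt A' (A'' x) x) (cA : Continuous A'')
    (hA0 : ∫ x in (0 : ℝ)..1, A x = 0) {κ α : ℝ} (hκ : 1 ≤ κ) (hα : 0 ≤ α)
    (h0 : ∫ x in (0 : ℝ)..1, A x ^ 2 ≤ α ^ 2)
    (h2 : ∫ x in (0 : ℝ)..1, A'' x ^ 2 ≤ (κ * M ^ 2 * α) ^ 2) :
    Wave (9 * √M * κ * α) (fun q => vec (pser M A (1 / 2) q))
      (fun q => vec (pser M A'' (5 / 2) q)) := by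
  have hM0 : 0 < M := by linarith
  have cA0 : Continuous A := continuous_iff_continuousAt.2 fun x => (dA x).continuousAt
  have cA1 : Continuous A' := continuous_iff_continuousAt.2 fun x => (dA' x).continuousAt
  have hA2 := periodic_deriv (periodic_deriv hA dA) dA'
  have add : ∀ {A : ℝ → ℝ} (_ : Function.Periodic A 1) (_ : Continuous A) (s : ℝ) (q r : ℝ → ℝ),
      TF q → TF r → vec (pser M A s fun v => q v + r v) = vec (pser M A s q) + vec (pser M A s r) := by
    intro A hA cA s q r hq hr
    obtain ⟨a, b, h⟩ := hq.exists_supp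
    obtain ⟨a', b', h'⟩ := hr.exists_supp
    rw [← vec_add (hq.memLp hM hA cA s) (hr.memLp hM hA cA s)]
    congr 1
    ext z
    exact pser_add M hA s h h' z
  have smul : ∀ {A : ℝ → ℝ} (_ : Function.Periodic A 1) (_ : Continuous A) (s c : ℝ) (q : ℝ → ℝ),
      TF q → vec (pser M A s fun v => c * q v) = c • vec (pser M A s q) := by
    intro A hA cA s c q hq
    rw [← vec_smul c (hq.memLp hM hA cA s)]
    congr 1
    ext z
    exact pser_const_mul M c A s q z
  have hρ : (9 * √M * κ * α) ^ 2 = 81 * M * κ ^ 2 * α ^ 2 := by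
    rw [mul_pow, mul_pow, mul_pow, Real.sq_sqrt hM0.le]; ring
  have hκ2 : 1 ≤ κ ^ 2 := one_le_pow₀ hκ
  have nn : ∀ A : ℝ → ℝ, 0 ≤ ∫ x in (0 : ℝ)..1, A x ^ 2 := fun A =>
    intervalIntegral.integral_nonneg zero_le_one fun x _ => sq_nonneg _
  refine ⟨add hA cA0 _, smul hA cA0 _, add hA2 cA _, smul hA2 cA _, by positivity,
    fun q hq => ?_, fun q hq => ?_, fun q r hq hr => ?_, fun q hq => ?_⟩
  · obtain ⟨a, b, h⟩ := hq.exists_supp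
    obtain ⟨B, -, hB⟩ := hq.bounded
    rw [norm_vec_sq (hq.memLp hM hA cA0 _), hρ]
    refine (sq_poin_lift_le hM hA cA0 hq.smooth.continuous.measurable h hB (1 / 2)).2.trans ?_
    have e : ∀ v : ℝ, Real.exp ((2 * (1 / 2) - 1) * (v - Real.log M)) = 1 := fun v => by norm_num
    simp only [e, one_mul]
    have hJ : 0 ≤ ∫ v, q v ^ 2 * (1 + Real.exp (-(2 * v))) :=
      integral_nonneg fun v => by positivity
    calc _ ≤ 81 * M * (α ^ 2 * ∫ v, q v ^ 2 * (1 + Real.exp (-(2 * v)))) :=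
        mul_le_mul (by linarith) (mul_le_mul_of_nonneg_right h0 hJ)
          (mul_nonneg (nn A) hJ) (by positivity)
      _ ≤ κ ^ 2 * (81 * M * (α ^ 2 * ∫ v, q v ^ 2 * (1 + Real.exp (-(2 * v))))) :=
        le_mul_of_one_le_left (by positivity) hκ2
      _ = _ := by ring
  · obtain ⟨a, b, h⟩ := hq.exists_supp
    obtain ⟨B, -, hB⟩ := hq.bounded
    rw [norm_vec_sq (hq.memLp hM hA2 cA _), hρ]
    refine (sq_poin_lift_le hM hA2 cA hq.smooth.continuous.measurable h hB (5 / 2)).2.trans ?_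
    have e : ∀ v : ℝ, Real.exp ((2 * (5 / 2) - 1) * (v - Real.log M)) *
        (q v ^ 2 * (1 + Real.exp (-(2 * v)))) = (M ^ 4)⁻¹ *
          (q v ^ 2 * (Real.exp (4 * v) * (1 + Real.exp (-(2 * v))))) := fun v => by
      rw [show (2 * (5 / 2) - 1) * (v - Real.log M) = 4 * v - Real.log M * (4 : ℕ) by
        push_cast; ring, Real.exp_sub, mul_comm (Real.log M), Real.exp_nat_mul, Real.exp_log hM0]
      field_simp
    simp only [e]
    rw [integral_const_mul]
    have hJ : 0 ≤ ∫ v, q v ^ 2 * (Real.exp (4 * v) * (1 + Real.exp (-(2 * v)))) :=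
      integral_nonneg fun v => by positivity
    calc _ ≤ 81 * M * ((κ * M ^ 2 * α) ^ 2 * ((M ^ 4)⁻¹ *
          ∫ v, q v ^ 2 * (Real.exp (4 * v) * (1 + Real.exp (-(2 * v)))))) :=
        mul_le_mul (by linarith) (mul_le_mul_of_nonneg_right h2 (by positivity))
          (mul_nonneg (nn A'') (by positivity)) (by positivity)
      _ = _ := by
        generalize ∫ v, q v ^ 2 * (Real.exp (4 * v) * (1 + Real.exp (-(2 * v)))) = J
        field_simp
  · rw [(dirichlet_pser hq hr hM hA dA dA' cA).2, (dirichlet_pser hr hq hM hA dA dA' cA).2,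
      real_inner_comm]
    simp only [gdot_comm (pser M A (1 / 2) q)]
  · obtain ⟨i, e⟩ := dirichlet_pser hq hq hM hA dA dA' cA
    obtain ⟨a, b, h⟩ := hq.exists_supp
    have ad := adm_prodF (φ := lift M q (1 / 2)) hA (fun y hy => lift_supp h hy)
    have m0 := hq.memLp hM hA cA0 (1 / 2)
    have hz : ∫ z in 𝒟ᵒ, pser M A (1 / 2) q z = 0 := by
      have := (integral_poin (Real.exp_pos _) ad ((cA0.measurable.comp measurable_re).mul
        ((measurable_lift hq.smooth.continuous.measurable _).comp measurable_im))
        (integrableOn_strip_prodF (cA0.continuousOn.integrableOn_Icc.mono_set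
          Set.Ico_subset_Icc_self) ?_)).2
      · rw [pser, this, integral_strip_prodF, hA0, zero_mul]
      · rw [integrableOn_exp_sub M]
        obtain ⟨B, -, hB⟩ := hq.bounded
        have cq := hq.smooth.continuous
        refine Continuous.integrable_of_hasCompactSupport ?_ ?_
        · have : Continuous (lift M q (1 / 2)) :=
            continuous_iff_continuousAt.2 fun y => (hasDerivAt_lift M hq _ y).continuousAt
          fun_prop (disch := intro; positivity)
        · refine HasCompactSupport.intro (isCompact_Icc (a := a) (b := b)) fun v hv => ?_
          have : q v = 0 := by
            by_contra hc
            exact hv (h v hc)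
          rw [lift_of_pos (Real.exp_pos _), Real.log_exp, add_sub_cancel, this]
          simp
    have := spectral_gap (w := pser M A (1 / 2) q) (hq.sm hA (contDiff_of_hasDerivAt dA cA1) _)
      (R := max (Real.exp (b - Real.log M)) (1 / Real.exp (a - Real.log M)))
      (fun z hz => ad.poin_eq_zero (Real.exp_pos _) ((le_max_left _ _).trans_lt hz)
        ((le_max_right _ _).trans_lt hz)) hz i
    rw [e, real_inner_self_eq_norm_sq, norm_vec_sq m0]
    linarith

end

end

end KB

namespace KB

open ModularGroup Matrix.SpecialLinearGroup
open UpperHalfPlane hiding I continuous_re continuous_im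
open scoped MatrixGroups Modular ENNReal ContDiff Topology RealInnerProductSpace

noncomputable section

theorem le_of_forall_pos_le_add_mul {x L D : ℝ} (h : ∀ ε > 0, x ≤ L + D * ε) : x ≤ L := by
  have h1 : Filter.Tendsto (fun ε => L + D * ε) (𝓝[>] 0) (𝓝 (L + D * 0)) :=
    (Continuous.tendsto (by fun_prop) 0).mono_left nhdsWithin_le_nhds
  rw [mul_zero, add_zero] at h1
  exact ge_of_tendsto h1 (by filter_upwards [self_mem_nhdsWithin] with ε hε using h ε hε)

/-- Smooth approximation in `L²` with control of supports. -/
theorem exists_tf_approx {q : ℝ → ℝ} (hq : Measurable q) {a b B : ℝ}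
    (sq : ∀ v, q v ≠ 0 → a ≤ v ∧ v ≤ b) (hB : ∀ v, |q v| ≤ B) {ε : ℝ} (hε : 0 < ε) :
    ∃ g, TF g ∧ (∀ v, g v ≠ 0 → a - 1 < v ∧ v ≤ b + 1) ∧ ∫ v, (q v - g v) ^ 2 ≤ ε ^ 2 := by
  have i1 : Integrable fun v => q v ^ 2 := by
    simpa using integrable_of_supp hq sq hB (W := fun _ => 1) continuous_const
  have m1 : MemLp q 2 volume := (memLp_two_iff_integrable_sq hq.aestronglyMeasurable).2 i1
  obtain ⟨g, h1, h2, h3⟩ := m1.exist_eLpNorm_sub_le (by simp) (by simp) hε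
  have m2 : MemLp g 2 volume := h2.continuous.memLp_of_hasCompactSupport h1
  have h4 : ∫ v, (q v - g v) ^ 2 ≤ ε ^ 2 := by
    have h5 : ‖(m1.sub m2).toLp‖ ≤ ε := by
      rw [Lp.norm_toLp]
      exact ENNReal.toReal_le_of_le_ofReal hε.le h3
    have h6 : ‖(m1.sub m2).toLp‖ ^ 2 = ∫ v, (q v - g v) ^ 2 := by
      rw [← real_inner_self_eq_norm_sq, L2.inner_def]
      refine integral_congr_ae ?_
      filter_upwards [(m1.sub m2).coeFn_toLp] with z h1
      rw [h1]
      simp [pow_two]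
    rw [← h6]
    exact pow_le_pow_left₀ (norm_nonneg _) h5 2
  have c1 : ContDiff ℝ ∞ fun v => cut (v - b) * cut (a - v) :=
    (contDiff_cut.comp (contDiff_id.sub contDiff_const)).mul
      (contDiff_cut.comp (contDiff_const.sub contDiff_id))
  refine ⟨fun v => cut (v - b) * cut (a - v) * g v, ⟨c1.mul h2, h1.mul_left⟩, fun v hv => ?_,
    (integral_mono_of_nonneg (ae_of_all _ fun v => sq_nonneg _) (m1.sub m2).integrable_sq
      (ae_of_all _ fun v => ?_)).trans h4⟩
  · have e1 := left_ne_zero_of_mul (left_ne_zero_of_mul hv)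
    have e2 := right_ne_zero_of_mul (left_ne_zero_of_mul hv)
    constructor
    · by_contra hc
      exact e2 (cut_eq_zero (by linarith))
    · by_contra hc
      exact e1 (cut_eq_zero (by linarith))
  · have e1 : q v = cut (v - b) * cut (a - v) * q v := by
      by_cases hv : q v = 0
      · rw [hv, mul_zero]
      · obtain ⟨l, r⟩ := sq v hv
        rw [cut_eq_one (by linarith), cut_eq_one (by linarith)]
        ring
    simp only [Pi.sub_apply]
    rw [show q v - cut (v - b) * cut (a - v) * g v = cut (v - b) * cut (a - v) * (q v - g v) by
      rw [mul_sub, ← e1], mul_pow]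
    refine mul_le_of_le_one_left (sq_nonneg _) (pow_le_one₀ ?_ ?_)
    · exact mul_nonneg (cut_nonneg _) (cut_nonneg _)
    · exact mul_le_one₀ (cut_le_one _) (cut_nonneg _) (cut_le_one _)

section

variable {M : ℝ} {A A' A'' : ℝ → ℝ}

theorem norm_vec_pser_le (hM : 1 / 3 ≤ M) (hA : Function.Periodic A 1)
    (dA : ∀ x, HasDerivAt A (A' x) x) (dA' : ∀ x, HasDerivAt A' (A'' x) x) (cA : Continuous A'')
    (hA0 : ∫ x in (0 : ℝ)..1, A x = 0) {κ α : ℝ} (hκ : 1 ≤ κ) (hα : 0 ≤ α)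
    (h0 : ∫ x in (0 : ℝ)..1, A x ^ 2 ≤ α ^ 2)
    (h2 : ∫ x in (0 : ℝ)..1, A'' x ^ 2 ≤ (κ * M ^ 2 * α) ^ 2) {X : ℝ} (hX : 1 ≤ X)
    (hX1 : ∀ v, |deriv cut v| ≤ X) (hX2 : ∀ v, |deriv (deriv cut) v| ≤ X)
    {q : ℝ → ℝ} (hq : Measurable q) {a b B T : ℝ}
    (sq : ∀ v, q v ≠ 0 → a ≤ v ∧ v ≤ b) (hB : ∀ v, |q v| ≤ B) (hT : 1 ≤ T) (ha : 1 - T ≤ a) :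
    ‖vec (pser M A (1 / 2) q)‖ ≤
      32 * X * (9 * √M * κ * α) * (T + 1) ^ 2 * √(∫ v, q v ^ 2) := by
  have H := wave_pser hM hA dA dA' cA hA0 hκ hα h0 h2
  set ρ := 9 * √M * κ * α with hρ
  have hρ0 : 0 ≤ ρ := H.nonneg
  have hM0 : 0 < M := by linarith
  have cA0 : Continuous A := continuous_iff_continuousAt.2 fun x => (dA x).continuousAt
  set P := ∫ v, q v ^ 2 with hP
  have hP0 : 0 ≤ P := integral_nonneg fun v => sq_nonneg _
  set E := Real.exp (-(2 * (-T))) with hE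
  have hE0 : 0 < E := Real.exp_pos _
  refine le_of_forall_pos_le_add_mul (D := ρ * √(1 + E) + 32 * X * ρ * (T + 1) ^ 2) fun ε hε => ?_
  obtain ⟨g, hg, sg', h3⟩ := exists_tf_approx hq sq hB hε
  have sg : ∀ v, g v ≠ 0 → a - 1 ≤ v ∧ v ≤ b + 1 := fun v hv => ⟨(sg' v hv).1.le, (sg' v hv).2⟩
  have m1 := hg.memLp hM hA cA0 (1 / 2)
  obtain ⟨Bg, hBg0, hBg⟩ := hg.bounded
  set r : ℝ → ℝ := fun v => q v - g v with hr
  have mr : Measurable r := hq.sub hg.smooth.continuous.measurable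
  have sr : ∀ v, r v ≠ 0 → a - 1 ≤ v ∧ v ≤ b + 1 := by
    intro v hv
    by_cases h : q v = 0
    · refine sg v fun h' => hv ?_
      simp [hr, h, h']
    · obtain ⟨l, u⟩ := sq v h
      constructor <;> linarith
  have br : ∀ v, |r v| ≤ B + Bg := fun v => (abs_sub _ _).trans (add_le_add (hB v) (hBg v))
  have m2 : MemLp (pser M A (1 / 2) r) 2 (volume.restrict 𝒟ᵒ) := memLp_poin_lift hM hA cA0 mr sr br _
  have e1 : vec (pser M A (1 / 2) q) = vec (pser M A (1 / 2) r) + vec (pser M A (1 / 2) g) := by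
    rw [← vec_add m2 m1]
    congr 1
    ext z
    rw [Pi.add_apply, ← pser_add M hA _ sr sg]
    congr 1
    ext v
    simp [hr]
  have iq : Integrable fun v => q v ^ 2 := by
    simpa using integrable_of_supp hq sq hB (W := fun _ => 1) continuous_const
  have ir : Integrable fun v => r v ^ 2 := by
    simpa using integrable_of_supp mr sr br (W := fun _ => 1) continuous_const
  have n1 : ‖vec (pser M A (1 / 2) r)‖ ≤ ρ * √(1 + E) * ε := by
    refine norm_le_of_sq (by positivity) ?_
    rw [norm_vec_sq m2]
    refine (sq_poin_lift_le hM hA cA0 mr sr br (1 / 2)).2.trans ?_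
    have e : ∀ v : ℝ, Real.exp ((2 * (1 / 2) - 1) * (v - Real.log M)) = 1 := fun v => by norm_num
    simp only [e, one_mul]
    have l1 : ∫ v, r v ^ 2 * (1 + Real.exp (-(2 * v))) ≤ (1 + E) * ε ^ 2 := by
      calc _ ≤ ∫ v, (1 + E) * r v ^ 2 := by
            refine integral_mono_of_nonneg (ae_of_all _ fun v => by positivity)
              (ir.const_mul _) (ae_of_all _ fun v => ?_)
            simp only
            by_cases h : r v = 0
            · simp [h]
            · rw [mul_comm]
              refine mul_le_mul_of_nonneg_right ?_ (sq_nonneg _)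
              have := (sr v h).1
              gcongr
              rw [hE, Real.exp_le_exp]
              linarith
        _ = (1 + E) * ∫ v, r v ^ 2 := integral_const_mul _ _
        _ ≤ _ := by gcongr
    have nn : 0 ≤ ∫ v, r v ^ 2 * (1 + Real.exp (-(2 * v))) :=
      integral_nonneg fun v => by positivity
    have hκ2 : 1 ≤ κ ^ 2 := one_le_pow₀ hκ
    calc _ ≤ 81 * M * (α ^ 2 * ∫ v, r v ^ 2 * (1 + Real.exp (-(2 * v)))) :=
          mul_le_mul (by linarith) (mul_le_mul_of_nonneg_right h0 nn)
            (mul_nonneg (intervalIntegral.integral_nonneg zero_le_one fun x _ => sq_nonneg _) nn)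
            (by positivity)
      _ ≤ κ ^ 2 * (81 * M * (α ^ 2 * ((1 + E) * ε ^ 2))) := by
          refine le_trans ?_ (le_mul_of_one_le_left (by positivity) hκ2)
          gcongr
      _ = _ := by
          rw [hρ, mul_pow, mul_pow, Real.sq_sqrt (by positivity), mul_pow, mul_pow, mul_pow,
            Real.sq_sqrt hM0.le]
          ring
  have n2 : ‖vec (pser M A (1 / 2) g)‖ ≤ 16 * X * ρ * (T + 1) ^ 2 * (2 * (√P + ε)) := by
    refine (H.norm_le hX hX1 hX2 hg (T := T + 1) (by linarith) fun v hv => ?_).trans ?_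
    · by_contra hc
      have := (sg' v hc).1
      linarith
    · have l2 : ∫ v, g v ^ 2 ≤ (2 * (√P + ε)) ^ 2 := by
        calc _ ≤ ∫ v, (2 * q v ^ 2 + 2 * r v ^ 2) := by
              refine integral_mono_of_nonneg (ae_of_all _ fun v => sq_nonneg _)
                ((iq.const_mul 2).add (ir.const_mul 2)) (ae_of_all _ fun v => ?_)
              simp only [hr]
              nlinarith [sq_nonneg (q v + (q v - g v))]
          _ = 2 * P + 2 * ∫ v, r v ^ 2 := by
              rw [integral_add (iq.const_mul 2) (ir.const_mul 2), integral_const_mul,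
                integral_const_mul]
          _ ≤ 2 * P + 2 * ε ^ 2 := by linarith
          _ ≤ _ := by
              have := Real.sq_sqrt hP0
              have := Real.sqrt_nonneg P
              nlinarith
      have : √(∫ v, g v ^ 2) ≤ 2 * (√P + ε) := Real.sqrt_le_iff.2 ⟨by positivity, l2⟩
      gcongr
  rw [e1]
  refine (norm_add_le _ _).trans ((add_le_add n1 n2).trans (le_of_eq ?_))
  ring

end

/-- The `L²` bound for incomplete Poincaré series with a mean-zero amplitude. -/
theorem exists_norm_poin_le : ∃ K : ℝ, 0 < K ∧ ∀ {M : ℝ} {A A' A'' : ℝ → ℝ}, 1 / 3 ≤ M →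
    Function.Periodic A 1 → (∀ x, HasDerivAt A (A' x) x) → (∀ x, HasDerivAt A' (A'' x) x) →
    Continuous A'' → ∫ x in (0 : ℝ)..1, A x = 0 → ∀ {κ α : ℝ}, 1 ≤ κ → 0 ≤ α →
    ∫ x in (0 : ℝ)..1, A x ^ 2 ≤ α ^ 2 →
    ∫ x in (0 : ℝ)..1, A'' x ^ 2 ≤ (κ * M ^ 2 * α) ^ 2 → ∀ {f : ℝ → ℝ} {Y R B T : ℝ},
    Measurable f → 0 < Y → (∀ y, f y ≠ 0 → Y ≤ y ∧ y ≤ R) → (∀ y, |f y| ≤ B) → 1 ≤ T →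
    Real.exp (1 - T) ≤ M * Y → MemLp (poin (prodF A f)) 2 (volume.restrict 𝒟ᵒ) ∧
    ‖vec (poin (prodF A f))‖ ≤
      K * κ * √M * α * T ^ 2 * √(∫ y in Set.Ioi 0, f y ^ 2 / y ^ 2) := by
  obtain ⟨X, hX, hX1, hX2⟩ := exists_cut_bound
  refine ⟨32 * X * 9 * 4, by positivity, ?_⟩
  intro M A A' A'' hM hA dA dA' cA hA0 κ α hκ hα h0 h2 f Y R B T hf hY sf hB hT hMY
  have hM0 : 0 < M := by linarith
  have cA0 : Continuous A := continuous_iff_continuousAt.2 fun x => (dA x).continuousAt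
  set q : ℝ → ℝ := fun v => Real.exp (-(1 / 2) * (v - Real.log M)) * f (Real.exp (v - Real.log M))
    with hq
  have mq : Measurable q := by
    refine Measurable.mul (by fun_prop) (hf.comp (by fun_prop))
  have sq : ∀ v, q v ≠ 0 → Real.log (M * Y) ≤ v ∧ v ≤ Real.log M + Real.log R := by
    intro v hv
    obtain ⟨l, r⟩ := sf _ (right_ne_zero_of_mul hv)
    rw [← Real.log_le_iff_le_exp hY] at l
    rw [← Real.le_log_iff_exp_le ((Real.exp_pos _).trans_le r)] at r
    rw [Real.log_mul hM0.ne' hY.ne']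
    constructor <;> linarith
  have hB0 : 0 ≤ B := (abs_nonneg _).trans (hB 0)
  have bq : ∀ v, |q v| ≤ Real.exp (-(1 / 2) * Real.log Y) * B := by
    intro v
    by_cases hv : q v = 0
    · rw [hv, abs_zero]; positivity
    · have := (sq v hv).1
      rw [Real.log_mul hM0.ne' hY.ne'] at this
      rw [hq, abs_mul, abs_of_pos (Real.exp_pos _)]
      refine mul_le_mul ?_ (hB _) (abs_nonneg _) (Real.exp_nonneg _)
      rw [Real.exp_le_exp]
      linarith
  have e : poin (prodF A f) = pser M A (1 / 2) q := by
    rw [pser]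
    congr 2
    ext y
    rcases lt_or_ge 0 y with hy | hy
    · rw [lift_of_pos hy, hq]
      simp only [add_sub_cancel_left]
      rw [Real.exp_log hy, ← mul_assoc, ← Real.exp_add]
      simp
    · rw [lift, if_neg (not_lt.2 hy)]
      by_contra h
      linarith [(sf y h).1]
  have hT2 : 1 - T ≤ Real.log (M * Y) := by
    rwa [Real.le_log_iff_exp_le (by positivity)]
  rw [e]
  refine ⟨memLp_poin_lift hM hA cA0 mq sq bq _,
    (norm_vec_pser_le hM hA dA dA' cA hA0 hκ hα h0 h2 hX hX1 hX2 mq sq bq hT hT2).trans ?_⟩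
  have e2 : ∫ v, q v ^ 2 = ∫ y in Set.Ioi 0, f y ^ 2 / y ^ 2 := by
    rw [integral_exp_sub M]
    refine integral_congr_ae (ae_of_all _ fun v => ?_)
    simp only [hq]
    rw [mul_pow, ← Real.exp_nat_mul]
    have : Real.exp ((2 : ℕ) * (-(1 / 2) * (v - Real.log M))) = (Real.exp (v - Real.log M))⁻¹ := by
      rw [← Real.exp_neg]; congr 1; push_cast; ring
    rw [this]
    field_simp
  rw [e2]
  have : (T + 1) ^ 2 ≤ 4 * T ^ 2 := by nlinarith
  calc _ ≤ 32 * X * (9 * √M * κ * α) * (4 * T ^ 2) * √(∫ y in Set.Ioi 0, f y ^ 2 / y ^ 2) := by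
        gcongr
    _ = _ := by ring

end

end KB

namespace KB

open ModularGroup Matrix.SpecialLinearGroup
open UpperHalfPlane hiding I continuous_re continuous_im
open scoped MatrixGroups Modular ENNReal ContDiff Topology RealInnerProductSpace

noncomputable section

/-- The contribution of one coset to the unfolded inner product. -/
def cosetTerm (F G : ℍ → ℝ) (p : CopPair) : ℝ := ∫ z in strip, F z * G (rep p • z)

theorem integral_poin_mul_poin {F G : ℍ → ℝ} {Y R Y' R' B : ℝ} (hY : 0 < Y) (hY' : 0 < Y')
    (hF : Adm Y R F) (hG : Adm Y' R' G) (mF : Measurable F) (mG : Measurable G)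
    (iF : IntegrableOn F strip) (bG : ∀ z, |G z| ≤ B) :
    ∃ s : Finset CopPair, (∀ p, p ∉ s → cosetTerm F G p = 0) ∧
      ∫ z in 𝒟ᵒ, poin F z * poin G z = (1 / 2) * ∑ p ∈ s, cosetTerm F G p := by
  obtain ⟨n, hn⟩ := exists_box hY' 1 Y R hY
  have h0 : ∀ z ∈ strip, ∀ p, p ∉ boxPairs n → F z * G (rep p • z) = 0 := by
    intro z hz p hp
    by_contra h
    have h1 := left_ne_zero_of_mul h
    have h2 := right_ne_zero_of_mul h
    have h3 := hF.supp z h1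
    exact hp (hn z h3.1 h3.2 (by rw [abs_le]; constructor <;> linarith [hz.1, hz.2]) p
      (hG.supp _ h2).1)
  have h4 : ∀ z ∈ strip, F z * poin G z = (1 / 2) * ∑ p ∈ boxPairs n, F z * G (rep p • z) := by
    intro z hz
    by_cases hFz : F z = 0
    · simp [hFz]
    rw [poin, ← Finset.mul_sum, tsum_eq_sum (s := boxPairs n)]
    · ring
    · intro p hp
      exact (mul_eq_zero.mp (h0 z hz p hp)).resolve_left hFz
  have hi : ∀ p, IntegrableOn (fun z => F z * G (rep p • z)) strip := by
    intro p
    refine Integrable.mul_bdd (c := B) iF ?_ (ae_of_all _ fun z => ?_)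
    · exact (mG.comp (measurable_rep_smul p)).aestronglyMeasurable
    · exact bG _
  have hi2 : IntegrableOn (fun z => F z * poin G z) strip := by
    have : IntegrableOn (fun z => (1 / 2) * ∑ p ∈ boxPairs n, F z * G (rep p • z)) strip :=
      (integrable_finsetSum _ fun p _ => hi p).const_mul _
    exact this.congr_fun (fun z hz => (h4 z hz).symm) measurableSet_strip
  have hinv := poin_smul hG.per
  refine ⟨boxPairs n, fun p hp => ?_, ?_⟩
  · rw [cosetTerm, setIntegral_congr_fun measurableSet_strip (fun z hz => h0 z hz p hp)]
    simp
  · have h5 := (integral_poin hY (hF.mul_left (G := poin G)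
      (fun m z => hinv _ z)) (mF.mul (measurable_poin hY' hG mG)) hi2).2
    simp_rw [poin_mul hinv] at h5
    rw [h5, setIntegral_congr_fun measurableSet_strip h4, integral_const_mul,
      integral_finsetSum _ fun p _ => hi p]
    rfl

/-- `cosetTerm` extended by zero. -/
def pairTerm (F G : ℍ → ℝ) (q : ℤ × ℤ) : ℝ :=
  open Classical in if h : IsCoprime q.1 q.2 then cosetTerm F G ⟨q, h⟩ else 0

theorem re_rep_smul (p : CopPair) (hc : (p.1.1 : ℝ) ≠ 0) (z : ℍ) : (rep p • z).re =
    (rep p 0 0 : ℤ) / (p.1.1 : ℝ) - ((p.1.1 : ℝ) * z.re + p.1.2) /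
      (p.1.1 * (((p.1.1 : ℝ) * z.re + p.1.2) ^ 2 + ((p.1.1 : ℝ) * z.im) ^ 2)) := by
  have hd := denom_pos p z
  have hdet := (rep p).det_coe
  rw [Matrix.det_fin_two, rep_c, rep_d] at hdet
  have hdet' : ((rep p 0 0 : ℤ) : ℝ) * p.1.2 - (rep p 0 1 : ℤ) * p.1.1 = 1 := by exact_mod_cast hdet
  have h1 : (rep p • z).re = ((rep p • z : ℍ) : ℂ).re := rfl
  rw [h1, coe_smul_eq_mob, mob, rep_c, rep_d, Complex.div_re]
  set a : ℝ := ((rep p 0 0 : ℤ) : ℝ)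
  set b : ℝ := ((rep p 0 1 : ℤ) : ℝ)
  set c : ℝ := ((p.1.1 : ℤ) : ℝ)
  set d : ℝ := ((p.1.2 : ℤ) : ℝ)
  have h2 : Complex.normSq ((p.1.1 : ℂ) * z + p.1.2) = (c * z.re + d) ^ 2 + (c * z.im) ^ 2 := by
    rw [Complex.normSq_apply]; simp [c, d]; ring
  rw [h2]
  have e1 : (((rep p 0 0 : ℤ) : ℂ) * z + (rep p 0 1 : ℤ)).re = a * z.re + b := by simp [a, b]
  have e2 : (((rep p 0 0 : ℤ) : ℂ) * z + (rep p 0 1 : ℤ)).im = a * z.im := by simp [a]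
  have e3 : ((p.1.1 : ℂ) * z + p.1.2).re = c * z.re + d := by simp [c, d]
  have e4 : ((p.1.1 : ℂ) * z + p.1.2).im = c * z.im := by simp [c]
  rw [e1, e2, e3, e4]
  field_simp
  linear_combination (-(c * z.re + d)) * hdet'

/-- The integrand in the upper half plane attached to a double coset. -/
def cosetFun (A B f h : ℝ → ℝ) (c d e : ℝ) (q : ℝ × ℝ) : ℝ :=
  A q.1 * f q.2 * (B (e / c - (c * q.1 + d) / (c * ((c * q.1 + d) ^ 2 + (c * q.2) ^ 2))) *
    h (q.2 / ((c * q.1 + d) ^ 2 + (c * q.2) ^ 2)))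

theorem periodic_int_sub {B : ℝ → ℝ} (hB : Function.Periodic B 1) {a e c : ℤ} (hc : (c : ℝ) ≠ 0)
    (h : c ∣ a - e) (x : ℝ) : B (a / c - x) = B (e / c - x) := by
  obtain ⟨k, hk⟩ := h
  have h1 : (a : ℝ) - e = c * k := by exact_mod_cast hk
  have h2 : (a : ℝ) / c - x = e / c - x + k * 1 := by
    field_simp; linear_combination h1
  rw [h2]
  exact hB.int_mul k _

theorem prodF_rep_smul {B h : ℝ → ℝ} (hB : Function.Periodic B 1) (p : CopPair)
    (hc : (p.1.1 : ℝ) ≠ 0) {e : ℤ} (he : p.1.1 ∣ e * p.1.2 - 1) (z : ℍ) :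
    prodF B h (rep p • z) = B (e / (p.1.1 : ℝ) - ((p.1.1 : ℝ) * z.re + p.1.2) /
      (p.1.1 * (((p.1.1 : ℝ) * z.re + p.1.2) ^ 2 + ((p.1.1 : ℝ) * z.im) ^ 2))) *
      h (z.im / (((p.1.1 : ℝ) * z.re + p.1.2) ^ 2 + ((p.1.1 : ℝ) * z.im) ^ 2)) := by
  rw [prodF, re_rep_smul p hc, im_rep_smul, periodic_int_sub hB hc]
  have hdet := (rep p).det_coe
  rw [Matrix.det_fin_two, rep_c, rep_d] at hdet
  have hcop : IsCoprime p.1.1 p.1.2 := p.2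
  refine hcop.dvd_of_dvd_mul_right ?_
  have : (rep p 0 0 - e) * p.1.2 = rep p 0 1 * p.1.1 - (e * p.1.2 - 1) := by
    linear_combination hdet
  rw [this]
  exact (dvd_mul_left _ _).sub he

theorem cosetTerm_eq {A B f h : ℝ → ℝ} (hB : Function.Periodic B 1)
    (p : CopPair) (hc : (p.1.1 : ℝ) ≠ 0) {e : ℤ} (he : p.1.1 ∣ e * p.1.2 - 1) :
    cosetTerm (prodF A f) (prodF B h) p = ∫ q in Set.Ico (0 : ℝ) 1 ×ˢ Set.Ioi (0 : ℝ),
      cosetFun A B f h p.1.1 p.1.2 e q / q.2 ^ 2 := by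
  rw [← integral_strip]
  refine integral_congr_ae (ae_of_all _ fun z => ?_)
  simp only
  rw [prodF_rep_smul hB p hc he, cosetFun, prodF]
  rfl

theorem cosetFun_translate {A B f h : ℝ → ℝ} (hA : Function.Periodic A 1) (c d e : ℝ) (l : ℤ)
    (q : ℝ × ℝ) : cosetFun A B f h c (d + l * c) e q = cosetFun A B f h c d e (q.1 + l, q.2) := by
  have h1 : A (q.1 + l) = A q.1 := by simpa using hA.int_mul l q.1
  simp only [cosetFun, h1]
  rw [show c * q.1 + (d + l * c) = c * (q.1 + l) + d by ring]

theorem hasSum_translate {Φ : ℝ × ℝ → ℝ} (hi : IntegrableOn Φ (Set.univ ×ˢ Set.Ioi (0 : ℝ))) :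
    HasSum (fun l : ℤ => ∫ q in Set.Ico (0 : ℝ) 1 ×ˢ Set.Ioi (0 : ℝ), Φ (q.1 + l, q.2))
      (∫ q in Set.univ ×ˢ Set.Ioi (0 : ℝ), Φ q) := by
  have hU : (Set.univ ×ˢ Set.Ioi (0 : ℝ) : Set (ℝ × ℝ)) =
      ⋃ l : ℤ, Set.Ico ((l : ℤ) : ℝ) (l + 1) ×ˢ Set.Ioi (0 : ℝ) := by
    rw [← Set.iUnion_prod_const]
    have := iUnion_Ico_add_intCast (0 : ℝ)
    simp only [zero_add] at this
    rw [this]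
  have hd : Pairwise (Function.onFun Disjoint fun l : ℤ => (Set.Ico ((l : ℤ) : ℝ) (l + 1) ×ˢ Set.Ioi (0 : ℝ))) := by
    intro i j hij
    have := Set.pairwise_disjoint_Ico_add_intCast (0 : ℝ) hij
    simp only [zero_add] at this
    exact Set.Disjoint.set_prod_left this _ _
  rw [hU] at hi ⊢
  have key := hasSum_integral_iUnion (fun l : ℤ => measurableSet_Ico.prod measurableSet_Ioi) hd hi
  suffices h0 : (fun l : ℤ => ∫ q in Set.Ico (0 : ℝ) 1 ×ˢ Set.Ioi (0 : ℝ), Φ (q.1 + l, q.2)) =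
      fun l : ℤ => ∫ q in Set.Ico ((l : ℤ) : ℝ) (l + 1) ×ˢ Set.Ioi (0 : ℝ), Φ q by
    rw [h0]; exact key
  funext l
  have h1 : MeasurePreserving (fun q : ℝ × ℝ => q + ((l : ℝ), (0 : ℝ))) volume volume :=
    measurePreserving_add_right _ _
  have h2 := h1.setIntegral_preimage_emb (MeasurableEquiv.addRight ((l : ℝ), (0 : ℝ))).measurableEmbedding
    Φ (Set.Ico ((l : ℤ) : ℝ) (l + 1) ×ˢ Set.Ioi (0 : ℝ))
  rw [← h2]
  congr 1
  · congr 1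
    ext q
    simp only [Set.mem_preimage, Set.mem_prod, Set.mem_Ico, Set.mem_Ioi, Prod.fst_add, Prod.snd_add]
    constructor
    · rintro ⟨⟨h1, h2⟩, h3⟩
      exact ⟨⟨by linarith, by linarith⟩, by linarith⟩
    · rintro ⟨⟨h1, h2⟩, h3⟩
      exact ⟨⟨by linarith, by linarith⟩, by linarith⟩
  · ext q; simp [Prod.add_def]

theorem integrableOn_cosetFun {A B f h : ℝ → ℝ} (mA : Measurable A) (mB : Measurable B)
    (mf : Measurable f) (mh : Measurable h) {α β φ η Y R Y' R' : ℝ} (bA : ∀ x, |A x| ≤ α)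
    (bB : ∀ x, |B x| ≤ β) (bf : ∀ x, |f x| ≤ φ) (bh : ∀ x, |h x| ≤ η) (hY : 0 < Y) (hY' : 0 < Y')
    (sf : ∀ y, f y ≠ 0 → Y ≤ y ∧ y ≤ R) (sh : ∀ y, h y ≠ 0 → Y' ≤ y ∧ y ≤ R')
    {c : ℝ} (hc : 0 < c) (d e : ℝ) :
    IntegrableOn (fun q => cosetFun A B f h c d e q / q.2 ^ 2) (Set.univ ×ˢ Set.Ioi (0 : ℝ)) := by
  set D := R / Y' + 1 with hD
  have hs : IntegrableOn (fun q => cosetFun A B f h c d e q / q.2 ^ 2)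
      (Set.Icc ((-D - d) / c) ((D - d) / c) ×ˢ Set.Icc Y R) := by
    refine Measure.integrableOn_of_bounded (M := α * φ * (β * η) / Y ^ 2) ?_ ?_ ?_
    · exact (isCompact_Icc.prod isCompact_Icc).measure_lt_top.ne
    · refine Measurable.aestronglyMeasurable ?_
      unfold cosetFun
      fun_prop
    · refine (ae_restrict_mem (measurableSet_Icc.prod measurableSet_Icc)).mono fun q hq => ?_
      have hq2 : Y ≤ q.2 := hq.2.1
      have hα := (abs_nonneg _).trans (bA 0)
      have hβ := (abs_nonneg _).trans (bB 0)
      have hφ := (abs_nonneg _).trans (bf 0)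
      have hη := (abs_nonneg _).trans (bh 0)
      rw [cosetFun, Real.norm_eq_abs, abs_div, abs_mul, abs_mul, abs_mul, abs_of_nonneg (sq_nonneg q.2)]
      gcongr
      exacts [bA _, bf _, bB _, bh _]
  refine hs.of_forall_sdiff_eq_zero (MeasurableSet.univ.prod measurableSet_Ioi) ?_
  rintro q ⟨hq1, hq2⟩
  by_contra hne
  refine hq2 ?_
  have hq0 : 0 < q.2 := hq1.2
  have h1 : cosetFun A B f h c d e q ≠ 0 := fun h => hne (by rw [h, zero_div])
  unfold cosetFun at h1
  have h2 := sf _ (right_ne_zero_of_mul (left_ne_zero_of_mul h1))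
  have h3 := (sh _ (right_ne_zero_of_mul (right_ne_zero_of_mul h1))).1
  have hpos : 0 < (c * q.1 + d) ^ 2 + (c * q.2) ^ 2 := by positivity
  rw [le_div_iff₀ hpos] at h3
  have h4 : (c * q.1 + d) ^ 2 ≤ R / Y' := by
    rw [le_div_iff₀ hY']; nlinarith [mul_nonneg hY'.le (sq_nonneg (c * q.2))]
  have h5 : |c * q.1 + d| ≤ D := by
    refine abs_le_of_sq_le_sq ?_ (by nlinarith [sq_nonneg (c * q.1 + d)])
    nlinarith [sq_nonneg (c * q.1 + d)]
  rw [abs_le] at h5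
  refine ⟨⟨?_, ?_⟩, h2⟩
  · rw [div_le_iff₀ hc]; linarith [h5.1]
  · rw [le_div_iff₀ hc]; linarith [h5.2]

/-- The integral transform attached to a residue class. -/
def cellInt (A B f h : ℝ → ℝ) (c d e : ℝ) : ℝ :=
  ∫ y in Set.Ioi (0 : ℝ), ∫ s : ℝ, A (y * s - d / c) * f y *
    (B (e / c - s * (1 / (c ^ 2 * y * (1 + s ^ 2)))) * h (1 / (c ^ 2 * y * (1 + s ^ 2)))) / y

theorem integral_cosetFun {A B f h : ℝ → ℝ} {c d e : ℝ} (hc : 0 < c)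
    (hi : IntegrableOn (fun q => cosetFun A B f h c d e q / q.2 ^ 2)
      (Set.univ ×ˢ Set.Ioi (0 : ℝ))) :
    ∫ q in Set.univ ×ˢ Set.Ioi (0 : ℝ), cosetFun A B f h c d e q / q.2 ^ 2 =
      cellInt A B f h c d e := by
  rw [IntegrableOn, Measure.volume_eq_prod, ← Measure.prod_restrict, Measure.restrict_univ] at hi
  rw [Measure.volume_eq_prod, ← Measure.prod_restrict, Measure.restrict_univ,
    integral_prod_symm _ hi, cellInt]
  refine setIntegral_congr_fun measurableSet_Ioi fun y hy => ?_
  have hy : 0 < y := hy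
  simp only
  have h1 := Measure.integral_comp_mul_left
    (fun x => cosetFun A B f h c d e (x - d / c, y) / y ^ 2) y
  rw [integral_sub_right_eq_self (fun x => cosetFun A B f h c d e (x, y) / y ^ 2) (d / c),
    abs_of_pos (inv_pos.mpr hy), smul_eq_mul] at h1
  have h2 : ∫ x, cosetFun A B f h c d e (x, y) / y ^ 2 =
      y * ∫ s, cosetFun A B f h c d e (y * s - d / c, y) / y ^ 2 := by
    rw [h1]; field_simp
  rw [h2, ← integral_const_mul]
  congr 1
  funext s
  have h3 : c * (y * s - d / c) + d = c * y * s := by field_simp; ring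
  have hs : 0 < 1 + s ^ 2 := by positivity
  simp only [cosetFun, h3]
  rw [show c * y * s / (c * ((c * y * s) ^ 2 + (c * y) ^ 2)) =
      s * (1 / (c ^ 2 * y * (1 + s ^ 2))) by field_simp; ring,
    show y / ((c * y * s) ^ 2 + (c * y) ^ 2) = 1 / (c ^ 2 * y * (1 + s ^ 2)) by
      field_simp; ring]
  field_simp

theorem cellInt_eq_zero {A B f h : ℝ → ℝ} {Y R Y' R' : ℝ} (hY : 0 < Y) (hY' : 0 < Y')
    (sf : ∀ y, f y ≠ 0 → Y ≤ y ∧ y ≤ R) (sh : ∀ y, h y ≠ 0 → Y' ≤ y ∧ y ≤ R')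
    {c d e : ℝ} (hc0 : 0 < c) (hc : 1 < c ^ 2 * (Y * Y')) : cellInt A B f h c d e = 0 := by
  rw [cellInt]
  refine setIntegral_eq_zero_of_forall_eq_zero fun y hy => ?_
  have hy : 0 < y := hy
  refine integral_eq_zero_of_ae (ae_of_all _ fun s => ?_)
  by_contra hne
  have h1 := left_ne_zero_of_mul hne
  have h2 := sf _ (right_ne_zero_of_mul (left_ne_zero_of_mul h1))
  have h3 := (sh _ (right_ne_zero_of_mul (right_ne_zero_of_mul h1))).1
  have hpos : 0 < c ^ 2 * y * (1 + s ^ 2) := by positivity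
  rw [le_div_iff₀ hpos] at h3
  have h4 : c ^ 2 * (Y * Y') ≤ Y' * (c ^ 2 * y * (1 + s ^ 2)) := by
    have : Y * 1 ≤ y * (1 + s ^ 2) := mul_le_mul h2.1 (by nlinarith [sq_nonneg s]) zero_le_one hy.le
    have h5 : 0 < Y' * c ^ 2 := by positivity
    nlinarith
  linarith

theorem pairTerm_coe (F G : ℍ → ℝ) (p : CopPair) : pairTerm F G p.1 = cosetTerm F G p := by
  rw [pairTerm, dif_pos p.2]

theorem pairTerm_of_not {F G : ℍ → ℝ} {q : ℤ × ℤ} (h : ¬ IsCoprime q.1 q.2) :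
    pairTerm F G q = 0 := by
  rw [pairTerm, dif_neg h]

theorem cosetTerm_congr {F G : ℍ → ℝ} (hG : ∀ (n : ℤ) z, G (T ^ n • z) = G z) {p : CopPair}
    {g : SL(2, ℤ)} (h0 : rep p 1 0 = g 1 0) (h1 : rep p 1 1 = g 1 1) :
    cosetTerm F G p = ∫ z in strip, F z * G (g • z) := by
  obtain ⟨n, hn⟩ := eq_T_zpow_mul_of_row_eq _ _ h0 h1
  rw [cosetTerm, hn]
  simp_rw [mul_smul, hG]

theorem pairTerm_neg {F G : ℍ → ℝ} (hG : ∀ (n : ℤ) z, G (T ^ n • z) = G z) (c d : ℤ) :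
    pairTerm F G (-c, -d) = pairTerm F G (c, d) := by
  by_cases h : IsCoprime c d
  · have h' : IsCoprime (-c) (-d) := h.neg_neg
    rw [pairTerm_coe F G ⟨(c, d), h⟩, pairTerm_coe F G ⟨(-c, -d), h'⟩,
      cosetTerm_congr hG (g := -rep ⟨(c, d), h⟩)]
    · simp_rw [ModularGroup.SL_neg_smul]
      rfl
    · simp [rep_c]
    · simp [rep_d]
  · rw [pairTerm_of_not (q := (c, d)) h, pairTerm_of_not (q := (-c, -d))]
    exact fun h' => h (by simpa using IsCoprime.neg_neg h')

theorem tsum_pairTerm_zero {F G : ℍ → ℝ} (hG : ∀ (n : ℤ) z, G (T ^ n • z) = G z) :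
    ∑' d : ℤ, pairTerm F G (0, d) = 2 * ∫ z in strip, F z * G z := by
  have h1 : pairTerm F G (0, 1) = ∫ z in strip, F z * G z := by
    rw [pairTerm_coe F G ⟨(0, 1), isCoprime_one_right⟩, cosetTerm_congr hG (g := 1)]
    · simp
    · simp [rep_c]
    · simp [rep_d]
  have h2 : pairTerm F G (0, -1) = ∫ z in strip, F z * G z := by
    rw [← h1, ← pairTerm_neg hG 0 1, neg_zero]
  rw [tsum_eq_sum (s := {1, -1}), Finset.sum_pair (by norm_num), h1, h2]
  · ring
  · intro d hd
    refine pairTerm_of_not fun h => hd ?_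
    rw [isCoprime_zero_left, Int.isUnit_iff] at h
    simpa using h

theorem inv_val_mul {c d : ℕ} [NeZero c] (h : d.Coprime c) (l : ℤ) :
    (c : ℤ) ∣ (((d : ZMod c)⁻¹).val : ℤ) * (l * c + d) - 1 := by
  rw [← ZMod.intCast_zmod_eq_zero_iff_dvd]
  push_cast
  rw [ZMod.natCast_self, mul_zero, zero_add, ZMod.natCast_val, ZMod.cast_id, mul_comm,
    ZMod.coe_mul_inv_eq_one d h, sub_self]

theorem tsum_int_residue (c : ℕ) [NeZero c] {t : ℤ → ℝ} (hs : Summable t) :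
    ∑' d, t d = ∑ d ∈ Finset.range c, ∑' l : ℤ, t (l * c + d) := by
  have hs' : Summable fun q : Fin c × ℤ => t (q.2 * c + ((q.1 : ℕ) : ℤ)) :=
    (((Equiv.prodComm (Fin c) ℤ).trans (Int.divModEquiv c).symm).summable_iff).mpr hs
  rw [Finset.sum_range, ← tsum_fintype (L := SummationFilter.unconditional _), ← hs'.tsum_prod]
  exact (((Equiv.prodComm (Fin c) ℤ).trans (Int.divModEquiv c).symm).tsum_eq t).symm

theorem tsum_pairTerm_pos {A B f h : ℝ → ℝ} (hA : Function.Periodic A 1)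
    (hB : Function.Periodic B 1) (c : ℕ) (hc : 0 < c)
    (hi : ∀ d e : ℝ, IntegrableOn (fun q => cosetFun A B f h c d e q / q.2 ^ 2)
      (Set.univ ×ˢ Set.Ioi (0 : ℝ)))
    (hs : Summable fun d : ℤ => pairTerm (prodF A f) (prodF B h) (c, d)) :
    ∑' d : ℤ, pairTerm (prodF A f) (prodF B h) (c, d) =
      ∑ d ∈ (Finset.range c).filter (fun x => Nat.Coprime x c),
        cellInt A B f h c d ((d : ZMod c)⁻¹).val := by
  have : NeZero c := ⟨hc.ne'⟩
  have hc' : (0 : ℝ) < c := by exact_mod_cast hc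
  have key : ∀ d : ℕ, ∑' l : ℤ, pairTerm (prodF A f) (prodF B h) (c, l * c + d) =
      if d.Coprime c then cellInt A B f h c d ((d : ZMod c)⁻¹).val else 0 := by
    intro d
    have hiff : ∀ l : ℤ, IsCoprime (c : ℤ) (l * c + d) ↔ d.Coprime c := by
      intro l
      rw [add_comm, IsCoprime.add_mul_right_right_iff, Nat.isCoprime_iff_coprime, Nat.coprime_comm]
    split_ifs with hd
    · rw [← integral_cosetFun hc' (hi _ _), ← (hasSum_translate (hi _ _)).tsum_eq]
      refine tsum_congr fun l => ?_
      have hcop := (hiff l).mpr hd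
      rw [pairTerm_coe _ _ ⟨((c : ℤ), l * c + d), hcop⟩,
        cosetTerm_eq hB _ (by simpa using hc.ne') (inv_val_mul hd l)]
      refine integral_congr_ae (ae_of_all _ fun q => ?_)
      simp only
      rw [← cosetFun_translate hA]
      push_cast
      rw [add_comm]
    · rw [← tsum_zero (α := ℝ) (β := ℤ)]
      exact tsum_congr fun l => pairTerm_of_not fun h => hd ((hiff l).mp h)
  rw [Finset.sum_filter, tsum_int_residue c hs]
  exact Finset.sum_congr rfl fun d _ => key d

theorem sum_cosetTerm {F G : ℍ → ℝ} {s : Finset CopPair}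
    (hs : ∀ p, p ∉ s → cosetTerm F G p = 0) :
    Summable (pairTerm F G) ∧ ∑ p ∈ s, cosetTerm F G p = ∑' q, pairTerm F G q := by
  have hsup : ∀ q, q ∉ s.map (Function.Embedding.subtype _) → pairTerm F G q = 0 := by
    intro q hq
    by_cases h : IsCoprime q.1 q.2
    · rw [pairTerm_coe F G ⟨q, h⟩]
      exact hs _ fun h' => hq (Finset.mem_map.mpr ⟨_, h', rfl⟩)
    · exact pairTerm_of_not h
  refine ⟨summable_of_ne_finset_zero (s := s.map (Function.Embedding.subtype _)) hsup, ?_⟩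
  rw [tsum_eq_sum hsup, Finset.sum_map]
  exact Finset.sum_congr rfl fun p _ => (pairTerm_coe F G p).symm

/-- The inner product of two Poincaré series in terms of sums over residue classes. -/
theorem integral_poin_prodF {A B f h : ℝ → ℝ} (hA : Function.Periodic A 1)
    (hB : Function.Periodic B 1) (mA : Measurable A) (mB : Measurable B)
    (mf : Measurable f) (mh : Measurable h) {α β φ η Y R Y' R' : ℝ} (bA : ∀ x, |A x| ≤ α)
    (bB : ∀ x, |B x| ≤ β) (bf : ∀ x, |f x| ≤ φ) (bh : ∀ x, |h x| ≤ η) (hY : 0 < Y) (hY' : 0 < Y')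
    (sf : ∀ y, f y ≠ 0 → Y ≤ y ∧ y ≤ R) (sh : ∀ y, h y ≠ 0 → Y' ≤ y ∧ y ≤ R')
    (iF : IntegrableOn (prodF A f) strip) {Q : ℕ} (hQ : 1 ≤ (Q : ℝ) ^ 2 * (Y * Y')) :
    ∫ z in 𝒟ᵒ, poin (prodF A f) z * poin (prodF B h) z =
      (∫ z in strip, prodF A f z * prodF B h z) +
      ∑ c ∈ Finset.Icc 1 Q, ∑ d ∈ (Finset.range c).filter (fun x => Nat.Coprime x c),
        cellInt A B f h c d ((d : ZMod c)⁻¹).val := by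
  have hF := adm_prodF hA sf
  have hG := adm_prodF hB sh
  obtain ⟨s, hs, hintegr⟩ := integral_poin_mul_poin (B := β * η) hY hY' hF hG
    ((mA.comp measurable_re).mul (mf.comp measurable_im))
    ((mB.comp measurable_re).mul (mh.comp measurable_im)) iF (fun z => by
      rw [prodF, abs_mul]
      exact mul_le_mul (bB _) (bh _) (abs_nonneg _) ((abs_nonneg _).trans (bB 0)))
  obtain ⟨hsum, heq⟩ := sum_cosetTerm hs
  have hc : ∀ c : ℕ, 0 < c → ∑' d : ℤ, pairTerm (prodF A f) (prodF B h) (c, d) =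
      ∑ d ∈ (Finset.range c).filter (fun x => Nat.Coprime x c),
        cellInt A B f h c d ((d : ZMod c)⁻¹).val := fun c hc =>
    tsum_pairTerm_pos hA hB c hc
      (fun d e => integrableOn_cosetFun mA mB mf mh bA bB bf bh hY hY' sf sh (by exact_mod_cast hc) d e)
      (hsum.prod_factor (c : ℤ))
  have hev : ∀ c : ℤ, ∑' d : ℤ, pairTerm (prodF A f) (prodF B h) (-c, d) =
      ∑' d : ℤ, pairTerm (prodF A f) (prodF B h) (c, d) := by
    intro c
    rw [← (Equiv.neg ℤ).tsum_eq]
    exact tsum_congr fun d => pairTerm_neg hG.per c d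
  rw [hintegr, heq, hsum.tsum_prod, tsum_int_eq_zero_add_two_mul_tsum_pnat
    (f := fun c : ℤ => ∑' d : ℤ, pairTerm (prodF A f) (prodF B h) (c, d)) hev hsum.prod,
    tsum_pairTerm_zero hG.per]
  have h3 : ∑' n : ℕ+, ∑' d : ℤ, pairTerm (prodF A f) (prodF B h) (((n : ℕ) : ℤ), d) =
      ∑ c ∈ Finset.Icc 1 Q, ∑ d ∈ (Finset.range c).filter (fun x => Nat.Coprime x c),
        cellInt A B f h c d ((d : ZMod c)⁻¹).val := by
    rw [← Finset.sum_subtype_of_mem (p := fun n : ℕ => 0 < n) (s := Finset.Icc 1 Q)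
      (fun c => ∑ d ∈ (Finset.range c).filter (fun x => Nat.Coprime x c),
        cellInt A B f h c d ((d : ZMod c)⁻¹).val) (fun c hc => (Finset.mem_Icc.mp hc).1)]
    rw [← tsum_eq_sum (L := SummationFilter.unconditional _)]
    · exact tsum_congr fun n => hc n n.pos
    · intro n hn
      have hn' : Q < (n : ℕ) := by
        by_contra hle
        exact hn (Finset.mem_subtype.mpr (Finset.mem_Icc.mpr ⟨n.2, not_lt.mp hle⟩))
      refine Finset.sum_eq_zero fun d _ => cellInt_eq_zero hY hY' sf sh
        (by exact_mod_cast n.2) ?_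
      have : (Q : ℝ) < ((n : ℕ) : ℝ) := by exact_mod_cast hn'
      refine hQ.trans_lt (mul_lt_mul_of_pos_right ?_ (by positivity))
      exact pow_lt_pow_left₀ this (by positivity) (by norm_num)
  rw [h3]
  ring

end

end KB

namespace KB

open ModularGroup Matrix.SpecialLinearGroup
open UpperHalfPlane hiding I continuous_re continuous_im
open scoped MatrixGroups Modular ENNReal ContDiff Topology RealInnerProductSpace

noncomputable section

theorem sobolev_point {u u' D : ℝ → ℝ} (du : ∀ x, HasDerivAt u (u' x) x) (cu' : Continuous u')
    (cD : Continuous D) (hD : ∀ x, |u' x| ≤ D x) (α : ℝ) {δ : ℝ} (hδ : 0 < δ) :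
    u α ≤ ∫ x in (α - δ / 2)..(α + δ / 2), (δ⁻¹ * u x + D x) := by
  have cu : Continuous u := continuous_iff_continuousAt.mpr fun x => (du x).continuousAt
  have hbd : ∀ t x : ℝ, |t| ≤ 1 / 2 → t * u' x ≤ D x := by
    intro t x ht
    have h1 : t * u' x ≤ |t| * |u' x| := by rw [← abs_mul]; exact le_abs_self _
    have h2 : |t| * |u' x| ≤ 1 / 2 * D x := mul_le_mul ht (hD x) (abs_nonneg _) (by norm_num)
    linarith [(abs_nonneg _).trans (hD x)]
  have hl := integral_add_le_of_hasDerivAt (G := fun x => (x - (α - δ / 2)) * δ⁻¹ * u x)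
    (g := fun x => 1 * δ⁻¹ * u x + (x - (α - δ / 2)) * δ⁻¹ * u' x) (P := fun _ => 0)
    (Q := fun x => δ⁻¹ * u x + D x) (a := α - δ / 2) (b := α) (by linarith)
    (fun x _ => ((((hasDerivAt_id x).sub_const _).mul_const _).mul (du x)))
    (by fun_prop) (by fun_prop) (by fun_prop) (fun x hx => by
      have : |(x - (α - δ / 2)) * δ⁻¹| ≤ 1 / 2 := by
        rw [← div_eq_mul_inv, abs_div, abs_of_pos hδ, div_le_iff₀ hδ, abs_le]
        constructor <;> linarith [hx.1, hx.2]
      linarith [hbd _ x this])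
  have hr := integral_add_le_of_hasDerivAt (G := fun x => (x - (α + δ / 2)) * δ⁻¹ * u x)
    (g := fun x => 1 * δ⁻¹ * u x + (x - (α + δ / 2)) * δ⁻¹ * u' x) (P := fun _ => 0)
    (Q := fun x => δ⁻¹ * u x + D x) (a := α) (b := α + δ / 2) (by linarith)
    (fun x _ => ((((hasDerivAt_id x).sub_const _).mul_const _).mul (du x)))
    (by fun_prop) (by fun_prop) (by fun_prop) (fun x hx => by
      have : |(x - (α + δ / 2)) * δ⁻¹| ≤ 1 / 2 := by
        rw [← div_eq_mul_inv, abs_div, abs_of_pos hδ, div_le_iff₀ hδ, abs_le]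
        constructor <;> linarith [hx.1, hx.2]
      linarith [hbd _ x this])
  have hadd := intervalIntegral.integral_add_adjacent_intervals
    (f := fun x => δ⁻¹ * u x + D x) (μ := volume) (a := α - δ / 2) (b := α) (c := α + δ / 2)
    (Continuous.intervalIntegrable (by fun_prop) _ _)
    (Continuous.intervalIntegrable (by fun_prop) _ _)
  rw [← hadd]
  simp only [intervalIntegral.integral_zero, zero_add, sub_self, zero_mul, sub_zero] at hl hr
  have e1 : (α - (α - δ / 2)) * δ⁻¹ * u α = u α / 2 := by field_simp; ring
  have e2 : 0 - (α - (α + δ / 2)) * δ⁻¹ * u α = u α / 2 := by field_simp; ring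
  rw [e1] at hl
  rw [e2] at hr
  linarith

theorem sum_sq_separated_le {ι : Type*} (s : Finset ι) (α : ι → ℝ) {δ L : ℝ} (hδ : 0 < δ)
    (hδ1 : δ ≤ 1) (hL : 0 < L) (h01 : ∀ i ∈ s, 0 ≤ α i ∧ α i ≤ 1)
    (hsep : ∀ i ∈ s, ∀ j ∈ s, i ≠ j → δ ≤ |α i - α j|) {w w' : ℝ → ℂ}
    (dw : ∀ x, HasDerivAt w (w' x) x) (cw' : Continuous w') (hper : Function.Periodic w 1)
    (hper' : Function.Periodic w' 1) :
    ∑ i ∈ s, ‖w (α i)‖ ^ 2 ≤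
      2 * ((δ⁻¹ + L) * (∫ x in (0 : ℝ)..1, ‖w x‖ ^ 2) + L⁻¹ * ∫ x in (0 : ℝ)..1, ‖w' x‖ ^ 2) := by
  have cw : Continuous w := continuous_iff_continuousAt.mpr fun x => (dw x).continuousAt
  set u : ℝ → ℝ := fun x => ‖w x‖ ^ 2 with hu
  set D : ℝ → ℝ := fun x => L * ‖w x‖ ^ 2 + L⁻¹ * ‖w' x‖ ^ 2 with hDdef
  set U : ℝ → ℝ := fun x => δ⁻¹ * u x + D x with hU
  have cU : Continuous U := by fun_prop
  have U0 : ∀ x, 0 ≤ U x := fun x => by positivity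
  have hpt : ∀ i, u (α i) ≤ ∫ x in Set.Ioc (α i - δ / 2) (α i + δ / 2), U x := by
    intro i
    rw [← intervalIntegral.integral_of_le (by linarith)]
    refine sobolev_point (u' := fun x => 2 * ⟪w x, w' x⟫) (D := D) (fun x => (dw x).norm_sq)
      (by fun_prop) (by fun_prop) (fun x => ?_) _ hδ
    rw [abs_mul, abs_two]
    have h1 := abs_real_inner_le_norm (w x) (w' x)
    have h2 : 2 * (‖w x‖ * ‖w' x‖) ≤ D x := by
      have : L * ‖w x‖ ^ 2 + L⁻¹ * ‖w' x‖ ^ 2 - 2 * (‖w x‖ * ‖w' x‖) =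
          L⁻¹ * (L * ‖w x‖ - ‖w' x‖) ^ 2 := by field_simp; ring
      have h3 : 0 ≤ L⁻¹ * (L * ‖w x‖ - ‖w' x‖) ^ 2 := by positivity
      simp only [hDdef]; linarith
    linarith
  have hdisj : Set.PairwiseDisjoint (s : Set ι)
      fun i => Set.Ioc (α i - δ / 2) (α i + δ / 2) := by
    intro i hi j hj hij
    have h1 := hsep i hi j hj hij
    rw [Function.onFun, Set.disjoint_left]
    intro x hx hx'
    rcases le_abs.mp h1 with h2 | h2 <;> linarith [hx.1, hx.2, hx'.1, hx'.2]
  have h1 : ∑ i ∈ s, u (α i) ≤ ∫ x in (-(1 / 2) : ℝ)..(3 / 2), U x := by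
    refine (Finset.sum_le_sum fun i _ => hpt i).trans ?_
    rw [← integral_biUnion_finset s (fun i _ => measurableSet_Ioc) hdisj
      (fun i _ => (cU.integrableOn_Icc).mono_set Set.Ioc_subset_Icc_self),
      intervalIntegral.integral_of_le (by norm_num)]
    refine setIntegral_mono_set ((cU.integrableOn_Icc).mono_set Set.Ioc_subset_Icc_self)
      (ae_of_all _ U0) (LE.le.eventuallyLE ?_)
    intro x hx
    obtain ⟨i, hi, hx⟩ := Set.mem_iUnion₂.mp hx
    have := h01 i hi
    constructor <;> linarith [hx.1, hx.2]
  have pU : Function.Periodic U 1 := fun x => by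
    simp only [hU, hu, hDdef, hper x, hper' x]
  have h2 : ∫ x in (-(1 / 2) : ℝ)..(3 / 2), U x = 2 * ∫ x in (0 : ℝ)..1, U x := by
    rw [← intervalIntegral.integral_add_adjacent_intervals (b := 1 / 2)
      (cU.intervalIntegrable _ _) (cU.intervalIntegrable _ _)]
    have e1 := pU.intervalIntegral_add_eq (-(1 / 2)) 0
    have e2 := pU.intervalIntegral_add_eq (1 / 2) 0
    norm_num at e1 e2 ⊢
    rw [e1, e2]; ring
  have h3 : ∫ x in (0 : ℝ)..1, U x = (δ⁻¹ + L) * (∫ x in (0 : ℝ)..1, ‖w x‖ ^ 2) +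
      L⁻¹ * ∫ x in (0 : ℝ)..1, ‖w' x‖ ^ 2 := by
    rw [← intervalIntegral.integral_const_mul, ← intervalIntegral.integral_const_mul,
      ← intervalIntegral.integral_add (Continuous.intervalIntegrable (by fun_prop) _ _)
      (Continuous.intervalIntegrable (by fun_prop) _ _)]
    congr 1
    funext x
    simp only [hU, hu, hDdef]; ring
  rw [← h3, ← h2]
  exact h1

/-- Trigonometric polynomials. -/
def tp (S : Finset ℕ) (a : ℕ → ℂ) (x : ℝ) : ℂ := ∑ m ∈ S, a m * eAdd (m * x)

theorem eAdd_add (x y : ℝ) : eAdd (x + y) = eAdd x * eAdd y := by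
  rw [eAdd, eAdd, eAdd, ← Complex.exp_add]; congr 1; push_cast; ring

theorem norm_eAdd (x : ℝ) : ‖eAdd x‖ = 1 := by
  rw [eAdd, show 2 * (Real.pi : ℂ) * I * x = ((2 * Real.pi * x : ℝ) : ℂ) * I by push_cast; ring]
  exact Complex.norm_exp_ofReal_mul_I _

theorem eAdd_int (n : ℤ) : eAdd n = 1 := by
  rw [eAdd, Complex.exp_eq_one_iff]
  exact ⟨n, by push_cast; ring⟩

theorem conj_eAdd (x : ℝ) : (starRingEnd ℂ) (eAdd x) = eAdd (-x) := by
  rw [eAdd, eAdd, ← Complex.exp_conj]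
  congr 1
  simp only [map_mul, Complex.conj_ofReal, Complex.conj_I, map_ofNat]
  push_cast; ring

theorem hasDerivAt_eAdd_mul (m x : ℝ) :
    HasDerivAt (fun x : ℝ => eAdd (m * x)) (2 * Real.pi * I * m * eAdd (m * x)) x := by
  have h1 : HasDerivAt (fun x : ℝ => 2 * (Real.pi : ℂ) * I * ((m * x : ℝ) : ℂ))
      (2 * Real.pi * I * ((m * 1 : ℝ) : ℂ)) x :=
    (((hasDerivAt_id x).const_mul m).ofReal_comp).const_mul _
  have := h1.cexp
  unfold eAdd
  convert this using 1
  push_cast; ring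

theorem hasDerivAt_tp (S : Finset ℕ) (a : ℕ → ℂ) (x : ℝ) :
    HasDerivAt (tp S a) (tp S (fun m => 2 * Real.pi * I * m * a m) x) x := by
  unfold tp
  refine HasDerivAt.fun_sum fun m _ => ?_
  have := (hasDerivAt_eAdd_mul m x).const_mul (a m)
  exact this.congr_deriv (by push_cast; ring)

theorem continuous_tp (S : Finset ℕ) (a : ℕ → ℂ) : Continuous (tp S a) :=
  continuous_iff_continuousAt.mpr fun x => (hasDerivAt_tp S a x).continuousAt

theorem periodic_tp (S : Finset ℕ) (a : ℕ → ℂ) : Function.Periodic (tp S a) 1 := by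
  intro x
  unfold tp
  refine Finset.sum_congr rfl fun m _ => ?_
  rw [mul_add, mul_one, eAdd_add]
  have := eAdd_int m
  push_cast at this
  rw [this, mul_one]

theorem integral_eAdd_int (k : ℤ) : ∫ x in (0 : ℝ)..1, eAdd (k * x) = if k = 0 then 1 else 0 := by
  split_ifs with h
  · simp [h, eAdd]
  · have h1 := integral_exp_mul_complex (a := 0) (b := 1) (c := 2 * Real.pi * I * k)
      (by simp [h, Real.pi_ne_zero])
    have h2 : (fun x : ℝ => eAdd (k * x)) = fun x : ℝ => Complex.exp (2 * Real.pi * I * k * x) := by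
      funext x
      rw [eAdd]; congr 1; push_cast; ring
    rw [h2, h1]
    have := eAdd_int k
    rw [eAdd] at this
    push_cast at this ⊢
    simp [this]

theorem integral_norm_sq_tp (S : Finset ℕ) (a : ℕ → ℂ) :
    ∫ x in (0 : ℝ)..1, ‖tp S a x‖ ^ 2 = ∑ m ∈ S, ‖a m‖ ^ 2 := by
  have h1 : ∀ x, ((‖tp S a x‖ ^ 2 : ℝ) : ℂ) =
      ∑ m ∈ S, ∑ n ∈ S, a m * (starRingEnd ℂ) (a n) * eAdd (((m - n : ℤ) : ℝ) * x) := by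
    intro x
    push_cast
    rw [← Complex.mul_conj', tp, map_sum, Finset.sum_mul_sum]
    refine Finset.sum_congr rfl fun m _ => Finset.sum_congr rfl fun n _ => ?_
    rw [map_mul, conj_eAdd]
    rw [sub_mul, sub_eq_add_neg, eAdd_add]
    ring
  have h2 : ((∫ x in (0 : ℝ)..1, ‖tp S a x‖ ^ 2 : ℝ) : ℂ) = ((∑ m ∈ S, ‖a m‖ ^ 2 : ℝ) : ℂ) := by
    have ce : ∀ k : ℝ, Continuous fun x : ℝ => eAdd (k * x) := fun k =>
      continuous_iff_continuousAt.mpr fun x => (hasDerivAt_eAdd_mul k x).continuousAt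
    rw [← intervalIntegral.integral_ofReal]
    simp_rw [h1]
    rw [intervalIntegral.integral_finsetSum]
    · rw [Complex.ofReal_sum]
      refine Finset.sum_congr rfl fun m hm => ?_
      rw [intervalIntegral.integral_finsetSum]
      · simp_rw [intervalIntegral.integral_const_mul, integral_eAdd_int, sub_eq_zero, mul_ite,
          mul_one, mul_zero, Nat.cast_inj]
        rw [Finset.sum_ite_eq S m, if_pos hm, Complex.mul_conj', Complex.ofReal_pow]
      · exact fun n _ => (continuous_const.mul (ce _)).intervalIntegrable _ _
    · exact fun m _ => (continuous_finsetSum _ fun n _ => continuous_const.mul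
        (ce _)).intervalIntegrable _ _
  exact_mod_cast h2

theorem integral_tp_eq_zero {S : Finset ℕ} (hS : 0 ∉ S) (a : ℕ → ℂ) :
    ∫ x in (0 : ℝ)..1, tp S a x = 0 := by
  unfold tp
  rw [intervalIntegral.integral_finsetSum]
  · refine Finset.sum_eq_zero fun m hm => ?_
    rw [intervalIntegral.integral_const_mul]
    have := integral_eAdd_int m
    push_cast at this
    rw [this, if_neg (fun h => hS (by rwa [Nat.cast_eq_zero.mp h] at hm)), mul_zero]
  · exact fun m _ => (continuous_const.mul (continuous_iff_continuousAt.mpr fun x =>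
      (hasDerivAt_eAdd_mul m x).continuousAt)).intervalIntegrable _ _

theorem large_sieve {ι : Type*} (s : Finset ι) (α : ι → ℝ) {δ M : ℝ} (hδ : 0 < δ)
    (hδ1 : δ ≤ 1) (hM : 0 < M) (h01 : ∀ i ∈ s, 0 ≤ α i ∧ α i ≤ 1)
    (hsep : ∀ i ∈ s, ∀ j ∈ s, i ≠ j → δ ≤ |α i - α j|) {S : Finset ℕ}
    (hS : ∀ m ∈ S, (m : ℝ) ≤ 3 * M) (a : ℕ → ℂ) :
    ∑ i ∈ s, ‖tp S a (α i)‖ ^ 2 ≤ 1000 * (δ⁻¹ + M) * ∑ m ∈ S, ‖a m‖ ^ 2 := by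
  refine (sum_sq_separated_le s α hδ hδ1 hM h01 hsep (hasDerivAt_tp S a) (continuous_tp _ _)
    (periodic_tp _ _) (periodic_tp _ _)).trans ?_
  rw [integral_norm_sq_tp, integral_norm_sq_tp]
  have h1 : ∑ m ∈ S, ‖2 * (Real.pi : ℂ) * I * m * a m‖ ^ 2 ≤ 400 * M ^ 2 * ∑ m ∈ S, ‖a m‖ ^ 2 := by
    rw [Finset.mul_sum]
    refine Finset.sum_le_sum fun m hm => ?_
    rw [norm_mul, mul_pow]
    gcongr
    have h2 : ‖2 * (Real.pi : ℂ) * I * m‖ = 2 * Real.pi * m := by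
      simp [abs_of_pos Real.pi_pos]
    rw [h2]
    have h3 := hS m hm
    have h4 : 2 * Real.pi * m ≤ 2 * 3.15 * (3 * M) := by
      have := Real.pi_lt_d2
      gcongr
    nlinarith [Real.pi_pos, (Nat.cast_nonneg m : (0 : ℝ) ≤ m), mul_nonneg Real.pi_pos.le (Nat.cast_nonneg m : (0 : ℝ) ≤ m)]
  set E := ∑ m ∈ S, ‖a m‖ ^ 2
  have hE : 0 ≤ E := Finset.sum_nonneg fun _ _ => by positivity
  have h5 : M⁻¹ * ∑ m ∈ S, ‖2 * (Real.pi : ℂ) * I * m * a m‖ ^ 2 ≤ 400 * M * E := by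
    rw [inv_mul_le_iff₀ hM]; linarith
  have h6 : 0 ≤ δ⁻¹ * E := by positivity
  have h7 : 0 ≤ M * E := by positivity
  linarith

end

end KB

namespace KB

open ModularGroup Matrix.SpecialLinearGroup
open UpperHalfPlane hiding I continuous_re continuous_im
open scoped MatrixGroups Modular ENNReal ContDiff Topology RealInnerProductSpace

noncomputable section

theorem frac_sep {Q c c' d d' : ℕ} (hc : 0 < c) (hc' : 0 < c') (hQ : c ≤ Q) (hQ' : c' ≤ Q)
    (hd : d.Coprime c) (hd' : d'.Coprime c') (hne : ¬ (c = c' ∧ d = d')) :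
    ((Q : ℝ) ^ 2)⁻¹ ≤ |(d : ℝ) / c - d' / c'| := by
  have h1 : (d : ℤ) * c' - d' * c ≠ 0 := by
    intro h
    have h2 : d * c' = d' * c := by zify; linarith
    have h3 : c ∣ c' := hd.symm.dvd_of_dvd_mul_left (Dvd.intro_left _ h2.symm)
    have h4 : c' ∣ c := hd'.symm.dvd_of_dvd_mul_left (Dvd.intro_left _ h2)
    have h5 := Nat.dvd_antisymm h3 h4
    subst h5
    exact hne ⟨rfl, Nat.eq_of_mul_eq_mul_right hc h2⟩
  have h2 : (1 : ℝ) ≤ |(d : ℝ) * c' - d' * c| := by exact_mod_cast Int.one_le_abs h1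
  have hcr : (0 : ℝ) < c := by exact_mod_cast hc
  have hcr' : (0 : ℝ) < c' := by exact_mod_cast hc'
  have h3 : (d : ℝ) / c - d' / c' = ((d : ℝ) * c' - d' * c) / (c * c') := by field_simp
  have hQr : (c : ℝ) ≤ Q := by exact_mod_cast hQ
  have hQr' : (c' : ℝ) ≤ Q := by exact_mod_cast hQ'
  rw [h3, abs_div, abs_of_pos (mul_pos hcr hcr'), inv_eq_one_div]
  gcongr
  rw [sq]
  gcongr

/-- Reduced residues. -/
def reds (c : ℕ) : Finset ℕ := (Finset.range c).filter (fun x => Nat.Coprime x c)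

theorem mem_reds {c d : ℕ} : d ∈ reds c ↔ d < c ∧ d.Coprime c := by simp [reds]

theorem large_sieve_farey {Q : ℕ} (hQ : 1 ≤ Q) {s : Finset ℕ} (hs : ∀ c ∈ s, 1 ≤ c ∧ c ≤ Q)
    {M : ℝ} (hM : 0 < M) {S : Finset ℕ} (hS : ∀ m ∈ S, (m : ℝ) ≤ 3 * M) (a : ℕ → ℂ) :
    ∑ c ∈ s, ∑ d ∈ reds c, ‖tp S a (d / c)‖ ^ 2 ≤
      1000 * ((Q : ℝ) ^ 2 + M) * ∑ m ∈ S, ‖a m‖ ^ 2 := by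
  have hQr : (1 : ℝ) ≤ Q := by exact_mod_cast hQ
  have := large_sieve (s.sigma fun c => reds c) (fun i => (i.2 : ℝ) / i.1) (δ := ((Q : ℝ) ^ 2)⁻¹)
    (by positivity) (inv_le_one_of_one_le₀ (one_le_pow₀ hQr)) hM ?_ ?_ hS a
  · rw [inv_inv, Finset.sum_sigma] at this
    exact this
  · rintro ⟨c, d⟩ hi
    rw [Finset.mem_sigma, mem_reds] at hi
    have hc : (0 : ℝ) < c := by exact_mod_cast (hs c hi.1).1
    refine ⟨by positivity, ?_⟩
    rw [div_le_one hc]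
    exact_mod_cast hi.2.1.le
  · rintro ⟨c, d⟩ hi ⟨c', d'⟩ hi' hne
    rw [Finset.mem_sigma, mem_reds] at hi hi'
    refine frac_sep (hs c hi.1).1 (hs c' hi'.1).1 (hs c hi.1).2 (hs c' hi'.1).2 hi.2.2 hi'.2.2 ?_
    rintro ⟨rfl, rfl⟩
    exact hne rfl

theorem tp_neg (S : Finset ℕ) (a : ℕ → ℂ) (x : ℝ) :
    ‖tp S a (-x)‖ = ‖tp S (fun m => (starRingEnd ℂ) (a m)) x‖ := by
  rw [← Complex.norm_conj, tp, tp, map_sum]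
  congr 1
  refine Finset.sum_congr rfl fun m _ => ?_
  rw [map_mul, conj_eAdd]
  congr 2
  ring

theorem large_sieve_residues {c : ℕ} (hc : 1 ≤ c) {M : ℝ} (hM : 0 < M) {S : Finset ℕ}
    (hS : ∀ m ∈ S, (m : ℝ) ≤ 3 * M) (a : ℕ → ℂ) :
    ∑ d ∈ Finset.range c, ‖tp S a (d / c)‖ ^ 2 ≤ 1000 * (c + M) * ∑ m ∈ S, ‖a m‖ ^ 2 := by
  have hc' : (1 : ℝ) ≤ c := by exact_mod_cast hc
  have := large_sieve (Finset.range c) (fun d => (d : ℝ) / c) (δ := (c : ℝ)⁻¹)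
    (by positivity) (inv_le_one_of_one_le₀ hc') hM ?_ ?_ hS a
  · rwa [inv_inv] at this
  · intro d hd
    refine ⟨by positivity, ?_⟩
    rw [div_le_one (by positivity)]
    exact_mod_cast (Finset.mem_range.mp hd).le
  · intro d _ d' _ hne
    rw [← sub_div, abs_div, abs_of_pos (by positivity : (0 : ℝ) < c), inv_eq_one_div]
    gcongr
    have : (d : ℤ) - d' ≠ 0 := by omega
    exact_mod_cast Int.one_le_abs this

/-- The inverse of a residue. -/
def invRes (c d : ℕ) : ℕ := ((d : ZMod c)⁻¹).val

theorem large_sieve_inv {c : ℕ} (hc : 1 ≤ c) {M : ℝ} (hM : 0 < M) {S : Finset ℕ}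
    (hS : ∀ m ∈ S, (m : ℝ) ≤ 3 * M) (a : ℕ → ℂ) {σ : ℤ} (hσ : σ = 1 ∨ σ = -1) :
    ∑ d ∈ reds c, ‖tp S a (σ * (invRes c d / c))‖ ^ 2 ≤
      1000 * (c + M) * ∑ m ∈ S, ‖a m‖ ^ 2 := by
  have : NeZero c := ⟨by omega⟩
  have hinj : Set.InjOn (invRes c) (reds c) := by
    intro d hd d' hd' h
    rw [Finset.mem_coe, mem_reds] at hd hd'
    have h1 := ZMod.val_injective c h
    have h2 := ZMod.coe_mul_inv_eq_one d hd.2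
    have h3 := ZMod.coe_mul_inv_eq_one d' hd'.2
    have h4 : (d : ZMod c) = d' := by
      calc (d : ZMod c) = d * (d' * (d' : ZMod c)⁻¹) := by rw [h3, mul_one]
        _ = (d * (d : ZMod c)⁻¹) * d' := by rw [h1]; ring
        _ = d' := by rw [h2, one_mul]
    rw [ZMod.natCast_eq_natCast_iff'] at h4
    rwa [Nat.mod_eq_of_lt hd.1, Nat.mod_eq_of_lt hd'.1] at h4
  have key : ∀ a : ℕ → ℂ, ∑ d ∈ reds c, ‖tp S a (invRes c d / c)‖ ^ 2 ≤
      1000 * (c + M) * ∑ m ∈ S, ‖a m‖ ^ 2 := by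
    intro a
    refine le_trans ?_ (large_sieve_residues hc hM hS a)
    rw [← Finset.sum_image (f := fun e : ℕ => ‖tp S a (e / c)‖ ^ 2) hinj]
    refine Finset.sum_le_sum_of_subset_of_nonneg ?_ fun _ _ _ => by positivity
    intro e he
    obtain ⟨d, _, rfl⟩ := Finset.mem_image.mp he
    exact Finset.mem_range.mpr (ZMod.val_lt _)
  rcases hσ with rfl | rfl
  · simpa using key a
  · have := key fun m => (starRingEnd ℂ) (a m)
    simp only [← tp_neg, Complex.norm_conj] at this
    simpa using this

/-- The bilinear form in Kloosterman sums of modulus `c`. -/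
def bilin (S S' : Finset ℕ) (a b : ℕ → ℂ) (σ : ℤ) (c : ℕ) : ℂ :=
  ∑ m ∈ S, ∑ n ∈ S', a m * b n * kloostermanS m (σ * n) c

theorem bilin_eq (S S' : Finset ℕ) (a b : ℕ → ℂ) (σ : ℤ) (c : ℕ) :
    bilin S S' a b σ c =
      ∑ d ∈ reds c, tp S a (d / c) * tp S' b (σ * (invRes c d / c)) := by
  have h1 : ∀ m n : ℕ, kloostermanS m (σ * n) c =
      ∑ d ∈ reds c, eAdd (m * (d / c)) * eAdd (n * (σ * (invRes c d / c))) := by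
    intro m n
    unfold kloostermanS reds invRes
    refine Finset.sum_congr rfl fun d _ => ?_
    rw [← eAdd_add]
    congr 1
    push_cast
    ring
  unfold bilin tp
  simp_rw [h1, Finset.sum_mul_sum, Finset.mul_sum]
  rw [Finset.sum_comm (s := reds c)]
  refine Finset.sum_congr rfl fun m _ => ?_
  rw [Finset.sum_comm]
  refine Finset.sum_congr rfl fun d _ => Finset.sum_congr rfl fun n _ => ?_
  ring

theorem sum_norm_bilin_le {Q : ℕ} (hQ : 1 ≤ Q) {s : Finset ℕ} (hs : ∀ c ∈ s, 1 ≤ c ∧ c ≤ Q)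
    {M N : ℝ} (hN : 1 / 3 ≤ N) (hNM : N ≤ M) {S S' : Finset ℕ} (hS : ∀ m ∈ S, (m : ℝ) ≤ 3 * M)
    (hS' : ∀ n ∈ S', (n : ℝ) ≤ 3 * N) {σ : ℤ} (hσ : σ = 1 ∨ σ = -1) (a : ℕ → ℂ) (b : ℕ → ℕ → ℂ)
    {α β : ℝ} (hα : 0 ≤ α) (hβ : 0 ≤ β) (ha : ∑ m ∈ S, ‖a m‖ ^ 2 ≤ α ^ 2)
    (hb : ∀ c ∈ s, ∑ n ∈ S', ‖b c n‖ ^ 2 ≤ β ^ 2) :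
    ∑ c ∈ s, ‖bilin S S' a (b c) σ c‖ ≤ 3000 * (Q * (Q + √(M * N))) * (α * β) := by
  have hM : 0 < M := by linarith
  have hN0 : 0 < N := by linarith
  have hQr : (1 : ℝ) ≤ Q := by exact_mod_cast hQ
  have h1 := large_sieve_farey hQ hs hM hS a
  have h2 : ∑ c ∈ s, ∑ d ∈ reds c, ‖tp S' (b c) (σ * (invRes c d / c))‖ ^ 2 ≤
      Q * (1000 * (Q + N) * β ^ 2) := by
    have h3 : ∀ c ∈ s, ∑ d ∈ reds c, ‖tp S' (b c) (σ * (invRes c d / c))‖ ^ 2 ≤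
        1000 * (Q + N) * β ^ 2 := by
      intro c hc
      refine (large_sieve_inv (hs c hc).1 hN0 hS' (b c) hσ).trans ?_
      have : (c : ℝ) ≤ Q := by exact_mod_cast (hs c hc).2
      exact mul_le_mul (by gcongr) (hb c hc) (by positivity) (by positivity)
    refine (Finset.sum_le_sum h3).trans ?_
    rw [Finset.sum_const, nsmul_eq_mul]
    have hcard : s.card ≤ Q := by
      have : s ⊆ Finset.Icc 1 Q := fun c hc => Finset.mem_Icc.mpr (hs c hc)
      simpa using Finset.card_le_card this
    have : (s.card : ℝ) ≤ Q := by exact_mod_cast hcard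
    gcongr
  have h3 : ∑ c ∈ s, ‖bilin S S' a (b c) σ c‖ ≤ ∑ i ∈ s.sigma fun c => reds c,
      ‖tp S a (i.2 / i.1)‖ * ‖tp S' (b i.1) (σ * (invRes i.1 i.2 / i.1))‖ := by
    rw [Finset.sum_sigma]
    refine Finset.sum_le_sum fun c _ => ?_
    rw [bilin_eq]
    refine (norm_sum_le _ _).trans (le_of_eq ?_)
    simp only [norm_mul]
  refine h3.trans (abs_le_of_sq_le_sq' ?_ (by positivity)).2
  refine (Finset.sum_mul_sq_le_sq_mul_sq _ _ _).trans ?_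
  rw [Finset.sum_sigma, Finset.sum_sigma]
  refine (mul_le_mul h1 h2 (Finset.sum_nonneg fun _ _ => Finset.sum_nonneg fun _ _ => by positivity)
    (by positivity)).trans ?_
  set R := √(M * N) with hR
  have hR2 : R ^ 2 = M * N := Real.sq_sqrt (by positivity)
  have hRN : N ≤ R := Real.le_sqrt_of_sq_le (by nlinarith)
  have hR0 : 0 ≤ R := Real.sqrt_nonneg _
  have key : ((Q : ℝ) ^ 2 + M) * (Q * (Q + N)) ≤ 9 * (Q * (Q + R)) ^ 2 := by
    have h5 : M ≤ 3 * R ^ 2 := by nlinarith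
    have h6 : M * N = R ^ 2 := hR2.symm
    have h7 : M * (Q * (Q + N)) ≤ 3 * R ^ 2 * Q ^ 2 + R ^ 2 * Q ^ 2 := by
      have : M * (Q * (Q + N)) = M * Q ^ 2 + (M * N) * Q := by ring
      rw [this, h6]
      gcongr
      nlinarith
    have h8 : (Q : ℝ) ^ 2 * (Q * (Q + N)) ≤ Q ^ 2 * (Q * (Q + R)) := by gcongr
    have h9 : (Q : ℝ) ^ 2 * (Q * (Q + R)) ≤ (Q * (Q + R)) ^ 2 := by
      rw [mul_pow]
      have : (Q : ℝ) * (Q + R) ≤ (Q + R) ^ 2 := by nlinarith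
      gcongr
    have h10 : R ^ 2 * (Q : ℝ) ^ 2 ≤ (Q * (Q + R)) ^ 2 := by
      rw [mul_pow, mul_comm]; gcongr; linarith
    nlinarith
  calc 1000 * ((Q : ℝ) ^ 2 + M) * (∑ m ∈ S, ‖a m‖ ^ 2) * (Q * (1000 * (Q + N) * β ^ 2))
      ≤ 1000 * ((Q : ℝ) ^ 2 + M) * α ^ 2 * (Q * (1000 * (Q + N) * β ^ 2)) := by gcongr
    _ = 1000 ^ 2 * (α * β) ^ 2 * (((Q : ℝ) ^ 2 + M) * (Q * (Q + N))) := by ring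
    _ ≤ 1000 ^ 2 * (α * β) ^ 2 * (9 * (Q * (Q + R)) ^ 2) := by gcongr
    _ = _ := by ring

end

end KB

namespace KB

open ModularGroup Matrix.SpecialLinearGroup
open UpperHalfPlane hiding I continuous_re continuous_im
open scoped MatrixGroups Modular ENNReal ContDiff Topology RealInnerProductSpace

noncomputable section

theorem integral_comp_sign {E : Type*} [NormedAddCommGroup E] [NormedSpace ℝ E] {F : ℝ → E}
    (hF : Function.Periodic F 1) {σ : ℤ} (hσ : σ = 1 ∨ σ = -1) :
    ∫ x in (0 : ℝ)..1, F (σ * x) = ∫ x in (0 : ℝ)..1, F x := by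
  rcases hσ with rfl | rfl
  · simp
  · have h1 := intervalIntegral.integral_comp_neg (a := 0) (b := 1) F
    have h2 := hF.intervalIntegral_add_eq (-1) 0
    simp only [neg_zero, zero_add, neg_add_cancel] at h1 h2
    simp only [Int.cast_neg, Int.cast_one, neg_one_mul]
    rw [h1, h2]

/-- Real periodic functions of mean zero oscillating at frequencies of size `M`. -/
structure Osc (M α : ℝ) (A : ℝ → ℝ) : Prop where
  periodic : Function.Periodic A 1
  deriv2 : ∃ A' A'' : ℝ → ℝ, (∀ x, HasDerivAt A (A' x) x) ∧ (∀ x, HasDerivAt A' (A'' x) x) ∧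
    Continuous A'' ∧ ∫ x in (0 : ℝ)..1, A'' x ^ 2 ≤ (36 * Real.pi ^ 2 * M ^ 2 * α) ^ 2
  mean : ∫ x in (0 : ℝ)..1, A x = 0
  sq : ∫ x in (0 : ℝ)..1, A x ^ 2 ≤ α ^ 2

theorem Osc.continuous {M α : ℝ} {A : ℝ → ℝ} (h : Osc M α A) : Continuous A := by
  obtain ⟨A', _, h1, _⟩ := h.deriv2
  exact continuous_iff_continuousAt.2 fun x => (h1 x).continuousAt

theorem Osc.exists_bound {M α : ℝ} {A : ℝ → ℝ} (h : Osc M α A) : ∃ B, ∀ x, |A x| ≤ B := by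
  obtain ⟨B, hB⟩ := h.periodic.isBounded_of_continuous one_ne_zero h.continuous |>.exists_norm_le
  exact ⟨B, fun x => hB _ ⟨x, rfl⟩⟩

theorem sum_norm_sq_freq_le {S : Finset ℕ} {M α : ℝ} (hM : 0 ≤ M) (hS : ∀ m ∈ S, (m : ℝ) ≤ 3 * M)
    {a : ℕ → ℂ} (ha : ∑ m ∈ S, ‖a m‖ ^ 2 ≤ α ^ 2) :
    ∑ m ∈ S, ‖2 * (Real.pi : ℂ) * I * m * (2 * Real.pi * I * m * a m)‖ ^ 2 ≤
      (36 * Real.pi ^ 2 * M ^ 2 * α) ^ 2 := by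
  calc ∑ m ∈ S, ‖2 * (Real.pi : ℂ) * I * m * (2 * Real.pi * I * m * a m)‖ ^ 2
      ≤ ∑ m ∈ S, (36 * Real.pi ^ 2 * M ^ 2) ^ 2 * ‖a m‖ ^ 2 := by
        refine Finset.sum_le_sum fun m hm => ?_
        rw [← mul_pow]
        simp only [norm_mul, Complex.norm_I, RCLike.norm_ofNat, Complex.norm_real, Real.norm_eq_abs,
          abs_of_pos Real.pi_pos, RCLike.norm_natCast, mul_one]
        have h1 : (m : ℝ) * m ≤ 3 * M * (3 * M) := by
          have := hS m hm
          gcongr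
        refine pow_le_pow_left₀ (by positivity) ?_ 2
        calc 2 * Real.pi * m * (2 * Real.pi * m * ‖a m‖)
            = 4 * Real.pi ^ 2 * (m * m) * ‖a m‖ := by ring
          _ ≤ 4 * Real.pi ^ 2 * (3 * M * (3 * M)) * ‖a m‖ := by gcongr
          _ = _ := by ring
    _ = (36 * Real.pi ^ 2 * M ^ 2) ^ 2 * ∑ m ∈ S, ‖a m‖ ^ 2 := by rw [Finset.mul_sum]
    _ ≤ (36 * Real.pi ^ 2 * M ^ 2) ^ 2 * α ^ 2 := by gcongr
    _ = _ := by ring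

theorem osc_tp {S : Finset ℕ} (h0 : 0 ∉ S) {M α : ℝ} (hM : 0 ≤ M)
    (hS : ∀ m ∈ S, (m : ℝ) ≤ 3 * M) {a : ℕ → ℂ} (ha : ∑ m ∈ S, ‖a m‖ ^ 2 ≤ α ^ 2) {σ : ℤ}
    (hσ : σ = 1 ∨ σ = -1) (L : ℂ →L[ℝ] ℝ) (hL : ∀ z, |L z| ≤ ‖z‖) :
    Osc M α fun x => L (tp S a (σ * x)) := by
  have hd : ∀ (a : ℕ → ℂ) (x : ℝ), HasDerivAt (fun x : ℝ => tp S a (σ * x))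
      ((σ : ℝ) • tp S (fun m => 2 * Real.pi * I * m * a m) (σ * x)) x := by
    intro a x
    have h1 : HasDerivAt (fun x : ℝ => (σ : ℝ) * x) σ x := by
      simpa using (hasDerivAt_id x).const_mul (σ : ℝ)
    exact (hasDerivAt_tp S a (σ * x)).scomp x h1
  have hc : ∀ a : ℕ → ℂ, Continuous fun x : ℝ => tp S a (σ * x) := fun a =>
    (continuous_tp S a).comp (by fun_prop)
  have hσ2 : (σ : ℝ) * σ = 1 := by rcases hσ with rfl | rfl <;> norm_num
  have hsq : ∀ a : ℕ → ℂ, ∫ x in (0 : ℝ)..1, L (tp S a (σ * x)) ^ 2 ≤ ∑ m ∈ S, ‖a m‖ ^ 2 := by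
    intro a
    rw [← integral_norm_sq_tp, ← integral_comp_sign (F := fun x => ‖tp S a x‖ ^ 2)
      (fun x => by simp only [periodic_tp S a x]) hσ]
    refine intervalIntegral.integral_mono zero_le_one ?_ ?_ fun x => ?_
    · exact ((L.continuous.comp (hc a)).pow 2).intervalIntegrable _ _
    · exact ((hc a).norm.pow 2).intervalIntegrable _ _
    · simp only
      rw [← sq_abs (L _)]
      exact pow_le_pow_left₀ (abs_nonneg _) (hL _) 2
  refine ⟨?_, ⟨fun x => L ((σ : ℝ) • tp S (fun m => 2 * Real.pi * I * m * a m) (σ * x)),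
    fun x => L (tp S (fun m => 2 * Real.pi * I * m * (2 * Real.pi * I * m * a m)) (σ * x)),
    fun x => ?_, fun x => ?_, ?_, ?_⟩, ?_, ?_⟩
  · intro x
    simp only
    rw [mul_add, mul_one]
    have hp : Function.Periodic (tp S a) (σ : ℝ) := by
      simpa using (periodic_tp S a).int_mul σ
    rw [hp]
  · exact L.hasFDerivAt.comp_hasDerivAt x (hd a x)
  · refine (L.hasFDerivAt.comp_hasDerivAt x ((hd _ x).const_smul (σ : ℝ))).congr_deriv ?_
    rw [smul_smul, hσ2, one_smul]
  · exact L.continuous.comp (hc _)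
  · exact (hsq _).trans (sum_norm_sq_freq_le hM hS ha)
  · have h1 := L.intervalIntegral_comp_comm ((hc a).intervalIntegrable (μ := volume) (0 : ℝ) 1)
    rw [h1, integral_comp_sign (periodic_tp S a) hσ, integral_tp_eq_zero h0, map_zero]
  · exact (hsq a).trans ha

theorem abs_integral_mul_le {A B : ℝ → ℝ} (cA : Continuous A) (cB : Continuous B) {α β : ℝ}
    (hα : 0 ≤ α) (hβ : 0 ≤ β) (hA : ∫ x in (0 : ℝ)..1, A x ^ 2 ≤ α ^ 2)
    (hB : ∫ x in (0 : ℝ)..1, B x ^ 2 ≤ β ^ 2) : |∫ x in (0 : ℝ)..1, A x * B x| ≤ α * β := by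
  set P := ∫ x in (0 : ℝ)..1, A x ^ 2
  set Q := ∫ x in (0 : ℝ)..1, B x ^ 2
  set J := ∫ x in (0 : ℝ)..1, A x * B x
  have hi : ∀ F : ℝ → ℝ, Continuous F → IntervalIntegrable F volume 0 1 :=
    fun F hF => hF.intervalIntegrable _ _
  have key : ∀ t : ℝ, 0 ≤ P * (t * t) + (2 * J) * t + Q := by
    intro t
    have h1 : ∫ x in (0 : ℝ)..1, (t * A x + B x) ^ 2 = P * (t * t) + (2 * J) * t + Q := by
      have h2 : (fun x => (t * A x + B x) ^ 2) =
          fun x => (t * t) * A x ^ 2 + (2 * t) * (A x * B x) + B x ^ 2 := by ext x; ring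
      rw [h2, intervalIntegral.integral_add, intervalIntegral.integral_add,
        intervalIntegral.integral_const_mul, intervalIntegral.integral_const_mul]
      · ring
      all_goals exact hi _ (by fun_prop)
    rw [← h1]
    exact intervalIntegral.integral_nonneg zero_le_one fun x _ => sq_nonneg _
  have hd := discrim_le_zero key
  rw [discrim] at hd
  have hP : 0 ≤ P := intervalIntegral.integral_nonneg zero_le_one fun x _ => sq_nonneg _
  have hQ : 0 ≤ Q := intervalIntegral.integral_nonneg zero_le_one fun x _ => sq_nonneg _
  refine abs_le_of_sq_le_sq ?_ (by positivity)
  have : P * Q ≤ α ^ 2 * β ^ 2 := mul_le_mul hA hB hQ (by positivity)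
  nlinarith

theorem integral_Ioi_sq_div_le {f : ℝ → ℝ} {Y : ℝ} (hY : 0 < Y) (sf : ∀ y, f y ≠ 0 → Y ≤ y)
    (bf : ∀ y, |f y| ≤ 1) :
    |∫ y in Set.Ioi 0, f y / y ^ 2| ≤ 1 / Y := by
  have h1 : IntegrableOn (fun y : ℝ => y ^ (-2 : ℝ)) (Set.Ioi Y) :=
    integrableOn_Ioi_rpow_of_lt (by norm_num) hY
  have h2 : ∫ y in Set.Ioi Y, y ^ (-2 : ℝ) = 1 / Y := by
    rw [integral_Ioi_rpow_of_lt (by norm_num) hY]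
    norm_num [Real.rpow_neg_one]
  have h3 : ∫ y in Set.Ioi 0, f y / y ^ 2 = ∫ y in Set.Ioi Y, f y / y ^ 2 := by
    have : ∫ y in Set.Ioi 0, f y / y ^ 2 = ∫ y in Set.Ici Y, f y / y ^ 2 := by
      refine setIntegral_eq_of_subset_of_forall_sdiff_eq_zero measurableSet_Ioi
        (fun y hy => hY.trans_le hy) fun y hy => ?_
      by_contra hne
      exact hy.2 (sf y (div_ne_zero_iff.mp hne).1)
    rw [this, integral_Ici_eq_integral_Ioi]
  rw [h3, ← h2, ← Real.norm_eq_abs]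
  refine norm_integral_le_of_norm_le h1 ?_
  refine (ae_restrict_mem measurableSet_Ioi).mono fun y hy => ?_
  have hy0 : 0 < y := hY.trans hy
  rw [Real.norm_eq_abs, abs_div, Real.rpow_neg hy0.le, abs_of_pos (by positivity : 0 < y ^ 2)]
  norm_cast
  rw [div_eq_mul_inv]
  exact mul_le_of_le_one_left (by positivity) (bf y)

theorem integrableOn_div_sq {f : ℝ → ℝ} (mf : Measurable f) {Y R : ℝ} (hY : 0 < Y)
    (sf : ∀ y, f y ≠ 0 → Y ≤ y ∧ y ≤ R) (bf : ∀ y, |f y| ≤ 1) :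
    IntegrableOn (fun y => f y / y ^ 2) (Set.Ioi 0) := by
  have h1 : IntegrableOn (fun y => f y / y ^ 2) (Set.Icc Y R) := by
    refine Measure.integrableOn_of_bounded (M := 1 / Y ^ 2) (by simp)
      (mf.div (measurable_id.pow_const 2)).aestronglyMeasurable ?_
    refine (ae_restrict_mem measurableSet_Icc).mono fun y hy => ?_
    have hy0 : 0 < y := hY.trans_le hy.1
    rw [Real.norm_eq_abs, abs_div, abs_of_pos (by positivity : 0 < y ^ 2)]
    have := hy.1
    have := bf y
    gcongr
  refine h1.of_forall_sdiff_eq_zero measurableSet_Ioi fun y hy => ?_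
  by_contra hne
  exact hy.2 (sf y (div_ne_zero_iff.mp hne).1)

theorem exists_sum_cellInt_le : ∃ K : ℝ, 0 < K ∧ ∀ {M N α β : ℝ} {A B f h : ℝ → ℝ}
    {Y R Y' R' T : ℝ} {Q : ℕ}, 1 / 3 ≤ M → 1 / 3 ≤ N → 0 ≤ α → 0 ≤ β → Osc M α A → Osc N β B →
    Measurable f → Measurable h → 0 < Y → 0 < Y' → (∀ y, f y ≠ 0 → Y ≤ y ∧ y ≤ R) →
    (∀ y, h y ≠ 0 → Y' ≤ y ∧ y ≤ R') → (∀ y, |f y| ≤ 1) → (∀ y, |h y| ≤ 1) → 1 ≤ T →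
    Real.exp (1 - T) ≤ M * Y → Real.exp (1 - T) ≤ N * Y' → 1 ≤ (Q : ℝ) ^ 2 * (Y * Y') →
    |∑ c ∈ Finset.Icc 1 Q, ∑ d ∈ reds c, cellInt A B f h c d (invRes c d)| ≤
      α * β * (K * T ^ 4 * √(M * N) * √(1 / (Y * Y')) + 1 / Y) := by
  obtain ⟨K, hK, H⟩ := exists_norm_poin_le
  refine ⟨(K * (36 * Real.pi ^ 2)) ^ 2, by positivity, ?_⟩
  intro M N α β A B f h Y R Y' R' T Q hM hN hα hβ hA hB mf mh hY hY' sf sh bf bh hT hMT hNT hQ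
  have hκ : 1 ≤ 36 * Real.pi ^ 2 := by nlinarith [Real.pi_gt_three]
  obtain ⟨A', A'', dA, dA', cA, sA⟩ := hA.deriv2
  obtain ⟨B', B'', dB, dB', cB, sB⟩ := hB.deriv2
  obtain ⟨mF, nF⟩ := H hM hA.periodic dA dA' cA hA.mean hκ hα hA.sq sA mf hY sf bf hT hMT
  obtain ⟨mG, nG⟩ := H hN hB.periodic dB dB' cB hB.mean hκ hβ hB.sq sB mh hY' sh bh hT hNT
  obtain ⟨bA, hbA⟩ := hA.exists_bound
  obtain ⟨bB, hbB⟩ := hB.exists_bound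
  have iA : IntegrableOn A (Set.Ico 0 1) :=
    (hA.continuous.integrableOn_Icc).mono_set Set.Ico_subset_Icc_self
  have hid := integral_poin_prodF hA.periodic hB.periodic hA.continuous.measurable
    hB.continuous.measurable mf mh hbA hbB bf bh hY hY' sf sh
    (integrableOn_strip_prodF iA (integrableOn_div_sq mf hY sf bf)) hQ
  have hdiag : |∫ z in strip, prodF A f z * prodF B h z| ≤ α * β * (1 / Y) := by
    have h1 : ∀ z, prodF A f z * prodF B h z = prodF (fun x => A x * B x) (fun y => f y * h y) z :=
      fun z => by simp only [prodF]; ring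
    simp only [h1]
    rw [integral_strip_prodF, abs_mul]
    refine mul_le_mul (abs_integral_mul_le hA.continuous hB.continuous hα hβ hA.sq hB.sq)
      (integral_Ioi_sq_div_le hY (fun y hy => (sf y (left_ne_zero_of_mul hy)).1) fun y => ?_)
      (abs_nonneg _) (by positivity)
    rw [abs_mul]
    exact mul_le_one₀ (bf y) (abs_nonneg _) (bh y)
  have hsq : ∀ {f : ℝ → ℝ} {Y : ℝ}, 0 < Y → (∀ y, f y ≠ 0 → Y ≤ y) → (∀ y, |f y| ≤ 1) →
      ∫ y in Set.Ioi 0, f y ^ 2 / y ^ 2 ≤ 1 / Y := by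
    intro f Y hY sf bf
    refine (le_abs_self _).trans (integral_Ioi_sq_div_le (f := fun y => f y ^ 2) hY
      (fun y hy => sf y (by intro h0; simp [h0] at hy)) fun y => ?_)
    rw [abs_pow]
    exact pow_le_one₀ (abs_nonneg _) (bf y)
  have hin : |∫ z in 𝒟ᵒ, poin (prodF A f) z * poin (prodF B h) z| ≤
      (K * (36 * Real.pi ^ 2) * √M * α * T ^ 2 * √(1 / Y)) *
      (K * (36 * Real.pi ^ 2) * √N * β * T ^ 2 * √(1 / Y')) := by
    rw [← inner_vec mF mG]
    refine (abs_real_inner_le_norm _ _).trans (mul_le_mul (nF.trans ?_) (nG.trans ?_)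
      (norm_nonneg _) (by positivity))
    · gcongr
      exact hsq hY (fun y hy => (sf y hy).1) bf
    · gcongr
      exact hsq hY' (fun y hy => (sh y hy).1) bh
  have hfin : ∑ c ∈ Finset.Icc 1 Q, ∑ d ∈ reds c, cellInt A B f h c d (invRes c d) =
      (∫ z in 𝒟ᵒ, poin (prodF A f) z * poin (prodF B h) z) -
        ∫ z in strip, prodF A f z * prodF B h z := by
    rw [hid, add_sub_cancel_left]
    rfl
  rw [hfin]
  refine (abs_sub _ _).trans ((add_le_add hin hdiag).trans (le_of_eq ?_))
  have e1 : √(M * N) = √M * √N := Real.sqrt_mul (by linarith) _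
  have e2 : √(1 / (Y * Y')) = √(1 / Y) * √(1 / Y') := by
    rw [← Real.sqrt_mul (by positivity)]
    congr 1
    field_simp
  rw [e1, e2]
  ring

end

end KB

namespace KB

open ModularGroup Matrix.SpecialLinearGroup
open UpperHalfPlane hiding I continuous_re continuous_im
open scoped MatrixGroups Modular ENNReal ContDiff Topology RealInnerProductSpace

noncomputable section

/-- The height of the image of a point under the long Weyl element. -/
def etaH (c : ℝ) (p : ℝ × ℝ) : ℝ := 1 / (c ^ 2 * p.1 * (1 + p.2 ^ 2))

/-- The weight of the Bruhat cell of modulus `c`. -/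
def cellW (f h : ℝ → ℝ) (c : ℝ) (p : ℝ × ℝ) : ℝ := f p.1 * h (etaH c p) / p.1

theorem measurable_etaH (c : ℝ) : Measurable (etaH c) := by
  unfold etaH
  fun_prop

theorem measurable_cellW {f h : ℝ → ℝ} (mf : Measurable f) (mh : Measurable h) (c : ℝ) :
    Measurable (cellW f h c) :=
  ((mf.comp measurable_fst).mul (mh.comp (measurable_etaH c))).div measurable_fst

theorem cellW_support {f h : ℝ → ℝ} {Y R Y' R' : ℝ} (hY : 0 < Y) (hY' : 0 < Y')
    (sf : ∀ y, f y ≠ 0 → Y ≤ y ∧ y ≤ R) (sh : ∀ y, h y ≠ 0 → Y' ≤ y ∧ y ≤ R') {c : ℝ} (hc : 0 < c)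
    {p : ℝ × ℝ} (hp : cellW f h c p ≠ 0) : Y ≤ p.1 ∧ p.1 ≤ R ∧
      p.1 * (1 + p.2 ^ 2) ≤ 1 / (c ^ 2 * Y') ∧ etaH c p ≤ R' := by
  have h1 := (div_ne_zero_iff.mp hp).1
  have h2 := sf _ (left_ne_zero_of_mul h1)
  have h3 := sh _ (right_ne_zero_of_mul h1)
  have hy : 0 < p.1 := hY.trans_le h2.1
  refine ⟨h2.1, h2.2, ?_, h3.2⟩
  have h4 := h3.1
  rw [etaH, le_div_iff₀ (by positivity)] at h4
  rw [le_div_iff₀ (by positivity)]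
  linarith

theorem abs_cellW_le {f h : ℝ → ℝ} {Y R Y' R' : ℝ} (hY : 0 < Y) (hY' : 0 < Y')
    (sf : ∀ y, f y ≠ 0 → Y ≤ y ∧ y ≤ R) (sh : ∀ y, h y ≠ 0 → Y' ≤ y ∧ y ≤ R')
    (bf : ∀ y, |f y| ≤ 1) (bh : ∀ y, |h y| ≤ 1) {c : ℝ} (hc : 0 < c)
    {p : ℝ × ℝ} (hp : cellW f h c p ≠ 0) : |cellW f h c p| ≤ 1 / p.1 := by
  have hy := hY.trans_le (cellW_support hY hY' sf sh hc hp).1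
  rw [cellW, abs_div, abs_of_pos hy, abs_mul]
  gcongr
  exact mul_le_one₀ (bf _) (abs_nonneg _) (bh _)

theorem integrable_cellW {f h : ℝ → ℝ} (mf : Measurable f) (mh : Measurable h) {Y R Y' R' : ℝ}
    (hY : 0 < Y) (hY' : 0 < Y') (sf : ∀ y, f y ≠ 0 → Y ≤ y ∧ y ≤ R)
    (sh : ∀ y, h y ≠ 0 → Y' ≤ y ∧ y ≤ R') (bf : ∀ y, |f y| ≤ 1) (bh : ∀ y, |h y| ≤ 1) {c : ℝ}
    (hc : 0 < c) : Integrable (cellW f h c) := by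
  set D := 1 / (c ^ 2 * Y') / Y + 1 with hD
  have hs : ∀ p, cellW f h c p ≠ 0 → p ∈ Set.Icc Y R ×ˢ Set.Icc (-D) D := by
    intro p hp
    obtain ⟨h1, h2, h3, -⟩ := cellW_support hY hY' sf sh hc hp
    refine ⟨⟨h1, h2⟩, abs_le.mp ?_⟩
    have h4 : Y * (1 + p.2 ^ 2) ≤ 1 / (c ^ 2 * Y') :=
      (mul_le_mul_of_nonneg_right h1 (by positivity)).trans h3
    have h5 : 1 + p.2 ^ 2 ≤ 1 / (c ^ 2 * Y') / Y := by rw [le_div_iff₀ hY]; linarith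
    rw [← sq_abs] at h5
    nlinarith [abs_nonneg p.2]
  have h1 : IntegrableOn (cellW f h c) (Set.Icc Y R ×ˢ Set.Icc (-D) D) := by
    refine Measure.integrableOn_of_bounded (M := 1 / Y) ?_
      (measurable_cellW mf mh c).aestronglyMeasurable ?_
    · exact (isCompact_Icc.prod isCompact_Icc).measure_lt_top.ne
    · refine ae_of_all _ fun p => ?_
      by_cases hp : cellW f h c p = 0
      · rw [hp, norm_zero]; positivity
      · refine (abs_cellW_le hY hY' sf sh bf bh hc hp).trans ?_
        have := (cellW_support hY hY' sf sh hc hp).1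
        gcongr
  rw [← integrableOn_univ]
  refine h1.of_forall_sdiff_eq_zero MeasurableSet.univ fun p hp => ?_
  by_contra hne
  exact hp.2 (hs p hne)

/-- The complex version of `cellInt`, as a double integral. -/
def cellZ (A B : ℝ → ℂ) (f h : ℝ → ℝ) (c d e : ℝ) : ℂ :=
  ∫ p : ℝ × ℝ, A (p.1 * p.2 - d / c) * B (e / c - p.2 * etaH c p) * (cellW f h c p : ℂ)

theorem integrable_mul_cellW {E : Type*} [NormedRing E] [NormedAlgebra ℝ E] {w : ℝ × ℝ → ℝ}
    (hw : Integrable w) {A B : ℝ → E} (cA : Continuous A) (cB : Continuous B) {α β : ℝ}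
    (bA : ∀ x, ‖A x‖ ≤ α) (bB : ∀ x, ‖B x‖ ≤ β) (c d e : ℝ) :
    Integrable fun p : ℝ × ℝ => w p • (A (p.1 * p.2 - d / c) * B (e / c - p.2 * etaH c p)) := by
  have m1 : AEStronglyMeasurable (fun p : ℝ × ℝ => A (p.1 * p.2 - d / c)) :=
    (cA.comp (by fun_prop)).aestronglyMeasurable
  have m2 : AEStronglyMeasurable (fun p : ℝ × ℝ => B (e / c - p.2 * etaH c p)) :=
    (cB.stronglyMeasurable.comp_measurable
      (measurable_const.sub (measurable_snd.mul (measurable_etaH c)))).aestronglyMeasurable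
  refine hw.smul_bdd (α * β) (m1.mul m2) (ae_of_all _ fun p => ?_)
  exact (norm_mul_le _ _).trans (mul_le_mul (bA _) (bB _) (norm_nonneg _)
    ((norm_nonneg _).trans (bA 0)))

theorem cellInt_eq_integral {A B f h : ℝ → ℝ} {Y R : ℝ} (hY : 0 < Y)
    (sf : ∀ y, f y ≠ 0 → Y ≤ y ∧ y ≤ R) {c : ℝ} (hw : Integrable (cellW f h c))
    (cA : Continuous A) (cB : Continuous B) {α β : ℝ} (bA : ∀ x, |A x| ≤ α) (bB : ∀ x, |B x| ≤ β)
    (d e : ℝ) : cellInt A B f h c d e =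
      ∫ p : ℝ × ℝ, cellW f h c p • (A (p.1 * p.2 - d / c) * B (e / c - p.2 * etaH c p)) := by
  have hi := integrable_mul_cellW hw cA cB bA bB c d e
  rw [Measure.volume_eq_prod] at hi ⊢
  rw [integral_prod _ hi, cellInt]
  rw [setIntegral_eq_integral_of_forall_compl_eq_zero]
  · refine integral_congr_ae (ae_of_all _ fun y => integral_congr_ae (ae_of_all _ fun s => ?_))
    simp only [etaH, cellW, smul_eq_mul]
    ring
  · intro y hy
    refine integral_eq_zero_of_ae (ae_of_all _ fun s => ?_)
    have : f y = 0 := by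
      by_contra hne
      exact hy (hY.trans_le (sf y hne).1)
    simp [this]

theorem cellZ_eq {A B : ℝ → ℂ} {f h : ℝ → ℝ} {Y R : ℝ} (hY : 0 < Y)
    (sf : ∀ y, f y ≠ 0 → Y ≤ y ∧ y ≤ R) {c : ℝ} (hw : Integrable (cellW f h c))
    (cA : Continuous A) (cB : Continuous B) {α β : ℝ} (bA : ∀ x, ‖A x‖ ≤ α) (bB : ∀ x, ‖B x‖ ≤ β)
    (d e : ℝ) : cellZ A B f h c d e =
      ((cellInt (fun x => (A x).re) (fun x => (B x).re) f h c d e : ℂ) -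
        cellInt (fun x => (A x).im) (fun x => (B x).im) f h c d e) +
      (cellInt (fun x => (A x).re) (fun x => (B x).im) f h c d e +
        cellInt (fun x => (A x).im) (fun x => (B x).re) f h c d e) * I := by
  have c1 : Continuous fun x => (A x).re := Complex.continuous_re.comp cA
  have c2 : Continuous fun x => (A x).im := Complex.continuous_im.comp cA
  have c3 : Continuous fun x => (B x).re := Complex.continuous_re.comp cB
  have c4 : Continuous fun x => (B x).im := Complex.continuous_im.comp cB
  have b1 : ∀ x, |(A x).re| ≤ α := fun x => (Complex.abs_re_le_norm _).trans (bA x)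
  have b2 : ∀ x, |(A x).im| ≤ α := fun x => (Complex.abs_im_le_norm _).trans (bA x)
  have b3 : ∀ x, |(B x).re| ≤ β := fun x => (Complex.abs_re_le_norm _).trans (bB x)
  have b4 : ∀ x, |(B x).im| ≤ β := fun x => (Complex.abs_im_le_norm _).trans (bB x)
  have i1 := integrable_mul_cellW hw c1 c3 b1 b3 c d e
  have i2 := integrable_mul_cellW hw c2 c4 b2 b4 c d e
  have i3 := integrable_mul_cellW hw c1 c4 b1 b4 c d e
  have i4 := integrable_mul_cellW hw c2 c3 b2 b3 c d e
  rw [cellInt_eq_integral hY sf hw c1 c3 b1 b3,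
    cellInt_eq_integral hY sf hw c2 c4 b2 b4,
    cellInt_eq_integral hY sf hw c1 c4 b1 b4,
    cellInt_eq_integral hY sf hw c2 c3 b2 b3]
  rw [← integral_complex_ofReal, ← integral_complex_ofReal, ← integral_complex_ofReal,
    ← integral_complex_ofReal, ← integral_sub i1.ofReal i2.ofReal, ← integral_add i3.ofReal i4.ofReal,
    ← integral_mul_const]
  refine Eq.trans ?_ (integral_add (i1.ofReal.sub i2.ofReal) ((i3.ofReal.add i4.ofReal).mul_const I))
  rw [cellZ]
  refine integral_congr_ae (ae_of_all _ fun p => ?_)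
  simp only [smul_eq_mul]
  push_cast
  set z := A (p.1 * p.2 - d / c)
  set w := B (e / c - p.2 * etaH c p)
  conv_lhs => rw [← Complex.re_add_im z, ← Complex.re_add_im w]
  linear_combination (z.im * w.im * cellW f h c p : ℂ) * Complex.I_sq

end

end KB

namespace KB

open ModularGroup Matrix.SpecialLinearGroup
open UpperHalfPlane hiding I continuous_re continuous_im
open scoped MatrixGroups Modular ENNReal ContDiff Topology RealInnerProductSpace

noncomputable section

/-- The weight transform arising from the big Bruhat cells. -/
def wt (k : ℝ → ℝ) (c : ℝ) : ℝ := Real.pi * ∫ r in Set.Ioi c, k r * (1 / c - c / r ^ 2)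

theorem integral_Ioi_comp_sq (F : ℝ → ℝ) {l : ℝ} (hl : 0 < l) :
    ∫ y in Set.Ioi 0, F y / y = ∫ r in Set.Ioi 0, 2 * F (l * r ^ 2) / r := by
  have h1 := integral_comp_mul_left_Ioi (fun y => F y / y) 0 hl
  rw [mul_zero] at h1
  have h2 : ∫ y in Set.Ioi 0, F y / y = ∫ u in Set.Ioi 0, F (l * u) / u := by
    have : ∫ u in Set.Ioi 0, F (l * u) / u = l • ∫ u in Set.Ioi 0, F (l * u) / (l * u) := by
      rw [← integral_smul]
      refine setIntegral_congr_fun measurableSet_Ioi fun u hu => ?_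
      have hu : 0 < u := hu
      simp only [smul_eq_mul]
      field_simp
    rw [this, h1, smul_smul, mul_inv_cancel₀ hl.ne', one_smul]
  rw [h2, ← integral_comp_rpow_Ioi_of_pos (p := 2) two_pos]
  refine setIntegral_congr_fun measurableSet_Ioi fun r hr => ?_
  have hr : 0 < r := hr
  have e : (2 : ℝ) - 1 = 1 := by norm_num
  simp only [smul_eq_mul, Real.rpow_two, e, Real.rpow_one]
  field_simp

theorem integral_sqrt_disc {ρ : ℝ} (hρ : 0 < ρ) :
    ∫ s : ℝ, √(ρ ^ 2 - s ^ 2) = Real.pi / 2 * ρ ^ 2 := by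
  have h1 : ∫ t : ℝ, √(1 - t ^ 2) = Real.pi / 2 := by
    rw [← integral_sqrt_one_sub_sq, intervalIntegral.integral_of_le (by norm_num)]
    symm
    refine setIntegral_eq_integral_of_forall_compl_eq_zero fun t ht => ?_
    refine Real.sqrt_eq_zero_of_nonpos ?_
    by_contra hne
    have : t ^ 2 < 1 := by linarith
    rw [sq_lt_one_iff_abs_lt_one, abs_lt] at this
    exact ht ⟨this.1, this.2.le⟩
  have h2 := Measure.integral_comp_mul_left (fun s => √(ρ ^ 2 - s ^ 2)) ρ
  have h3 : ∀ t : ℝ, √(ρ ^ 2 - (ρ * t) ^ 2) = ρ * √(1 - t ^ 2) := fun t => by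
    rw [show ρ ^ 2 - (ρ * t) ^ 2 = ρ ^ 2 * (1 - t ^ 2) by ring, Real.sqrt_mul (by positivity),
      Real.sqrt_sq hρ.le]
  simp only [h3] at h2
  rw [integral_const_mul, h1, abs_of_pos (inv_pos.mpr hρ), smul_eq_mul] at h2
  field_simp at h2 ⊢
  linarith

theorem integral_sqrt_cone {c r : ℝ} (hc : 0 < c) (hr : 0 < r) :
    ∫ s : ℝ, √(1 - c ^ 2 * (1 + s ^ 2) / r ^ 2) =
      if c < r then Real.pi / 2 * (r / c - c / r) else 0 := by
  split_ifs with h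
  · have hpos : 0 < (r / c) ^ 2 - 1 := by
      have : 1 < r / c := (one_lt_div hc).mpr h
      nlinarith
    set ρ := √((r / c) ^ 2 - 1)
    have hρ2 : ρ ^ 2 = (r / c) ^ 2 - 1 := Real.sq_sqrt hpos.le
    have h1 : ∀ s : ℝ, √(1 - c ^ 2 * (1 + s ^ 2) / r ^ 2) = c / r * √(ρ ^ 2 - s ^ 2) := by
      intro s
      rw [show 1 - c ^ 2 * (1 + s ^ 2) / r ^ 2 = (c / r) ^ 2 * (ρ ^ 2 - s ^ 2) by
        rw [hρ2]; field_simp; ring, Real.sqrt_mul (by positivity), Real.sqrt_sq (by positivity)]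
    simp only [h1]
    rw [integral_const_mul, integral_sqrt_disc (Real.sqrt_pos.mpr hpos), hρ2]
    field_simp
  · refine integral_eq_zero_of_ae (ae_of_all _ fun s => Real.sqrt_eq_zero_of_nonpos ?_)
    have h1 : r ^ 2 ≤ c ^ 2 * (1 + s ^ 2) := by
      have : r ^ 2 ≤ c ^ 2 := pow_le_pow_left₀ hr.le (not_lt.mp h) 2
      nlinarith [sq_nonneg (c * s)]
    rw [sub_nonpos, le_div_iff₀ (by positivity)]
    linarith

/-- The vertical weight of the first Poincaré series. -/
def vertF (Y R : ℝ) (y : ℝ) : ℝ := (Set.Icc Y R).indicator (fun y => √(1 - Y / y)) y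

/-- The vertical weight of the second Poincaré series. -/
def vertH (k : ℝ → ℝ) (Y : ℝ) (y : ℝ) : ℝ := k (1 / √(Y * y))

theorem measurable_vertF (Y R : ℝ) : Measurable (vertF Y R) :=
  Measurable.indicator (by fun_prop) measurableSet_Icc

theorem vertF_support {Y R y : ℝ} (h : vertF Y R y ≠ 0) : Y ≤ y ∧ y ≤ R :=
  show y ∈ Set.Icc Y R from Set.mem_of_indicator_ne_zero h

theorem abs_vertF_le {Y R : ℝ} (hY : 0 < Y) (y : ℝ) : |vertF Y R y| ≤ 1 := by
  by_cases h : y ∈ Set.Icc Y R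
  · rw [vertF, Set.indicator_of_mem h, abs_of_nonneg (Real.sqrt_nonneg _), Real.sqrt_le_one]
    have : 0 < y := hY.trans_le h.1
    have : 0 ≤ Y / y := by positivity
    linarith
  · rw [vertF, Set.indicator_of_notMem h, abs_zero]
    exact zero_le_one

theorem measurable_vertH {k : ℝ → ℝ} (mk : Measurable k) (Y : ℝ) : Measurable (vertH k Y) :=
  mk.comp (by fun_prop)

theorem vertH_support {k : ℝ → ℝ} {C : ℝ} (hC : 0 < C) (sk : ∀ r, k r ≠ 0 → C ≤ r ∧ r ≤ 3 * C)
    {Y : ℝ} (hY : 0 < Y) {y : ℝ} (h : vertH k Y y ≠ 0) :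
    1 / (9 * Y * C ^ 2) ≤ y ∧ y ≤ 1 / (Y * C ^ 2) := by
  obtain ⟨h1, h2⟩ := sk _ h
  have h3 : 0 < √(Y * y) := by
    by_contra hne
    have : √(Y * y) = 0 := le_antisymm (not_lt.mp hne) (Real.sqrt_nonneg _)
    rw [this, div_zero] at h1
    linarith
  have h4 : √(Y * y) ^ 2 = Y * y := Real.sq_sqrt (Real.sqrt_pos.mp h3).le
  have hy : 0 < y := by
    have := Real.sqrt_pos.mp h3
    exact (pos_iff_pos_of_mul_pos this).mp hY
  rw [le_div_iff₀ h3] at h1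
  rw [div_le_iff₀ h3] at h2
  constructor
  · rw [div_le_iff₀ (by positivity)]
    have : (1 : ℝ) ^ 2 ≤ (3 * C * √(Y * y)) ^ 2 := pow_le_pow_left₀ zero_le_one h2 2
    rw [mul_pow, h4] at this
    nlinarith
  · rw [le_div_iff₀ (by positivity)]
    have : (C * √(Y * y)) ^ 2 ≤ 1 ^ 2 := pow_le_pow_left₀ (by positivity) h1 2
    rw [mul_pow, h4] at this
    nlinarith

theorem cellW_vert_subst {k : ℝ → ℝ} {C : ℝ}
    (sk : ∀ r, k r ≠ 0 → C ≤ r ∧ r ≤ 3 * C) {Y : ℝ} (hY : 0 < Y) {c : ℝ} (hc : 1 ≤ c) (s : ℝ) :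
    ∫ y : ℝ, cellW (vertF Y (9 * Y * C ^ 2)) (vertH k Y) c (y, s) =
      ∫ r in Set.Ioi 0, 2 * k r / r * √(1 - c ^ 2 * (1 + s ^ 2) / r ^ 2) := by
  have hc0 : 0 < c := by linarith
  rw [← setIntegral_eq_integral_of_forall_compl_eq_zero (s := Set.Ioi 0)]
  · simp only [cellW]
    have hl : 0 < Y / (c ^ 2 * (1 + s ^ 2)) := by positivity
    rw [integral_Ioi_comp_sq (fun y => vertF Y (9 * Y * C ^ 2) y * vertH k Y (etaH c (y, s))) hl]
    refine setIntegral_congr_fun measurableSet_Ioi fun r hr => ?_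
    have hr : 0 < r := hr
    have h1 : vertH k Y (etaH c (Y / (c ^ 2 * (1 + s ^ 2)) * r ^ 2, s)) = k r := by
      rw [vertH, etaH]
      congr 1
      rw [show Y * (1 / (c ^ 2 * (Y / (c ^ 2 * (1 + s ^ 2)) * r ^ 2) * (1 + s ^ 2))) = (1 / r) ^ 2 by
        field_simp, Real.sqrt_sq (by positivity), one_div_one_div]
    simp only [h1]
    by_cases hk : k r = 0
    · simp [hk]
    have hk2 := (sk r hk).2
    have h2 : vertF Y (9 * Y * C ^ 2) (Y / (c ^ 2 * (1 + s ^ 2)) * r ^ 2) =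
        √(1 - c ^ 2 * (1 + s ^ 2) / r ^ 2) := by
      have e : Y / (Y / (c ^ 2 * (1 + s ^ 2)) * r ^ 2) = c ^ 2 * (1 + s ^ 2) / r ^ 2 := by
        field_simp
      by_cases hin : Y ≤ Y / (c ^ 2 * (1 + s ^ 2)) * r ^ 2
      · rw [vertF, Set.indicator_of_mem, e]
        refine ⟨hin, ?_⟩
        have h3 : (1 : ℝ) ≤ c ^ 2 * (1 + s ^ 2) := by nlinarith [sq_nonneg s, sq_nonneg (c * s)]
        calc Y / (c ^ 2 * (1 + s ^ 2)) * r ^ 2 ≤ Y * (3 * C) ^ 2 := by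
              gcongr
              exact div_le_self hY.le h3
          _ = _ := by ring
      · rw [vertF, Set.indicator_of_notMem fun h => hin h.1, ← e, eq_comm]
        refine Real.sqrt_eq_zero_of_nonpos ?_
        rw [sub_nonpos, le_div_iff₀ (by positivity), one_mul]
        exact (not_le.mp hin).le
    rw [h2]
    ring
  · intro y hy
    have : vertF Y (9 * Y * C ^ 2) y = 0 := by
      by_contra hne
      exact hy (hY.trans_le (vertF_support hne).1)
    simp [cellW, this]

theorem integral_cellW_vert {k : ℝ → ℝ} (mk : Measurable k) (bk : ∀ r, |k r| ≤ 1) {C : ℝ}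
    (hC : 0 < C) (sk : ∀ r, k r ≠ 0 → C ≤ r ∧ r ≤ 3 * C) {Y : ℝ} (hY : 0 < Y) {c : ℝ}
    (hc : 1 ≤ c) :
    ∫ p, cellW (vertF Y (9 * Y * C ^ 2)) (vertH k Y) c p = wt k c := by
  have hc0 : 0 < c := by linarith
  have hi := integrable_cellW (measurable_vertF Y (9 * Y * C ^ 2)) (measurable_vertH mk Y) hY
    (Y' := 1 / (9 * Y * C ^ 2)) (R' := 1 / (Y * C ^ 2)) (by positivity) (fun y => vertF_support)
    (fun y => vertH_support hC sk hY) (abs_vertF_le hY) (fun y => bk _) hc0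
  rw [Measure.volume_eq_prod] at hi ⊢
  rw [integral_prod_symm _ hi]
  simp only [cellW_vert_subst sk hY hc]
  set Ψ : ℝ × ℝ → ℝ := fun q => 2 * k q.2 / q.2 * √(1 - c ^ 2 * (1 + q.1 ^ 2) / q.2 ^ 2) with hΨ
  have mΨ : Measurable Ψ := by
    have : Measurable fun q : ℝ × ℝ => k q.2 := mk.comp measurable_snd
    refine Measurable.mul ((this.const_mul 2).div measurable_snd) ?_
    fun_prop
  have hΨs : ∀ q, Ψ q ≠ 0 → q ∈ Set.Icc (-(3 * C)) (3 * C) ×ˢ Set.Icc C (3 * C) := by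
    intro q hq
    have h1 := (div_ne_zero_iff.mp (left_ne_zero_of_mul hq)).1
    have h2 := sk _ (right_ne_zero_of_mul h1)
    refine ⟨?_, h2⟩
    have h3 := right_ne_zero_of_mul hq
    have hq0 : 0 < q.2 := by linarith
    have h4 : c ^ 2 * (1 + q.1 ^ 2) / q.2 ^ 2 < 1 := by
      by_contra hne
      exact h3 (Real.sqrt_eq_zero_of_nonpos (by linarith))
    rw [div_lt_one (by positivity)] at h4
    have h5 : q.1 ^ 2 ≤ (3 * C) ^ 2 := by
      have : q.2 ^ 2 ≤ (3 * C) ^ 2 := pow_le_pow_left₀ hq0.le h2.2 2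
      have : 1 ≤ c ^ 2 := by nlinarith
      nlinarith [sq_nonneg q.1]
    exact abs_le.mp (abs_le_of_sq_le_sq h5 (by positivity))
  have hΨi : Integrable Ψ ((volume : Measure ℝ).prod (volume.restrict (Set.Ioi 0))) := by
    have h1 : IntegrableOn Ψ (Set.Icc (-(3 * C)) (3 * C) ×ˢ Set.Icc C (3 * C)) := by
      refine Measure.integrableOn_of_bounded (M := 2 / C) ?_ mΨ.aestronglyMeasurable ?_
      · exact (isCompact_Icc.prod isCompact_Icc).measure_lt_top.ne
      · refine (ae_restrict_mem (measurableSet_Icc.prod measurableSet_Icc)).mono fun q hq => ?_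
        have hq2 := hq.2.1
        have hq0 : 0 < q.2 := hC.trans_le hq2
        rw [hΨ, norm_mul, norm_div, norm_mul, Real.norm_eq_abs, Real.norm_eq_abs, Real.norm_eq_abs,
          Real.norm_eq_abs, abs_of_pos hq0, abs_two, abs_of_nonneg (Real.sqrt_nonneg _)]
        have h2 : √(1 - c ^ 2 * (1 + q.1 ^ 2) / q.2 ^ 2) ≤ 1 := by
          rw [Real.sqrt_le_one]
          have : 0 ≤ c ^ 2 * (1 + q.1 ^ 2) / q.2 ^ 2 := by positivity
          linarith
        calc 2 * |k q.2| / q.2 * √(1 - c ^ 2 * (1 + q.1 ^ 2) / q.2 ^ 2)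
            ≤ 2 * 1 / C * 1 := by
              have := bk q.2
              gcongr
          _ = 2 / C := by ring
    have h2 : Integrable Ψ := by
      rw [← integrableOn_univ]
      refine h1.of_forall_sdiff_eq_zero MeasurableSet.univ fun q hq => ?_
      by_contra hne
      exact hq.2 (hΨs q hne)
    have h3 : IntegrableOn Ψ (Set.univ ×ˢ Set.Ioi 0) := h2.integrableOn
    rwa [IntegrableOn, Measure.volume_eq_prod, ← Measure.prod_restrict, Measure.restrict_univ] at h3
  rw [integral_integral_swap (f := fun s r => Ψ (s, r)) hΨi, wt, ← integral_const_mul]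
  simp only [hΨ]
  have h4 : ∫ r in Set.Ioi 0, ∫ s : ℝ, 2 * k r / r * √(1 - c ^ 2 * (1 + s ^ 2) / r ^ 2) =
      ∫ r in Set.Ioi 0, (Set.Ioi c).indicator
        (fun r => Real.pi * (k r * (1 / c - c / r ^ 2))) r := by
    refine setIntegral_congr_fun measurableSet_Ioi fun r hr => ?_
    have hr : 0 < r := hr
    rw [integral_const_mul, integral_sqrt_cone hc0 hr]
    by_cases h : c < r
    · rw [if_pos h, Set.indicator_of_mem (Set.mem_Ioi.mpr h)]
      field_simp
    · rw [if_neg h, Set.indicator_of_notMem (by simpa using h), mul_zero]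
  rw [h4, setIntegral_indicator measurableSet_Ioi, Set.Ioi_inter_Ioi, sup_eq_right.mpr hc0.le]

end

end KB

namespace KB

open ModularGroup Matrix.SpecialLinearGroup
open UpperHalfPlane hiding I continuous_re continuous_im
open scoped MatrixGroups Modular ENNReal ContDiff Topology RealInnerProductSpace

noncomputable section

/-- Twist of a sequence by an additive character. -/
def twist (a : ℕ → ℂ) (t : ℝ) (m : ℕ) : ℂ := a m * eAdd (m * t)

theorem tp_add_eq (S : Finset ℕ) (a : ℕ → ℂ) (x t : ℝ) : tp S a (x + t) = tp S (twist a t) x := by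
  unfold tp twist
  refine Finset.sum_congr rfl fun m _ => ?_
  rw [mul_add, eAdd_add]
  ring

theorem norm_twist (a : ℕ → ℂ) (t : ℝ) (m : ℕ) : ‖twist a t m‖ = ‖a m‖ := by
  rw [twist, norm_mul, norm_eAdd, mul_one]

theorem norm_eAdd_sub_one_le (x : ℝ) : ‖eAdd x - 1‖ ≤ 2 * Real.pi * |x| := by
  rw [eAdd, show 2 * (Real.pi : ℂ) * I * x = I * ((2 * Real.pi * x : ℝ) : ℂ) by push_cast; ring]
  refine (Real.norm_exp_I_mul_ofReal_sub_one_le).trans (le_of_eq ?_)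
  rw [Real.norm_eq_abs, abs_mul, abs_of_pos Real.two_pi_pos]

theorem norm_twist_sub_le (a : ℕ → ℂ) (t : ℝ) {m : ℕ} {M : ℝ} (hm : (m : ℝ) ≤ 3 * M) :
    ‖twist a t m - a m‖ ≤ 24 * M * |t| * ‖a m‖ := by
  rw [twist, show a m * eAdd (m * t) - a m = a m * (eAdd (m * t) - 1) by ring, norm_mul,
    mul_comm]
  refine mul_le_mul_of_nonneg_right ((norm_eAdd_sub_one_le _).trans ?_) (norm_nonneg _)
  rw [abs_mul, Nat.abs_cast]
  calc 2 * Real.pi * (m * |t|) ≤ 2 * 4 * (3 * M * |t|) := by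
        have := Real.pi_le_four
        gcongr
    _ = _ := by ring

theorem sum_norm_twist_sub_sq_le {S : Finset ℕ} {M α : ℝ} (hM : 0 ≤ M)
    (hS : ∀ m ∈ S, (m : ℝ) ≤ 3 * M) {a : ℕ → ℂ} (ha : ∑ m ∈ S, ‖a m‖ ^ 2 ≤ α ^ 2) {t T : ℝ}
    (ht : |t| ≤ T) : ∑ m ∈ S, ‖twist a t m - a m‖ ^ 2 ≤ (24 * M * T * α) ^ 2 := by
  calc ∑ m ∈ S, ‖twist a t m - a m‖ ^ 2 ≤ ∑ m ∈ S, (24 * M * T) ^ 2 * ‖a m‖ ^ 2 := by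
        refine Finset.sum_le_sum fun m hm => ?_
        rw [← mul_pow]
        refine pow_le_pow_left₀ (norm_nonneg _) ((norm_twist_sub_le a t (hS m hm)).trans ?_) 2
        gcongr
    _ = (24 * M * T) ^ 2 * ∑ m ∈ S, ‖a m‖ ^ 2 := by rw [Finset.mul_sum]
    _ ≤ (24 * M * T) ^ 2 * α ^ 2 := by gcongr
    _ = _ := by ring

theorem bilin_sub_left (S S' : Finset ℕ) (a a' b : ℕ → ℂ) (σ : ℤ) (c : ℕ) :
    bilin S S' (fun m => a m - a' m) b σ c = bilin S S' a b σ c - bilin S S' a' b σ c := by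
  simp only [bilin, sub_mul, Finset.sum_sub_distrib]

theorem bilin_sub_right (S S' : Finset ℕ) (a b b' : ℕ → ℂ) (σ : ℤ) (c : ℕ) :
    bilin S S' a (fun m => b m - b' m) σ c = bilin S S' a b σ c - bilin S S' a b' σ c := by
  simp only [bilin, mul_sub, sub_mul, Finset.sum_sub_distrib]

theorem sum_norm_bilin_twist_sub_le {q : ℕ} (hq : 1 ≤ q) {D : Finset ℕ}
    (hD : ∀ c ∈ D, q ≤ c ∧ c ≤ 2 * q) {M N : ℝ} (hN : 1 / 3 ≤ N) (hNM : N ≤ M) {S S' : Finset ℕ}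
    (hS : ∀ m ∈ S, (m : ℝ) ≤ 3 * M) (hS' : ∀ n ∈ S', (n : ℝ) ≤ 3 * N) {σ : ℤ}
    (hσ : σ = 1 ∨ σ = -1) {a b : ℕ → ℂ} {α β : ℝ} (hα : 0 ≤ α) (hβ : 0 ≤ β)
    (ha : ∑ m ∈ S, ‖a m‖ ^ 2 ≤ α ^ 2) (hb : ∑ n ∈ S', ‖b n‖ ^ 2 ≤ β ^ 2) (t : ℝ) {u : ℕ → ℝ} {U : ℝ}
    (hu : ∀ c ∈ D, |u c| ≤ U) (hU : 0 ≤ U) :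
    ∑ c ∈ D, ‖bilin S S' (twist a t) (twist b (u c)) σ c - bilin S S' a b σ c‖ ≤
      if (q : ℝ) ≤ √(M * N) then 36000 * (q * √(M * N)) * (α * β)
      else 432000 * q ^ 2 * (M * |t| + N * U) * (α * β) := by
  have hM0 : 0 < M := by linarith
  have hN0 : 0 < N := by linarith
  have hD' : ∀ c ∈ D, 1 ≤ c ∧ c ≤ 2 * q := fun c hc => ⟨hq.trans (hD c hc).1, (hD c hc).2⟩
  have h2q : 1 ≤ 2 * q := by omega
  have hat : ∑ m ∈ S, ‖twist a t m‖ ^ 2 ≤ α ^ 2 := by simpa only [norm_twist] using ha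
  have hbt : ∀ c ∈ D, ∑ n ∈ S', ‖twist b (u c) n‖ ^ 2 ≤ β ^ 2 := fun c _ => by
    simpa only [norm_twist] using hb
  split_ifs with h
  · have h1 := sum_norm_bilin_le h2q hD' hN hNM hS hS' hσ (twist a t) (fun c => twist b (u c)) hα hβ
      hat hbt
    have h2 := sum_norm_bilin_le h2q hD' hN hNM hS hS' hσ a (fun _ => b) hα hβ ha fun _ _ => hb
    calc ∑ c ∈ D, ‖bilin S S' (twist a t) (twist b (u c)) σ c - bilin S S' a b σ c‖
        ≤ ∑ c ∈ D, (‖bilin S S' (twist a t) (twist b (u c)) σ c‖ + ‖bilin S S' a b σ c‖) :=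
          Finset.sum_le_sum fun c _ => norm_sub_le _ _
      _ ≤ 3000 * (((2 * q : ℕ) : ℝ) * ((2 * q : ℕ) + √(M * N))) * (α * β) +
          3000 * (((2 * q : ℕ) : ℝ) * ((2 * q : ℕ) + √(M * N))) * (α * β) := by
          rw [Finset.sum_add_distrib]
          exact add_le_add h1 h2
      _ = 12000 * (q * (2 * q + √(M * N))) * (α * β) := by push_cast; ring
      _ ≤ 12000 * (q * (2 * √(M * N) + √(M * N))) * (α * β) := by gcongr
      _ = _ := by ring
  · have hR : √(M * N) ≤ q := (not_le.mp h).le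
    have h1 := sum_norm_bilin_le h2q hD' hN hNM hS hS' hσ (fun m => twist a t m - a m)
      (fun c => twist b (u c)) (by positivity : 0 ≤ 24 * M * |t| * α) hβ
      (sum_norm_twist_sub_sq_le hM0.le hS ha le_rfl) hbt
    have h2 := sum_norm_bilin_le h2q hD' hN hNM hS hS' hσ a (fun c n => twist b (u c) n - b n) hα
      (by positivity : 0 ≤ 24 * N * U * β) ha fun c hc =>
        sum_norm_twist_sub_sq_le hN0.le hS' hb (hu c hc)
    calc ∑ c ∈ D, ‖bilin S S' (twist a t) (twist b (u c)) σ c - bilin S S' a b σ c‖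
        ≤ ∑ c ∈ D, (‖bilin S S' (fun m => twist a t m - a m) (twist b (u c)) σ c‖ +
            ‖bilin S S' a (fun n => twist b (u c) n - b n) σ c‖) := by
          refine Finset.sum_le_sum fun c _ => ?_
          rw [bilin_sub_left, bilin_sub_right]
          refine (le_of_eq ?_).trans (norm_add_le _ _)
          congr 1
          ring
      _ ≤ 3000 * (((2 * q : ℕ) : ℝ) * ((2 * q : ℕ) + √(M * N))) * (24 * M * |t| * α * β) +
          3000 * (((2 * q : ℕ) : ℝ) * ((2 * q : ℕ) + √(M * N))) * (α * (24 * N * U * β)) := by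
          rw [Finset.sum_add_distrib]
          exact add_le_add h1 h2
      _ = 144000 * (q * (2 * q + √(M * N))) * (M * |t| + N * U) * (α * β) := by push_cast; ring
      _ ≤ 144000 * (q * (2 * q + q)) * (M * |t| + N * U) * (α * β) := by gcongr
      _ = _ := by ring

theorem sum_reds_tp_mul_tp (S S' : Finset ℕ) (a b : ℕ → ℂ) {σ : ℤ} (c : ℕ)
    (t u : ℝ) : ∑ d ∈ reds c, tp S a ((-1 : ℤ) * (t - d / c)) * tp S' b (σ * (invRes c d / c - u)) =
      bilin S S' (twist a (-t)) (twist b (-(σ * u))) σ c := by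
  rw [bilin_eq]
  refine Finset.sum_congr rfl fun d _ => ?_
  rw [← tp_add_eq, ← tp_add_eq]
  congr 2
  · push_cast; ring
  · ring

theorem exists_bound_tp (S : Finset ℕ) (a : ℕ → ℂ) : ∃ B, ∀ x, ‖tp S a x‖ ≤ B := by
  refine ⟨∑ m ∈ S, ‖a m‖, fun x => (norm_sum_le _ _).trans (Finset.sum_le_sum fun m _ => ?_)⟩
  rw [norm_mul, norm_eAdd, mul_one]

/-- The twisted bilinear form occurring in the Bruhat cell of modulus `c`. -/
def twBilin (S S' : Finset ℕ) (a b : ℕ → ℂ) (σ : ℤ) (c : ℕ) (p : ℝ × ℝ) : ℂ :=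
  bilin S S' (twist a (-(p.1 * p.2))) (twist b (-(σ * (p.2 * etaH c p)))) σ c

theorem integrable_cellW_twBilin (S S' : Finset ℕ) (a b : ℕ → ℂ) (σ : ℤ) (c : ℕ) {w : ℝ × ℝ → ℝ}
    (hw : Integrable w) : Integrable fun p => w p • twBilin S S' a b σ c p := by
  obtain ⟨α, hα⟩ := exists_bound_tp S a
  obtain ⟨β, hβ⟩ := exists_bound_tp S' b
  have h1 : (fun p => w p • twBilin S S' a b σ c p) = fun p => ∑ d ∈ reds c,
      w p • (tp S a ((-1 : ℤ) * (p.1 * p.2 - d / c)) *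
        tp S' b (σ * (invRes c d / c - p.2 * etaH c p))) := by
    ext p
    rw [← Finset.smul_sum, sum_reds_tp_mul_tp, twBilin]
  rw [h1]
  refine integrable_finsetSum _ fun d _ => ?_
  exact integrable_mul_cellW hw (A := fun x => tp S a ((-1 : ℤ) * x)) (B := fun x => tp S' b (σ * x))
    ((continuous_tp S a).comp (by fun_prop)) ((continuous_tp S' b).comp (by fun_prop))
    (fun x => hα _) (fun x => hβ _) c d (invRes c d)

theorem sum_cellZ_eq (S S' : Finset ℕ) (a b : ℕ → ℂ) (σ : ℤ) (c : ℕ) {f h : ℝ → ℝ}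
    (hw : Integrable (cellW f h c)) :
    ∑ d ∈ reds c, cellZ (fun x => tp S a ((-1 : ℤ) * x)) (fun x => tp S' b (σ * x)) f h c d
      (invRes c d) = ∫ p, cellW f h c p • twBilin S S' a b σ c p := by
  obtain ⟨α, hα⟩ := exists_bound_tp S a
  obtain ⟨β, hβ⟩ := exists_bound_tp S' b
  unfold cellZ
  rw [← integral_finsetSum]
  · refine integral_congr_ae (ae_of_all _ fun p => ?_)
    simp only
    rw [← Finset.sum_mul, sum_reds_tp_mul_tp, twBilin, Complex.real_smul, mul_comm]
  · intro d _
    refine (integrable_mul_cellW hw (A := fun x => tp S a ((-1 : ℤ) * x))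
      (B := fun x => tp S' b (σ * x)) ((continuous_tp S a).comp (by fun_prop))
      ((continuous_tp S' b).comp (by fun_prop)) (fun x => hα _) (fun x => hβ _) c d
      (invRes c d)).congr (ae_of_all _ fun p => ?_)
    simp only
    rw [Complex.real_smul, mul_comm]

end

end KB

namespace KB

open ModularGroup Matrix.SpecialLinearGroup
open UpperHalfPlane hiding I continuous_re continuous_im
open scoped MatrixGroups Modular ENNReal ContDiff Topology RealInnerProductSpace

noncomputable section

/-- The region of integration, and its majorant, for the moduli in a dyadic block. -/
def majReg (Y R L : ℝ) : Set (ℝ × ℝ) := {p | (Y ≤ p.1 ∧ p.1 ≤ R) ∧ p.2 ^ 2 ≤ L ^ 2 * Y / p.1}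

def majF (Y R L : ℝ) : ℝ × ℝ → ℝ := (majReg Y R L).indicator fun p => 1 / √(L ^ 2 * Y * p.1)

theorem measurableSet_majReg (Y R L : ℝ) : MeasurableSet (majReg Y R L) := by
  refine MeasurableSet.inter (MeasurableSet.inter ?_ ?_) ?_
  · exact measurableSet_le measurable_const measurable_fst
  · exact measurableSet_le measurable_fst measurable_const
  · exact measurableSet_le (measurable_snd.pow_const 2) (measurable_const.div measurable_fst)

theorem integrable_majF {Y R L : ℝ} (hY : 0 < Y) (hL : 0 < L) : Integrable (majF Y R L) := by
  have hsub : majReg Y R L ⊆ Set.Icc Y R ×ˢ Set.Icc (-L) L := by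
    intro p hp
    refine ⟨hp.1, abs_le.mp (abs_le_of_sq_le_sq (hp.2.trans ?_) hL.le)⟩
    have hy : 0 < p.1 := hY.trans_le hp.1.1
    rw [div_le_iff₀ hy]
    have := hp.1.1
    gcongr
  rw [majF, integrable_indicator_iff (measurableSet_majReg Y R L)]
  refine Measure.integrableOn_of_bounded (M := 1 / √(L ^ 2 * Y * Y)) ?_ ?_ ?_
  · exact ((measure_mono hsub).trans_lt (isCompact_Icc.prod isCompact_Icc).measure_lt_top).ne
  · exact Measurable.aestronglyMeasurable (by fun_prop)
  · refine (ae_restrict_mem (measurableSet_majReg Y R L)).mono fun p hp => ?_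
    have := hp.1.1
    rw [Real.norm_eq_abs, abs_of_nonneg (by positivity)]
    gcongr

theorem integral_majF {Y R L : ℝ} (hY : 0 < Y) (hYR : Y ≤ R) (hL : 0 < L) :
    ∫ p, majF Y R L p = 2 * Real.log (R / Y) := by
  have hi := integrable_majF (R := R) hY hL
  rw [Measure.volume_eq_prod] at hi ⊢
  rw [integral_prod _ hi]
  have h1 : ∀ y : ℝ, ∫ s : ℝ, majF Y R L (y, s) = (Set.Icc Y R).indicator (fun y => 2 * y⁻¹) y := by
    intro y
    by_cases hy : y ∈ Set.Icc Y R
    · have hy0 : 0 < y := hY.trans_le hy.1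
      rw [Set.indicator_of_mem hy]
      have h2 : (fun s : ℝ => majF Y R L (y, s)) = (Set.Icc (-√(L ^ 2 * Y / y)) √(L ^ 2 * Y / y)).indicator
          fun _ => 1 / √(L ^ 2 * Y * y) := by
        ext s
        have hiff : s ∈ Set.Icc (-√(L ^ 2 * Y / y)) √(L ^ 2 * Y / y) ↔ s ^ 2 ≤ L ^ 2 * Y / y := by
          rw [Set.mem_Icc, ← abs_le, ← Real.sqrt_sq_eq_abs, Real.sqrt_le_sqrt_iff (by positivity)]
        by_cases hs : s ^ 2 ≤ L ^ 2 * Y / y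
        · rw [Set.indicator_of_mem (hiff.mpr hs)]
          exact Set.indicator_of_mem (show (y, s) ∈ majReg Y R L from ⟨hy, hs⟩) _
        · rw [Set.indicator_of_notMem (mt hiff.mp hs)]
          exact Set.indicator_of_notMem (fun h : (y, s) ∈ majReg Y R L => hs h.2) _
      rw [h2, integral_indicator measurableSet_Icc, setIntegral_const, measureReal_def,
        Real.volume_Icc, ENNReal.toReal_ofReal (by linarith [Real.sqrt_nonneg (L ^ 2 * Y / y)]),
        smul_eq_mul]
      have h3 : √(L ^ 2 * Y * y) = y * √(L ^ 2 * Y / y) := by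
        rw [show L ^ 2 * Y * y = y ^ 2 * (L ^ 2 * Y / y) by field_simp, Real.sqrt_mul (by positivity),
          Real.sqrt_sq hy0.le]
      rw [h3]
      have : 0 < √(L ^ 2 * Y / y) := Real.sqrt_pos.mpr (by positivity)
      field_simp
      ring
    · rw [Set.indicator_of_notMem hy]
      refine integral_eq_zero_of_ae (ae_of_all _ fun s => ?_)
      exact Set.indicator_of_notMem (fun h => hy h.1) _
  simp only [h1]
  rw [integral_indicator measurableSet_Icc, integral_Icc_eq_integral_Ioc,
    ← intervalIntegral.integral_of_le hYR, intervalIntegral.integral_const_mul,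
    integral_inv_of_pos hY (hY.trans_le hYR)]

theorem phase_arith {q L C Y M N ρ y t X P : ℝ} (hC : 0 < C) (hY : 0 < Y) (hM : 0 < M)
    (hN : 0 < N) (hL : 0 < L) (hP : 0 ≤ P) (hqL : q * L = 3 * C) (hρ : 0 < ρ) (hρL : ρ ≤ L)
    (ht : |t| ≤ ρ) (hy : 0 < y) (hρ2 : ρ ^ 2 * y = L ^ 2 * Y) (hMY : M * Y * C ^ 2 = X)
    (hNY : N / Y = X) (hX : 0 ≤ X) :
    432000 * q ^ 2 * (M * (y * |t|) + N * (|t| / (Y * C ^ 2))) * P * ρ ≤ 10 ^ 7 * X * P := by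
  have hL2 : q ^ 2 * L ^ 2 = 9 * C ^ 2 := by rw [← mul_pow, hqL]; ring
  have h1 : 432000 * q ^ 2 * (M * (y * |t|) + N * (|t| / (Y * C ^ 2))) * P * ρ ≤
      432000 * q ^ 2 * (M * (y * ρ) + N * (ρ / (Y * C ^ 2))) * P * ρ := by gcongr
  have h2 : 432000 * q ^ 2 * (M * (y * ρ) + N * (ρ / (Y * C ^ 2))) * P * ρ =
      432000 * (M * (q ^ 2 * (ρ ^ 2 * y)) + q ^ 2 * (N / Y) * (ρ * ρ) / C ^ 2) * P := by
    field_simp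
  have h3 : 432000 * (M * (q ^ 2 * (ρ ^ 2 * y)) + q ^ 2 * (N / Y) * (ρ * ρ) / C ^ 2) * P ≤
      432000 * (M * (q ^ 2 * (ρ ^ 2 * y)) + q ^ 2 * (N / Y) * (L * L) / C ^ 2) * P := by
    have : 0 < N / Y := by positivity
    gcongr
  have h4 : 432000 * (M * (q ^ 2 * (ρ ^ 2 * y)) + q ^ 2 * (N / Y) * (L * L) / C ^ 2) * P =
      432000 * (9 * (M * Y * C ^ 2) + 9 * (N / Y)) * P := by
    have e1 : q ^ 2 * (N / Y) * (L * L) / C ^ 2 = 9 * (N / Y) := by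
      rw [show q ^ 2 * (N / Y) * (L * L) = (q ^ 2 * L ^ 2) * (N / Y) by ring, hL2]
      field_simp
    have e2 : M * (q ^ 2 * (ρ ^ 2 * y)) = 9 * (M * Y * C ^ 2) := by
      rw [hρ2, show M * (q ^ 2 * (L ^ 2 * Y)) = M * ((q ^ 2 * L ^ 2) * Y) by ring, hL2]
      ring
    rw [e1, e2]
  have h6 : 432000 * (9 * (M * Y * C ^ 2) + 9 * (N / Y)) * P = 7776000 * X * P := by
    rw [hMY, hNY]; ring
  have h5 : 0 ≤ X * P := mul_nonneg hX hP
  refine h1.trans (h2.trans_le (h3.trans (h4.trans_le (h6.trans_le ?_))))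
  linarith

theorem norm_sum_phase_le {q : ℕ} (hq : 1 ≤ q) {D : Finset ℕ} (hD : ∀ c ∈ D, q ≤ c ∧ c ≤ 2 * q)
    {M N : ℝ} (hN : 1 / 3 ≤ N) (hNM : N ≤ M) {S S' : Finset ℕ}
    (hS : ∀ m ∈ S, (m : ℝ) ≤ 3 * M) (hS' : ∀ n ∈ S', (n : ℝ) ≤ 3 * N) {σ : ℤ}
    (hσ : σ = 1 ∨ σ = -1) {a b : ℕ → ℂ} {α β : ℝ} (hα : 0 ≤ α) (hβ : 0 ≤ β)
    (ha : ∑ m ∈ S, ‖a m‖ ^ 2 ≤ α ^ 2) (hb : ∑ n ∈ S', ‖b n‖ ^ 2 ≤ β ^ 2)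
    {k : ℝ → ℝ} (mk : Measurable k) (bk : ∀ r, |k r| ≤ 1) {C : ℝ} (hC : 1 / 3 ≤ C)
    (sk : ∀ r, k r ≠ 0 → C ≤ r ∧ r ≤ 3 * C) {Y : ℝ} (hY : Y = √(N / M) / C) :
    ‖∑ c ∈ D, ((∫ p, cellW (vertF Y (9 * Y * C ^ 2)) (vertH k Y) c p • twBilin S S' a b σ c p) -
      wt k c • bilin S S' a b σ c)‖ ≤
      10 ^ 7 * (C * √(M * N)) * (α * β) * (2 * Real.log (9 * C ^ 2)) := by
  have hM0 : 0 < M := by linarith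
  have hN0 : 0 < N := by linarith
  have hC0 : 0 < C := by linarith
  have hY0 : 0 < Y := by rw [hY]; have := Real.sqrt_pos.mpr (div_pos hN0 hM0); positivity
  have hq1 : (1 : ℝ) ≤ q := by exact_mod_cast hq
  have hMY : M * Y * C ^ 2 = C * √(M * N) := by
    have : √(M * N) = M * √(N / M) := by
      rw [show M * N = M ^ 2 * (N / M) by field_simp, Real.sqrt_mul (by positivity),
        Real.sqrt_sq hM0.le]
    rw [this, hY]; field_simp
  have hNY : N / Y = C * √(M * N) := by
    have h1 : √(M * N) * √(N / M) = N := by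
      rw [← Real.sqrt_mul (by positivity), show M * N * (N / M) = N ^ 2 by field_simp,
        Real.sqrt_sq hN0.le]
    have := Real.sqrt_pos.mpr (div_pos hN0 hM0)
    rw [hY]
    nth_rewrite 1 [← h1]
    field_simp
  set L := 3 * C / q with hL
  have hL0 : 0 < L := by positivity
  set f := vertF Y (9 * Y * C ^ 2)
  set h := vertH k Y
  have hY' : 0 < 1 / (9 * Y * C ^ 2) := by positivity
  have sf : ∀ y, f y ≠ 0 → Y ≤ y ∧ y ≤ 9 * Y * C ^ 2 := fun y => vertF_support
  have sh : ∀ y, h y ≠ 0 → 1 / (9 * Y * C ^ 2) ≤ y ∧ y ≤ 1 / (Y * C ^ 2) :=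
    fun y => vertH_support hC0 sk hY0
  have bf : ∀ y, |f y| ≤ 1 := abs_vertF_le hY0
  have bh : ∀ y, |h y| ≤ 1 := fun y => bk _
  have hw : ∀ c ∈ D, Integrable (cellW f h c) := fun c hc =>
    integrable_cellW (measurable_vertF _ _) (measurable_vertH mk Y) hY0 hY' sf sh bf bh (by
      have := (hD c hc).1; exact_mod_cast (by omega : 0 < c))
  have hterm : ∀ c ∈ D, (∫ p, cellW f h c p • twBilin S S' a b σ c p) -
      wt k c • bilin S S' a b σ c =
        ∫ p, cellW f h c p • (twBilin S S' a b σ c p - bilin S S' a b σ c) := by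
    intro c hc
    have hc1 : (1 : ℝ) ≤ c := by have := (hD c hc).1; exact_mod_cast hq.trans this
    rw [← integral_cellW_vert mk bk hC0 sk hY0 hc1, ← integral_smul_const, ← integral_sub
      (integrable_cellW_twBilin S S' a b σ c (hw c hc)) ((hw c hc).smul_const _)]
    simp only [smul_sub]
  have hintegr : ∀ c ∈ D, Integrable fun p =>
      cellW f h c p • (twBilin S S' a b σ c p - bilin S S' a b σ c) := by
    intro c hc
    simp only [smul_sub]
    exact (integrable_cellW_twBilin S S' a b σ c (hw c hc)).sub ((hw c hc).smul_const _)
  rw [Finset.sum_congr rfl hterm, ← integral_finsetSum _ hintegr]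
  have hlog : 2 * Real.log (9 * C ^ 2) = ∫ p, majF Y (9 * Y * C ^ 2) L p := by
    rw [integral_majF hY0 _ hL0]
    · congr 2; field_simp
    · have h1 : 1 ≤ 9 * C ^ 2 := by nlinarith
      calc Y ≤ Y * (9 * C ^ 2) := le_mul_of_one_le_right hY0.le h1
        _ = _ := by ring
  rw [hlog, ← integral_const_mul]
  refine norm_integral_le_of_norm_le ((integrable_majF hY0 hL0).const_mul _) (ae_of_all _ fun p => ?_)
  set D' := D.filter fun c : ℕ => cellW f h c p ≠ 0 with hD'
  have hsupp : ∀ c ∈ D', Y ≤ p.1 ∧ p ∈ majReg Y (9 * Y * C ^ 2) L ∧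
      etaH c p ≤ 1 / (Y * C ^ 2) := by
    intro c hc
    obtain ⟨hcD, hcw⟩ := Finset.mem_filter.mp hc
    have hcq : (q : ℝ) ≤ c := by exact_mod_cast (hD c hcD).1
    have hc0 : (0 : ℝ) < c := by linarith
    obtain ⟨h1, h2, h3, h4⟩ := cellW_support hY0 hY' sf sh hc0 hcw
    refine ⟨h1, ⟨⟨h1, h2⟩, ?_⟩, h4⟩
    have hy0 : 0 < p.1 := hY0.trans_le h1
    rw [le_div_iff₀ hy0]
    calc p.2 ^ 2 * p.1 ≤ p.1 * (1 + p.2 ^ 2) := by nlinarith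
      _ ≤ 1 / (c ^ 2 * (1 / (9 * Y * C ^ 2))) := h3
      _ ≤ 1 / (q ^ 2 * (1 / (9 * Y * C ^ 2))) := by gcongr
      _ = L ^ 2 * Y := by rw [hL]; field_simp; norm_num
  rcases D'.eq_empty_or_nonempty with he | ⟨c₀, hc₀⟩
  · have : ∑ c ∈ D, cellW f h c p • (twBilin S S' a b σ c p - bilin S S' a b σ c) = 0 := by
      refine Finset.sum_eq_zero fun c hc => ?_
      have : cellW f h c p = 0 := by
        by_contra hne
        exact Finset.notMem_empty c (he ▸ Finset.mem_filter.mpr ⟨hc, hne⟩)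
      rw [this, zero_smul]
    rw [this, norm_zero]
    have : 0 ≤ majF Y (9 * Y * C ^ 2) L p := Set.indicator_nonneg (fun p _ => by positivity) p
    positivity
  obtain ⟨hyY, hreg, -⟩ := hsupp c₀ hc₀
  have hy0 : 0 < p.1 := hY0.trans_le hyY
  have hu : ∀ c ∈ D', |-(σ * (p.2 * etaH c p))| ≤ |p.2| / (Y * C ^ 2) := by
    intro c hc
    have h1 : |(σ : ℝ)| = 1 := by rcases hσ with rfl | rfl <;> simp
    have h2 : 0 ≤ etaH c p := by unfold etaH; positivity
    rw [abs_neg, abs_mul, abs_mul, h1, one_mul, abs_of_nonneg h2, div_eq_mul_one_div]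
    have := (hsupp c hc).2.2
    gcongr
  have hbd := sum_norm_bilin_twist_sub_le hq (D := D') (fun c hc => hD c (Finset.mem_of_mem_filter c hc))
    hN hNM hS hS' hσ hα hβ ha hb (-(p.1 * p.2)) hu (by positivity)
  have hle : ‖∑ c ∈ D, cellW f h c p • (twBilin S S' a b σ c p - bilin S S' a b σ c)‖ ≤
      1 / p.1 * ∑ c ∈ D', ‖twBilin S S' a b σ c p - bilin S S' a b σ c‖ := by
    refine (norm_sum_le _ _).trans ?_
    rw [hD', Finset.sum_filter, Finset.mul_sum]
    refine Finset.sum_le_sum fun c hc => ?_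
    split_ifs with hcw
    · rw [norm_smul, Real.norm_eq_abs]
      refine mul_le_mul_of_nonneg_right (abs_cellW_le hY0 hY' sf sh bf bh ?_ hcw) (norm_nonneg _)
      have := (hD c hc).1; exact_mod_cast (by omega : 0 < c)
    · rw [not_not] at hcw
      rw [hcw, zero_smul, norm_zero, mul_zero]
  refine hle.trans ?_
  set ρ := √(L ^ 2 * Y / p.1) with hρ
  have hρ0 : 0 < ρ := Real.sqrt_pos.mpr (by positivity)
  have hρ2 : ρ ^ 2 * p.1 = L ^ 2 * Y := by
    rw [hρ, Real.sq_sqrt (by positivity)]; field_simp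
  have hsρ : |p.2| ≤ ρ := Real.abs_le_sqrt hreg.2
  have hρL : ρ ≤ L := by
    refine Real.sqrt_le_iff.mpr ⟨hL0.le, ?_⟩
    rw [div_le_iff₀ hy0]; gcongr
  have hmaj : majF Y (9 * Y * C ^ 2) L p = 1 / (p.1 * ρ) := by
    rw [majF, Set.indicator_of_mem hreg]
    congr 1
    rw [hρ, show L ^ 2 * Y * p.1 = p.1 ^ 2 * (L ^ 2 * Y / p.1) by field_simp,
      Real.sqrt_mul (by positivity), Real.sqrt_sq hy0.le]
  set X := C * √(M * N) with hX
  have hX0 : 0 ≤ X := by positivity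
  have hqL : q * L = 3 * C := by rw [hL]; field_simp
  rw [hmaj, mul_one_div, div_mul_eq_mul_div, one_mul, div_le_div_iff₀ hy0 (by positivity)]
  suffices hsuff : (∑ c ∈ D', ‖twBilin S S' a b σ c p - bilin S S' a b σ c‖) * ρ ≤
      10 ^ 7 * X * (α * β) by
    calc (∑ c ∈ D', ‖twBilin S S' a b σ c p - bilin S S' a b σ c‖) * (p.1 * ρ) =
        ((∑ c ∈ D', ‖twBilin S S' a b σ c p - bilin S S' a b σ c‖) * ρ) * p.1 := by ring
      _ ≤ _ := by gcongr
  refine (mul_le_mul_of_nonneg_right hbd hρ0.le).trans ?_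
  split_ifs with hqM
  · calc 36000 * (q * √(M * N)) * (α * β) * ρ ≤ 36000 * (q * √(M * N)) * (α * β) * L := by gcongr
      _ = 36000 * ((q * L) * √(M * N)) * (α * β) := by ring
      _ = 108000 * X * (α * β) := by rw [hqL, hX]; ring
      _ ≤ 10 ^ 7 * X * (α * β) := by
        have : 0 ≤ X * (α * β) := by positivity
        nlinarith
  · have hab : |-(p.1 * p.2)| = p.1 * |p.2| := by rw [abs_neg, abs_mul, abs_of_pos hy0]
    rw [hab]
    exact phase_arith hC0 hY0 hM0 hN0 hL0 (mul_nonneg hα hβ) hqL hρ0 hρL hsρ hy0 hρ2 hMY hNY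
      (by positivity)

end

end KB

namespace KB

open ModularGroup Matrix.SpecialLinearGroup
open UpperHalfPlane hiding I continuous_re continuous_im
open scoped MatrixGroups Modular ENNReal ContDiff Topology RealInnerProductSpace

noncomputable section


theorem eAdd_div_congr {c : ℕ} {x y : ℤ} (h : (x : ZMod c) = y) :
    eAdd ((x : ℝ) / c) = eAdd ((y : ℝ) / c) := by
  rcases Nat.eq_zero_or_pos c with rfl | hc
  · simp
  obtain ⟨t, ht⟩ := (ZMod.intCast_eq_intCast_iff_dvd_sub _ _ _).mp h
  have h1 : (y : ℝ) / c = x / c + (t : ℤ) := by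
    have h2 : (y : ℝ) = x + c * t := by
      have : y = x + c * t := by linarith
      exact_mod_cast this
    have : (c : ℝ) ≠ 0 := by positivity
    rw [h2]; field_simp
  rw [h1, eAdd_add, eAdd_int, mul_one]

theorem kloostermanS_swap (m n : ℕ) {σ : ℤ} (hσ : σ = 1 ∨ σ = -1) (c : ℕ) :
    kloostermanS m (σ * n) c = kloostermanS n (σ * m) c := by
  rcases Nat.eq_zero_or_pos c with rfl | hc
  · simp [kloostermanS]
  have : NeZero c := ⟨hc.ne'⟩
  have hσ2 : (σ : ZMod c) * σ = 1 := by rcases hσ with rfl | rfl <;> simp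
  have key : ∀ x : ℕ, Nat.Coprime x c →
      ((((σ : ZMod c) * (x : ZMod c)⁻¹).val : ℕ) : ZMod c) = σ * (x : ZMod c)⁻¹ := fun x _ =>
    ZMod.natCast_zmod_val _
  have keyi : ∀ x : ℕ, Nat.Coprime x c → ((σ : ZMod c) * (x : ZMod c)⁻¹)⁻¹ = σ * x := by
    intro x hx
    refine (ZMod.inv_eq_of_mul_eq_one c _ _ ?_)
    have := ZMod.coe_mul_inv_eq_one x hx
    linear_combination (x : ZMod c) * (x : ZMod c)⁻¹ * hσ2 + this
  have hmem : ∀ x ∈ (Finset.range c).filter fun x => Nat.Coprime x c,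
      ((σ : ZMod c) * (x : ZMod c)⁻¹).val ∈ (Finset.range c).filter fun x => Nat.Coprime x c := by
    intro x hx
    have hx2 := (Finset.mem_filter.mp hx).2
    refine Finset.mem_filter.mpr ⟨Finset.mem_range.mpr (ZMod.val_lt _), ?_⟩
    rw [← ZMod.isUnit_iff_coprime, key x hx2]
    refine IsUnit.of_mul_eq_one (σ * (x : ZMod c)) ?_
    have := ZMod.coe_mul_inv_eq_one x hx2
    linear_combination (x : ZMod c) * (x : ZMod c)⁻¹ * hσ2 + this
  have hinv : ∀ x ∈ (Finset.range c).filter fun x => Nat.Coprime x c,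
      ((σ : ZMod c) * ((((σ : ZMod c) * (x : ZMod c)⁻¹).val : ℕ) : ZMod c)⁻¹).val = x := by
    intro x hx
    have hx2 := (Finset.mem_filter.mp hx).2
    rw [key x hx2, keyi x hx2, ← mul_assoc, hσ2, one_mul,
      ZMod.val_cast_of_lt (Finset.mem_range.mp (Finset.mem_filter.mp hx).1)]
  unfold kloostermanS
  refine Finset.sum_nbij' (fun x => ((σ : ZMod c) * (x : ZMod c)⁻¹).val)
    (fun x => ((σ : ZMod c) * (x : ZMod c)⁻¹).val) hmem hmem hinv hinv fun x hx => ?_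
  have hx2 := (Finset.mem_filter.mp hx).2
  refine eAdd_div_congr ?_
  push_cast
  rw [key x hx2, keyi x hx2, ZMod.natCast_zmod_val, ZMod.natCast_zmod_val]
  linear_combination (-(m : ZMod c) * x) * hσ2

theorem bilin_swap (S S' : Finset ℕ) (a b : ℕ → ℂ) {σ : ℤ} (hσ : σ = 1 ∨ σ = -1) (c : ℕ) :
    bilin S S' a b σ c = bilin S' S b a σ c := by
  unfold bilin
  rw [Finset.sum_comm]
  refine Finset.sum_congr rfl fun n _ => Finset.sum_congr rfl fun m _ => ?_
  rw [kloostermanS_swap m n hσ]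
  ring

theorem sum_Icc_eq_sum_dyadic (Q : ℕ) (F : ℕ → ℂ) : ∑ c ∈ Finset.Icc 1 Q, F c =
    ∑ j ∈ Finset.range (Nat.log 2 Q + 1),
      ∑ c ∈ (Finset.Icc 1 Q).filter fun c => Nat.log 2 c = j, F c := by
  refine (Finset.sum_fiberwise_of_maps_to (fun c hc => ?_) _).symm
  exact Finset.mem_range.mpr (Nat.lt_succ_of_le (Nat.log_mono_right (Finset.mem_Icc.mp hc).2))

theorem log_two_ceil_le {C : ℝ} (hC : 1 / 3 ≤ C) :
    ((Nat.log 2 ⌈3 * C⌉₊ + 1 : ℕ) : ℝ) ≤ 2 * (1 + Real.log (27 * C)) := by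
  have h1 : (2 : ℝ) ^ Nat.log 2 ⌈3 * C⌉₊ ≤ 6 * C := by
    have h2 : 2 ^ Nat.log 2 ⌈3 * C⌉₊ ≤ ⌈3 * C⌉₊ :=
      Nat.pow_log_le_self 2 (Nat.ceil_pos.mpr (by linarith)).ne'
    have h3 : ((2 ^ Nat.log 2 ⌈3 * C⌉₊ : ℕ) : ℝ) ≤ ⌈3 * C⌉₊ := by exact_mod_cast h2
    have h4 := Nat.ceil_lt_add_one (show 0 ≤ 3 * C by linarith)
    push_cast at h3
    linarith
  have h2 := Real.log_le_log (by positivity) h1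
  rw [Real.log_pow] at h2
  have h3 : Real.log (6 * C) ≤ Real.log (27 * C) := Real.log_le_log (by linarith) (by linarith)
  have h4 := Real.log_two_gt_d9
  have h5 : (0 : ℝ) ≤ Nat.log 2 ⌈3 * C⌉₊ := by positivity
  push_cast
  nlinarith

theorem log_pow_four_le {ε : ℝ} (hε : 0 < ε) {C : ℝ} (hC : 1 / 3 ≤ C) :
    (1 + Real.log (27 * C)) ^ 4 ≤ (1 + 4 / ε) ^ 4 * 27 ^ ε * C ^ ε := by
  have hδ : 0 < ε / 4 := by positivity
  have h1 := Real.log_le_rpow_div (show 0 ≤ 27 * C by linarith) hδ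
  have h2 : 1 ≤ (27 * C) ^ (ε / 4) := Real.one_le_rpow (by linarith) hδ.le
  have h3 : 0 ≤ Real.log (27 * C) := Real.log_nonneg (by linarith)
  have h4 : 1 + Real.log (27 * C) ≤ (1 + 4 / ε) * (27 * C) ^ (ε / 4) := by
    have : (27 * C) ^ (ε / 4) / (ε / 4) = 4 / ε * (27 * C) ^ (ε / 4) := by field_simp
    rw [this] at h1
    linarith
  calc (1 + Real.log (27 * C)) ^ 4 ≤ ((1 + 4 / ε) * (27 * C) ^ (ε / 4)) ^ 4 := by gcongr
    _ = (1 + 4 / ε) ^ 4 * (27 * C) ^ ε := by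
      rw [mul_pow, ← Real.rpow_natCast ((27 * C) ^ (ε / 4)), ← Real.rpow_mul (by linarith)]
      congr 2
      push_cast; ring
    _ = _ := by rw [Real.mul_rpow (by norm_num) (by linarith), mul_assoc]

theorem exists_sum_cellZ_le : ∃ K : ℝ, 0 < K ∧ ∀ {M N α β C Y : ℝ} {S S' : Finset ℕ} {σ : ℤ}
    {a b : ℕ → ℂ} {k : ℝ → ℝ}, 1 / 3 ≤ N → N ≤ M → 1 / 3 ≤ C → 0 ∉ S → 0 ∉ S' →
    (∀ m ∈ S, (m : ℝ) ≤ 3 * M) → (∀ n ∈ S', (n : ℝ) ≤ 3 * N) → (σ = 1 ∨ σ = -1) → 0 ≤ α → 0 ≤ β →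
    ∑ m ∈ S, ‖a m‖ ^ 2 ≤ α ^ 2 → ∑ n ∈ S', ‖b n‖ ^ 2 ≤ β ^ 2 → Measurable k → (∀ r, |k r| ≤ 1) →
    (∀ r, k r ≠ 0 → C ≤ r ∧ r ≤ 3 * C) → Y = √(N / M) / C →
    ‖∑ c ∈ Finset.Icc 1 ⌈3 * C⌉₊,
      ∫ p, cellW (vertF Y (9 * Y * C ^ 2)) (vertH k Y) c p • twBilin S S' a b σ c p‖ ≤
      K * (1 + Real.log (27 * C)) ^ 4 * (C * √(M * N)) * (α * β) := by
  obtain ⟨K, hK, H⟩ := exists_sum_cellInt_le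
  refine ⟨4 * (3 * K + 3), by positivity, ?_⟩
  intro M N α β C Y S S' σ a b k hN hNM hC h0 h0' hS hS' hσ hα hβ ha hb mk bk sk hY
  have hM0 : 0 < M := by linarith
  have hN0 : 0 < N := by linarith
  have hC0 : 0 < C := by linarith
  have hsq := Real.sqrt_pos.mpr (div_pos hN0 hM0)
  have hY0 : 0 < Y := by rw [hY]; positivity
  have hmn : √(M * N) = M * √(N / M) := by
    rw [show M * N = M ^ 2 * (N / M) by field_simp, Real.sqrt_mul (by positivity),
      Real.sqrt_sq hM0.le]
  have hmn2 : √(M * N) * √(N / M) = N := by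
    rw [← Real.sqrt_mul (by positivity), show M * N * (N / M) = N ^ 2 by field_simp,
      Real.sqrt_sq hN0.le]
  have hmn3 : 1 / 3 ≤ √(M * N) := Real.le_sqrt_of_sq_le (by nlinarith)
  set T := 1 + Real.log (27 * C) with hT
  have hT1 : 1 ≤ T := by linarith [Real.log_nonneg (show 1 ≤ 27 * C by linarith)]
  have hexp : Real.exp (1 - T) = 1 / (27 * C) := by
    rw [hT, show 1 - (1 + Real.log (27 * C)) = -Real.log (27 * C) by ring, Real.exp_neg,
      Real.exp_log (by positivity), one_div]
  have hY' : 0 < 1 / (9 * Y * C ^ 2) := by positivity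
  have hMY : Real.exp (1 - T) ≤ M * Y := by
    rw [hexp, hY, show M * (√(N / M) / C) = √(M * N) / C by rw [hmn]; ring,
      div_le_div_iff₀ (by positivity) hC0]
    nlinarith
  have hNY : Real.exp (1 - T) ≤ N * (1 / (9 * Y * C ^ 2)) := by
    have : N * (1 / (9 * Y * C ^ 2)) = √(M * N) / (9 * C) := by
      nth_rewrite 1 [← hmn2]
      rw [hY]; field_simp
    rw [hexp, this, div_le_div_iff₀ (by positivity) (by positivity)]
    nlinarith
  have hYY : Y * (1 / (9 * Y * C ^ 2)) = 1 / (3 * C) ^ 2 := by field_simp; norm_num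
  have hQ : 1 ≤ ((⌈3 * C⌉₊ : ℕ) : ℝ) ^ 2 * (Y * (1 / (9 * Y * C ^ 2))) := by
    rw [hYY, mul_one_div, le_div_iff₀ (by positivity), one_mul]
    exact pow_le_pow_left₀ (by positivity) (Nat.le_ceil _) 2
  have hbnd : ∀ L L' : ℂ →L[ℝ] ℝ, (∀ z, |L z| ≤ ‖z‖) → (∀ z, |L' z| ≤ ‖z‖) →
      |∑ c ∈ Finset.Icc 1 ⌈3 * C⌉₊, ∑ d ∈ reds c, cellInt (fun x => L (tp S a ((-1 : ℤ) * x)))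
        (fun x => L' (tp S' b (σ * x))) (vertF Y (9 * Y * C ^ 2)) (vertH k Y) c d (invRes c d)| ≤
      (3 * K + 3) * T ^ 4 * (C * √(M * N)) * (α * β) := by
    intro L L' hL hL'
    refine (H (by linarith) hN hα hβ (osc_tp h0 hM0.le hS ha (Or.inr rfl) L hL)
      (osc_tp h0' hN0.le hS' hb hσ L' hL') (measurable_vertF _ _) (measurable_vertH mk Y) hY0 hY'
      (fun y => vertF_support) (fun y => vertH_support hC0 sk hY0) (abs_vertF_le hY0)
      (fun y => bk _) hT1 hMY hNY hQ).trans ?_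
    have e1 : √(1 / (Y * (1 / (9 * Y * C ^ 2)))) = 3 * C := by
      rw [hYY, one_div_one_div, Real.sqrt_sq (by positivity)]
    have e2 : 1 / Y ≤ 3 * (C * √(M * N)) := by
      rw [hY, one_div_div, div_le_iff₀ hsq]
      have : 3 * (C * √(M * N)) * √(N / M) = C * (3 * N) := by
        rw [show 3 * (C * √(M * N)) * √(N / M) = C * (3 * (√(M * N) * √(N / M))) by ring, hmn2]
      rw [this]
      nlinarith
    have e3 : 1 ≤ T ^ 4 := one_le_pow₀ hT1
    have hX : 0 ≤ C * √(M * N) := by positivity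
    rw [e1]
    calc α * β * (K * T ^ 4 * √(M * N) * (3 * C) + 1 / Y)
        ≤ α * β * (K * T ^ 4 * √(M * N) * (3 * C) + 3 * (T ^ 4 * (C * √(M * N)))) := by
          gcongr
          nlinarith
      _ = _ := by ring
  have hre : ∀ z : ℂ, |reCLM z| ≤ ‖z‖ := Complex.abs_re_le_norm
  have him : ∀ z : ℂ, |imCLM z| ≤ ‖z‖ := Complex.abs_im_le_norm
  obtain ⟨Ba, hBa⟩ := exists_bound_tp S a
  obtain ⟨Bb, hBb⟩ := exists_bound_tp S' b
  have hw : ∀ c ∈ Finset.Icc 1 ⌈3 * C⌉₊,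
      Integrable (cellW (vertF Y (9 * Y * C ^ 2)) (vertH k Y) c) := fun c hc =>
    integrable_cellW (measurable_vertF _ _) (measurable_vertH mk Y) hY0 hY'
      (fun y => vertF_support) (fun y => vertH_support hC0 sk hY0) (abs_vertF_le hY0)
      (fun y => bk _) (by exact_mod_cast (Finset.mem_Icc.mp hc).1)
  have hsum : ∑ c ∈ Finset.Icc 1 ⌈3 * C⌉₊,
      ∫ p, cellW (vertF Y (9 * Y * C ^ 2)) (vertH k Y) c p • twBilin S S' a b σ c p =
      ∑ c ∈ Finset.Icc 1 ⌈3 * C⌉₊, ∑ d ∈ reds c, cellZ (fun x => tp S a ((-1 : ℤ) * x))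
        (fun x => tp S' b (σ * x)) (vertF Y (9 * Y * C ^ 2)) (vertH k Y) c d (invRes c d) :=
    Finset.sum_congr rfl fun c hc => (sum_cellZ_eq S S' a b σ c (hw c hc)).symm
  have hsplit : ∀ c ∈ Finset.Icc 1 ⌈3 * C⌉₊, ∀ d ∈ reds c,
      cellZ (fun x => tp S a ((-1 : ℤ) * x)) (fun x => tp S' b (σ * x))
        (vertF Y (9 * Y * C ^ 2)) (vertH k Y) c d (invRes c d) = _ := fun c hc d _ =>
    cellZ_eq hY0 (fun y => vertF_support) (hw c hc)
      ((continuous_tp S a).comp (continuous_const.mul continuous_id))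
      ((continuous_tp S' b).comp (continuous_const.mul continuous_id))
      (fun x => hBa _) (fun x => hBb _) d (invRes c d)
  rw [hsum, Finset.sum_congr rfl fun c hc => Finset.sum_congr rfl (hsplit c hc)]
  simp only [Finset.sum_add_distrib, Finset.sum_sub_distrib, ← Finset.sum_mul, ← ofReal_sum]
  have b1 := hbnd reCLM reCLM hre hre
  have b2 := hbnd imCLM imCLM him him
  have b3 := hbnd reCLM imCLM hre him
  have b4 := hbnd imCLM reCLM him hre
  simp only [reCLM_apply, imCLM_apply] at b1 b2 b3 b4
  refine (norm_add_le _ _).trans ?_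
  rw [norm_mul, norm_I, mul_one]
  refine (add_le_add (norm_sub_le _ _) (norm_add_le _ _)).trans ?_
  simp only [norm_real, Real.norm_eq_abs]
  refine (add_le_add (add_le_add b1 b2) (add_le_add b3 b4)).trans_eq ?_
  ring

/-- The bound for the weights `wt k`, when `N ≤ M`. -/
theorem exists_sum_wt_bilin_le_of_le : ∃ K : ℝ, 0 < K ∧
    ∀ {M N α β C : ℝ} {S S' : Finset ℕ} {σ : ℤ}
    {a b : ℕ → ℂ} {k : ℝ → ℝ}, 1 / 3 ≤ N → N ≤ M → 1 / 3 ≤ C → 0 ∉ S → 0 ∉ S' →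
    (∀ m ∈ S, (m : ℝ) ≤ 3 * M) → (∀ n ∈ S', (n : ℝ) ≤ 3 * N) → (σ = 1 ∨ σ = -1) → 0 ≤ α → 0 ≤ β →
    ∑ m ∈ S, ‖a m‖ ^ 2 ≤ α ^ 2 → ∑ n ∈ S', ‖b n‖ ^ 2 ≤ β ^ 2 → Measurable k → (∀ r, |k r| ≤ 1) →
    (∀ r, k r ≠ 0 → C ≤ r ∧ r ≤ 3 * C) →
    ‖∑ c ∈ Finset.Icc 1 ⌈3 * C⌉₊, wt k c • bilin S S' a b σ c‖ ≤
      K * (1 + Real.log (27 * C)) ^ 4 * (C * √(M * N)) * (α * β) := by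
  obtain ⟨K, hK, H⟩ := exists_sum_cellZ_le
  refine ⟨K + 8 * 10 ^ 7, by positivity, ?_⟩
  intro M N α β C S S' σ a b k hN hNM hC h0 h0' hS hS' hσ hα hβ ha hb mk bk sk
  set Y := √(N / M) / C with hY
  have h1 := H hN hNM hC h0 h0' hS hS' hσ hα hβ ha hb mk bk sk hY
  set V : ℕ → ℂ := fun c =>
    ∫ p, cellW (vertF Y (9 * Y * C ^ 2)) (vertH k Y) c p • twBilin S S' a b σ c p with hV
  have h2 : ∑ c ∈ Finset.Icc 1 ⌈3 * C⌉₊, wt k c • bilin S S' a b σ c =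
      ∑ c ∈ Finset.Icc 1 ⌈3 * C⌉₊, V c -
        ∑ c ∈ Finset.Icc 1 ⌈3 * C⌉₊, (V c - wt k c • bilin S S' a b σ c) := by
    rw [Finset.sum_sub_distrib]; ring
  set T := 1 + Real.log (27 * C) with hT
  have hT1 : 1 ≤ T := by linarith [Real.log_nonneg (show 1 ≤ 27 * C by linarith)]
  set P := C * √(M * N) * (α * β) with hP
  have hP0 : 0 ≤ P := by positivity
  have hlog : 2 * Real.log (9 * C ^ 2) ≤ 4 * T := by
    have : Real.log (9 * C ^ 2) ≤ Real.log ((27 * C) ^ 2) :=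
      Real.log_le_log (by positivity) (by nlinarith)
    rw [Real.log_pow] at this
    push_cast at this
    linarith
  have h3 : ‖∑ c ∈ Finset.Icc 1 ⌈3 * C⌉₊, (V c - wt k c • bilin S S' a b σ c)‖ ≤
      8 * 10 ^ 7 * (T ^ 2 * P) := by
    rw [sum_Icc_eq_sum_dyadic]
    refine (norm_sum_le _ _).trans ?_
    have hblock : ∀ j ∈ Finset.range (Nat.log 2 ⌈3 * C⌉₊ + 1),
        ‖∑ c ∈ (Finset.Icc 1 ⌈3 * C⌉₊).filter fun c => Nat.log 2 c = j,
          (V c - wt k c • bilin S S' a b σ c)‖ ≤ 4 * 10 ^ 7 * (T * P) := by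
      intro j _
      have h4 := norm_sum_phase_le (q := 2 ^ j) Nat.one_le_two_pow
        (D := (Finset.Icc 1 ⌈3 * C⌉₊).filter fun c => Nat.log 2 c = j) (fun c hc => by
          obtain ⟨hc1, hc2⟩ := Finset.mem_filter.mp hc
          have hc0 : c ≠ 0 := by have := (Finset.mem_Icc.mp hc1).1; omega
          rw [← hc2]
          refine ⟨Nat.pow_log_le_self 2 hc0, ?_⟩
          have := Nat.lt_pow_succ_log_self (b := 2) (by norm_num) c
          rw [pow_succ] at this
          omega)
        hN hNM hS hS' hσ hα hβ ha hb mk bk hC sk hY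
      refine h4.trans ?_
      rw [mul_assoc (10 ^ 7), ← hP]
      nlinarith [mul_le_mul_of_nonneg_left hlog hP0]
    refine (Finset.sum_le_card_nsmul _ _ _ hblock).trans ?_
    rw [Finset.card_range, nsmul_eq_mul]
    refine (mul_le_mul_of_nonneg_right (log_two_ceil_le hC) (by positivity)).trans_eq ?_
    rw [← hT]; ring
  rw [h2]
  refine (norm_sub_le _ _).trans ((add_le_add h1 h3).trans ?_)
  have h5 : T ^ 2 ≤ T ^ 4 := pow_le_pow_right₀ hT1 (by norm_num)
  calc K * T ^ 4 * (C * √(M * N)) * (α * β) + 8 * 10 ^ 7 * (T ^ 2 * P)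
      ≤ K * T ^ 4 * (C * √(M * N)) * (α * β) + 8 * 10 ^ 7 * (T ^ 4 * P) := by gcongr
    _ = _ := by rw [hP]; ring

/-- The bound for bilinear forms in Kloosterman sums smoothed over the modulus by `wt k`. -/
theorem exists_sum_wt_bilin_le {ε : ℝ} (hε : 0 < ε) : ∃ K : ℝ, 0 < K ∧
    ∀ {M N α β C : ℝ} {S S' : Finset ℕ} {σ : ℤ}
    {a b : ℕ → ℂ} {k : ℝ → ℝ}, 1 / 3 ≤ M → 1 / 3 ≤ N → 1 / 3 ≤ C → 0 ∉ S → 0 ∉ S' →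
    (∀ m ∈ S, (m : ℝ) ≤ 3 * M) → (∀ n ∈ S', (n : ℝ) ≤ 3 * N) → (σ = 1 ∨ σ = -1) → 0 ≤ α → 0 ≤ β →
    ∑ m ∈ S, ‖a m‖ ^ 2 ≤ α ^ 2 → ∑ n ∈ S', ‖b n‖ ^ 2 ≤ β ^ 2 → Measurable k → (∀ r, |k r| ≤ 1) →
    (∀ r, k r ≠ 0 → C ≤ r ∧ r ≤ 3 * C) →
    ‖∑ c ∈ Finset.Icc 1 ⌈3 * C⌉₊, wt k c • bilin S S' a b σ c‖ ≤
      K * C ^ (1 + ε) * √(M * N) * (α * β) := by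
  obtain ⟨K, hK, H⟩ := exists_sum_wt_bilin_le_of_le
  refine ⟨K * ((1 + 4 / ε) ^ 4 * 27 ^ ε), by positivity, ?_⟩
  intro M N α β C S S' σ a b k hM hN hC h0 h0' hS hS' hσ hα hβ ha hb mk bk sk
  have hC0 : 0 < C := by linarith
  have h1 : ‖∑ c ∈ Finset.Icc 1 ⌈3 * C⌉₊, wt k c • bilin S S' a b σ c‖ ≤
      K * (1 + Real.log (27 * C)) ^ 4 * (C * √(M * N)) * (α * β) := by
    rcases le_total N M with h | h
    · exact H hN h hC h0 h0' hS hS' hσ hα hβ ha hb mk bk sk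
    · simp only [bilin_swap S S' a b hσ]
      rw [mul_comm M N, mul_comm α β]
      exact H hM h hC h0' h0 hS' hS hσ hβ hα hb ha mk bk sk
  refine h1.trans ?_
  have h2 := log_pow_four_le hε hC
  calc K * (1 + Real.log (27 * C)) ^ 4 * (C * √(M * N)) * (α * β)
      ≤ K * ((1 + 4 / ε) ^ 4 * 27 ^ ε * C ^ ε) * (C * √(M * N)) * (α * β) := by gcongr
    _ = _ := by rw [Real.rpow_add hC0, Real.rpow_one]; ring

end

end KB

namespace KB

open ModularGroup Matrix.SpecialLinearGroup
open UpperHalfPlane hiding I continuous_re continuous_im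
open scoped MatrixGroups Modular ENNReal ContDiff Topology RealInnerProductSpace

noncomputable section


theorem wt_eq {φ φ₁ φ₂ : ℝ → ℝ} (h₁ : ∀ x, HasDerivAt φ (φ₁ x) x)
    (h₂ : ∀ x, HasDerivAt φ₁ (φ₂ x) x) (c₂ : Continuous φ₂) {R : ℝ} (hs : ∀ x, R < x → φ x = 0)
    (hs₁ : ∀ x, R < x → φ₁ x = 0) (hs₂ : ∀ x, R < x → φ₂ x = 0) {c : ℝ} (hc : 0 < c) :
    wt (fun r => (r ^ 2 * φ₂ r + r * φ₁ r - φ r) / (2 * Real.pi)) c = φ c := by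
  set D := max R c + 1 with hD
  have hRD : R < D := by linarith [le_max_left R c]
  have hcD : c ≤ D := by linarith [le_max_right R c]
  have c₁ : Continuous φ₁ := continuous_iff_continuousAt.mpr fun x => (h₂ x).continuousAt
  have c₀ : Continuous φ := continuous_iff_continuousAt.mpr fun x => (h₁ x).continuousAt
  have hpos : ∀ r ∈ Set.uIcc c D, 0 < r := fun r hr => by
    rw [Set.uIcc_of_le hcD] at hr; linarith [hr.1]
  have hd : ∀ r ∈ Set.uIcc c D, HasDerivAt
      (fun r => ((r ^ 2 * φ₁ r - r * φ r) / c - c * (φ₁ r + φ r / r)) / (2 * Real.pi))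
      ((r ^ 2 * φ₂ r + r * φ₁ r - φ r) / (2 * Real.pi) * (1 / c - c / r ^ 2)) r := by
    intro r hr
    have hr0 := hpos r hr
    have d1 := ((((hasDerivAt_id r).pow 2).mul (h₂ r)).sub ((hasDerivAt_id r).mul (h₁ r))).div_const c
    have d2 := ((h₂ r).add ((h₁ r).div (hasDerivAt_id r) hr0.ne')).const_mul c
    refine ((d1.sub d2).div_const (2 * Real.pi)).congr_deriv ?_
    simp only [id, Pi.pow_apply]
    field_simp
    push_cast
    ring
  have hcont : ContinuousOn (fun r => (r ^ 2 * φ₂ r + r * φ₁ r - φ r) / (2 * Real.pi) *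
      (1 / c - c / r ^ 2)) (Set.uIcc c D) := by
    refine ContinuousOn.mul (by fun_prop) (continuousOn_const.sub (ContinuousOn.div continuousOn_const
      (by fun_prop) fun r hr => (pow_pos (hpos r hr) 2).ne'))
  have hintegr := intervalIntegral.integral_eq_sub_of_hasDerivAt hd hcont.intervalIntegrable
  rw [hs D hRD, hs₁ D hRD] at hintegr
  unfold wt
  have hset : ∫ r in Set.Ioi c, (r ^ 2 * φ₂ r + r * φ₁ r - φ r) / (2 * Real.pi) *
      (1 / c - c / r ^ 2) = ∫ r in Set.Ioc c D, (r ^ 2 * φ₂ r + r * φ₁ r - φ r) / (2 * Real.pi) *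
      (1 / c - c / r ^ 2) := by
    refine setIntegral_eq_of_subset_of_forall_sdiff_eq_zero measurableSet_Ioi
      (fun r hr => hr.1) fun r hr => ?_
    have hr2 : R < r := by
      by_contra hle
      exact hr.2 ⟨hr.1, by linarith⟩
    rw [hs r hr2, hs₁ r hr2, hs₂ r hr2]
    simp
  rw [hset, ← intervalIntegral.integral_of_le hcD, hintegr]
  have := Real.pi_pos
  field_simp
  ring

theorem eq_zero_of_support_deriv {φ φ₁ : ℝ → ℝ} (h₁ : ∀ x, HasDerivAt φ (φ₁ x) x) {A B : ℝ}
    (hs : ∀ x, φ x ≠ 0 → A ≤ x ∧ x ≤ B) : ∀ x, φ₁ x ≠ 0 → A ≤ x ∧ x ≤ B := by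
  intro x
  contrapose
  intro hx
  have hev : φ =ᶠ[𝓝 x] fun _ => 0 := by
    have : (Set.Icc A B)ᶜ ∈ 𝓝 x := isClosed_Icc.isOpen_compl.mem_nhds hx
    filter_upwards [this] with y hy
    by_contra hne
    exact hy (hs y hne)
  have := (h₁ x).congr_of_eventuallyEq hev.symm
  exact this.unique (hasDerivAt_const x 0)

/-- The bound for bilinear forms in Kloosterman sums with a smooth weight in the modulus. -/
theorem exists_sum_smooth_bilin_le {ε : ℝ} (hε : 0 < ε) : ∃ K : ℝ, 0 < K ∧
    ∀ {M N α β C E : ℝ} {S S' : Finset ℕ} {σ : ℤ}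
    {a b : ℕ → ℂ} {φ φ₁ φ₂ : ℝ → ℝ}, 1 / 3 ≤ M → 1 / 3 ≤ N → 1 / 3 ≤ C → 0 ∉ S → 0 ∉ S' →
    (∀ m ∈ S, (m : ℝ) ≤ 3 * M) → (∀ n ∈ S', (n : ℝ) ≤ 3 * N) → (σ = 1 ∨ σ = -1) → 0 ≤ α → 0 ≤ β →
    ∑ m ∈ S, ‖a m‖ ^ 2 ≤ α ^ 2 → ∑ n ∈ S', ‖b n‖ ^ 2 ≤ β ^ 2 → (∀ x, HasDerivAt φ (φ₁ x) x) →
    (∀ x, HasDerivAt φ₁ (φ₂ x) x) → Continuous φ₂ → (∀ x, φ x ≠ 0 → C ≤ x ∧ x ≤ 3 * C) → 0 < E →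
    (∀ x, |φ x| ≤ E) → (∀ x, |φ₁ x| ≤ E / C) → (∀ x, |φ₂ x| ≤ E / C ^ 2) →
    ‖∑ c ∈ Finset.Icc 1 ⌈3 * C⌉₊, φ c • bilin S S' a b σ c‖ ≤
      K * C ^ (1 + ε) * √(M * N) * (α * β) * E := by
  obtain ⟨K, hK, H⟩ := exists_sum_wt_bilin_le hε
  refine ⟨3 * K, by positivity, ?_⟩
  intro M N α β C E S S' σ a b φ φ₁ φ₂ hM hN hC h0 h0' hS hS' hσ hα hβ ha hb h₁ h₂ c₂ hs hE b₀ b₁ b₂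
  have hC0 : 0 < C := by linarith
  have hs₁ := eq_zero_of_support_deriv h₁ hs
  have hs₂ := eq_zero_of_support_deriv h₂ hs₁
  have c₁ : Continuous φ₁ := continuous_iff_continuousAt.mpr fun x => (h₂ x).continuousAt
  have c₀ : Continuous φ := continuous_iff_continuousAt.mpr fun x => (h₁ x).continuousAt
  have hz : ∀ {ψ : ℝ → ℝ}, (∀ x, ψ x ≠ 0 → C ≤ x ∧ x ≤ 3 * C) → ∀ x, 3 * C < x →
      ψ x / (3 * E) = 0 := fun {ψ} h x hx => by
    have : ψ x = 0 := by by_contra hne; linarith [(h x hne).2]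
    rw [this, zero_div]
  set k : ℝ → ℝ := fun r => (r ^ 2 * (φ₂ r / (3 * E)) + r * (φ₁ r / (3 * E)) - φ r / (3 * E)) /
    (2 * Real.pi) with hk
  have hwt : ∀ c : ℝ, 0 < c → wt k c = φ c / (3 * E) := fun c hc =>
    wt_eq (φ := fun x => φ x / (3 * E)) (φ₁ := fun x => φ₁ x / (3 * E))
      (φ₂ := fun x => φ₂ x / (3 * E)) (fun x => (h₁ x).div_const _) (fun x => (h₂ x).div_const _)
      (c₂.div_const _) (hz hs) (hz hs₁) (hz hs₂) hc
  have sk : ∀ r, k r ≠ 0 → C ≤ r ∧ r ≤ 3 * C := by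
    intro r hr
    by_contra hne
    have e0 : φ r = 0 := by by_contra h; exact hne (hs r h)
    have e1 : φ₁ r = 0 := by by_contra h; exact hne (hs₁ r h)
    have e2 : φ₂ r = 0 := by by_contra h; exact hne (hs₂ r h)
    exact hr (by simp [hk, e0, e1, e2])
  have bk : ∀ r, |k r| ≤ 1 := by
    intro r
    by_cases hr : k r = 0
    · rw [hr, abs_zero]; exact zero_le_one
    obtain ⟨hr1, hr2⟩ := sk r hr
    have hr0 : 0 < r := by linarith
    have e : k r = (r ^ 2 * φ₂ r + r * φ₁ r - φ r) / (6 * Real.pi * E) := by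
      simp only [hk]; field_simp; ring
    have hpi := Real.pi_gt_three
    rw [e, abs_div, abs_of_pos (show 0 < 6 * Real.pi * E by positivity),
      div_le_one (by positivity)]
    have t2 : |r ^ 2 * φ₂ r| ≤ 9 * E := by
      rw [abs_mul, abs_of_pos (by positivity)]
      calc r ^ 2 * |φ₂ r| ≤ (3 * C) ^ 2 * (E / C ^ 2) := by gcongr; exact b₂ r
        _ = 9 * E := by field_simp; norm_num
    have t1 : |r * φ₁ r| ≤ 3 * E := by
      rw [abs_mul, abs_of_pos (by positivity)]
      calc r * |φ₁ r| ≤ (3 * C) * (E / C) := by gcongr; exact b₁ r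
        _ = 3 * E := by field_simp
    have t3 := abs_sub (r ^ 2 * φ₂ r + r * φ₁ r) (φ r)
    have t4 := abs_add_le (r ^ 2 * φ₂ r) (r * φ₁ r)
    have t5 := b₀ r
    nlinarith
  have mk : Measurable k := Continuous.measurable (by fun_prop)
  have h := H hM hN hC h0 h0' hS hS' hσ hα hβ ha hb mk bk sk
  have heq : ∑ c ∈ Finset.Icc 1 ⌈3 * C⌉₊, φ c • bilin S S' a b σ c =
      (3 * E) • ∑ c ∈ Finset.Icc 1 ⌈3 * C⌉₊, wt k c • bilin S S' a b σ c := by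
    rw [Finset.smul_sum]
    refine Finset.sum_congr rfl fun c hc => ?_
    rw [hwt c (by exact_mod_cast (Finset.mem_Icc.mp hc).1), smul_smul]
    congr 1
    field_simp
  rw [heq, norm_smul, Real.norm_eq_abs, abs_of_pos (by positivity)]
  calc 3 * E * _ ≤ 3 * E * (K * C ^ (1 + ε) * √(M * N) * (α * β)) := by gcongr
    _ = _ := by ring

end

end KB

namespace KB

open ModularGroup Matrix.SpecialLinearGroup
open UpperHalfPlane hiding I continuous_re continuous_im
open scoped MatrixGroups Modular ENNReal ContDiff Topology RealInnerProductSpace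

noncomputable section


theorem sum_mul_by_parts {S : Finset ℕ} {A : ℕ} (hS : ∀ m ∈ S, m ≤ A) (H w : ℕ → ℂ) (h0 : H 0 = 0) :
    ∑ m ∈ S, H m * w m =
      ∑ μ ∈ Finset.range A, (H (μ + 1) - H μ) * ∑ m ∈ S.filter (μ < ·), w m := by
  simp only [Finset.mul_sum, Finset.sum_filter, mul_ite, mul_zero]
  rw [Finset.sum_comm]
  refine Finset.sum_congr rfl fun m hm => ?_
  have h1 : (Finset.range A).filter (· < m) = Finset.range m := by
    ext μ
    have := hS m hm
    simp only [Finset.mem_filter, Finset.mem_range]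
    omega
  rw [← Finset.sum_filter, h1, ← Finset.sum_mul, Finset.sum_range_sub, h0, sub_zero]

/-- The mixed second difference. -/
def dd (G : ℝ → ℝ → ℝ) (x y : ℝ) : ℝ := G (x + 1) (y + 1) - G x (y + 1) - (G (x + 1) y - G x y)

theorem sum_mul_by_parts₂ {S S' : Finset ℕ} {A B : ℕ} (hS : ∀ m ∈ S, m ≤ A) (hS' : ∀ n ∈ S', n ≤ B)
    (G : ℝ → ℝ → ℝ) (w : ℕ → ℕ → ℂ) (h0 : ∀ y, G 0 y = 0) (h0' : ∀ x, G x 0 = 0) :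
    ∑ m ∈ S, ∑ n ∈ S', (G m n : ℂ) * w m n =
      ∑ μ ∈ Finset.range A, ∑ ν ∈ Finset.range B, dd G μ ν •
        ∑ m ∈ S.filter (μ < ·), ∑ n ∈ S'.filter (ν < ·), w m n := by
  have h1 : ∀ m ∈ S, ∑ n ∈ S', (G m n : ℂ) * w m n = ∑ ν ∈ Finset.range B,
      ((G m (ν + 1 : ℕ) : ℂ) - G m ν) * ∑ n ∈ S'.filter (ν < ·), w m n := fun m _ =>
    sum_mul_by_parts hS' (fun n => (G m n : ℂ)) (w m) (by simp [h0'])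
  rw [Finset.sum_congr rfl h1, Finset.sum_comm, Finset.sum_comm (s := Finset.range A)]
  refine Finset.sum_congr rfl fun ν _ => ?_
  rw [sum_mul_by_parts hS (fun m => (G m (ν + 1 : ℕ) : ℂ) - G m ν) _ (by simp [h0])]
  refine Finset.sum_congr rfl fun μ _ => ?_
  rw [real_smul, dd]
  push_cast
  ring

theorem contDiff_deriv_snd_snd {G : ℝ × ℝ × ℝ → ℝ} (hG : ContDiff ℝ (⊤ : ℕ∞) G) :
    ContDiff ℝ (⊤ : ℕ∞) fun p : ℝ × ℝ × ℝ => deriv (fun c => G (p.1, p.2.1, c)) p.2.2 := by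
  have h1 : (fun p : ℝ × ℝ × ℝ => deriv (fun c => G (p.1, p.2.1, c)) p.2.2) =
      fun p => fderiv ℝ G p (0, 0, 1) := by
    ext p
    have hd : DifferentiableAt ℝ G (p.1, p.2.1, p.2.2) := hG.differentiable (by simp) _
    exact (hd.hasFDerivAt.comp_hasDerivAt p.2.2 ((hasDerivAt_const p.2.2 p.1).prodMk
      ((hasDerivAt_const p.2.2 p.2.1).prodMk (hasDerivAt_id p.2.2)))).deriv
  rw [h1]
  exact (hG.fderiv_right (m := (⊤ : ℕ∞)) (by simp)).clm_apply contDiff_const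

theorem contDiff_deriv_snd_fst {G : ℝ × ℝ × ℝ → ℝ} (hG : ContDiff ℝ (⊤ : ℕ∞) G) :
    ContDiff ℝ (⊤ : ℕ∞) fun p : ℝ × ℝ × ℝ => deriv (fun n => G (p.1, n, p.2.2)) p.2.1 := by
  have h1 : (fun p : ℝ × ℝ × ℝ => deriv (fun n => G (p.1, n, p.2.2)) p.2.1) =
      fun p => fderiv ℝ G p (0, 1, 0) := by
    ext p
    have hd : DifferentiableAt ℝ G (p.1, p.2.1, p.2.2) := hG.differentiable (by simp) _
    exact (hd.hasFDerivAt.comp_hasDerivAt p.2.1 ((hasDerivAt_const p.2.1 p.1).prodMk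
      ((hasDerivAt_id p.2.1).prodMk (hasDerivAt_const p.2.1 p.2.2)))).deriv
  rw [h1]
  exact (hG.fderiv_right (m := (⊤ : ℕ∞)) (by simp)).clm_apply contDiff_const

theorem contDiff_iteratedDeriv_third {g : ℝ → ℝ → ℝ → ℝ}
    (hg : ContDiff ℝ (⊤ : ℕ∞) fun p : ℝ × ℝ × ℝ => g p.1 p.2.1 p.2.2) (l : ℕ) :
    ContDiff ℝ (⊤ : ℕ∞) fun p : ℝ × ℝ × ℝ => iteratedDeriv l (g p.1 p.2.1) p.2.2 := by
  induction l with
  | zero => simpa using hg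
  | succ l ih =>
    simp only [iteratedDeriv_succ]
    exact contDiff_deriv_snd_snd ih

theorem abs_dd_le {F : ℝ → ℝ → ℝ} {B : ℝ} (h₁ : ∀ m, Differentiable ℝ (F m))
    (h₂ : ∀ n, Differentiable ℝ fun m => deriv (F m) n)
    (hB : ∀ m n, |deriv (fun m' => deriv (F m') n) m| ≤ B) (x y : ℝ) : |dd F x y| ≤ B := by
  have h3 : ∀ n, |deriv (F (x + 1)) n - deriv (F x) n| ≤ B := by
    intro n
    have := convex_univ.norm_image_sub_le_of_norm_deriv_le (f := fun m => deriv (F m) n)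
      (fun m _ => h₂ n m) (fun m _ => hB m n) (Set.mem_univ x) (Set.mem_univ (x + 1))
    simpa using this
  have h4 : ∀ n, HasDerivAt (fun n => F (x + 1) n - F x n)
      (deriv (F (x + 1)) n - deriv (F x) n) n := fun n =>
    (h₁ (x + 1) n).hasDerivAt.sub (h₁ x n).hasDerivAt
  have := convex_univ.norm_image_sub_le_of_norm_deriv_le (f := fun n => F (x + 1) n - F x n)
    (fun n _ => (h4 n).differentiableAt) (fun n _ => (h4 n).deriv ▸ h3 n) (Set.mem_univ y)
    (Set.mem_univ (y + 1))
  simpa [dd] using this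

end

end KB

/-- The Deshouillers–Iwaniec bound for bilinear forms in Kloosterman sums:
for every `ε > 0` there is `K > 0` such that for all `C, M, N > 0`, every smooth
`g : ℝ³ → ℝ` supported in `[M,3M] × [N,3N] × [C,3C]` (in the variables `(m, n, c)`) with
`|∂_m^j ∂_n^k ∂_c^l g| ≤ M^{-j} N^{-k} C^{-l}` for `0 ≤ j, k, l ≤ 2`, all complex sequences
`a`, `b`, and either sign,
`|∑_c ∑_m ∑_n a_m b_n g(m,n,c) S(m, ±n; c)| ≤ K C^{1+ε} √(MN) ‖a‖₂ ‖b‖₂`. -/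
theorem deshouillers_iwaniec_bilinear (ε : ℝ) (hε : 0 < ε) :
    ∃ K : ℝ, 0 < K ∧
      ∀ (C M N : ℝ), 0 < C → 0 < M → 0 < N →
      ∀ g : ℝ → ℝ → ℝ → ℝ,
        ContDiff ℝ (⊤ : ℕ∞) (fun p : ℝ × ℝ × ℝ => g p.1 p.2.1 p.2.2) →
        (∀ m n c : ℝ, g m n c ≠ 0 →
          m ∈ Set.Icc M (3 * M) ∧ n ∈ Set.Icc N (3 * N) ∧ c ∈ Set.Icc C (3 * C)) →
        (∀ j k l : ℕ, j ≤ 2 → k ≤ 2 → l ≤ 2 → ∀ m n c : ℝ,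
          |iteratedDeriv j
              (fun m' : ℝ => iteratedDeriv k
                (fun n' : ℝ => iteratedDeriv l (fun c' : ℝ => g m' n' c') c) n) m|
            ≤ 1 / (M ^ j * N ^ k * C ^ l)) →
      ∀ (a b : ℕ → ℂ) (σ : ℤ), (σ = 1 ∨ σ = -1) →
        ‖∑' c : ℕ, ∑' m : ℕ, ∑' n : ℕ,
            a m * b n * (g m n c : ℂ) * kloostermanS (m : ℤ) (σ * n) c‖
          ≤ K * C ^ (1 + ε) * Real.sqrt (M * N) *
            Real.sqrt (∑ m ∈ Finset.Icc ⌈M⌉₊ ⌊3 * M⌋₊, ‖a m‖ ^ 2) *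
            Real.sqrt (∑ n ∈ Finset.Icc ⌈N⌉₊ ⌊3 * N⌋₊, ‖b n‖ ^ 2) := by
  obtain ⟨K, hK, H⟩ := KB.exists_sum_smooth_bilin_le hε
  refine ⟨9 * K, by positivity, ?_⟩
  intro C M N hC0 hM0 hN0 g hg hsupp hder a b σ hσ
  set S := Finset.Icc ⌈M⌉₊ ⌊3 * M⌋₊ with hS
  set S' := Finset.Icc ⌈N⌉₊ ⌊3 * N⌋₊ with hS'
  have hthird : ∀ {X : ℝ} {x : ℕ}, 0 < X → (x : ℝ) ∈ Set.Icc X (3 * X) → 1 / 3 ≤ X := by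
    intro X x hX hx
    have h1 : (0 : ℝ) < x := hX.trans_le hx.1
    have h2 : (1 : ℝ) ≤ x := by exact_mod_cast h1
    linarith [hx.2]
  by_cases hbig : 1 / 3 ≤ M ∧ 1 / 3 ≤ N ∧ 1 / 3 ≤ C
  swap
  · have hz : ∀ m n c : ℕ, g m n c = 0 := by
      intro m n c
      by_contra hne
      obtain ⟨h1, h2, h3⟩ := hsupp _ _ _ hne
      exact hbig ⟨hthird hM0 h1, hthird hN0 h2, hthird hC0 h3⟩
    simp only [hz, ofReal_zero, mul_zero, zero_mul, tsum_zero, norm_zero]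
    positivity
  obtain ⟨hM, hN, hC⟩ := hbig
  have hmem : ∀ {X : ℝ} {x : ℕ}, (x : ℝ) ∈ Set.Icc X (3 * X) → x ∈ Finset.Icc ⌈X⌉₊ ⌊3 * X⌋₊ :=
    fun hx => Finset.mem_Icc.mpr ⟨Nat.ceil_le.mpr hx.1, Nat.le_floor hx.2⟩
  have htsum : ∑' c : ℕ, ∑' m : ℕ, ∑' n : ℕ,
      a m * b n * (g m n c : ℂ) * kloostermanS (m : ℤ) (σ * n) c =
      ∑ c ∈ Finset.Icc 1 ⌈3 * C⌉₊, ∑ m ∈ S, ∑ n ∈ S',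
        (g m n c : ℂ) * (a m * b n * kloostermanS (m : ℤ) (σ * n) c) := by
    have hz : ∀ m n c : ℕ, ¬(m ∈ S ∧ n ∈ S' ∧ c ∈ Finset.Icc 1 ⌈3 * C⌉₊) → g m n c = 0 := by
      intro m n c h
      by_contra hne
      obtain ⟨h1, h2, h3⟩ := hsupp _ _ _ hne
      refine h ⟨hmem h1, hmem h2, Finset.mem_Icc.mpr ⟨?_, ?_⟩⟩
      · have : (0 : ℝ) < c := hC0.trans_le h3.1
        exact_mod_cast this
      · exact_mod_cast h3.2.trans (Nat.le_ceil _)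
    rw [tsum_eq_sum (s := Finset.Icc 1 ⌈3 * C⌉₊)]
    · refine Finset.sum_congr rfl fun c _ => ?_
      rw [tsum_eq_sum (s := S)]
      · refine Finset.sum_congr rfl fun m _ => ?_
        rw [tsum_eq_sum (s := S')]
        · exact Finset.sum_congr rfl fun n _ => by ring
        · intro n hn
          rw [hz m n c fun h => hn h.2.1]; simp
      · intro m hm
        simp [hz m _ c fun h => hm h.1]
    · intro c hc
      simp [hz _ _ c fun h => hc h.2.2]
  have hzero : ∀ {x y c : ℝ}, x = 0 ∨ y = 0 → g x y c = 0 := by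
    intro x y c h
    by_contra hne
    obtain ⟨h1, h2, -⟩ := hsupp _ _ _ hne
    rcases h with rfl | rfl
    · linarith [h1.1]
    · linarith [h2.1]
  have hSle : ∀ {X : ℝ}, 0 ≤ X → ∀ x ∈ Finset.Icc ⌈X⌉₊ ⌊3 * X⌋₊, (x : ℝ) ≤ 3 * X :=
    fun hX x hx => (Nat.le_floor_iff (by positivity)).mp (Finset.mem_Icc.mp hx).2
  have hparts : ∀ c : ℕ, ∑ m ∈ S, ∑ n ∈ S',
      (g m n c : ℂ) * (a m * b n * kloostermanS (m : ℤ) (σ * n) c) =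
      ∑ μ ∈ Finset.range ⌊3 * M⌋₊, ∑ ν ∈ Finset.range ⌊3 * N⌋₊,
        KB.dd (fun x y => g x y c) μ ν •
          KB.bilin (S.filter (μ < ·)) (S'.filter (ν < ·)) a b σ c := fun c =>
    KB.sum_mul_by_parts₂ (fun m hm => (Finset.mem_Icc.mp hm).2) (fun n hn => (Finset.mem_Icc.mp hn).2)
      (fun x y => g x y c) (fun m n => a m * b n * kloostermanS (m : ℤ) (σ * n) c)
      (fun y => hzero (Or.inl rfl)) (fun x => hzero (Or.inr rfl))
  have hF := KB.contDiff_iteratedDeriv_third hg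
  have hdd : ∀ l ≤ 2, ∀ x y c : ℝ,
      |KB.dd (fun x y => iteratedDeriv l (g x y) c) x y| ≤ 1 / (M * N) / C ^ l := by
    intro l hl x y c
    have h2 := KB.contDiff_deriv_snd_fst (hF l)
    refine KB.abs_dd_le (fun m => ?_) (fun n => ?_) (fun m n => ?_) x y
    · exact ((hF l).comp (contDiff_const.prodMk (contDiff_id.prodMk contDiff_const) :
        ContDiff ℝ (⊤ : ℕ∞) fun n : ℝ => (m, n, c))).differentiable (by simp)
    · exact (h2.comp (contDiff_id.prodMk contDiff_const :
        ContDiff ℝ (⊤ : ℕ∞) fun m : ℝ => (m, n, c))).differentiable (by simp)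
    · have := hder 1 1 l (by norm_num) (by norm_num) hl m n c
      simp only [iteratedDeriv_one, pow_one] at this
      rwa [div_div]
  have hderiv : ∀ l, ∀ x y c : ℝ, HasDerivAt (fun c => KB.dd (fun x y => iteratedDeriv l (g x y) c) x y)
      (KB.dd (fun x y => iteratedDeriv (l + 1) (g x y) c) x y) c := by
    intro l x y c
    have h1 : ∀ x y : ℝ, HasDerivAt (iteratedDeriv l (g x y)) (iteratedDeriv (l + 1) (g x y) c) c := by
      intro x y
      rw [iteratedDeriv_succ]
      exact (((hF l).comp (contDiff_const.prodMk (contDiff_const.prodMk contDiff_id) :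
        ContDiff ℝ (⊤ : ℕ∞) fun c : ℝ => (x, y, c))).differentiable (by simp) c).hasDerivAt
    exact ((h1 _ _).sub (h1 _ _)).sub ((h1 _ _).sub (h1 _ _))
  have hblock : ∀ μ ν : ℕ, ‖∑ c ∈ Finset.Icc 1 ⌈3 * C⌉₊, KB.dd (fun x y => g x y c) μ ν •
      KB.bilin (S.filter (μ < ·)) (S'.filter (ν < ·)) a b σ c‖ ≤
      K * C ^ (1 + ε) * √(M * N) * (√(∑ m ∈ S, ‖a m‖ ^ 2) * √(∑ n ∈ S', ‖b n‖ ^ 2)) *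
        (1 / (M * N)) := by
    intro μ ν
    have hsub : ∀ (T : Finset ℕ) (p : ℕ → Prop) [DecidablePred p] (f : ℕ → ℂ),
        ∑ m ∈ T.filter p, ‖f m‖ ^ 2 ≤ √(∑ m ∈ T, ‖f m‖ ^ 2) ^ 2 := by
      intro T p _ f
      rw [Real.sq_sqrt (by positivity)]
      exact Finset.sum_le_sum_of_subset_of_nonneg (Finset.filter_subset _ _) fun _ _ _ => by positivity
    have d0 := hderiv 0 μ ν
    simp only [iteratedDeriv_zero, zero_add] at d0
    have b0 := hdd 0 (by norm_num) μ ν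
    simp only [iteratedDeriv_zero, pow_zero, div_one] at b0
    have b1 := hdd 1 (by norm_num) μ ν
    simp only [pow_one] at b1
    have h0 : ∀ {X : ℝ}, 0 < X → 0 ∉ Finset.Icc ⌈X⌉₊ ⌊3 * X⌋₊ := fun hX h =>
      (Nat.ceil_pos.mpr hX).not_ge (Finset.mem_Icc.mp h).1
    refine H (S := S.filter (μ < ·)) (S' := S'.filter (ν < ·)) (E := 1 / (M * N)) (C := C)
      (φ := fun c => KB.dd (fun x y => g x y c) μ ν)
      (φ₁ := fun c => KB.dd (fun x y => iteratedDeriv 1 (g x y) c) μ ν)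
      (φ₂ := fun c => KB.dd (fun x y => iteratedDeriv 2 (g x y) c) μ ν) hM hN hC
      (fun h => h0 hM0 (Finset.mem_of_mem_filter 0 h))
      (fun h => h0 hN0 (Finset.mem_of_mem_filter 0 h)) (fun m hm => hSle hM0.le m (Finset.mem_of_mem_filter m hm))
      (fun n hn => hSle hN0.le n (Finset.mem_of_mem_filter n hn)) hσ (Real.sqrt_nonneg _)
      (Real.sqrt_nonneg _) (hsub _ _ _) (hsub _ _ _) d0 (hderiv 1 μ ν)
      (continuous_iff_continuousAt.mpr fun c => (hderiv 2 μ ν c).continuousAt) ?_ (by positivity)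
      b0 b1 (hdd 2 le_rfl μ ν)
    intro c hc
    by_contra hne
    refine hc ?_
    have : ∀ x y, g x y c = 0 := fun x y => by
      by_contra h
      exact hne (hsupp _ _ _ h).2.2
    simp [KB.dd, this]
  rw [htsum, Finset.sum_congr rfl fun c _ => hparts c, Finset.sum_comm]
  refine (norm_sum_le _ _).trans ?_
  have hrow : ∀ μ ∈ Finset.range ⌊3 * M⌋₊, ‖∑ c ∈ Finset.Icc 1 ⌈3 * C⌉₊,
      ∑ ν ∈ Finset.range ⌊3 * N⌋₊, KB.dd (fun x y => g x y c) μ ν •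
        KB.bilin (S.filter (μ < ·)) (S'.filter (ν < ·)) a b σ c‖ ≤
      (3 * N) * (K * C ^ (1 + ε) * √(M * N) *
        (√(∑ m ∈ S, ‖a m‖ ^ 2) * √(∑ n ∈ S', ‖b n‖ ^ 2)) * (1 / (M * N))) := by
    intro μ _
    rw [Finset.sum_comm]
    refine (norm_sum_le _ _).trans ((Finset.sum_le_card_nsmul _ _ _ fun ν _ => hblock μ ν).trans ?_)
    rw [Finset.card_range, nsmul_eq_mul]
    exact mul_le_mul_of_nonneg_right (Nat.floor_le (by positivity : 0 ≤ 3 * N)) (by positivity)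
  refine (Finset.sum_le_card_nsmul _ _ _ hrow).trans ?_
  rw [Finset.card_range, nsmul_eq_mul]
  refine (mul_le_mul_of_nonneg_right (Nat.floor_le (by positivity : 0 ≤ 3 * M))
    (by positivity)).trans_eq ?_
  generalize √(∑ m ∈ S, ‖a m‖ ^ 2) = α
  generalize √(∑ n ∈ S', ‖b n‖ ^ 2) = β
  generalize √(M * N) = X
  generalize C ^ (1 + ε) = Z
  field_simp
  ring
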